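/- Let G be a field of characteristic 0 and Γ a finitely generated subgroup of the multiplicative group G*. Then there is a finite set of normalized pairs in G* × G* such that for every normalized pair (a1, a2) ∈ G* × G* outside this set, the equation a1·x1 + a2·x2 = 1 has at most two solutions (x1, x2) ∈ Γ × Γ (the solution (1,1) included). -/

import Mathlib

section Part0
set_option autoImplicit false

/-- Abstract arithmetic data. -/
structure PF (K : Type) [Field K] where
  ι : Type
  fin : Fintype ι
  dec : DecidableEq ι
  O : Subring K
  R : Subring K
  R_le : R ≤ O
  pid : IsPrincipalIdealRing O
  den : ∀ x : K, ∃ D : ℕ, D ≠ 0 ∧ (D : K) * x ∈ R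
  abv : ι → AbsoluteValue K ℝ
  m : ι → ℕ
  m_pos : ∀ v, 0 < m v
  one_le : ∀ x ∈ O, x ≠ 0 → 1 ≤ ∏ v, abv v x ^ m v
  finite_bdd : ∀ B : ℝ, {x : K | x ∈ O ∧ ∀ v, abv v x ≤ B}.Finite
  siegel : ∃ C : ℝ, 1 ≤ C ∧ ∀ (α β : Type) [Fintype α] [Fintype β] [Nonempty β]
    (a : α → β → K) (B : ℝ), 1 ≤ B → 2 * Fintype.card α ≤ Fintype.card β →
    (∀ i j, a i j ∈ R) → (∀ v i j, abv v (a i j) ≤ B) →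
    ∃ ξ : β → K, (∀ j, ξ j ∈ O) ∧ ξ ≠ 0 ∧ (∀ i, ∑ j, a i j * ξ j = 0) ∧
      ∀ v j, abv v (ξ j) ≤ C * Fintype.card β * B
  mink : ∀ (I : Type) [Fintype I] [Nonempty I] [DecidableEq I] (A : ι → Matrix I I K),
    (∀ v, (A v).det ≠ 0) → ∃ C : ℝ, 0 < C ∧ ∀ t : ι → I → ℝ, (∀ v i, 0 < t v i) →
    C ≤ ∏ v, (∏ i, t v i) ^ m v →
    ∃ x : I → K, (∀ i, x i ∈ O) ∧ x ≠ 0 ∧ ∀ v i, abv v ((A v).mulVec x i) ≤ t v i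
  v0 : ι
  m_v0 : m v0 = 1

attribute [instance] PF.fin PF.dec

namespace PF

variable {K : Type} [Field K] (F : PF K)

/-- Weighted product over the places. -/
noncomputable def pr (a : F.ι → ℝ) : ℝ := ∏ v, a v ^ F.m v

/-- total multiplicity -/
noncomputable def M : ℕ := ∑ v, F.m v

lemma pr_mul (a b : F.ι → ℝ) : F.pr (fun v => a v * b v) = F.pr a * F.pr b := by
  simp [pr, mul_pow, Finset.prod_mul_distrib]

lemma pr_const (c : ℝ) : F.pr (fun _ => c) = c ^ F.M := by
  simp [pr, M, Finset.prod_pow_eq_pow_sum]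

lemma pr_pow (a : F.ι → ℝ) (n : ℕ) : F.pr (fun v => a v ^ n) = F.pr a ^ n := by
  simp only [pr, ← Finset.prod_pow]
  exact Finset.prod_congr rfl fun v _ => by rw [← pow_mul, ← pow_mul, mul_comm]

lemma pr_prod {α : Type*} (s : Finset α) (a : α → F.ι → ℝ) :
    F.pr (fun v => ∏ i ∈ s, a i v) = ∏ i ∈ s, F.pr (a i) := by
  simp only [pr, ← Finset.prod_pow]
  rw [Finset.prod_comm]

lemma pr_le {a b : F.ι → ℝ} (ha : ∀ v, 0 ≤ a v) (h : ∀ v, a v ≤ b v) : F.pr a ≤ F.pr b :=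
  Finset.prod_le_prod (fun v _ => pow_nonneg (ha v) _) fun v _ => pow_le_pow_left₀ (ha v) (h v) _

lemma pr_nonneg {a : F.ι → ℝ} (ha : ∀ v, 0 ≤ a v) : 0 ≤ F.pr a :=
  Finset.prod_nonneg fun v _ => pow_nonneg (ha v) _

lemma pr_pos {a : F.ι → ℝ} (ha : ∀ v, 0 < a v) : 0 < F.pr a :=
  Finset.prod_pos fun v _ => pow_pos (ha v) _

lemma pr_one : F.pr (fun _ => 1) = 1 := by simp [pr]

lemma one_le_pr {a : F.ι → ℝ} (ha : ∀ v, 1 ≤ a v) : 1 ≤ F.pr a := by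
  rw [← F.pr_one]; exact F.pr_le (fun _ => zero_le_one) ha

lemma pr_exp (a : F.ι → ℝ) : F.pr (fun v => Real.exp (a v)) = Real.exp (∑ v, F.m v * a v) := by
  simp [pr, Real.exp_sum, Real.exp_nat_mul]

lemma pr_rpow (Q : ℝ) (hQ : 0 < Q) (a : F.ι → ℝ) :
    F.pr (fun v => Q ^ a v) = Q ^ (∑ v, F.m v * a v) := by
  simp only [Real.rpow_def_of_pos hQ, pr_exp, Finset.mul_sum]
  congr 1; exact Finset.sum_congr rfl fun v _ => by ring

lemma pr_abv {x : K} (hx : x ∈ F.O) (h0 : x ≠ 0) : 1 ≤ F.pr (fun v => F.abv v x) :=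
  F.one_le x hx h0

lemma eq_zero_of_pr {x : K} (hx : x ∈ F.O) (h : F.pr (fun v => F.abv v x) < 1) : x = 0 := by
  by_contra h0; exact absurd (F.pr_abv hx h0) (not_le.2 h)

lemma log_pr {a : F.ι → ℝ} (ha : ∀ v, 0 < a v) :
    Real.log (F.pr a) = ∑ v, F.m v * Real.log (a v) := by
  unfold pr
  rw [Real.log_prod (fun v _ => (pow_pos (ha v) _).ne')]
  simp

lemma M_pos : 0 < F.M :=
  Finset.sum_pos (fun v _ => F.m_pos v) ⟨F.v0, Finset.mem_univ _⟩

lemma nat_mem (n : ℕ) : (n : K) ∈ F.O := natCast_mem F.O n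

lemma abv_nat_le (v : F.ι) (n : ℕ) : F.abv v (n : K) ≤ n := by
  induction n with
  | zero => simp
  | succ n ih =>
    push_cast
    refine ((F.abv v).add_le _ _).trans ?_
    simpa using ih

end PF

/-! ### Weighted `ℓ¹` norm of polynomials -/

open MvPolynomial

section N1

variable {K : Type*} [Field K] {σ τ : Type*} [Fintype σ] [Fintype τ] (v : AbsoluteValue K ℝ)

/-- Weighted `ℓ¹` norm. -/
noncomputable def N1 (p : MvPolynomial σ K) (r : σ → ℝ) : ℝ :=
  ∑ b ∈ p.support, v (coeff b p) * ∏ i, r i ^ b i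

lemma N1_eq_of_subset {p : MvPolynomial σ K} {s : Finset (σ →₀ ℕ)} (h : p.support ⊆ s)
    (r : σ → ℝ) : N1 v p r = ∑ b ∈ s, v (coeff b p) * ∏ i, r i ^ b i := by
  refine Finset.sum_subset h fun b _ hb => ?_
  rw [notMem_support_iff.1 hb]; simp

lemma N1_nonneg (p : MvPolynomial σ K) {r : σ → ℝ} (hr : ∀ i, 0 ≤ r i) : 0 ≤ N1 v p r :=
  Finset.sum_nonneg fun b _ => mul_nonneg (v.nonneg _) (Finset.prod_nonneg fun i _ => pow_nonneg (hr i) _)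

lemma N1_zero (r : σ → ℝ) : N1 v (0 : MvPolynomial σ K) r = 0 := by simp [N1]

lemma N1_monomial (b : σ →₀ ℕ) (c : K) (r : σ → ℝ) :
    N1 v (monomial b c) r = v c * ∏ i, r i ^ b i := by
  classical
  rw [N1_eq_of_subset v (support_monomial_subset (s := b) (a := c))]
  simp

lemma N1_C (c : K) (r : σ → ℝ) : N1 v (C c : MvPolynomial σ K) r = v c := by
  rw [C_apply, N1_monomial]; simp

lemma N1_one (r : σ → ℝ) : N1 v (1 : MvPolynomial σ K) r = 1 := by
  rw [← C_1, N1_C]; simp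

lemma N1_X (i : σ) (r : σ → ℝ) : N1 v (X i : MvPolynomial σ K) r = r i := by
  classical
  rw [X, N1_monomial]; simp [Finsupp.single_apply, Finset.prod_pow_boole]

lemma N1_add_le (p q : MvPolynomial σ K) {r : σ → ℝ} (hr : ∀ i, 0 ≤ r i) :
    N1 v (p + q) r ≤ N1 v p r + N1 v q r := by
  classical
  rw [N1_eq_of_subset v (support_add (p := p) (q := q)), N1_eq_of_subset v (Finset.subset_union_left (s₂ := q.support)),
    N1_eq_of_subset v (Finset.subset_union_right (s₁ := p.support)), ← Finset.sum_add_distrib]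
  refine Finset.sum_le_sum fun b _ => ?_
  rw [← add_mul, coeff_add]
  exact mul_le_mul_of_nonneg_right (v.add_le _ _) (Finset.prod_nonneg fun i _ => pow_nonneg (hr i) _)

lemma N1_sum_le {α : Type*} (s : Finset α) (p : α → MvPolynomial σ K) {r : σ → ℝ}
    (hr : ∀ i, 0 ≤ r i) : N1 v (∑ a ∈ s, p a) r ≤ ∑ a ∈ s, N1 v (p a) r := by
  classical
  induction s using Finset.induction_on with
  | empty => simp [N1_zero]
  | insert a s ha ih =>
    rw [Finset.sum_insert ha, Finset.sum_insert ha]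
    exact (N1_add_le v _ _ hr).trans (by gcongr)

lemma N1_neg (p : MvPolynomial σ K) (r : σ → ℝ) : N1 v (-p) r = N1 v p r := by
  simp [N1]

lemma N1_mul_le (p q : MvPolynomial σ K) {r : σ → ℝ} (hr : ∀ i, 0 ≤ r i) :
    N1 v (p * q) r ≤ N1 v p r * N1 v q r := by
  classical
  have e : p * q = ∑ a ∈ p.support, ∑ b ∈ q.support, monomial (a + b) (coeff a p * coeff b q) := by
    conv_lhs => rw [p.as_sum, q.as_sum, Finset.sum_mul_sum]
    simp [monomial_mul]
  rw [e]
  refine (N1_sum_le v _ _ hr).trans ?_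
  rw [N1, N1, Finset.sum_mul_sum]
  refine Finset.sum_le_sum fun a _ => (N1_sum_le v _ _ hr).trans (Finset.sum_le_sum fun b _ => ?_)
  rw [N1_monomial]
  simp only [map_mul, Finsupp.add_apply, pow_add, Finset.prod_mul_distrib]
  apply le_of_eq; ring

lemma N1_pow_le (p : MvPolynomial σ K) (n : ℕ) {r : σ → ℝ} (hr : ∀ i, 0 ≤ r i) :
    N1 v (p ^ n) r ≤ N1 v p r ^ n := by
  induction n with
  | zero => simp [N1_one]
  | succ n ih =>
    rw [pow_succ, pow_succ]
    exact (N1_mul_le v _ _ hr).trans (mul_le_mul_of_nonneg_right ih (N1_nonneg v _ hr))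

lemma N1_prod_le {α : Type*} (s : Finset α) (p : α → MvPolynomial σ K) {r : σ → ℝ}
    (hr : ∀ i, 0 ≤ r i) : N1 v (∏ a ∈ s, p a) r ≤ ∏ a ∈ s, N1 v (p a) r := by
  classical
  induction s using Finset.induction_on with
  | empty => simp [N1_one]
  | insert a s ha ih =>
    rw [Finset.prod_insert ha, Finset.prod_insert ha]
    exact (N1_mul_le v _ _ hr).trans (mul_le_mul_of_nonneg_left ih (N1_nonneg v _ hr))

lemma bind_eq_sum (φ : σ → MvPolynomial τ K) (p : MvPolynomial σ K) :
    bind₁ φ p = ∑ b ∈ p.support, C (coeff b p) * ∏ i, φ i ^ b i := by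
  rw [bind₁, aeval_def, eval₂_eq']; rfl

lemma N1_bind_le (φ : σ → MvPolynomial τ K) (p : MvPolynomial σ K) {r : τ → ℝ}
    (hr : ∀ i, 0 ≤ r i) : N1 v (bind₁ φ p) r ≤ N1 v p (fun i => N1 v (φ i) r) := by
  rw [bind_eq_sum]
  refine (N1_sum_le v _ _ hr).trans (Finset.sum_le_sum fun b _ => ?_)
  refine (N1_mul_le v _ _ hr).trans ?_
  rw [N1_C]
  refine mul_le_mul_of_nonneg_left ((N1_prod_le v _ _ hr).trans ?_) (v.nonneg _)
  exact Finset.prod_le_prod (fun i _ => N1_nonneg v _ hr) fun i _ => N1_pow_le v _ _ hr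

lemma N1_mono (p : MvPolynomial σ K) {r r' : σ → ℝ} (hr : ∀ i, 0 ≤ r i) (h : ∀ i, r i ≤ r' i) :
    N1 v p r ≤ N1 v p r' :=
  Finset.sum_le_sum fun b _ => mul_le_mul_of_nonneg_left
    (Finset.prod_le_prod (fun i _ => pow_nonneg (hr i) _) fun i _ => pow_le_pow_left₀ (hr i) (h i) _)
    (v.nonneg _)

lemma coeff_le_N1 (p : MvPolynomial σ K) (b : σ →₀ ℕ) {r : σ → ℝ} (hr : ∀ i, 0 ≤ r i) :
    v (coeff b p) * ∏ i, r i ^ b i ≤ N1 v p r := by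
  classical
  rw [N1_eq_of_subset v (Finset.subset_insert b p.support)]
  exact Finset.single_le_sum (f := fun b => v (coeff b p) * ∏ i, r i ^ b i)
    (fun b _ => mul_nonneg (v.nonneg _) (Finset.prod_nonneg fun i _ => pow_nonneg (hr i) _))
    (Finset.mem_insert_self _ _)

lemma N1_pos {p : MvPolynomial σ K} (hp : p ≠ 0) {r : σ → ℝ} (hr : ∀ i, 0 < r i) : 0 < N1 v p r := by
  obtain ⟨b, hb⟩ := ne_zero_iff.1 hp
  exact (mul_pos (v.pos hb) (Finset.prod_pos fun i _ => pow_pos (hr i) _)).trans_le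
    (coeff_le_N1 v p b fun i => (hr i).le)

/-- norm with all weights one -/
noncomputable abbrev N11 (p : MvPolynomial σ K) : ℝ := N1 v p (fun _ => 1)

lemma coeff_le_N11 (p : MvPolynomial σ K) (b : σ →₀ ℕ) : v (coeff b p) ≤ N11 v p := by
  simpa using coeff_le_N1 v p b (r := fun _ => 1) (fun _ => zero_le_one)

end N1

/-! ### Weighted index -/
section Idx

variable {K : Type*} [Field K] {σ τ : Type*} [Fintype σ] [Fintype τ]

/-- all exponents have weight at least `θ` -/
def IdxGe (w : σ → ℝ) (θ : ℝ) (p : MvPolynomial σ K) : Prop :=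
  ∀ e, coeff e p ≠ 0 → θ ≤ ∑ i, w i * (e i : ℝ)

lemma IdxGe.add {w : σ → ℝ} {θ : ℝ} {p q : MvPolynomial σ K} (hp : IdxGe w θ p) (hq : IdxGe w θ q) :
    IdxGe w θ (p + q) := by
  intro e he
  by_cases h : coeff e p = 0
  · exact hq e (by simpa [h] using he)
  · exact hp e h

lemma IdxGe.zero (w : σ → ℝ) (θ : ℝ) : IdxGe w θ (0 : MvPolynomial σ K) := by
  intro e he; simp at he

lemma IdxGe.sum {α : Type*} {w : σ → ℝ} {θ : ℝ} (s : Finset α) {p : α → MvPolynomial σ K}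
    (hp : ∀ a ∈ s, IdxGe w θ (p a)) : IdxGe w θ (∑ a ∈ s, p a) := by
  classical
  induction s using Finset.induction_on with
  | empty => simpa using IdxGe.zero w θ
  | insert a s ha ih =>
    rw [Finset.sum_insert ha]
    exact (hp a (by simp)).add (ih fun b hb => hp b (by simp [hb]))

lemma IdxGe.mono {w : σ → ℝ} {θ θ' : ℝ} {p : MvPolynomial σ K} (hp : IdxGe w θ p) (h : θ' ≤ θ) :
    IdxGe w θ' p := fun e he => h.trans (hp e he)

lemma IdxGe.mul {w : σ → ℝ} {θ θ' : ℝ} {p q : MvPolynomial σ K} (hp : IdxGe w θ p)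
    (hq : IdxGe w θ' q) : IdxGe w (θ + θ') (p * q) := by
  classical
  intro e he
  rw [coeff_mul] at he
  obtain ⟨⟨a, b⟩, hab, h⟩ := Finset.exists_ne_zero_of_sum_ne_zero he
  rw [Finset.HasAntidiagonal.mem_antidiagonal] at hab
  have h1 := hp a (left_ne_zero_of_mul h)
  have h2 := hq b (right_ne_zero_of_mul h)
  simp only at hab
  rw [← hab]
  simp only [Finsupp.add_apply, Nat.cast_add, mul_add, Finset.sum_add_distrib]
  linarith

lemma IdxGe.C (w : σ → ℝ) (c : K) : IdxGe w 0 (MvPolynomial.C c : MvPolynomial σ K) := by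
  classical
  intro e he
  rw [coeff_C] at he
  have : e = 0 := by by_contra h; exact he (if_neg (Ne.symm h))
  simp [this]

lemma IdxGe.one (w : σ → ℝ) : IdxGe w 0 (1 : MvPolynomial σ K) := by
  rw [← C_1]; exact IdxGe.C w 1

lemma IdxGe.X (w : σ → ℝ) (i : σ) : IdxGe w (w i) (MvPolynomial.X i : MvPolynomial σ K) := by
  classical
  intro e he
  rw [coeff_X'] at he
  have : e = Finsupp.single i 1 := by by_contra h; exact he (if_neg (Ne.symm h))
  simp [this, Finsupp.single_apply]

lemma IdxGe.pow {w : σ → ℝ} {θ : ℝ} {p : MvPolynomial σ K} (hp : IdxGe w θ p) (n : ℕ) :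
    IdxGe w (θ * n) (p ^ n) := by
  induction n with
  | zero => simpa using IdxGe.one w
  | succ n ih => rw [pow_succ]; exact (ih.mul hp).mono (by push_cast; linarith)

lemma IdxGe.prod {α : Type*} {w : σ → ℝ} (s : Finset α) {θ : α → ℝ} {p : α → MvPolynomial σ K}
    (hp : ∀ a ∈ s, IdxGe w (θ a) (p a)) : IdxGe w (∑ a ∈ s, θ a) (∏ a ∈ s, p a) := by
  classical
  induction s using Finset.induction_on with
  | empty => simpa using IdxGe.one w
  | insert a s ha ih =>
    rw [Finset.prod_insert ha, Finset.sum_insert ha]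
    exact (hp a (by simp)).mul (ih fun b hb => hp b (by simp [hb]))

lemma IdxGe.bind {w : τ → ℝ} {w' : σ → ℝ} {θ : ℝ} {φ : σ → MvPolynomial τ K}
    (hφ : ∀ i, IdxGe w (w' i) (φ i)) {p : MvPolynomial σ K} (hp : IdxGe w' θ p) :
    IdxGe w θ (bind₁ φ p) := by
  rw [bind_eq_sum]
  refine IdxGe.sum _ fun b hb => ?_
  have h1 := hp b (mem_support_iff.1 hb)
  have h2 := (IdxGe.C w (coeff b p)).mul
    (IdxGe.prod Finset.univ (θ := fun i => w' i * (b i : ℝ)) (fun i _ => (hφ i).pow (b i)))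
  exact h2.mono (by linarith)

end Idx

end Part0

section Part1
set_option autoImplicit false
open MvPolynomial

/-! ### Hasse derivatives and generalized Wronskians -/
section Hasse

variable {K : Type*} [Field K] {σ : Type*} [Fintype σ]

/-- Hasse derivative. -/
noncomputable def hs (a : σ →₀ ℕ) : MvPolynomial σ K →ₗ[K] MvPolynomial σ K :=
  (basisMonomials σ K).constr K fun b => monomial (b - a) (∏ i, ((b i).choose (a i) : K))

lemma hs_monomial (a b : σ →₀ ℕ) (c : K) :
    hs a (monomial b c) = monomial (b - a) (c * ∏ i, ((b i).choose (a i) : K)) := by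
  have h : monomial b c = c • (basisMonomials σ K b) := by simp [smul_monomial]
  rw [h, map_smul, hs, Module.Basis.constr_basis, smul_monomial, smul_eq_mul]

lemma hs_zero (p : MvPolynomial σ K) : hs 0 p = p := by
  induction p using MvPolynomial.induction_on'' with
  | C a => rw [C_apply, hs_monomial]; simp
  | monomial_add a b f _ _ h1 h2 => rw [map_add, h1, hs_monomial]; simp
  | mul_X p i h => 
    clear h
    induction p using MvPolynomial.induction_on' with
    | monomial u a => rw [X, monomial_mul, hs_monomial]; simp
    | add p q hp hq => rw [add_mul, map_add, hp, hq]

lemma pderiv_hs (i : σ) (a : σ →₀ ℕ) (p : MvPolynomial σ K) :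
    pderiv i (hs a p) = ((a i : K) + 1) • hs (a + Finsupp.single i 1) p := by
  classical
  induction p using MvPolynomial.induction_on' with
  | add p q hp hq => simp only [map_add, smul_add, hp, hq]
  | monomial b c =>
    rw [hs_monomial, hs_monomial, pderiv_monomial, smul_monomial, tsub_tsub]
    congr 1
    rw [smul_eq_mul, mul_left_comm, mul_assoc]
    congr 1
    rw [← Finset.mul_prod_erase _ _ (Finset.mem_univ i), ← Finset.mul_prod_erase _ _ (Finset.mem_univ i)]
    have h1 : ∀ j ∈ Finset.univ.erase i, (((b j).choose ((a + Finsupp.single i 1 : σ →₀ ℕ) j) : ℕ) : K)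
        = ((b j).choose (a j) : ℕ) := by
      intro j hj
      have : i ≠ j := (Finset.ne_of_mem_erase hj).symm
      simp [Finsupp.single_apply, this]
    rw [Finset.prod_congr rfl h1]
    have h2 := Nat.choose_succ_right_eq (b i) (a i)
    have h3 : (((b i).choose (a i + 1) : ℕ) : K) * ((a i : K) + 1) = ((b i).choose (a i) : ℕ) * ((b i - a i : ℕ) : K) := by
      simpa only [Nat.cast_mul, Nat.cast_add, Nat.cast_one] using congrArg (Nat.cast (R := K)) h2
    simp only [Finsupp.add_apply, Finsupp.single_eq_same, Finsupp.coe_tsub, Pi.sub_apply]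
    linear_combination (-(∏ j ∈ Finset.univ.erase i, (((b j).choose (a j) : ℕ) : K))) * h3

/-- translation -/
noncomputable def tr (ξ : σ → K) : MvPolynomial σ K →ₐ[K] MvPolynomial σ K :=
  bind₁ fun i => X i + C (ξ i)

lemma pderiv_tr (ξ : σ → K) (i : σ) (p : MvPolynomial σ K) :
    pderiv i (tr ξ p) = tr ξ (pderiv i p) := by
  classical
  induction p using MvPolynomial.induction_on with
  | C a => simp [tr]
  | add p q hp hq => simp only [map_add, hp, hq]
  | mul_X p j h =>
    have : pderiv i (tr ξ (X j)) = tr ξ (pderiv i (X j)) := by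
      simp [tr, pderiv_X, Pi.single_apply]
    rw [map_mul, Derivation.leibniz, Derivation.leibniz, h, this]
    simp [smul_eq_mul]

lemma finsupp_deg_induction {P : (σ →₀ ℕ) → Prop} (h0 : P 0)
    (h1 : ∀ a i, P a → P (a + Finsupp.single i 1)) (a : σ →₀ ℕ) : P a := by
  classical
  have key : ∀ n, ∀ a : σ →₀ ℕ, ∑ i, a i = n → P a := by
    intro n
    induction n with
    | zero =>
      intro a ha
      have : a = 0 := by
        ext i; exact (Finset.sum_eq_zero_iff.1 ha) i (Finset.mem_univ i)
      rw [this]; exact h0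
    | succ n ih =>
      intro a ha
      obtain ⟨i, -, hi⟩ := Finset.exists_ne_zero_of_sum_ne_zero (s := Finset.univ) (f := fun i => a i) (by omega)
      have hle : Finsupp.single i 1 ≤ a := by
        rw [Finsupp.single_le_iff]; omega
      have e : a = (a - Finsupp.single i 1) + Finsupp.single i 1 := (tsub_add_cancel_of_le hle).symm
      rw [e]
      refine h1 _ _ (ih _ ?_)
      have : ∑ j, a j = ∑ j, ((a - Finsupp.single i 1 : σ →₀ ℕ) j + (Finsupp.single i 1 : σ →₀ ℕ) j) := by
        conv_lhs => rw [e]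
        rfl
      rw [Finset.sum_add_distrib] at this
      have h3 : ∑ j, (Finsupp.single i 1 : σ →₀ ℕ) j = 1 := by simp [Finsupp.single_apply]
      omega
  exact key _ a rfl

lemma hs_tr [CharZero K] (ξ : σ → K) (a : σ →₀ ℕ) : ∀ p : MvPolynomial σ K,
    hs a (tr ξ p) = tr ξ (hs a p) := by
  induction a using finsupp_deg_induction with
  | h0 => intro p; simp [hs_zero]
  | h1 a i ih =>
    intro p
    have h := pderiv_hs i a (tr ξ p)
    rw [ih, pderiv_tr, pderiv_hs, map_smul] at h
    have h0 : ((a i : K) + 1) ≠ 0 := by exact_mod_cast Nat.succ_ne_zero (a i)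
    exact (smul_right_injective _ h0 h).symm

lemma coeff_hs (a : σ →₀ ℕ) (p : MvPolynomial σ K) (e : σ →₀ ℕ) :
    coeff e (hs a p) = coeff (e + a) p * ∏ i, (((e + a) i).choose (a i) : K) := by
  classical
  induction p using MvPolynomial.induction_on' with
  | add p q hp hq => simp only [map_add, coeff_add, hp, hq, add_mul]
  | monomial b c =>
    rw [hs_monomial, coeff_monomial, coeff_monomial]
    by_cases h : b = e + a
    · simp [h]
    · rw [if_neg h]
      by_cases h' : b - a = e
      · rw [if_pos h']
        have : ¬ a ≤ b := fun hle => h (by rw [← h', tsub_add_cancel_of_le hle])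
        rw [Finsupp.le_def] at this
        push_neg at this
        obtain ⟨i, hi⟩ := this
        rw [Finset.prod_eq_zero (Finset.mem_univ i)]
        · simp
        · rw [Nat.choose_eq_zero_of_lt hi]; simp
      · simp [h']

/-- rows of the Wronskian -/
lemma eq_zero_of_hs_eval {f : MvPolynomial σ K} (x : σ → K)
    (h : ∀ a, eval x (hs a f) = 0) : f = 0 := by
  classical
  by_contra hf
  obtain ⟨b, hb, hmax⟩ := Finset.exists_max_image f.support (fun b => ∑ i, b i) (support_nonempty.2 hf)
  have : hs b f = C (coeff b f) := by
    ext e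
    rw [coeff_hs, coeff_C]
    split_ifs with h0
    · rw [← h0]; simp
    · by_cases h1 : coeff (e + b) f = 0
      · simp [h1]
      · exfalso
        have := hmax _ (mem_support_iff.2 h1)
        simp only [Finsupp.add_apply, Finset.sum_add_distrib] at this
        have h2 : ∑ i, e i = 0 := by omega
        apply h0
        ext i; exact ((Finset.sum_eq_zero_iff.1 h2) i (Finset.mem_univ i)).symm
  have h2 := h b
  rw [this, eval_C] at h2
  exact mem_support_iff.1 hb h2


variable [CharZero K] {s : ℕ}

/-- span of the Wronskian rows of order at most `k` -/
noncomputable def wS (f : Fin s → MvPolynomial σ K) (k : ℕ) :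
    Submodule (FractionRing (MvPolynomial σ K)) (Fin s → FractionRing (MvPolynomial σ K)) :=
  Submodule.span _ {x | ∃ a : σ →₀ ℕ, ∑ i, a i ≤ k ∧ x = fun j => algebraMap _ _ (hs a (f j))}

lemma wS_mono (f : Fin s → MvPolynomial σ K) {k l : ℕ} (h : k ≤ l) : wS f k ≤ wS f l :=
  Submodule.span_mono fun _ ⟨a, ha, hx⟩ => ⟨a, ha.trans h, hx⟩

lemma row_mem (f : Fin s → MvPolynomial σ K) (a : σ →₀ ℕ) {k : ℕ} (h : ∑ i, a i ≤ k) :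
    (fun j => algebraMap (MvPolynomial σ K) (FractionRing (MvPolynomial σ K)) (hs a (f j))) ∈ wS f k :=
  Submodule.subset_span ⟨a, h, rfl⟩

lemma sum_add_single (a : σ →₀ ℕ) (i : σ) : ∑ j, (a + Finsupp.single i 1 : σ →₀ ℕ) j = ∑ j, a j + 1 := by
  classical
  simp [Finset.sum_add_distrib, Finsupp.single_apply]

lemma wS_deriv (f : Fin s → MvPolynomial σ K) (k : ℕ) (i : σ) (y) (hy : y ∈ wS f k) :
    ∃ c : MvPolynomial σ K, c ≠ 0 ∧ ∃ z : Fin s → MvPolynomial σ K,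
      (∀ j, algebraMap _ (FractionRing (MvPolynomial σ K)) c * y j = algebraMap _ _ (z j)) ∧
      (fun j => algebraMap (MvPolynomial σ K) (FractionRing (MvPolynomial σ K)) (pderiv i (z j)))
        ∈ wS f (k + 1) := by
  induction hy using Submodule.span_induction with
  | mem x hx =>
    obtain ⟨a, ha, rfl⟩ := hx
    refine ⟨1, one_ne_zero, fun j => hs a (f j), by simp, ?_⟩
    have h := row_mem f (a + Finsupp.single i 1) (k := k + 1) (by rw [sum_add_single]; omega)
    have h2 := (wS f (k+1)).smul_mem (algebraMap (MvPolynomial σ K) _ (C ((a i : K) + 1))) h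
    convert h2 using 1
    funext j
    simp [pderiv_hs, smul_eq_C_mul]
  | zero => exact ⟨1, one_ne_zero, 0, by simp, by
    convert (wS f (k + 1)).zero_mem using 1
    funext j; simp⟩
  | add x y hx hy hx' hy' =>
    obtain ⟨c, hc, z, hz, hzm⟩ := hx'
    obtain ⟨c', hc', z', hz', hzm'⟩ := hy'
    refine ⟨c * c', mul_ne_zero hc hc', fun j => c' * z j + c * z' j, ?_, ?_⟩
    · intro j
      simp only [Pi.add_apply, map_mul, map_add, ← hz, ← hz']
      ring
    · have hx1 := wS_mono f (Nat.le_succ k) hx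
      have hy1 := wS_mono f (Nat.le_succ k) hy
      have := add_mem (add_mem ((wS f (k+1)).smul_mem (algebraMap (MvPolynomial σ K) _ c') hzm)
        ((wS f (k+1)).smul_mem (algebraMap (MvPolynomial σ K) _ (c * pderiv i c')) hx1))
        (add_mem ((wS f (k+1)).smul_mem (algebraMap (MvPolynomial σ K) _ c) hzm')
        ((wS f (k+1)).smul_mem (algebraMap (MvPolynomial σ K) _ (c' * pderiv i c)) hy1))
      convert this using 1
      funext j
      simp only [Pi.add_apply, Pi.smul_apply, smul_eq_mul, map_add, Derivation.leibniz, map_mul, ← hz, ← hz']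
      ring
  | smul l x hx hx' =>
    obtain ⟨c, hc, z, hz, hzm⟩ := hx'
    obtain ⟨p, q, hq, rfl⟩ := IsFractionRing.div_surjective (A := MvPolynomial σ K) l
    have hq0 : q ≠ 0 := nonZeroDivisors.ne_zero hq
    have hq1 : algebraMap (MvPolynomial σ K) (FractionRing (MvPolynomial σ K)) q ≠ 0 := by
      simpa using hq0
    refine ⟨q * c, mul_ne_zero hq0 hc, fun j => p * z j, ?_, ?_⟩
    · intro j
      simp only [Pi.smul_apply, smul_eq_mul, map_mul, ← hz]
      field_simp
    · have hx1 := wS_mono f (Nat.le_succ k) hx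
      have := add_mem ((wS f (k+1)).smul_mem (algebraMap (MvPolynomial σ K) _ p) hzm)
        ((wS f (k+1)).smul_mem (algebraMap (MvPolynomial σ K) _ (c * pderiv i p)) hx1)
      convert this using 1
      funext j
      simp only [Pi.add_apply, Pi.smul_apply, smul_eq_mul, map_add, Derivation.leibniz, map_mul, ← hz]
      ring

lemma wS_stable (f : Fin s → MvPolynomial σ K) (k : ℕ) (h : wS f (k + 1) ≤ wS f k) (a : σ →₀ ℕ) :
    (fun j => algebraMap (MvPolynomial σ K) (FractionRing (MvPolynomial σ K)) (hs a (f j))) ∈ wS f k := by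
  induction a using finsupp_deg_induction with
  | h0 => exact row_mem f 0 (by simp)
  | h1 a i ih =>
    obtain ⟨c, hc, z, hz, hzm⟩ := wS_deriv f k i _ ih
    have hz' : ∀ j, z j = c * hs a (f j) := by
      intro j
      have := hz j
      rw [← map_mul] at this
      exact (IsFractionRing.injective (MvPolynomial σ K) _ this).symm
    have hzm := h hzm
    have h1 := sub_mem hzm ((wS f k).smul_mem (algebraMap (MvPolynomial σ K) _ (pderiv i c)) ih)
    have hc1 : algebraMap (MvPolynomial σ K) (FractionRing (MvPolynomial σ K)) (c * C ((a i : K) + 1)) ≠ 0 := by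
      have h0 : ((a i : K) + 1) ≠ 0 := by exact_mod_cast Nat.succ_ne_zero (a i)
      rw [Ne, map_eq_zero_iff _ (IsFractionRing.injective (MvPolynomial σ K) _)]
      exact mul_ne_zero hc (by rw [Ne, C_eq_zero]; exact h0)
    rw [← Submodule.smul_mem_iff _ hc1]
    convert h1 using 1
    funext j
    simp only [Pi.sub_apply, Pi.smul_apply, smul_eq_mul, hz', Derivation.leibniz, pderiv_hs, map_add, map_mul,
      smul_eq_C_mul]
    ring

lemma wS_all (f : Fin s → MvPolynomial σ K) (hf : LinearIndependent K f)
    (W : Submodule (FractionRing (MvPolynomial σ K)) (Fin s → FractionRing (MvPolynomial σ K)))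
    (h : ∀ a : σ →₀ ℕ, (fun j => algebraMap (MvPolynomial σ K) (FractionRing (MvPolynomial σ K)) (hs a (f j))) ∈ W) :
    W = ⊤ := by
  classical
  by_contra hW
  obtain ⟨φ, hφ, hle⟩ := Submodule.exists_le_ker_of_lt_top W (lt_top_iff_ne_top.2 hW)
  obtain ⟨q, hq⟩ := IsLocalization.exist_integer_multiples_of_finite (nonZeroDivisors (MvPolynomial σ K))
    (fun j : Fin s => φ (Pi.single j 1))
  choose c hc using hq
  have hq0 : (q : MvPolynomial σ K) ≠ 0 := nonZeroDivisors.ne_zero q.2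
  have hφx : ∀ x, φ x = ∑ j, x j * φ (Pi.single j 1) := by
    intro x
    conv_lhs => rw [pi_eq_sum_univ' x]
    rw [map_sum]
    simp [Pi.single_apply]
  have hsum : ∀ a, ∑ j, c j * hs a (f j) = 0 := by
    intro a
    have h1 := hle (h a)
    rw [LinearMap.mem_ker, hφx] at h1
    apply IsFractionRing.injective (MvPolynomial σ K) (FractionRing (MvPolynomial σ K))
    rw [map_sum, map_zero, ← smul_zero (q : MvPolynomial σ K), ← h1, Finset.smul_sum]
    refine Finset.sum_congr rfl fun j _ => ?_
    rw [map_mul, hc]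
    simp only [Algebra.smul_def]
    ring
  have hcne : ∃ j, c j ≠ 0 := by
    by_contra hcon
    push_neg at hcon
    apply hφ
    refine LinearMap.ext fun x => ?_
    rw [hφx]
    simp only [LinearMap.zero_apply]
    refine Finset.sum_eq_zero fun j _ => ?_
    have := hc j
    rw [hcon j, map_zero, Algebra.smul_def] at this
    rcases mul_eq_zero.1 this.symm with h2 | h2
    · exact absurd ((map_eq_zero_iff _ (IsFractionRing.injective (MvPolynomial σ K) _)).1 h2) hq0
    · rw [h2, mul_zero]
  obtain ⟨j0, hj0⟩ := hcne
  obtain ⟨x, hx⟩ : ∃ x, eval x (c j0) ≠ 0 := by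
    by_contra hcon
    push_neg at hcon
    exact hj0 (MvPolynomial.funext fun x => by simpa using hcon x)
  have h0 : ∑ j, eval x (c j) • f j = 0 := by
    apply eq_zero_of_hs_eval x
    intro a
    have := congrArg (eval x) (hsum a)
    simpa [smul_eval] using this
  exact hx (Fintype.linearIndependent_iff.1 hf _ h0 j0)

/-- Generalized Wronskian criterion. -/
theorem wronskian (f : Fin s → MvPolynomial σ K) (hf : LinearIndependent K f) :
    ∃ μ : Fin s → (σ →₀ ℕ), (∀ i, ∑ l, μ i l < s) ∧
      (Matrix.of fun i j => hs (μ i) (f j)).det ≠ 0 := by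
  classical
  rcases Nat.eq_zero_or_pos s with rfl | hs0
  · exact ⟨fun _ => 0, fun i => i.elim0, by simp⟩
  have key : ∀ k, k < s → wS f k = ⊤ ∨ k + 1 ≤ Module.finrank (FractionRing (MvPolynomial σ K)) (wS f k) := by
    intro k
    induction k with
    | zero =>
      intro _
      right
      rw [Nat.succ_le_iff, Nat.pos_iff_ne_zero, Ne, Submodule.finrank_eq_zero]
      intro h
      have := row_mem f 0 (k := 0) (by simp)
      rw [h, Submodule.mem_bot] at this
      have h2 := congrFun this ⟨0, hs0⟩
      simp only [hs_zero, Pi.zero_apply] at h2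
      exact hf.ne_zero ⟨0, hs0⟩ ((map_eq_zero_iff _ (IsFractionRing.injective (MvPolynomial σ K) _)).1 h2)
    | succ k ih =>
      intro hk
      rcases ih (by omega) with h | h
      · left; rw [eq_top_iff, ← h]; exact wS_mono f (Nat.le_succ k)
      · by_cases hle : wS f (k + 1) ≤ wS f k
        · left
          have := wS_all f hf (wS f k) (wS_stable f k hle)
          rw [eq_top_iff, ← this]; exact wS_mono f (Nat.le_succ k)
        · right
          have : wS f k < wS f (k + 1) := lt_of_le_of_ne (wS_mono f (Nat.le_succ k)) fun h => hle h.ge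
          have := Submodule.finrank_lt_finrank_of_lt this
          omega
  have htop : wS f (s - 1) = ⊤ := by
    rcases key (s - 1) (by omega) with h | h
    · exact h
    · apply Submodule.eq_top_of_finrank_eq
      have := Submodule.finrank_le (wS f (s - 1))
      simp at this ⊢
      omega
  obtain ⟨b, hb, hspan, hli⟩ := exists_linearIndependent (FractionRing (MvPolynomial σ K))
    {x : Fin s → FractionRing (MvPolynomial σ K) | ∃ a : σ →₀ ℕ, ∑ i, a i ≤ s - 1 ∧ x = fun j => algebraMap _ _ (hs a (f j))}
  rw [← wS, htop] at hspan
  let B := Module.Basis.mk hli (by rw [Subtype.range_coe, hspan])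
  haveI : Finite b := Module.Finite.finite_basis B
  haveI := Fintype.ofFinite b
  have hcard : Fintype.card b = s := by
    have := Module.finrank_eq_card_basis B
    simpa using this.symm
  let e : Fin s ≃ b := (Fintype.equivFinOfCardEq hcard).symm
  choose μ hμ1 hμ2 using fun i => hb (e i).2
  refine ⟨μ, fun i => by have := hμ1 i; omega, ?_⟩
  have hli2 : LinearIndependent (FractionRing (MvPolynomial σ K))
      (Matrix.of fun i j => algebraMap (MvPolynomial σ K) (FractionRing (MvPolynomial σ K)) (hs (μ i) (f j))).row := by
    have := hli.comp e e.injective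
    have e2 : (Matrix.of fun i j => algebraMap (MvPolynomial σ K) (FractionRing (MvPolynomial σ K))
        (hs (μ i) (f j))).row = Subtype.val ∘ e := by
      funext i
      simp only [Function.comp]
      rw [hμ2 i]; rfl
    rw [e2]; exact this
  rw [Matrix.linearIndependent_rows_iff_isUnit, Matrix.isUnit_iff_isUnit_det] at hli2
  intro h0
  apply hli2.ne_zero
  have := congrArg (algebraMap (MvPolynomial σ K) (FractionRing (MvPolynomial σ K))) h0
  rw [RingHom.map_det, map_zero] at this
  exact this

end Hasse

end Part1

section Part2
set_option autoImplicit false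
open MvPolynomial

/-! ### One variable estimate -/
section One
open Polynomial in
/-- univariate weighted norm -/
noncomputable def n1 {K : Type*} [Field K] (v : AbsoluteValue K ℝ) (p : K[X]) (r : ℝ) : ℝ :=
  ∑ i ∈ p.support, v (p.coeff i) * r ^ i

open Polynomial
variable {K : Type*} [Field K] (v : AbsoluteValue K ℝ)

lemma n1_eq_of_subset {p : K[X]} {s : Finset ℕ} (h : p.support ⊆ s) (r : ℝ) :
    n1 v p r = ∑ i ∈ s, v (p.coeff i) * r ^ i := by
  refine Finset.sum_subset h fun b _ hb => ?_
  rw [Polynomial.notMem_support_iff.1 hb]; simp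

lemma n1_eq_range {p : K[X]} {n : ℕ} (h : p.natDegree < n) (r : ℝ) :
    n1 v p r = ∑ i ∈ Finset.range n, v (p.coeff i) * r ^ i :=
  n1_eq_of_subset v (fun i hi => by
    have := Polynomial.le_natDegree_of_mem_supp i hi
    simp; omega) r

lemma n1_nonneg (p : K[X]) {r : ℝ} (hr : 0 ≤ r) : 0 ≤ n1 v p r :=
  Finset.sum_nonneg fun _ _ => by positivity

lemma n1_add_le (p q : K[X]) {r : ℝ} (hr : 0 ≤ r) : n1 v (p + q) r ≤ n1 v p r + n1 v q r := by
  classical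
  rw [n1_eq_of_subset v (Polynomial.support_add (p := p) (q := q)),
    n1_eq_of_subset v (Finset.subset_union_left (s₂ := q.support)),
    n1_eq_of_subset v (Finset.subset_union_right (s₁ := p.support)), ← Finset.sum_add_distrib]
  refine Finset.sum_le_sum fun b _ => ?_
  rw [← add_mul, Polynomial.coeff_add]
  exact mul_le_mul_of_nonneg_right (v.add_le _ _) (by positivity)

lemma n1_neg (p : K[X]) (r : ℝ) : n1 v (-p) r = n1 v p r := by simp [n1]

lemma n1_C_mul (c : K) (p : K[X]) (r : ℝ) : n1 v (Polynomial.C c * p) r = v c * n1 v p r := by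
  rw [n1_eq_of_subset v (s := p.support) (fun i hi => ?_), n1, Finset.mul_sum]
  · exact Finset.sum_congr rfl fun i _ => by simp [mul_assoc]
  · rw [Polynomial.mem_support_iff] at hi ⊢
    rw [Polynomial.coeff_C_mul] at hi
    exact right_ne_zero_of_mul hi

lemma n1_X_mul (p : K[X]) (r : ℝ) : n1 v (Polynomial.X * p) r = r * n1 v p r := by
  have h1 : p.natDegree < p.natDegree + 1 := by omega
  have h2 : (Polynomial.X * p).natDegree < p.natDegree + 1 + 1 := by
    have := Polynomial.natDegree_mul_le (p := (Polynomial.X : K[X])) (q := p)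
    have := Polynomial.natDegree_X_le (R := K)
    omega
  rw [n1_eq_range v h1, n1_eq_range v h2, Finset.sum_range_succ', Finset.mul_sum]
  simp only [Polynomial.coeff_X_mul, Polynomial.coeff_X_mul_zero]
  simp only [map_zero, zero_mul, add_zero]
  exact Finset.sum_congr rfl fun i _ => by rw [pow_succ]; ring

/-- weight to use -/
lemma n1_lower (α β : K) : ∃ r : ℝ, (r = 1 / 2 ∨ r = 2) ∧ ∀ q : K[X],
    max (v α) (v β) / 2 * n1 v q r ≤ n1 v ((Polynomial.C β * Polynomial.X - Polynomial.C α) * q) r := by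
  rcases le_total (v β) (v α) with h | h
  · refine ⟨1 / 2, Or.inl rfl, fun q => ?_⟩
    rw [max_eq_left h]
    have h1 := n1_add_le v (-((Polynomial.C β * Polynomial.X - Polynomial.C α) * q))
      (Polynomial.C β * (Polynomial.X * q)) (r := 1 / 2) (by norm_num)
    have e : -((Polynomial.C β * Polynomial.X - Polynomial.C α) * q) + Polynomial.C β * (Polynomial.X * q)
      = Polynomial.C α * q := by ring
    rw [e, n1_neg, n1_C_mul, n1_C_mul, n1_X_mul] at h1
    have h2 := n1_nonneg v q (r := 1 / 2) (by norm_num)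
    nlinarith [mul_le_mul_of_nonneg_right h h2]
  · refine ⟨2, Or.inr rfl, fun q => ?_⟩
    rw [max_eq_right h]
    have h1 := n1_add_le v ((Polynomial.C β * Polynomial.X - Polynomial.C α) * q)
      (Polynomial.C α * q) (r := 2) (by norm_num)
    have e : ((Polynomial.C β * Polynomial.X - Polynomial.C α) * q) + Polynomial.C α * q
      = Polynomial.C β * (Polynomial.X * q) := by ring
    rw [e, n1_C_mul, n1_C_mul, n1_X_mul] at h1
    have h2 := n1_nonneg v q (r := 2) (by norm_num)
    nlinarith [mul_le_mul_of_nonneg_right h h2, mul_nonneg (v.nonneg β) h2]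

lemma n1_lower_coeff (α β : K) (e D : ℕ) (q : K[X]) (hD : ((Polynomial.C β * Polynomial.X - Polynomial.C α) ^ e * q).natDegree ≤ D)
    (hq : q.natDegree ≤ D) (i : ℕ) :
    (max (v α) (v β) / 2) ^ e * v (q.coeff i) ≤
      2 ^ D * n1 v ((Polynomial.C β * Polynomial.X - Polynomial.C α) ^ e * q) 1 := by
  obtain ⟨r, hr, h⟩ := n1_lower v α β
  have hr0 : 0 ≤ r := by rcases hr with rfl | rfl <;> norm_num
  have hm : 0 ≤ max (v α) (v β) / 2 := by
    have := (v.nonneg α).trans (le_max_left (v α) (v β)); positivity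
  have h2 : ∀ e : ℕ, (max (v α) (v β) / 2) ^ e * n1 v q r ≤ n1 v ((Polynomial.C β * Polynomial.X - Polynomial.C α) ^ e * q) r := by
    intro e
    induction e with
    | zero => simp
    | succ e ih =>
      rw [pow_succ', pow_succ', mul_assoc, mul_assoc]
      exact (mul_le_mul_of_nonneg_left ih hm).trans (h _)
  by_cases hi : q.natDegree < i
  · rw [Polynomial.coeff_eq_zero_of_natDegree_lt hi]
    simp
    have := n1_nonneg v ((Polynomial.C β * Polynomial.X - Polynomial.C α) ^ e * q) (r := 1) (by norm_num)
    positivity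
  have h3 : v (q.coeff i) * r ^ i ≤ n1 v q r := by
    rw [n1_eq_range v (Nat.lt_succ_self _)]
    exact Finset.single_le_sum (f := fun i => v (q.coeff i) * r ^ i) (fun b _ => by positivity)
      (Finset.mem_range.2 (by omega))
  have h4 := (mul_le_mul_of_nonneg_left h3 (pow_nonneg hm e)).trans (h2 e)
  have hx := pow_nonneg hm e
  have hy := v.nonneg (q.coeff i)
  rcases hr with rfl | rfl
  · have h5 : n1 v ((Polynomial.C β * Polynomial.X - Polynomial.C α) ^ e * q) (1 / 2) ≤
      n1 v ((Polynomial.C β * Polynomial.X - Polynomial.C α) ^ e * q) 1 := by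
      refine Finset.sum_le_sum fun j _ => mul_le_mul_of_nonneg_left ?_ (v.nonneg _)
      exact pow_le_pow_left₀ (by norm_num) (by norm_num) _
    have h6 : (1 : ℝ) ≤ 2 ^ D * (1 / 2) ^ i := by
      have : (2 : ℝ) ^ i ≤ 2 ^ D := pow_le_pow_right₀ (by norm_num) (by omega)
      rw [one_div, inv_pow, ← div_eq_mul_inv, one_le_div (by positivity)]
      exact this
    calc (max (v α) (v β) / 2) ^ e * v (q.coeff i) ≤ (max (v α) (v β) / 2) ^ e * v (q.coeff i) * (2 ^ D * (1 / 2) ^ i) :=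
          le_mul_of_one_le_right (by positivity) h6
      _ = 2 ^ D * ((max (v α) (v β) / 2) ^ e * (v (q.coeff i) * (1 / 2) ^ i)) := by ring
      _ ≤ _ := mul_le_mul_of_nonneg_left (h4.trans h5) (by positivity)
  · have h5 : n1 v ((Polynomial.C β * Polynomial.X - Polynomial.C α) ^ e * q) 2 ≤
      2 ^ D * n1 v ((Polynomial.C β * Polynomial.X - Polynomial.C α) ^ e * q) 1 := by
      rw [n1, n1, Finset.mul_sum]
      refine Finset.sum_le_sum fun j hj => ?_
      have hj := Polynomial.le_natDegree_of_mem_supp j hj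
      have : (2 : ℝ) ^ j ≤ 2 ^ D := pow_le_pow_right₀ (by norm_num) (by omega)
      rw [one_pow, mul_one, mul_comm]
      exact mul_le_mul_of_nonneg_right this (v.nonneg _)
    have h6 : (1 : ℝ) ≤ 2 ^ i := one_le_pow₀ (by norm_num)
    calc (max (v α) (v β) / 2) ^ e * v (q.coeff i) ≤ (max (v α) (v β) / 2) ^ e * (v (q.coeff i) * 2 ^ i) := by
          gcongr; exact le_mul_of_one_le_right hy h6
      _ ≤ _ := h4.trans h5

end One

section RothOne
variable {K : Type} [Field K] [CharZero K] (F : PF K)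

lemma PF.isFrac : IsFractionRing F.O K := by
  refine IsFractionRing.of_field F.O K fun z => ?_
  obtain ⟨D, hD, h⟩ := F.den z
  have hc : (D : K) ≠ 0 := by exact_mod_cast hD
  exact ⟨⟨_, F.R_le h⟩, ⟨D, F.nat_mem D⟩, by
    show z = (D : K) * z / D
    field_simp⟩

lemma PF.gauss (α β : F.O) (hαβ : IsCoprime α β) (hβ : β ≠ 0) (e : ℕ) (p : Polynomial F.O)
    (h : (Polynomial.X - Polynomial.C ((α : K) / (β : K))) ^ e ∣ p.map F.O.subtype) :
    (Polynomial.C β * Polynomial.X - Polynomial.C α) ^ e ∣ p := by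
  haveI := F.isFrac
  haveI := F.pid
  letI : StrongNormalizationMonoid F.O := UniqueFactorizationMonoid.normalizationMonoid
  letI : NormalizedGCDMonoid F.O := UniqueFactorizationMonoid.toNormalizedGCDMonoid F.O
  have hprim : (Polynomial.C β * Polynomial.X - Polynomial.C α).IsPrimitive := by
    rw [Polynomial.isPrimitive_iff_isUnit_of_C_dvd]
    intro r hr
    rw [Polynomial.C_dvd_iff_dvd_coeff] at hr
    have h0 := hr 0
    have h1 := hr 1
    simp at h0 h1
    exact hαβ.isUnit_of_dvd' h0 h1
  have hprim2 : ((Polynomial.C β * Polynomial.X - Polynomial.C α) ^ e).IsPrimitive := by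
    induction e with
    | zero => simpa using Polynomial.isPrimitive_one
    | succ e ih => rw [pow_succ]; exact (ih ((pow_dvd_pow _ (Nat.le_succ e)).trans h)).mul hprim
  rw [Polynomial.IsPrimitive.dvd_iff_fraction_map_dvd_fraction_map K hprim2]
  have hβ' : (β : K) ≠ 0 := by simpa using hβ
  have e1 : ((Polynomial.C β * Polynomial.X - Polynomial.C α) ^ e).map (algebraMap F.O K)
      = Polynomial.C ((β : K) ^ e) * (Polynomial.X - Polynomial.C ((α : K) / (β : K))) ^ e := by
    rw [Polynomial.map_pow, Polynomial.C_pow, ← mul_pow, mul_sub, ← Polynomial.C_mul, mul_div_cancel₀ _ hβ']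
    simp
    rfl
  rw [e1]
  exact (Polynomial.isUnit_C.2 (isUnit_iff_ne_zero.2 (pow_ne_zero _ hβ'))).mul_left_dvd.2 h

lemma tr_neg_tr {σ : Type*} [Fintype σ] (ξ : σ → K) (p : MvPolynomial σ K) : tr (-ξ) (tr ξ p) = p := by
  rw [tr, tr, bind₁_bind₁]
  simp

lemma PF.roth_one (V : MvPolynomial Unit K) (hV : ∀ b, coeff b V ∈ F.O) (hV0 : V ≠ 0) (D : ℕ)
    (hD : ∀ b, coeff b V ≠ 0 → b () ≤ D) (α β : F.O) (hαβ : IsCoprime α β) (hβ : β ≠ 0) (e : ℕ)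
    (he : ∀ b, coeff b (tr (fun _ => (α : K) / (β : K)) V) ≠ 0 → e ≤ b ()) :
    F.pr (fun v => max (F.abv v α) (F.abv v β)) ^ e ≤ 4 ^ (D * F.M) * F.pr (fun v => N11 (F.abv v) V) := by
  classical
  set ξ : Unit → K := fun _ => (α : K) / (β : K) with hξ
  let φ : MvPolynomial Unit K →ₐ[K] Polynomial K := aeval fun _ => Polynomial.X
  have hφ : ∀ p, φ p = ∑ b ∈ p.support, Polynomial.C (coeff b p) * Polynomial.X ^ (b ()) := by
    intro p
    simp only [φ, aeval_def, eval₂_eq']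
    simp
  have hcoef : ∀ p i, (φ p).coeff i = coeff (Finsupp.single () i) p := by
    intro p i
    rw [hφ]
    simp only [Polynomial.finset_sum_coeff, Polynomial.coeff_C_mul, Polynomial.coeff_X_pow]
    rw [Finset.sum_eq_single (Finsupp.single () i)]
    · simp
    · intro b _ hb
      rw [if_neg, mul_zero]
      intro h; apply hb; ext; simp [h]
    · intro h; simp [notMem_support_iff.1 h]
  have hdiv : (Polynomial.X - Polynomial.C ((α : K) / (β : K))) ^ e ∣ φ V := by
    have h1 : φ V = ∑ b ∈ (tr ξ V).support, Polynomial.C (coeff b (tr ξ V)) *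
        (Polynomial.X - Polynomial.C ((α : K) / (β : K))) ^ (b ()) := by
      conv_lhs => rw [← tr_neg_tr ξ V, tr, bind_eq_sum, map_sum]
      refine Finset.sum_congr rfl fun b _ => ?_
      have : φ (C (coeff b (tr ξ V))) = Polynomial.C (coeff b (tr ξ V)) := by
        simp only [φ, aeval_C]; rfl
      have h3 : φ (C ((α : K) / (β : K))) = Polynomial.C ((α : K) / (β : K)) := by
        simp only [φ, aeval_C]; rfl
      have h2 : φ (X ()) = Polynomial.X := by simp [φ]
      rw [map_mul, this]
      simp [map_pow, map_add, h2, hξ, h3, sub_eq_add_neg]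
    rw [h1]
    refine Finset.dvd_sum fun b hb => Dvd.dvd.mul_left (pow_dvd_pow _ (he b (mem_support_iff.1 hb))) _
  have hφ0 : φ V ≠ 0 := by
    obtain ⟨b, hb⟩ := ne_zero_iff.1 hV0
    intro h
    apply hb
    have := hcoef V (b ())
    rw [h, Polynomial.coeff_zero] at this
    rw [this]; congr 1; ext; simp
  have hdeg : (φ V).natDegree ≤ D := by
    refine Polynomial.natDegree_le_iff_coeff_eq_zero.2 fun N hN => ?_
    rw [hcoef]
    by_contra h
    have := hD _ h
    simp at this; omega
  -- lift to O
  obtain ⟨p, hp⟩ : ∃ p : Polynomial F.O, p.map F.O.subtype = φ V := by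
    have := Polynomial.lifts_iff_coeff_lifts (f := F.O.subtype) (φ V)
    have h2 := this.2 fun n => by
      rw [hcoef]; exact ⟨⟨_, hV _⟩, rfl⟩
    exact h2
  obtain ⟨q, hq⟩ := F.gauss α β hαβ hβ e p (by rw [hp]; exact hdiv)
  have hq2 : φ V = (Polynomial.C (β : K) * Polynomial.X - Polynomial.C (α : K)) ^ e * q.map F.O.subtype := by
    rw [← hp, hq]; simp
  have hq0 : q.map F.O.subtype ≠ 0 := right_ne_zero_of_mul (hq2 ▸ hφ0)
  have hβ' : (β : K) ≠ 0 := by simpa using hβ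
  have hlin : (Polynomial.C (β : K) * Polynomial.X - Polynomial.C (α : K)).natDegree = 1 := by
    rw [sub_eq_add_neg, ← Polynomial.C_neg]; exact Polynomial.natDegree_linear hβ'
  have hdeg2 : e + (q.map F.O.subtype).natDegree ≤ D := by
    rw [hq2, Polynomial.natDegree_mul (left_ne_zero_of_mul (hq2 ▸ hφ0)) hq0, Polynomial.natDegree_pow, hlin] at hdeg
    omega
  obtain ⟨i, hi⟩ : ∃ i, (q.map F.O.subtype).coeff i ≠ 0 := by
    by_contra h; push_neg at h; exact hq0 (Polynomial.ext (by simpa using h))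
  have hin1 : ∀ v, n1 (F.abv v) (φ V) 1 ≤ N11 (F.abv v) V := by
    intro v
    have : ∀ s : Finset (Unit →₀ ℕ), n1 (F.abv v) (∑ b ∈ s, Polynomial.C (coeff b V) * Polynomial.X ^ (b ())) 1
        ≤ ∑ b ∈ s, F.abv v (coeff b V) := by
      intro s
      induction s using Finset.induction_on with
      | empty => simp [n1]
      | insert a s ha ih =>
        rw [Finset.sum_insert ha, Finset.sum_insert ha]
        refine (n1_add_le _ _ _ zero_le_one).trans (add_le_add ?_ ih)
        rw [n1_C_mul]
        have : ∀ k : ℕ, n1 (F.abv v) (Polynomial.X ^ k) 1 = 1 := by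
          intro k
          induction k with
          | zero => 
            rw [n1_eq_range (n := 1) _ (by simp)]; simp
          | succ k ih => rw [pow_succ', n1_X_mul, ih, one_mul]
        rw [this, mul_one]
    have h := this V.support
    rw [← hφ] at h
    simpa [N11, N1] using h
  have hloc : ∀ v, (max (F.abv v α) (F.abv v β) / 2) ^ e * F.abv v ((q.map F.O.subtype).coeff i) ≤
      2 ^ D * N11 (F.abv v) V := by
    intro v
    have := n1_lower_coeff (F.abv v) (α : K) (β : K) e D (q.map F.O.subtype) (by rw [← hq2]; exact hdeg) (by omega) i
    rw [← hq2] at this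
    exact this.trans (mul_le_mul_of_nonneg_left (hin1 v) (by positivity))
  have hmax : ∀ v, 0 ≤ max (F.abv v α) (F.abv v β) := fun v => ((F.abv v).nonneg _).trans (le_max_left _ _)
  have h1 := F.pr_le (fun v => mul_nonneg (pow_nonneg (div_nonneg (hmax v) zero_le_two) _) ((F.abv v).nonneg _)) hloc
  rw [F.pr_mul, F.pr_mul, F.pr_pow (fun v => max (F.abv v α) (F.abv v β) / 2), F.pr_const] at h1
  simp only [div_eq_mul_inv] at h1
  rw [F.pr_mul, F.pr_const] at h1
  have h2 : 1 ≤ F.pr (fun v => F.abv v ((q.map F.O.subtype).coeff i)) :=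
    F.pr_abv (by simp) hi
  have h3 : 0 ≤ (F.pr (fun v => max (F.abv v α) (F.abv v β)) * 2⁻¹ ^ F.M) ^ e := by
    have := F.pr_nonneg hmax
    positivity
  have h4 := (le_mul_of_one_le_right h3 h2).trans h1
  rw [mul_pow] at h4
  have hN : 0 ≤ F.pr (fun v => N11 (F.abv v) V) := F.pr_nonneg fun v => N1_nonneg _ _ (fun _ => zero_le_one)
  have h5 : (2⁻¹ ^ F.M : ℝ) ^ e * 2 ^ (F.M * e) = 1 := by
    rw [← pow_mul, ← mul_pow]; norm_num
  have h6 : (2 : ℝ) ^ (F.M * e) ≤ 2 ^ (D * F.M) := by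
    apply pow_le_pow_right₀ (by norm_num)
    rw [mul_comm]; exact Nat.mul_le_mul_right _ (by omega)
  calc F.pr (fun v => max (F.abv v α) (F.abv v β)) ^ e
      = (F.pr (fun v => max (F.abv v α) (F.abv v β)) ^ e * (2⁻¹ ^ F.M) ^ e) * 2 ^ (F.M * e) := by
        rw [mul_assoc, h5, mul_one]
    _ ≤ ((2 ^ D) ^ F.M * F.pr (fun v => N11 (F.abv v) V)) * 2 ^ (D * F.M) := by
        gcongr
    _ = (2 ^ (D * F.M) * 2 ^ (D * F.M)) * F.pr (fun v => N11 (F.abv v) V) := by rw [← pow_mul]; ring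
    _ = _ := by rw [← mul_pow]; norm_num

end RothOne

end Part2

section Part3
set_option autoImplicit false
open MvPolynomial

section Ten
variable {K : Type*} [Field K] {m : ℕ}

/-- the product `u(x_1..x_m) w(x_0)` -/
noncomputable def ten (u : MvPolynomial (Fin m) K) (w : MvPolynomial Unit K) : MvPolynomial (Fin (m + 1)) K :=
  rename Fin.succ u * rename (fun _ => 0) w

lemma ten_monomial (b : Fin m →₀ ℕ) (t : Unit →₀ ℕ) (c d : K) :
    ten (monomial b c) (monomial t d) = monomial (Finsupp.cons (t ()) b) (c * d) := by
  rw [ten, rename_monomial, rename_monomial, monomial_mul]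
  congr 2
  ext i
  refine Fin.cases ?_ (fun i => ?_) i
  · rw [Finsupp.add_apply, Finsupp.cons_zero, Finsupp.mapDomain_notin_range _ _ (by simp)]
    have : t = Finsupp.single () (t ()) := by ext; simp
    rw [this, Finsupp.mapDomain_single]; simp
  · rw [Finsupp.add_apply, Finsupp.cons_succ, Finsupp.mapDomain_apply (Fin.succ_injective _)]
    have : t = Finsupp.single () (t ()) := by ext; simp
    rw [this, Finsupp.mapDomain_single]; simp

lemma ten_add_left (u u' : MvPolynomial (Fin m) K) (w : MvPolynomial Unit K) :
    ten (u + u') w = ten u w + ten u' w := by simp [ten, add_mul]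

lemma ten_add_right (u : MvPolynomial (Fin m) K) (w w' : MvPolynomial Unit K) :
    ten u (w + w') = ten u w + ten u w' := by simp [ten, mul_add]

lemma coeff_ten (u : MvPolynomial (Fin m) K) (w : MvPolynomial Unit K) (b : Fin m →₀ ℕ) (t : Unit →₀ ℕ) :
    coeff (Finsupp.cons (t ()) b) (ten u w) = coeff b u * coeff t w := by
  classical
  induction u using MvPolynomial.induction_on' with
  | add p q hp hq => rw [ten_add_left, coeff_add, hp, hq, coeff_add, add_mul]
  | monomial b' c =>
    induction w using MvPolynomial.induction_on' with
    | add p q hp hq => rw [ten_add_right, coeff_add, hp, hq, coeff_add, mul_add]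
    | monomial t' d =>
      rw [ten_monomial, coeff_monomial, coeff_monomial, coeff_monomial]
      by_cases h1 : b' = b
      · by_cases h2 : t' = t
        · simp [h1, h2]
        · rw [if_neg, if_neg h2, mul_zero]
          intro h
          apply h2
          ext
          simpa using congrArg (fun z => z 0) h
      · rw [if_neg, if_neg h1, zero_mul]
        intro h
        apply h1
        have := congrArg Finsupp.tail h
        simpa using this

lemma hs_ten (a : Fin m →₀ ℕ) (k : Unit →₀ ℕ) (u : MvPolynomial (Fin m) K) (w : MvPolynomial Unit K) :
    hs (Finsupp.cons (k ()) a) (ten u w) = ten (hs a u) (hs k w) := by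
  induction u using MvPolynomial.induction_on' with
  | add p q hp hq => rw [ten_add_left, (hs _).map_add, (hs _).map_add, hp, hq, ten_add_left]
  | monomial b' c =>
    induction w using MvPolynomial.induction_on' with
    | add p q hp hq => rw [ten_add_right, (hs _).map_add, (hs _).map_add, hp, hq, ten_add_right]
    | monomial t' d =>
      rw [ten_monomial, hs_monomial, hs_monomial, hs_monomial, ten_monomial, Fin.prod_univ_succ]
      have h1 : Finsupp.cons (t' ()) b' - Finsupp.cons (k ()) a = Finsupp.cons ((t' - k) ()) (b' - a) := by
        ext i
        refine Fin.cases ?_ (fun i => ?_) i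
        · simp
        · simp
      rw [h1]
      congr 1
      simp; ring

lemma tr_ten (ξ : Fin (m + 1) → K) (u : MvPolynomial (Fin m) K) (w : MvPolynomial Unit K) :
    tr ξ (ten u w) = ten (tr (fun i => ξ i.succ) u) (tr (fun _ => ξ 0) w) := by
  rw [ten, ten, map_mul]
  congr 1
  · rw [tr, tr, bind₁_rename, rename_bind₁]
    congr 2
    funext i; simp
  · rw [tr, tr, bind₁_rename, rename_bind₁]
    congr 2
    funext i; simp

/-- decomposition of a polynomial -/
lemma exists_ten (p : MvPolynomial (Fin (m + 1)) K) (d : ℕ) (hd : ∀ e, coeff e p ≠ 0 → e 0 ≤ d) :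
    ∃ s : ℕ, s ≤ d + 1 ∧ ∃ (f : Fin s → MvPolynomial (Fin m) K) (g : Fin s → MvPolynomial Unit K),
      LinearIndependent K f ∧ LinearIndependent K g ∧ p = ∑ j, ten (f j) (g j) := by
  classical
  let c : Fin (d + 1) → MvPolynomial (Fin m) K := fun t => (finSuccEquiv K m p).coeff t
  have hc : ∀ t b, coeff b (c t) = coeff (Finsupp.cons (t : ℕ) b) p := fun t b => finSuccEquiv_coeff_coeff _ _ _
  let S := Submodule.span K (Set.range c)
  haveI : Module.Finite K S := FiniteDimensional.span_of_finite K (Set.finite_range c)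
  let B := Module.finBasis K S
  have hcm : ∀ t, c t ∈ S := fun t => Submodule.subset_span ⟨t, rfl⟩
  refine ⟨Module.finrank K S, ?_, fun j => (B j : MvPolynomial (Fin m) K),
    fun j => ∑ t : Fin (d + 1), monomial (Finsupp.single () (t : ℕ)) (B.repr ⟨c t, hcm t⟩ j), ?_, ?_, ?_⟩
  · have := finrank_range_le_card (R := K) c
    rw [Fintype.card_fin] at this
    exact this
  · exact B.linearIndependent.map' S.subtype (Submodule.ker_subtype S)
  · rw [Fintype.linearIndependent_iff]
    intro l hl
    -- functional
    let φ : S →ₗ[K] K := B.constr K l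
    have hφ : ∀ t, φ ⟨c t, hcm t⟩ = 0 := by
      intro t
      rw [Module.Basis.constr_apply_fintype]
      have := congrArg (coeff (Finsupp.single () (t : ℕ))) hl
      simp only [coeff_sum, coeff_smul, coeff_monomial, coeff_zero] at this
      rw [← this]
      refine Finset.sum_congr rfl fun j _ => ?_
      rw [Finset.sum_eq_single t]
      · simp [mul_comm]
      · intro t' _ h
        rw [if_neg]
        intro h'
        apply h
        have := congrArg (fun z => z ()) h'
        exact Fin.ext (by simpa using this)
      · simp
    have hφ0 : φ = 0 := by
      have : ∀ x (hx : x ∈ S), φ ⟨x, hx⟩ = 0 := by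
        intro x hx
        induction hx using Submodule.span_induction with
        | mem x hx => obtain ⟨t, rfl⟩ := hx; exact hφ t
        | zero => exact map_zero φ
        | add x y hx hy h1 h2 =>
          have := map_add φ ⟨x, hx⟩ ⟨y, hy⟩
          rw [h1, h2, add_zero] at this; exact this
        | smul a x hx h =>
          have := map_smul φ a ⟨x, hx⟩
          rw [h, smul_zero] at this; exact this
      ext ⟨x, hx⟩
      simpa using this x hx
    intro j
    have : φ (B j) = l j := by simp [φ]
    rw [← this, hφ0]; rfl
  · ext e
    obtain ⟨t, b, rfl⟩ : ∃ (t : Unit →₀ ℕ) (b : Fin m →₀ ℕ), e = Finsupp.cons (t ()) b :=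
      ⟨Finsupp.single () (e 0), Finsupp.tail e, by simp⟩
    rw [coeff_sum]
    simp only [coeff_ten, coeff_sum, coeff_monomial]
    by_cases ht : t () ≤ d
    · have h1 : ∀ j, (∑ x : Fin (d + 1), if Finsupp.single () (x : ℕ) = t then (B.repr ⟨c x, hcm x⟩) j else 0)
          = B.repr ⟨c ⟨t (), by omega⟩, hcm _⟩ j := by
        intro j
        rw [Finset.sum_eq_single ⟨t (), by omega⟩]
        · rw [if_pos]; ext; simp
        · intro x _ hx
          rw [if_neg]
          rintro rfl
          apply hx; simp
        · simp
      simp only [h1]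
      have h2 := B.sum_repr ⟨c ⟨t (), by omega⟩, hcm _⟩
      have h3 := congrArg (fun z : S => coeff b (z : MvPolynomial (Fin m) K)) h2
      simp only [hc] at h3
      rw [← h3]
      rw [Submodule.coe_sum, coeff_sum]
      refine Finset.sum_congr rfl fun j _ => ?_
      rw [Submodule.coe_smul, coeff_smul, smul_eq_mul, mul_comm]
    · rw [Finset.sum_eq_zero]
      · by_contra h
        have := hd _ h
        simp at this; omega
      · intro j _
        rw [Finset.sum_eq_zero, mul_zero]
        intro x _
        rw [if_neg]
        rintro rfl
        apply ht
        have := x.2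
        simp; omega

end Ten

section IntPoly
variable {K : Type} [Field K] (F : PF K) {σ : Type*}

/-- polynomials with coefficients in `O` -/
noncomputable def PF.IP (σ : Type*) : Subring (MvPolynomial σ K) := (MvPolynomial.map (σ := σ) F.O.subtype).range

lemma PF.mem_IP {p : MvPolynomial σ K} : p ∈ F.IP σ ↔ ∀ b, coeff b p ∈ F.O := by
  constructor
  · rintro ⟨q, rfl⟩ b
    rw [coeff_map]; exact (coeff b q).2
  · intro h
    rw [p.as_sum]
    refine Subring.sum_mem _ fun b _ => ⟨monomial b ⟨coeff b p, h b⟩, ?_⟩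
    rw [map_monomial]; rfl

variable [Fintype σ]
lemma N11_hs_le (v : F.ι) (a : σ →₀ ℕ) (p : MvPolynomial σ K) (d : σ → ℕ) (hd : ∀ e, coeff e p ≠ 0 → ∀ i, e i ≤ d i) :
    N11 (F.abv v) (hs a p) ≤ 2 ^ (∑ i, d i) * N11 (F.abv v) p := by
  classical
  conv_lhs => rw [p.as_sum, map_sum]
  refine (N1_sum_le (F.abv v) _ _ (fun _ => zero_le_one)).trans ?_
  rw [N11, N1, Finset.mul_sum]
  refine Finset.sum_le_sum fun b hb => ?_
  rw [hs_monomial, N1_monomial, map_mul]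
  simp only [one_pow, Finset.prod_const_one, mul_one]
  rw [mul_comm]
  refine mul_le_mul_of_nonneg_right ?_ ((F.abv v).nonneg _)
  have : (∏ i, ((b i).choose (a i) : K)) = ((∏ i, (b i).choose (a i) : ℕ) : K) := by push_cast; rfl
  rw [this]
  refine (F.abv_nat_le v _).trans ?_
  rw [← Finset.prod_pow_eq_pow_sum]
  push_cast
  refine Finset.prod_le_prod (fun _ _ => by positivity) fun i _ => ?_
  have h1 : (b i).choose (a i) ≤ 2 ^ (b i) := Nat.choose_le_two_pow _ _
  have h2 : 2 ^ b i ≤ 2 ^ d i := Nat.pow_le_pow_right (by norm_num) (hd b (mem_support_iff.1 hb) i)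
  exact_mod_cast h1.trans h2

lemma hs_mem_IP (a : σ →₀ ℕ) {p : MvPolynomial σ K} (hp : p ∈ F.IP σ) : hs a p ∈ F.IP σ := by
  rw [F.mem_IP] at hp ⊢
  intro b
  rw [coeff_hs]
  exact F.O.mul_mem (hp _) (F.O.prod_mem fun i _ => F.nat_mem _)

lemma det_mem_IP {s : ℕ} (A : Matrix (Fin s) (Fin s) (MvPolynomial σ K)) (h : ∀ i j, A i j ∈ F.IP σ) :
    A.det ∈ F.IP σ := by
  rw [Matrix.det_apply']
  exact Subring.sum_mem _ fun π _ => Subring.mul_mem _ (intCast_mem _ _) (Subring.prod_mem _ fun i _ => h _ _)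

lemma N11_det_le (v : F.ι) {s : ℕ} (A : Matrix (Fin s) (Fin s) (MvPolynomial σ K)) (B : ℝ)
    (h : ∀ i j, N11 (F.abv v) (A i j) ≤ B) : N11 (F.abv v) A.det ≤ s.factorial * B ^ s := by
  rw [Matrix.det_apply']
  refine (N1_sum_le (F.abv v) _ _ (fun _ => zero_le_one)).trans ?_
  have : ∀ π : Equiv.Perm (Fin s), N1 (F.abv v) (((Equiv.Perm.sign π : ℤ) : MvPolynomial σ K) * ∏ i, A (π i) i) (fun _ => 1) ≤ B ^ s := by
    intro π
    have e : N1 (F.abv v) (((Equiv.Perm.sign π : ℤ) : MvPolynomial σ K) * ∏ i, A (π i) i) (fun _ => 1)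
        = N1 (F.abv v) (∏ i, A (π i) i) (fun _ => 1) := by
      rcases Int.units_eq_one_or (Equiv.Perm.sign π) with h | h
      · simp [h]
      · rw [h]; simp [N1_neg]
    rw [e]
    refine (N1_prod_le (F.abv v) _ _ (fun _ => zero_le_one)).trans ?_
    refine (Finset.prod_le_prod (fun i _ => N1_nonneg _ _ (fun _ => zero_le_one)) fun i _ => h (π i) i).trans ?_
    simp
  refine (Finset.sum_le_sum fun π _ => this π).trans ?_
  simp [Fintype.card_perm]

lemma IdxGe.det {s : ℕ} {w : σ → ℝ} {θ : Fin s → ℝ} (A : Matrix (Fin s) (Fin s) (MvPolynomial σ K))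
    (h : ∀ i j, IdxGe w (θ j) (A i j)) : IdxGe w (∑ j, θ j) A.det := by
  rw [Matrix.det_apply']
  refine IdxGe.sum _ fun π _ => ?_
  have h1 : IdxGe w 0 (((Equiv.Perm.sign π : ℤ) : MvPolynomial σ K)) := by
    have := IdxGe.C w ((Equiv.Perm.sign π : ℤ) : K)
    simpa using this
  have := h1.mul (IdxGe.prod Finset.univ fun i _ => h (π i) i)
  simpa using this

end IntPoly

end Part3

section Part4
set_option autoImplicit false
open MvPolynomial

section Roth
variable {K : Type} [Field K] [CharZero K] (F : PF K)

lemma sum_max_ge (x : ℝ) (hx : 0 < x) (hx1 : x ≤ 1) (d s : ℕ) (hd : 1 ≤ d) (hs : s ≤ d + 1) :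
    s * x ^ 2 / 8 ≤ ∑ k ∈ Finset.range s, max 0 (x - k / d) := by
  have hd0 : (0 : ℝ) < d := by exact_mod_cast hd
  set n := min s (⌊x * d / 2⌋₊ + 1) with hn
  have h1 : (x / 2) * n ≤ ∑ k ∈ Finset.range n, max 0 (x - (k : ℝ) / d) := by
    rw [mul_comm, ← nsmul_eq_mul, ← Finset.card_range n, ← Finset.sum_const, Finset.card_range]
    refine Finset.sum_le_sum fun k hk => ?_
    refine le_max_of_le_right ?_
    have hk1 : k ≤ ⌊x * d / 2⌋₊ := by
      have := Finset.mem_range.1 hk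
      have := min_le_right s (⌊x * d / 2⌋₊ + 1)
      omega
    have hk2 : (k : ℝ) ≤ x * d / 2 := (Nat.le_floor_iff (by positivity)).1 hk1
    have : (k : ℝ) / d ≤ x / 2 := by
      rw [div_le_iff₀ hd0]; linarith
    linarith
  have h2 : ∑ k ∈ Finset.range n, max 0 (x - (k : ℝ) / d) ≤ ∑ k ∈ Finset.range s, max 0 (x - (k : ℝ) / d) :=
    Finset.sum_le_sum_of_subset_of_nonneg (Finset.range_mono (min_le_left _ _)) fun _ _ _ => le_max_left _ _
  have h3 : x * s / 4 ≤ n := by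
    rw [hn]; push_cast
    have hs' : (s : ℝ) ≤ 2 * d := by
      have : s ≤ 2 * d := by omega
      exact_mod_cast this
    refine le_min ?_ ?_
    · have : (0 : ℝ) ≤ s := by positivity
      nlinarith
    · have := Nat.lt_floor_add_one (x * d / 2)
      nlinarith
  nlinarith

lemma exists_W {m : ℕ} (p : MvPolynomial (Fin (m + 1)) K) (hp : p ≠ 0) (d : ℕ)
    (hd : ∀ e, coeff e p ≠ 0 → e 0 ≤ d) :
    ∃ s : ℕ, 1 ≤ s ∧ s ≤ d + 1 ∧ ∃ (μ : Fin s → (Fin m →₀ ℕ)) (k : Fin s → ℕ)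
      (U : MvPolynomial (Fin m) K) (V : MvPolynomial Unit K),
      (∀ i, ∑ l, μ i l < s) ∧ (∀ f : ℕ → ℝ, ∑ i, f (k i) = ∑ i ∈ Finset.range s, f i) ∧ U ≠ 0 ∧ V ≠ 0 ∧
      (Matrix.of fun i j => hs (Finsupp.cons (k j) (μ i)) p).det = ten U V := by
  classical
  obtain ⟨s, hs1, f, g, hf, hg, hpe⟩ := exists_ten p d hd
  obtain ⟨μ, hμ, hU⟩ := wronskian f hf
  obtain ⟨ν, hν, hV⟩ := wronskian g hg
  refine ⟨s, ?_, hs1, μ, fun j => ν j (), (Matrix.of fun i j => hs (μ i) (f j)).det,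
    (Matrix.of fun i j => hs (ν i) (g j)).det, hμ, ?_, hU, hV, ?_⟩
  · rcases Nat.eq_zero_or_pos s with rfl | h
    · exact absurd (by simpa using hpe) hp
    · exact h
  · intro φ
    have hlt : ∀ j, ν j () < s := fun j => by simpa using hν j
    have hinj : Function.Injective fun j => (⟨ν j (), hlt j⟩ : Fin s) := by
      intro i j hij
      by_contra hne
      apply hV
      refine Matrix.det_zero_of_row_eq hne ?_
      have : ν i = ν j := by
        ext; simpa using hij
      funext l
      simp [this]
    have hb := Finite.injective_iff_bijective.1 hinj
    rw [← Fin.sum_univ_eq_sum_range]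
    exact hb.sum_comp fun j : Fin s => φ j
  · have e1 : (Matrix.of fun i j => hs (Finsupp.cons (ν j ()) (μ i)) p) =
        ((rename Fin.succ : MvPolynomial (Fin m) K →ₐ[K] _).mapMatrix (Matrix.of fun i j => hs (μ i) (f j))) *
        ((rename (fun _ => 0) : MvPolynomial Unit K →ₐ[K] MvPolynomial (Fin (m + 1)) K).mapMatrix
          (Matrix.of fun i j => hs (ν i) (g j))).transpose := by
      ext1 i j
      rw [Matrix.mul_apply, Matrix.of_apply, hpe, map_sum]
      refine Finset.sum_congr rfl fun l _ => ?_
      rw [hs_ten]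
      rfl
    rw [e1, Matrix.det_mul, Matrix.det_transpose, ← AlgHom.map_det, ← AlgHom.map_det, ten]

/-- height of a fraction -/
noncomputable def PF.hh (α β : K) : ℝ := F.pr (fun v => max (F.abv v α) (F.abv v β))

lemma PF.one_le_N11 {σ : Type*} [Fintype σ] {p : MvPolynomial σ K} (hp : p ≠ 0) (hI : p ∈ F.IP σ) :
    1 ≤ F.pr fun v => N11 (F.abv v) p := by
  obtain ⟨b, hb⟩ := ne_zero_iff.1 hp
  exact (F.pr_abv (F.mem_IP.1 hI b) hb).trans (F.pr_le (fun v => (F.abv v).nonneg _) fun v => coeff_le_N11 _ _ _)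

set_option maxHeartbeats 1600000 in
theorem PF.roth (m : ℕ) : ∀ τ : ℝ, 0 < τ → ∃ κ : ℝ, 1 ≤ κ ∧ ∀ (d : Fin m → ℕ) (D : ℕ), 1 ≤ D →
    (∀ j, 1 ≤ d j ∧ d j ≤ D) → (∀ i j, i < j → κ * d i ≤ d j) →
    ∀ p : MvPolynomial (Fin m) K, p ≠ 0 → p ∈ F.IP _ → (∀ e, coeff e p ≠ 0 → ∀ i, e i ≤ d i) →
    ∀ α β : Fin m → F.O, (∀ j, IsCoprime (α j) (β j)) → (∀ j, β j ≠ 0) →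
    (∀ j, κ * (Real.log (F.pr fun v => N11 (F.abv v) p) + D) ≤ d j * Real.log (F.hh (α j) (β j))) →
    ¬ IdxGe (fun j => (d j : ℝ)⁻¹) τ (tr (fun j => (α j : K) / (β j : K)) p) := by
  classical
  induction m with
  | zero =>
    intro τ hτ
    refine ⟨1, le_rfl, fun d D _ _ _ p hp _ _ α β _ _ _ h => ?_⟩
    have : tr (fun j => (α j : K) / (β j : K)) p ≠ 0 := by
      intro h0
      apply hp
      rw [← tr_neg_tr (fun j => (α j : K) / (β j : K)) p, h0, map_zero]
    obtain ⟨b, hb⟩ := ne_zero_iff.1 this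
    have := h b hb
    simp at this
    linarith
  | succ m ih =>
    intro τ0 hτ0
    set τ := min τ0 1 with hτdef
    have hτ : 0 < τ := lt_min hτ0 one_pos
    have hτ1 : τ ≤ 1 := min_le_right _ _
    set τ' := τ ^ 2 / 128 with hτ'
    have hτ'0 : 0 < τ' := by positivity
    obtain ⟨κ', hκ'1, hκ'⟩ := ih τ' hτ'0
    set C1 : ℝ := F.M * (m + 3) + 1 with hC1
    have hC1p : 1 ≤ C1 := by rw [hC1]; nlinarith [show (0 : ℝ) ≤ F.M from by positivity, show (0 : ℝ) ≤ m from by positivity]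
    set κ : ℝ := κ' * (C1 + 1) + 2 / τ + (2 * F.M + C1 + 1) / τ' with hκ
    have hM0 : (0 : ℝ) ≤ F.M := by positivity
    have hk1 : κ' * (C1 + 1) ≤ κ := by
      have : 0 ≤ 2 / τ := by positivity
      have : 0 ≤ (2 * F.M + C1 + 1) / τ' := by positivity
      linarith
    have hk2 : 2 / τ ≤ κ := by
      have : 0 ≤ κ' * (C1 + 1) := by positivity
      have : 0 ≤ (2 * F.M + C1 + 1) / τ' := by positivity
      linarith
    have hk3 : 2 * F.M + C1 + 1 ≤ κ * τ' := by
      rw [← div_le_iff₀ hτ'0]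
      have : 0 ≤ κ' * (C1 + 1) := by positivity
      have : 0 ≤ 2 / τ := by positivity
      linarith
    have hkk' : κ' ≤ κ := by nlinarith
    refine ⟨κ, by linarith, fun d D hD hd hgap p hp hpI hpd α β hαβ hβ hh hidx => ?_⟩
    have hidx : IdxGe (fun j => (d j : ℝ)⁻¹) τ (tr (fun j => (α j : K) / (β j : K)) p) := hidx.mono (min_le_left _ _)
    set ξ : Fin (m + 1) → K := fun j => (α j : K) / (β j : K) with hξ
    obtain ⟨s, hs1, hsd, μ, k, U, V, hμ, hk, hU, hV, hW⟩ := exists_W p hp (d 0) fun e he => hpd e he 0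
    set W := (Matrix.of fun i j => hs (Finsupp.cons (k j) (μ i)) p).det with hWdef
    have hdpos : ∀ j, (0 : ℝ) < d j := fun j => by exact_mod_cast (hd j).1
    have hd0 := hdpos 0
    have hs0 : (1 : ℝ) ≤ s := by exact_mod_cast hs1
    -- index of W
    have hWidx : IdxGe (fun j => (d j : ℝ)⁻¹) (s * τ ^ 2 / 32) (tr ξ W) := by
      have e1 : tr ξ W = (Matrix.of fun i j => hs (Finsupp.cons (k j) (μ i)) (tr ξ p)).det := by
        rw [hWdef, AlgHom.map_det]
        congr 1
        ext1 i j
        rw [Matrix.of_apply, hs_tr]; rfl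
      rw [e1]
      have h1 : IdxGe (fun j => (d j : ℝ)⁻¹) (∑ j, max 0 (τ / 2 - (k j : ℝ) / d 0))
          (Matrix.of fun i j => hs (Finsupp.cons (k j) (μ i)) (tr ξ p)).det := by
        refine IdxGe.det _ fun i j e he => ?_
        refine max_le (Finset.sum_nonneg fun l _ => mul_nonneg (inv_nonneg.2 (hdpos l).le) (by positivity)) ?_
        rw [Matrix.of_apply, coeff_hs] at he
        have h2 := hidx _ (left_ne_zero_of_mul he)
        simp only [Finsupp.add_apply, Nat.cast_add, mul_add, Finset.sum_add_distrib] at h2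
        rw [Fin.sum_univ_succ (fun l => (d l : ℝ)⁻¹ * ((Finsupp.cons (k j) (μ i)) l : ℝ))] at h2
        simp only [Finsupp.cons_zero, Finsupp.cons_succ] at h2
        have h3 : ∑ l : Fin m, (d l.succ : ℝ)⁻¹ * (μ i l : ℝ) ≤ τ / 2 := by
          have h4 : ∀ l : Fin m, (d l.succ : ℝ)⁻¹ ≤ τ / 2 * (d 0 : ℝ)⁻¹ := by
            intro l
            have h5 := hgap 0 l.succ (Fin.succ_pos l)
            have h6 : 2 / τ * d 0 ≤ d l.succ := (mul_le_mul_of_nonneg_right hk2 hd0.le).trans h5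
            rw [inv_le_comm₀ (hdpos _) (by positivity), mul_inv, inv_inv, inv_div]
            exact h6
          calc ∑ l : Fin m, (d l.succ : ℝ)⁻¹ * (μ i l : ℝ) ≤ ∑ l : Fin m, (τ / 2 * (d 0 : ℝ)⁻¹) * (μ i l : ℝ) :=
                Finset.sum_le_sum fun l _ => mul_le_mul_of_nonneg_right (h4 l) (by positivity)
            _ = (τ / 2 * (d 0 : ℝ)⁻¹) * ((∑ l, μ i l : ℕ) : ℝ) := by push_cast; rw [Finset.mul_sum]
            _ ≤ (τ / 2 * (d 0 : ℝ)⁻¹) * d 0 := by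
                have : ∑ l, μ i l ≤ d 0 := by have := hμ i; omega
                have : ((∑ l, μ i l : ℕ) : ℝ) ≤ d 0 := by exact_mod_cast this
                exact mul_le_mul_of_nonneg_left this (by positivity)
            _ = τ / 2 := by field_simp
        rw [div_eq_inv_mul (k j : ℝ)]
        linarith
      refine h1.mono ?_
      rw [hk (fun k => max 0 (τ / 2 - (k : ℝ) / d 0))]
      refine le_trans (le_of_eq ?_) (sum_max_ge (τ / 2) (by positivity) (by linarith) (d 0) s (hd 0).1 hsd)
      ring
    -- integrality and size
    have hWI : W ∈ F.IP _ := det_mem_IP F _ fun i j => hs_mem_IP F _ hpI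
    have hWd : ∀ e, coeff e W ≠ 0 → ∀ i, e i ≤ s * d i := by
      intro e he i
      have h1 : IdxGe (fun l => if l = i then (-1 : ℝ) else 0) (∑ j : Fin s, -(d i : ℝ)) W := by
        refine IdxGe.det _ fun a j e he => ?_
        rw [Matrix.of_apply, coeff_hs] at he
        have := hpd _ (left_ne_zero_of_mul he) i
        simp only [Finsupp.add_apply] at this
        simp only [ite_mul, zero_mul, Finset.sum_ite_eq', Finset.mem_univ, if_true]
        have h2 : (e i : ℝ) ≤ d i := by exact_mod_cast (by omega : e i ≤ d i)
        linarith
      have := h1 e he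
      simp only [ite_mul, zero_mul, Finset.sum_ite_eq', Finset.mem_univ, if_true] at this
      simp at this
      exact_mod_cast this
    set L : ℝ := Real.log (F.pr fun v => N11 (F.abv v) p) + D with hL
    have hlogp : 0 ≤ Real.log (F.pr fun v => N11 (F.abv v) p) := Real.log_nonneg (F.one_le_N11 hp hpI)
    have hD1 : (1 : ℝ) ≤ D := by exact_mod_cast hD
    have hLD : (D : ℝ) ≤ L := by linarith
    have hprp : 0 < F.pr fun v => N11 (F.abv v) p := lt_of_lt_of_le one_pos (F.one_le_N11 hp hpI)
    have hWsize : Real.log (F.pr fun v => N11 (F.abv v) W) ≤ s * (C1 * L) := by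
      have h1 : (F.pr fun v => N11 (F.abv v) W) ≤ F.pr fun v => s.factorial * (2 ^ (∑ i, d i) * N11 (F.abv v) p) ^ s :=
        F.pr_le (fun v => N1_nonneg _ _ fun _ => zero_le_one) fun v =>
          N11_det_le F v _ _ fun i j => N11_hs_le F v _ p d hpd
      rw [F.pr_mul, F.pr_const, F.pr_pow (fun v => 2 ^ (∑ i, d i) * N11 (F.abv v) p), F.pr_mul, F.pr_const] at h1
      have hW0 : W ≠ 0 := by
        obtain ⟨b, hb⟩ := ne_zero_iff.1 hU
        obtain ⟨t, ht⟩ := ne_zero_iff.1 hV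
        intro h
        have := coeff_ten U V b t
        rw [← hW, h, coeff_zero] at this
        exact mul_ne_zero hb ht this.symm
      have h2 := Real.log_le_log (lt_of_lt_of_le one_pos (F.one_le_N11 hW0 hWI)) h1
      have hf : (0 : ℝ) < s.factorial := by positivity
      rw [Real.log_mul (by positivity) (by positivity), Real.log_pow, Real.log_pow,
        Real.log_mul (by positivity) (by positivity), Real.log_pow, Real.log_pow] at h2
      have h3 : Real.log s.factorial ≤ s * (2 * D) := by
        have h4 : (s.factorial : ℝ) ≤ (s : ℝ) ^ s := by exact_mod_cast Nat.factorial_le_pow s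
        have h5 := Real.log_le_log hf h4
        rw [Real.log_pow] at h5
        refine h5.trans (mul_le_mul_of_nonneg_left ?_ (by positivity))
        have h6 : Real.log s ≤ s := (Real.log_le_sub_one_of_pos (by linarith)).trans (by linarith)
        have h7 : s ≤ 2 * D := by have := hd 0; omega
        have h8 : (s : ℝ) ≤ 2 * D := by exact_mod_cast h7
        linarith
      have h4 : ((∑ i, d i : ℕ) : ℝ) * Real.log 2 ≤ (m + 1) * D := by
        have h5 : (∑ i, d i) ≤ (m + 1) * D := by
          refine (Finset.sum_le_card_nsmul _ _ D fun i _ => (hd i).2).trans ?_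
          simp
        have h6 : ((∑ i, d i : ℕ) : ℝ) ≤ (m + 1) * D := by exact_mod_cast h5
        have h7 : Real.log 2 ≤ 1 := by have := Real.log_two_lt_d9; linarith
        have h8 : 0 ≤ Real.log 2 := Real.log_nonneg (by norm_num)
        have h9 : (0 : ℝ) ≤ ((∑ i, d i : ℕ) : ℝ) := by positivity
        nlinarith
      have h5 : (F.M : ℝ) * Real.log s.factorial ≤ F.M * (s * (2 * D)) := mul_le_mul_of_nonneg_left h3 hM0
      have h6 : (F.M : ℝ) * (((∑ i, d i : ℕ) : ℝ) * Real.log 2) ≤ F.M * ((m + 1) * D) :=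
        mul_le_mul_of_nonneg_left h4 hM0
      have h7 : (s : ℝ) * (F.M * (((∑ i, d i : ℕ) : ℝ) * Real.log 2) + Real.log (F.pr fun v => N11 (F.abv v) p))
        ≤ s * (F.M * ((m + 1) * D) + Real.log (F.pr fun v => N11 (F.abv v) p)) := by
        apply mul_le_mul_of_nonneg_left _ (by linarith)
        linarith
      have h8 : (F.M : ℝ) * (s * (2 * D)) + s * (F.M * ((m + 1) * D) + Real.log (F.pr fun v => N11 (F.abv v) p))
        ≤ s * (C1 * L) := by
        have : (F.M : ℝ) * (2 * D) + (F.M * ((m + 1) * D) + Real.log (F.pr fun v => N11 (F.abv v) p)) ≤ C1 * L := by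
          have h9 : (F.M : ℝ) * (m + 3) * D ≤ F.M * (m + 3) * L := mul_le_mul_of_nonneg_left hLD (by positivity)
          rw [hC1]
          nlinarith
        have := mul_le_mul_of_nonneg_left this (by linarith : (0 : ℝ) ≤ s)
        linarith
      linarith
    have hpolyW : ∀ {σ : Type} [Fintype σ] (q : MvPolynomial σ K) (g : (σ →₀ ℕ) → (Fin (m + 1) →₀ ℕ)),
        Function.Injective g → q ≠ 0 → q ∈ F.IP σ →
        (∀ b, coeff b q = coeff (g b) W) → Real.log (F.pr fun v => N11 (F.abv v) q) ≤ s * (C1 * L) := by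
      intro σ _ q g hg hq0 hqI hq
      refine le_trans (Real.log_le_log (lt_of_lt_of_le one_pos (F.one_le_N11 hq0 hqI)) ?_) hWsize
      refine F.pr_le (fun v => N1_nonneg _ _ fun _ => zero_le_one) fun v => ?_
      rw [N11, N1, N11, N1]
      simp only [one_pow, Finset.prod_const_one, mul_one]
      simp only [hq]
      refine le_trans (Finset.sum_map q.support ⟨g, hg⟩ (fun e => F.abv v (coeff e W))).symm.le ?_
      refine Finset.sum_le_sum_of_subset_of_nonneg ?_ fun _ _ _ => (F.abv v).nonneg _
      intro e he
      obtain ⟨b, hb, rfl⟩ := Finset.mem_map.1 he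
      rw [mem_support_iff] at hb ⊢
      rw [hq] at hb; exact hb
    obtain ⟨b0, hb0⟩ := ne_zero_iff.1 hU
    obtain ⟨t0, ht0⟩ := ne_zero_iff.1 hV
    -- the factors
    set U1 := coeff t0 V • U with hU1
    set V1 := coeff b0 U • V with hV1
    have hcU : ∀ b, coeff b U1 = coeff (Finsupp.cons (t0 ()) b) W := fun b => by
      rw [hW, coeff_ten, hU1, coeff_smul, smul_eq_mul, mul_comm]
    have hcV : ∀ t, coeff t V1 = coeff (Finsupp.cons (t ()) b0) W := fun t => by
      rw [hW, coeff_ten, hV1, coeff_smul, smul_eq_mul]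
    have hU10 : U1 ≠ 0 := smul_ne_zero ht0 hU
    have hV10 : V1 ≠ 0 := smul_ne_zero hb0 hV
    have hU1I : U1 ∈ F.IP _ := F.mem_IP.2 fun b => by rw [hcU]; exact F.mem_IP.1 hWI _
    have hV1I : V1 ∈ F.IP _ := F.mem_IP.2 fun b => by rw [hcV]; exact F.mem_IP.1 hWI _
    have hsU := hpolyW U1 (fun b => Finsupp.cons (t0 ()) b)
      (fun b b' h => by simpa using congrArg Finsupp.tail h) hU10 hU1I hcU
    have hsV := hpolyW V1 (fun t => Finsupp.cons (t ()) b0)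
      (fun t t' h => by ext; simpa using congrArg (fun z => z 0) h) hV10 hV1I hcV
    -- apply the induction hypothesis to U1
    have hUidx := hκ' (fun j => s * d j.succ) (s * D) (Nat.mul_pos hs1 hD)
      (fun j => ⟨Nat.mul_pos hs1 (hd _).1, Nat.mul_le_mul_left _ (hd _).2⟩)
      (fun i j hij => by
        have := hgap i.succ j.succ (Fin.succ_lt_succ_iff.2 hij)
        push_cast
        have h2 : κ' * d i.succ ≤ d j.succ := (mul_le_mul_of_nonneg_right hkk' (hdpos _).le).trans this
        calc κ' * (s * d i.succ) = s * (κ' * d i.succ) := by ring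
          _ ≤ s * d j.succ := mul_le_mul_of_nonneg_left h2 (by linarith))
      U1 hU10 hU1I
      (fun e he i => by
        rw [hcU] at he
        have := hWd _ he i.succ
        simpa using this)
      (fun j => α j.succ) (fun j => β j.succ) (fun j => hαβ _) (fun j => hβ _)
      (fun j => by
        push_cast
        have h1 := hh j.succ
        have h2 : κ' * ((C1 + 1) * L) ≤ κ * L := by
          rw [← mul_assoc]; exact mul_le_mul_of_nonneg_right hk1 (by linarith)
        have h3 : s * (κ' * ((C1 + 1) * L)) ≤ s * (d j.succ * Real.log (F.hh (α j.succ) (β j.succ))) :=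
          mul_le_mul_of_nonneg_left (h2.trans h1) (by linarith)
        have h4 : Real.log (F.pr fun v => N11 (F.abv v) U1) + s * D ≤ s * ((C1 + 1) * L) := by
          have := mul_le_mul_of_nonneg_left hLD (by linarith : (0 : ℝ) ≤ s)
          linarith
        have h5 := mul_le_mul_of_nonneg_left h4 (by linarith : 0 ≤ κ')
        calc _ ≤ _ := h5
          _ = s * (κ' * ((C1 + 1) * L)) := by ring
          _ ≤ _ := h3
          _ = _ := by ring)
    rw [IdxGe] at hUidx
    push_neg at hUidx
    obtain ⟨b, hb, hbsum⟩ := hUidx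
    -- the one-variable factor
    have hVidx : ∃ t, coeff t (tr (fun _ => (α 0 : K) / (β 0 : K)) V1) ≠ 0 ∧ t () < ⌊s * d 0 * τ'⌋₊ + 1 := by
      by_contra hcon
      push_neg at hcon
      have h1 := F.roth_one V1 (F.mem_IP.1 hV1I) hV10 (s * d 0)
        (fun t ht => by rw [hcV] at ht; simpa using hWd _ ht 0) (α 0) (β 0) (hαβ 0) (hβ 0) _ hcon
      have hh0 : 0 < F.hh (α 0) (β 0) := by
        have hβ' : (β 0 : K) ≠ 0 := by simpa using hβ 0
        exact F.pr_pos fun v => lt_of_lt_of_le ((F.abv v).pos hβ') (le_max_right _ _)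
      have h2 := Real.log_le_log (pow_pos hh0 _) h1
      have hpv : 0 < F.pr fun v => N11 (F.abv v) V1 := lt_of_lt_of_le one_pos (F.one_le_N11 hV10 hV1I)
      rw [Real.log_pow, Real.log_mul (by positivity) hpv.ne', Real.log_pow] at h2
      push_cast at h2
      have h3 := hh 0
      have hκL : 0 ≤ κ * L := by
        have : 0 ≤ L := by linarith
        have : 0 ≤ κ := by linarith
        positivity
      have hlog : 0 ≤ Real.log (F.hh (α 0) (β 0)) := by
        by_contra hneg
        push_neg at hneg
        nlinarith
      have h4 : s * d 0 * τ' ≤ (⌊s * d 0 * τ'⌋₊ : ℝ) + 1 := (Nat.lt_floor_add_one _).le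
      have h5 := mul_le_mul_of_nonneg_right h4 hlog
      have h6 : s * τ' * (κ * L) ≤ s * τ' * (d 0 * Real.log (F.hh (α 0) (β 0))) :=
        mul_le_mul_of_nonneg_left h3 (by positivity)
      have h7 : (s : ℝ) * (2 * F.M + C1 + 1) * L ≤ s * (κ * τ') * L := by
        apply mul_le_mul_of_nonneg_right _ (by linarith)
        exact mul_le_mul_of_nonneg_left hk3 (by linarith)
      have h8 : Real.log 4 ≤ 2 := by
        have : (4 : ℝ) = 2 ^ 2 := by norm_num
        rw [this, Real.log_pow]
        have := Real.log_two_lt_d9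
        push_cast; linarith
      have h9 : (s : ℝ) * d 0 * F.M * Real.log 4 ≤ s * L * F.M * 2 := by
        have : (d 0 : ℝ) ≤ D := by exact_mod_cast (hd 0).2
        have : (d 0 : ℝ) ≤ L := by linarith
        have h10 : 0 ≤ Real.log 4 := Real.log_nonneg (by norm_num)
        gcongr
      have h10 : 0 < (s : ℝ) * L := by
        have : 0 < L := by linarith
        positivity
      have h2' : ((⌊s * d 0 * τ'⌋₊ : ℝ) + 1) * Real.log (F.hh (α 0) (β 0)) ≤
        s * d 0 * F.M * Real.log 4 + Real.log (F.pr fun v => N11 (F.abv v) V1) := h2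
      nlinarith
    obtain ⟨t, ht, htlt⟩ := hVidx
    have hb' : coeff b (tr (fun i => ξ i.succ) U) ≠ 0 := by
      intro h
      apply hb
      rw [hU1, map_smul, coeff_smul]
      show _ • coeff b (tr (fun i => ξ i.succ) U) = 0
      rw [h, smul_zero]
    have ht' : coeff t (tr (fun _ => ξ 0) V) ≠ 0 := by
      intro h
      apply ht
      rw [hV1, map_smul, coeff_smul]
      show _ • coeff t (tr (fun _ => ξ 0) V) = 0
      rw [h, smul_zero]
    have hfin := hWidx (Finsupp.cons (t ()) b) (by
      rw [hW, tr_ten, coeff_ten]; exact mul_ne_zero hb' ht')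
    rw [Fin.sum_univ_succ] at hfin
    simp only [Finsupp.cons_zero, Finsupp.cons_succ] at hfin
    have h1 : ∑ i : Fin m, (d i.succ : ℝ)⁻¹ * (b i : ℝ) < s * τ' := by
      have h2 : ∑ i : Fin m, (d i.succ : ℝ)⁻¹ * (b i : ℝ) = s * ∑ i : Fin m, ((s * d i.succ : ℕ) : ℝ)⁻¹ * (b i : ℝ) := by
        rw [Finset.mul_sum]
        refine Finset.sum_congr rfl fun i _ => ?_
        have := hdpos i.succ
        have : (0 : ℝ) < s := by linarith
        push_cast
        field_simp
      rw [h2]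
      exact mul_lt_mul_of_pos_left hbsum (by linarith)
    have h2 : (d 0 : ℝ)⁻¹ * (t () : ℝ) ≤ s * τ' := by
      have h3 : (t () : ℝ) ≤ s * d 0 * τ' := by
        have h4 : t () ≤ ⌊s * d 0 * τ'⌋₊ := by omega
        exact (Nat.le_floor_iff (by positivity)).1 h4
      rw [inv_mul_le_iff₀ hd0]
      linarith
    have h3 : 0 < (s : ℝ) * τ ^ 2 := by positivity
    rw [hτ'] at h1 h2
    linarith

end Roth

end Part4

section Part5
set_option autoImplicit false
open MvPolynomial

section Cheb
variable {m : ℕ} {β : Type*} [DecidableEq β]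

lemma cheb_cross (t : Fin m → Finset β) (y : Fin m → β → ℝ) (h0 : ∀ j, ∑ c ∈ t j, y j c = 0)
    (j j' : Fin m) (hj : j ≠ j') : ∑ a ∈ Fintype.piFinset t, y j (a j) * y j' (a j') = 0 := by
  have := Finset.prod_univ_sum t (fun x c => if x = j then y j c else if x = j' then y j' c else 1)
  have h2 : ∀ a : Fin m → β, ∏ x, (if x = j then y j (a x) else if x = j' then y j' (a x) else 1) =
      y j (a j) * y j' (a j') := by
    intro a
    rw [← Finset.mul_prod_erase _ _ (Finset.mem_univ j), if_pos rfl,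
      ← Finset.mul_prod_erase _ _ (Finset.mem_erase.2 ⟨hj.symm, Finset.mem_univ j'⟩), if_neg hj.symm, if_pos rfl,
      Finset.prod_eq_one, mul_one]
    intro x hx
    rw [Finset.mem_erase, Finset.mem_erase] at hx
    rw [if_neg hx.2.1, if_neg hx.1]
  simp only [h2] at this
  rw [← this]
  refine Finset.prod_eq_zero (Finset.mem_univ j) ?_
  simpa using h0 j

lemma cheb_sum (t : Fin m → Finset β) (y : Fin m → β → ℝ) (h0 : ∀ j, ∑ c ∈ t j, y j c = 0)
    (h1 : ∀ j, ∀ c ∈ t j, |y j c| ≤ 1) :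
    ∑ a ∈ Fintype.piFinset t, (∑ j, y j (a j)) ^ 2 ≤ m * (Fintype.piFinset t).card := by
  have e : ∀ a : Fin m → β, (∑ j, y j (a j)) ^ 2 = ∑ j, ∑ j', y j (a j) * y j' (a j') := by
    intro a; rw [sq, Finset.sum_mul_sum]
  simp only [e]
  rw [Finset.sum_comm]
  have : ∀ j, ∑ a ∈ Fintype.piFinset t, ∑ j', y j (a j) * y j' (a j') ≤ (Fintype.piFinset t).card := by
    intro j
    rw [Finset.sum_comm, Finset.sum_eq_single j]
    · rw [← nsmul_one, ← Finset.sum_const]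
      refine Finset.sum_le_sum fun a ha => ?_
      have h2 := h1 j (a j) (Fintype.mem_piFinset.1 ha j)
      rw [← sq, ← sq_abs]
      exact pow_le_one₀ (abs_nonneg _) h2
    · intro j' _ hne
      exact cheb_cross t y h0 j j' hne.symm
    · simp
  refine (Finset.sum_le_sum fun j _ => this j).trans ?_
  simp

lemma cheb (t : Fin m → Finset β) (y : Fin m → β → ℝ) (h0 : ∀ j, ∑ c ∈ t j, y j c = 0)
    (h1 : ∀ j, ∀ c ∈ t j, |y j c| ≤ 1) (ε : ℝ) (hε : 0 < ε) (hm : 0 < m) :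
    (((Fintype.piFinset t).filter fun a => ¬ |∑ j, y j (a j)| ≤ ε * m).card : ℝ) * (ε ^ 2 * m) ≤
      (Fintype.piFinset t).card := by
  have h2 := cheb_sum t y h0 h1
  have h3 : (((Fintype.piFinset t).filter fun a => ¬ |∑ j, y j (a j)| ≤ ε * m).card : ℝ) * (ε * m) ^ 2 ≤
      ∑ a ∈ Fintype.piFinset t, (∑ j, y j (a j)) ^ 2 := by
    rw [← nsmul_eq_mul, ← Finset.sum_const]
    refine le_trans (Finset.sum_le_sum fun a ha => ?_)
      (Finset.sum_le_sum_of_subset_of_nonneg (Finset.filter_subset _ _) fun _ _ _ => sq_nonneg _)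
    have := (Finset.mem_filter.1 ha).2
    push_neg at this
    rw [← sq_abs (∑ j, y j (a j))]
    exact pow_le_pow_left₀ (by positivity) this.le 2
  have h4 := h3.trans h2
  have hm' : (0 : ℝ) < m := by exact_mod_cast hm
  have h5 : (m : ℝ) * ((((Fintype.piFinset t).filter fun a => ¬ |∑ j, y j (a j)| ≤ ε * m).card : ℝ) * (ε ^ 2 * m))
      ≤ m * (Fintype.piFinset t).card := by
    refine le_trans (le_of_eq ?_) h4
    ring
  exact le_of_mul_le_mul_left h5 hm'

end Cheb

section Comp
variable {I : Type} [Fintype I] [DecidableEq I] [Nonempty I]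

lemma anti_mem (d : ℕ) (c : I → ℕ) : c ∈ Finset.piAntidiag (Finset.univ : Finset I) d ↔ ∑ i, c i = d := by
  simp

lemma anti_mean (d : ℕ) (hd : 1 ≤ d) (i : I) :
    ∑ c ∈ Finset.piAntidiag (Finset.univ : Finset I) d, ((c i : ℝ) / d - 1 / Fintype.card I) = 0 := by
  have hd' : (0 : ℝ) < d := by exact_mod_cast hd
  have hn : (0 : ℝ) < Fintype.card I := by exact_mod_cast Fintype.card_pos
  have hsym : ∀ i', ∑ c ∈ Finset.piAntidiag (Finset.univ : Finset I) d, (c i' : ℝ) =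
      ∑ c ∈ Finset.piAntidiag (Finset.univ : Finset I) d, (c i : ℝ) := by
    intro i'
    refine Finset.sum_nbij' (fun c => c ∘ Equiv.swap i i') (fun c => c ∘ Equiv.swap i i') ?_ ?_ ?_ ?_ ?_
    · intro c hc
      rw [anti_mem] at hc ⊢
      rw [← hc]
      exact Equiv.sum_comp (Equiv.swap i i') c
    · intro c hc
      rw [anti_mem] at hc ⊢
      rw [← hc]
      exact Equiv.sum_comp (Equiv.swap i i') c
    · intro c _; funext x; simp
    · intro c _; funext x; simp
    · intro c _; simp
  have hall : ∑ i', ∑ c ∈ Finset.piAntidiag (Finset.univ : Finset I) d, (c i' : ℝ) =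
      (Finset.piAntidiag (Finset.univ : Finset I) d).card * d := by
    rw [Finset.sum_comm, ← nsmul_eq_mul, ← Finset.sum_const]
    refine Finset.sum_congr rfl fun c hc => ?_
    rw [anti_mem] at hc
    exact_mod_cast hc
  rw [Finset.sum_congr rfl fun i' _ => hsym i'] at hall
  simp at hall
  rw [Finset.sum_sub_distrib, ← Finset.sum_div]
  simp
  field_simp
  linarith

lemma anti_card (d : ℕ) : (Finset.piAntidiag (Finset.univ : Finset I) d).card ≤ (2 ^ Fintype.card I) ^ d := by
  have h1 : Finset.piAntidiag (Finset.univ : Finset I) d ⊆ Fintype.piFinset fun _ => Finset.range (d + 1) := by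
    intro c hc
    rw [anti_mem] at hc
    rw [Fintype.mem_piFinset]
    intro i
    rw [Finset.mem_range, ← hc]
    have := Finset.single_le_sum (fun i _ => Nat.zero_le (c i)) (Finset.mem_univ i)
    omega
  refine (Finset.card_le_card h1).trans ?_
  rw [Fintype.card_piFinset]
  simp only [Finset.card_range, Finset.prod_const, Finset.card_univ]
  rw [← pow_mul, mul_comm, pow_mul]
  exact Nat.pow_le_pow_left (Nat.lt_two_pow_self) _

lemma anti_nonempty (d : ℕ) : (Finset.piAntidiag (Finset.univ : Finset I) d).Nonempty := by
  obtain ⟨i⟩ := ‹Nonempty I›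
  exact ⟨Pi.single i d, by rw [anti_mem]; simp⟩

end Comp

section Aux
variable {K : Type} [Field K] [CharZero K] (F : PF K)
variable {I : Type} [Fintype I] [DecidableEq I] [Nonempty I]

/-- the linear substitution on each block -/
noncomputable def lin {m : ℕ} (B : Fin m → Matrix I I K) : Fin m × I → MvPolynomial (Fin m × I) K :=
  fun p => ∑ l, C (B p.1 p.2 l) * X (p.1, l)

/-- multihomogeneous of degree `d` -/
def MH {m : ℕ} (d : Fin m → ℕ) (p : MvPolynomial (Fin m × I) K) : Prop :=
  ∀ b, coeff b p ≠ 0 → ∀ j, ∑ i, b (j, i) = d j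

lemma MH.iff {m : ℕ} (d : Fin m → ℕ) (p : MvPolynomial (Fin m × I) K) :
    MH d p ↔ ∀ j, IdxGe (fun q : Fin m × I => if q.1 = j then (1 : ℝ) else 0) (d j) p ∧
      IdxGe (fun q : Fin m × I => if q.1 = j then (-1 : ℝ) else 0) (-(d j)) p := by
  have e : ∀ (j : Fin m) (c : ℝ) (b : Fin m × I →₀ ℕ),
      ∑ q : Fin m × I, (if q.1 = j then c else 0) * (b q : ℝ) = c * ((∑ i, b (j, i) : ℕ) : ℝ) := by
    intro j c b
    rw [Fintype.sum_prod_type, Finset.sum_eq_single j]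
    · simp [Finset.mul_sum]
    · intro j' _ h; simp [h]
    · simp
  constructor
  · intro h j
    refine ⟨fun b hb => ?_, fun b hb => ?_⟩
    · rw [e, h b hb j, one_mul]
    · rw [e, h b hb j]; simp
  · intro h b hb j
    have h1 := (h j).1 b hb
    have h2 := (h j).2 b hb
    rw [e] at h1 h2
    have : ((∑ i, b (j, i) : ℕ) : ℝ) = d j := by linarith
    exact_mod_cast this

lemma MH.bind {m : ℕ} {d : Fin m → ℕ} {p : MvPolynomial (Fin m × I) K} (hp : MH d p) (B : Fin m → Matrix I I K) :
    MH d (bind₁ (lin B) p) := by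
  rw [MH.iff] at hp ⊢
  have e : ∀ (j : Fin m) (c : ℝ) (i : Fin m × I),
      IdxGe (fun q : Fin m × I => if q.1 = j then c else 0) (if i.1 = j then c else 0) (lin B i) := by
    intro j c i
    refine IdxGe.sum _ fun l _ => ?_
    have := (IdxGe.C (fun q : Fin m × I => if q.1 = j then c else 0) (B i.1 i.2 l)).mul
      (IdxGe.X (fun q : Fin m × I => if q.1 = j then c else 0) (i.1, l))
    simpa using this
  exact fun j => ⟨IdxGe.bind (e j 1) (hp j).1, IdxGe.bind (e j (-1)) (hp j).2⟩

lemma mem_mapRange {σ : Type*} (S : Subring K) {p : MvPolynomial σ K} :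
    p ∈ (MvPolynomial.map (σ := σ) S.subtype).range ↔ ∀ b, coeff b p ∈ S := by
  constructor
  · rintro ⟨q, rfl⟩ b
    rw [coeff_map]; exact (coeff b q).2
  · intro h
    rw [p.as_sum]
    refine Subring.sum_mem _ fun b _ => ⟨monomial b ⟨coeff b p, h b⟩, ?_⟩
    rw [map_monomial]; rfl

lemma PF.common_den {α : Type*} [Fintype α] (x : α → K) : ∃ D : ℕ, D ≠ 0 ∧ ∀ a, (D : K) * x a ∈ F.R := by
  classical
  choose D hD h using fun a => F.den (x a)
  refine ⟨∏ a, D a, Finset.prod_ne_zero_iff.2 fun a _ => hD a, fun a => ?_⟩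
  rw [← Finset.mul_prod_erase _ _ (Finset.mem_univ a)]
  push_cast
  have : (D a : K) * (∏ x ∈ Finset.univ.erase a, (D x : K)) * x a = (∏ x ∈ Finset.univ.erase a, (D x : K)) * (D a * x a) := by ring
  rw [this]
  exact F.R.mul_mem (F.R.prod_mem fun i _ => natCast_mem _ _) (h a)

theorem PF.aux (B : F.ι → Matrix I I K) (ε : ℝ) (hε : 0 < ε) : ∃ m0 : ℕ, ∃ Cc : ℝ, 1 ≤ Cc ∧ ∀ m, m0 ≤ m → 1 ≤ m →
    ∀ d : Fin m → ℕ, (∀ j, 1 ≤ d j) → ∃ P : MvPolynomial (Fin m × I) K, P ≠ 0 ∧ P ∈ F.IP _ ∧ MH d P ∧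
      (∀ v, N11 (F.abv v) P ≤ Cc ^ (∑ j, d j)) ∧
      ∀ v a, coeff a (bind₁ (lin fun _ => B v) P) ≠ 0 →
        ∀ i, |∑ j, (a (j, i) : ℝ) / d j - m / Fintype.card I| ≤ ε * m := by
  classical
  obtain ⟨D, hD0, hD⟩ := F.common_den (fun q : F.ι × I × I => B q.1 q.2.1 q.2.2)
  obtain ⟨Cs, hCs1, hCs⟩ := F.siegel
  set n := Fintype.card I with hn
  have hn0 : 0 < n := Fintype.card_pos
  -- scaled matrices
  let B' : F.ι → Matrix I I K := fun v => (D : K) • B v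
  have hB' : ∀ v i l, B' v i l ∈ F.R := fun v i l => by
    simpa [B'] using hD (v, i, l)
  set C0 : ℝ := 1 + ∑ v, ∑ v', ∑ i, ∑ l, F.abv v' (B' v i l) with hC0
  have hnn : ∀ v v' i l, 0 ≤ F.abv v' (B' v i l) := fun v v' i l => (F.abv v').nonneg _
  have hC0le : ∀ v v' i, ∑ l, F.abv v' (B' v i l) ≤ C0 := by
    intro v v' i
    have h1 : ∑ l, F.abv v' (B' v i l) ≤ ∑ i, ∑ l, F.abv v' (B' v i l) :=
      Finset.single_le_sum (f := fun i => ∑ l, F.abv v' (B' v i l)) (fun i _ => Finset.sum_nonneg fun l _ => hnn _ _ _ _) (Finset.mem_univ i)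
    have h2 : ∑ i, ∑ l, F.abv v' (B' v i l) ≤ ∑ v', ∑ i, ∑ l, F.abv v' (B' v i l) :=
      Finset.single_le_sum (f := fun v' => ∑ i, ∑ l, F.abv v' (B' v i l))
        (fun i _ => Finset.sum_nonneg fun l _ => Finset.sum_nonneg fun l _ => hnn _ _ _ _) (Finset.mem_univ v')
    have h3 : ∑ v', ∑ i, ∑ l, F.abv v' (B' v i l) ≤ ∑ v, ∑ v', ∑ i, ∑ l, F.abv v' (B' v i l) :=
      Finset.single_le_sum (f := fun v => ∑ v', ∑ i, ∑ l, F.abv v' (B' v i l))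
        (fun i _ => Finset.sum_nonneg fun l _ => Finset.sum_nonneg fun l _ => Finset.sum_nonneg fun l _ => hnn _ _ _ _) (Finset.mem_univ v)
    linarith
  have hC01 : 1 ≤ C0 := by
    have : 0 ≤ ∑ v, ∑ v', ∑ i, ∑ l, F.abv v' (B' v i l) :=
      Finset.sum_nonneg fun l _ => Finset.sum_nonneg fun l _ => Finset.sum_nonneg fun l _ => Finset.sum_nonneg fun l _ => hnn _ _ _ _
    linarith
  refine ⟨⌈2 * n * Fintype.card F.ι / ε ^ 2⌉₊, Cs * (2 ^ n) * (2 ^ n) * C0, ?_, ?_⟩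
  · have : (1 : ℝ) ≤ 2 ^ n := one_le_pow₀ (by norm_num)
    exact one_le_mul_of_one_le_of_one_le (one_le_mul_of_one_le_of_one_le (one_le_mul_of_one_le_of_one_le hCs1 this) this) hC01
  intro m hm0 hm1 d hd
  have hm' : (0 : ℝ) < m := by exact_mod_cast hm1
  have hm2 : 2 * n * Fintype.card F.ι ≤ ε ^ 2 * m := by
    have := (Nat.le_ceil _).trans (by exact_mod_cast hm0 : ((⌈2 * n * Fintype.card F.ι / ε ^ 2⌉₊ : ℕ) : ℝ) ≤ m)
    rw [div_le_iff₀ (by positivity)] at this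
    linarith
  let t : Fin m → Finset (I → ℕ) := fun j => Finset.piAntidiag Finset.univ (d j)
  set Mon := Fintype.piFinset t with hMon
  have hMne : Mon.Nonempty := by
    rw [hMon, Fintype.piFinset_nonempty]; exact fun j => anti_nonempty _
  let e : (Fin m → I → ℕ) → (Fin m × I →₀ ℕ) := fun a => Finsupp.equivFunOnFinite.symm fun q => a q.1 q.2
  have he : ∀ a q, e a q = a q.1 q.2 := fun a q => rfl
  have heinj : Function.Injective e := by
    intro a b h; funext j i
    simpa [he] using DFunLike.congr_fun h (j, i)
  have hesum : ∀ a ∈ Mon, ∀ j, ∑ i, e a (j, i) = d j := by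
    intro a ha j
    have := Fintype.mem_piFinset.1 ha j
    exact (anti_mem _ _).1 this
  have hMcard : (Mon.card : ℝ) ≤ (2 ^ n) ^ (∑ j, d j) := by
    have h1 : Mon.card ≤ (2 ^ n) ^ (∑ j, d j) := by
      rw [hMon, Fintype.card_piFinset, ← Finset.prod_pow_eq_pow_sum]
      exact Finset.prod_le_prod' fun j _ => anti_card _
    exact_mod_cast h1
  let y : I → Fin m → (I → ℕ) → ℝ := fun i j c => (c i : ℝ) / d j - 1 / n
  let bad : I → Finset (Fin m → I → ℕ) := fun i => Mon.filter fun a => ¬ |∑ j, y i j (a j)| ≤ ε * m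
  have hbad : ∀ i, ((bad i).card : ℝ) * (ε ^ 2 * m) ≤ Mon.card := by
    intro i
    refine cheb t (y i) (fun j => anti_mean _ (hd j) i) (fun j c hc => ?_) ε hε hm1
    rw [anti_mem] at hc
    have hdj : (0 : ℝ) < d j := by exact_mod_cast hd j
    have h1 : (c i : ℝ) / d j ≤ 1 := by
      rw [div_le_one hdj]
      have := Finset.single_le_sum (fun i _ => Nat.zero_le (c i)) (Finset.mem_univ i)
      exact_mod_cast hc ▸ this
    have h2 : 0 ≤ (c i : ℝ) / d j := by positivity
    have h3 : (1 : ℝ) / n ≤ 1 := by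
      rw [div_le_one (by exact_mod_cast hn0)]; exact_mod_cast hn0
    have h4 : 0 ≤ (1 : ℝ) / n := by positivity
    rw [abs_le]
    constructor <;> simp only [y] <;> linarith
  let Bad := Finset.univ.biUnion bad
  have hBad : (Bad.card : ℝ) * (ε ^ 2 * m) ≤ n * Mon.card := by
    have h1 : (Bad.card : ℝ) ≤ ∑ i, ((bad i).card : ℝ) := by exact_mod_cast Finset.card_biUnion_le
    calc (Bad.card : ℝ) * (ε ^ 2 * m) ≤ (∑ i, ((bad i).card : ℝ)) * (ε ^ 2 * m) :=
          mul_le_mul_of_nonneg_right h1 (by positivity)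
      _ = ∑ i, ((bad i).card : ℝ) * (ε ^ 2 * m) := Finset.sum_mul _ _ _
      _ ≤ ∑ i : I, (Mon.card : ℝ) := Finset.sum_le_sum fun i _ => hbad i
      _ = _ := by simp [hn]
  have hcard : 2 * (Fintype.card F.ι * Bad.card) ≤ Mon.card := by
    have h1 : (0 : ℝ) < n := by exact_mod_cast hn0
    have h2 : (n : ℝ) * (2 * (Fintype.card F.ι * Bad.card)) ≤ n * Mon.card := by
      calc (n : ℝ) * (2 * (Fintype.card F.ι * Bad.card)) = Bad.card * (2 * n * Fintype.card F.ι) := by ring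
        _ ≤ Bad.card * (ε ^ 2 * m) := mul_le_mul_of_nonneg_left hm2 (by positivity)
        _ ≤ _ := hBad
    have := le_of_mul_le_mul_left h2 h1
    exact_mod_cast this
  let φ : F.ι → Fin m × I → MvPolynomial (Fin m × I) K := fun v => lin fun _ => B' v
  let ent : (F.ι × Bad) → Mon → K := fun q b => coeff (e q.2) (∏ x, φ q.1 x ^ (e b x))
  have hentR : ∀ q b, ent q b ∈ F.R := by
    intro q b
    refine (mem_mapRange F.R).1 (Subring.prod_mem _ fun x _ => Subring.pow_mem _ (Subring.sum_mem _ fun l _ =>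
      Subring.mul_mem _ ?_ ?_) _) _
    · exact ⟨C ⟨_, hB' _ _ _⟩, by rw [map_C]; rfl⟩
    · exact ⟨X _, by rw [map_X]⟩
  have hφN : ∀ v v' x, N11 (F.abv v') (φ v x) ≤ C0 := by
    intro v v' x
    refine le_trans ?_ (hC0le v v' x.2)
    refine (N1_sum_le _ _ _ fun _ => zero_le_one).trans (Finset.sum_le_sum fun l _ => ?_)
    refine (N1_mul_le _ _ _ fun _ => zero_le_one).trans ?_
    rw [N1_C, N1_X, mul_one]
  have hSum : ∀ b ∈ Mon, ∑ x, e b x = ∑ j, d j := by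
    intro b hb
    rw [Fintype.sum_prod_type]
    exact Finset.sum_congr rfl fun j _ => hesum b hb j
  have hentB : ∀ v' q b, F.abv v' (ent q b) ≤ C0 ^ (∑ j, d j) := by
    intro v' q b
    refine (coeff_le_N11 _ _ _).trans ?_
    refine (N1_prod_le _ _ _ fun _ => zero_le_one).trans ?_
    rw [← hSum b b.2, ← Finset.prod_pow_eq_pow_sum]
    refine Finset.prod_le_prod (fun x _ => N1_nonneg _ _ fun _ => zero_le_one) fun x _ => ?_
    refine (N1_pow_le _ _ _ fun _ => zero_le_one).trans ?_
    exact pow_le_pow_left₀ (N1_nonneg _ _ fun _ => zero_le_one) (hφN q.1 v' x) _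
  haveI : Nonempty Mon := ⟨⟨_, hMne.choose_spec⟩⟩
  obtain ⟨ξ, hξO, hξ0, hξ, hξB⟩ := hCs (F.ι × Bad) Mon ent (C0 ^ (∑ j, d j)) (one_le_pow₀ hC01)
    (by simpa using hcard) hentR hentB
  set P : MvPolynomial (Fin m × I) K := ∑ b : Mon, monomial (e b) (ξ b) with hP
  have hPc : ∀ b : Mon, coeff (e b) P = ξ b := by
    intro b
    rw [hP, coeff_sum, Finset.sum_eq_single b]
    · rw [coeff_monomial, if_pos rfl]
    · intro b' _ h
      rw [coeff_monomial, if_neg]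
      intro h'; exact h (Subtype.ext (heinj h'))
    · simp
  have hMH : MH d P := by
    intro b hb j
    rw [hP, coeff_sum] at hb
    obtain ⟨b', _, hb'⟩ := Finset.exists_ne_zero_of_sum_ne_zero hb
    rw [coeff_monomial] at hb'
    have : e b' = b := by by_contra h; rw [if_neg h] at hb'; exact hb' rfl
    rw [← this]
    exact hesum _ b'.2 j
  refine ⟨P, ?_, ?_, hMH, ?_, ?_⟩
  · intro h
    apply hξ0
    funext b
    rw [← hPc b, h, coeff_zero]; rfl
  · rw [hP, F.mem_IP]
    intro b
    rw [coeff_sum]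
    refine F.O.sum_mem fun b' _ => ?_
    rw [coeff_monomial]
    split_ifs
    · exact hξO _
    · exact F.O.zero_mem
  · intro v
    have h1 : N11 (F.abv v) P ≤ ∑ b : Mon, F.abv v (ξ b) := by
      refine (N1_sum_le _ _ _ fun _ => zero_le_one).trans (Finset.sum_le_sum fun b _ => ?_)
      rw [N1_monomial]; simp
    refine h1.trans ((Finset.sum_le_sum fun b _ => hξB v b).trans ?_)
    simp only [Finset.sum_const, Finset.card_univ, Fintype.card_coe, nsmul_eq_mul]
    have hS : ∑ j, d j ≠ 0 := by
      have := Finset.single_le_sum (fun j _ => Nat.zero_le (d j)) (Finset.mem_univ (⟨0, hm1⟩ : Fin m))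
      have := hd ⟨0, hm1⟩
      omega
    have h2 : Cs ≤ Cs ^ (∑ j, d j) := le_self_pow₀ hCs1 hS
    have : (Cs * 2 ^ n * 2 ^ n * C0) ^ (∑ j, d j) = (2 ^ n) ^ (∑ j, d j) * (Cs ^ (∑ j, d j) * (2 ^ n) ^ (∑ j, d j) * C0 ^ (∑ j, d j)) := by
      rw [mul_pow, mul_pow, mul_pow]; ring
    rw [this]
    have : (0 : ℝ) ≤ Cs := by linarith
    have : (0 : ℝ) ≤ C0 := by linarith
    gcongr
  · intro v a ha i
    by_contra hcon
    -- a is in the image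
    have haMH := hMH.bind (fun _ => B v) a ha
    let a' : Fin m → I → ℕ := fun j i => a (j, i)
    have haa : e a' = a := by ext q; rfl
    have ha'M : a' ∈ Mon := Fintype.mem_piFinset.2 fun j => (anti_mem _ _).2 (haMH j)
    have hyy : ∑ j, y i j (a' j) = ∑ j, (a (j, i) : ℝ) / d j - m / n := by
      simp only [y, Finset.sum_sub_distrib]
      simp [a', div_eq_mul_inv]
    have ha'B : a' ∈ Bad := Finset.mem_biUnion.2 ⟨i, Finset.mem_univ _, Finset.mem_filter.2 ⟨ha'M, by rw [hyy]; exact hcon⟩⟩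
    have h1 := hξ (v, ⟨a', ha'B⟩)
    have h2 : coeff a (bind₁ (φ v) P) = 0 := by
      rw [← h1, hP, map_sum, coeff_sum]
      refine Finset.sum_congr rfl fun b _ => ?_
      rw [bind₁_monomial, coeff_C_mul, mul_comm]
      simp only [ent, haa]
      congr 2
      exact Finset.prod_subset (Finset.subset_univ _) fun x _ hx => by
        rw [Finsupp.notMem_support_iff.1 hx, pow_zero]
    have h3 : bind₁ (φ v) P = C ((D : K) ^ (∑ j, d j)) * bind₁ (lin fun _ => B v) P := by
      rw [bind_eq_sum, bind_eq_sum, Finset.mul_sum]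
      refine Finset.sum_congr rfl fun b hb => ?_
      have hφ : ∀ x, φ v x = C (D : K) * lin (fun _ => B v) x := by
        intro x
        simp only [φ, lin, B', Finset.mul_sum]
        refine Finset.sum_congr rfl fun l _ => ?_
        rw [Matrix.smul_apply, smul_eq_mul, C_mul, mul_assoc]
      have hs : ∑ x, b x = ∑ j, d j := by
        rw [Fintype.sum_prod_type]
        exact Finset.sum_congr rfl fun j _ => hMH b (mem_support_iff.1 hb) j
      simp only [hφ, mul_pow]
      rw [Finset.prod_mul_distrib, Finset.prod_pow_eq_pow_sum, hs, C_pow]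
      ring
    rw [h3, coeff_C_mul] at h2
    have hDK : (D : K) ≠ 0 := by exact_mod_cast hD0
    rcases mul_eq_zero.1 h2 with h | h
    · exact pow_ne_zero _ hDK h
    · exact ha h

end Aux

end Part5

section Part6
set_option autoImplicit false
open MvPolynomial

section Restr
variable {K : Type} [Field K] {σ : Type*} [Fintype σ]

/-- approximate equality with respect to a weight -/
def IRel (w : σ → ℝ) (θ : ℝ) (u u' : MvPolynomial σ K) : Prop :=
  IdxGe w θ u ∧ IdxGe w θ u' ∧ IdxGe w (θ + 1) (u - u')

lemma IRel.mul {w : σ → ℝ} {θ θ' : ℝ} {u u' x x' : MvPolynomial σ K} (h : IRel w θ u u') (h' : IRel w θ' x x') :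
    IRel w (θ + θ') (u * x) (u' * x') := by
  refine ⟨h.1.mul h'.1, h.2.1.mul h'.2.1, ?_⟩
  have : u * x - u' * x' = u * (x - x') + (u - u') * x' := by ring
  rw [this]
  exact ((h.1.mul h'.2.2).mono (by linarith)).add ((h.2.2.mul h'.2.1).mono (by linarith))

lemma IRel.refl {w : σ → ℝ} {θ : ℝ} {u : MvPolynomial σ K} (h : IdxGe w θ u) : IRel w θ u u :=
  ⟨h, h, by rw [sub_self]; exact IdxGe.zero _ _⟩

lemma IRel.pow {w : σ → ℝ} {θ : ℝ} {u u' : MvPolynomial σ K} (h : IRel w θ u u') (n : ℕ) :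
    IRel w (θ * n) (u ^ n) (u' ^ n) := by
  induction n with
  | zero => simpa using IRel.refl (IdxGe.one w)
  | succ n ih =>
    rw [pow_succ, pow_succ]
    have := ih.mul h
    push_cast
    rwa [mul_add, mul_one]

lemma IRel.prod {α : Type*} {w : σ → ℝ} (s : Finset α) {θ : α → ℝ} {u u' : α → MvPolynomial σ K}
    (h : ∀ a ∈ s, IRel w (θ a) (u a) (u' a)) : IRel w (∑ a ∈ s, θ a) (∏ a ∈ s, u a) (∏ a ∈ s, u' a) := by
  classical
  induction s using Finset.induction_on with
  | empty => simpa using IRel.refl (IdxGe.one w)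
  | insert a s ha ih =>
    rw [Finset.prod_insert ha, Finset.prod_insert ha, Finset.sum_insert ha]
    exact (h a (Finset.mem_insert_self _ _)).mul (ih fun b hb => h b (Finset.mem_insert_of_mem hb))

lemma IRel.bind {w : σ → ℝ} {ζ : σ → MvPolynomial σ K} (hζ : ∀ i, IRel w (w i) (ζ i) (X i)) {θ : ℝ}
    {q : MvPolynomial σ K} (hq : IdxGe w θ q) : IdxGe w (θ + 1) (bind₁ ζ q - q) := by
  have e : bind₁ X q = q := by rw [bind₁, aeval_X_left]; rfl
  have e2 : bind₁ ζ q - q = bind₁ ζ q - bind₁ X q := by rw [e]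
  rw [e2]
  rw [bind_eq_sum, bind_eq_sum, ← Finset.sum_sub_distrib]
  refine IdxGe.sum _ fun b hb => ?_
  rw [← mul_sub]
  have h1 := (IRel.prod (w := w) Finset.univ fun i _ => (hζ i).pow (b i)).2.2
  have h2 := (IdxGe.C w (coeff b q)).mul h1
  refine h2.mono ?_
  have := hq b (mem_support_iff.1 hb)
  linarith

variable {m : ℕ} {I : Type} [Fintype I] [DecidableEq I]

/-- exponent part outside of `a, b` -/
def rst (a b : I) (e : Fin m × I →₀ ℕ) : Fin m × I → ℕ := fun q => if q.2 = a ∨ q.2 = b then 0 else e q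

/-- exponent part on `b` -/
noncomputable def bpt (b : I) (e : Fin m × I →₀ ℕ) : Fin m →₀ ℕ := Finsupp.equivFunOnFinite.symm fun j => e (j, b)

/-- extraction of the part with given exponents outside of `a, b`, specialized at `x_a = 1` -/
noncomputable def Lg (a b : I) (γ : Fin m × I → ℕ) : MvPolynomial (Fin m × I) K →ₗ[K] MvPolynomial (Fin m) K :=
  (basisMonomials (Fin m × I) K).constr K fun e => by
    classical exact if rst a b e = γ then monomial (bpt b e) 1 else 0

lemma Lg_monomial (a b : I) (γ : Fin m × I → ℕ) (e : Fin m × I →₀ ℕ) (c : K) :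
    Lg a b γ (monomial e c) = if rst a b e = γ then monomial (bpt b e) c else 0 := by
  have : (monomial e c : MvPolynomial (Fin m × I) K) = c • basisMonomials (Fin m × I) K e := by
    rw [coe_basisMonomials, smul_monomial, smul_eq_mul, mul_one]
  rw [this, map_smul, Lg, Module.Basis.constr_basis]
  split_ifs
  · rw [smul_monomial, smul_eq_mul, mul_one]
  · rw [smul_zero]

lemma Lg_eq (a b : I) (γ : Fin m × I → ℕ) (p : MvPolynomial (Fin m × I) K) :
    Lg a b γ p = ∑ e ∈ p.support, if rst a b e = γ then monomial (bpt b e) (coeff e p) else 0 := by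
  conv_lhs => rw [p.as_sum, map_sum]
  exact Finset.sum_congr rfl fun e _ => Lg_monomial _ _ _ _ _

lemma Lg_coeff_ne (a b : I) (γ : Fin m × I → ℕ) (p : MvPolynomial (Fin m × I) K) (t : Fin m →₀ ℕ)
    (h : coeff t (Lg a b γ p) ≠ 0) : ∃ e, coeff e p ≠ 0 ∧ rst a b e = γ ∧ bpt b e = t := by
  classical
  rw [Lg_eq, coeff_sum] at h
  obtain ⟨e, he, h⟩ := Finset.exists_ne_zero_of_sum_ne_zero h
  refine ⟨e, mem_support_iff.1 he, ?_⟩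
  split_ifs at h with h1
  · refine ⟨h1, ?_⟩
    rw [coeff_monomial] at h
    by_contra h2
    rw [if_neg h2] at h
    exact h rfl
  · simp at h

/-- shift substitution -/
noncomputable def ph0 (a b : I) (μ : Fin m → K) : Fin m × I → MvPolynomial (Fin m × I) K := fun q =>
  if q.2 = a then 1 else if q.2 = b then X q + C (μ q.1) else X q

lemma Lg_ph0 (a b : I) (hab : a ≠ b) (γ : Fin m × I → ℕ) (μ : Fin m → K) (p : MvPolynomial (Fin m × I) K) :
    Lg a b γ (bind₁ (ph0 a b μ) p) = tr μ (Lg a b γ p) := by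
  classical
  -- auxiliary formula
  have aux : ∀ (e : Fin m × I →₀ ℕ) (q : MvPolynomial (Fin m) K),
      Lg a b γ (monomial (Finsupp.equivFunOnFinite.symm (rst a b e)) 1 * rename (fun j => (j, b)) q) =
        if rst a b e = γ then q else 0 := by
    intro e q
    induction q using MvPolynomial.induction_on' with
    | add x y hx hy => rw [map_add, mul_add, map_add, hx, hy]; split_ifs <;> simp
    | monomial t c =>
      rw [rename_monomial, monomial_mul, Lg_monomial, one_mul]
      have hinj : Function.Injective (fun j : Fin m => (j, b)) := fun x y h => by simpa using h
      have h1 : rst a b (Finsupp.equivFunOnFinite.symm (rst a b e) + Finsupp.mapDomain (fun j => (j, b)) t) = rst a b e := by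
        funext q
        by_cases hq : q.2 = a ∨ q.2 = b
        · simp [rst, hq]
        · simp only [rst, hq, if_false, Finsupp.add_apply]
          rw [Finsupp.mapDomain_notin_range]
          · simp [rst, hq]
          · rintro ⟨j, rfl⟩; exact hq (Or.inr rfl)
      have h2 : bpt b (Finsupp.equivFunOnFinite.symm (rst a b e) + Finsupp.mapDomain (fun j => (j, b)) t) = t := by
        ext j
        simp only [bpt, Finsupp.coe_equivFunOnFinite_symm, Finsupp.add_apply]
        rw [Finsupp.mapDomain_apply hinj]
        simp [rst]
      rw [h1, h2]
  have main : ∀ e : Fin m × I →₀ ℕ, ∏ q, ph0 (K := K) a b μ q ^ e q =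
      monomial (Finsupp.equivFunOnFinite.symm (rst a b e)) 1 * rename (fun j => (j, b)) (tr μ (monomial (bpt b e) 1)) := by
    intro e
    have h1 : (monomial (Finsupp.equivFunOnFinite.symm (rst a b e)) 1 : MvPolynomial (Fin m × I) K) =
        ∏ q, X q ^ rst a b e q := by
      rw [monomial_eq, C_1, one_mul, Finsupp.prod_fintype _ _ (by simp)]
      rfl
    have h2 : (monomial (bpt b e) 1 : MvPolynomial (Fin m) K) = ∏ j, X j ^ e (j, b) := by
      rw [monomial_eq, C_1, one_mul, Finsupp.prod_fintype _ _ (by simp)]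
      rfl
    rw [h1, h2, map_prod, map_prod, Fintype.prod_prod_type, Fintype.prod_prod_type, ← Finset.prod_mul_distrib]
    refine Finset.prod_congr rfl fun j _ => ?_
    have h3 : rename (fun j => (j, b)) (tr μ (X j ^ e (j, b))) = (X (j, b) + C (μ j) : MvPolynomial (Fin m × I) K) ^ e (j, b) := by
      rw [map_pow, map_pow, tr, bind₁_X_right]; simp
    rw [h3, mul_comm, ← Finset.mul_prod_erase _ _ (Finset.mem_univ b)]
    have h4 : ph0 (K := K) a b μ (j, b) = X (j, b) + C (μ j) := by
      simp [ph0, hab.symm]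
    rw [h4]
    congr 1
    rw [← Finset.mul_prod_erase Finset.univ (fun i => X (j, i) ^ rst a b e (j, i)) (Finset.mem_univ b)]
    have h5 : rst a b e (j, b) = 0 := by simp [rst]
    rw [h5, pow_zero, one_mul]
    refine Finset.prod_congr rfl fun i hi => ?_
    have hib := Finset.ne_of_mem_erase hi
    by_cases hia : i = a
    · simp [ph0, rst, hia]
    · simp [ph0, rst, hia, hib]
  rw [bind_eq_sum, map_sum, Lg_eq, map_sum]
  refine Finset.sum_congr rfl fun e _ => ?_
  rw [main, C_mul', map_smul, aux]
  split_ifs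
  · rw [← map_smul, smul_monomial, smul_eq_mul, mul_one]
  · simp

/-- shear substitution -/
noncomputable def shr (a b : I) (lam : Fin m → I → K) : Fin m × I → MvPolynomial (Fin m × I) K := fun q =>
  if q.2 = b then X q + ∑ i, (if i = a ∨ i = b then 0 else C (lam q.1 i) * X (q.1, i)) else X q

lemma restrict (F : PF K) (a b : I) (hab : a ≠ b) (d : Fin m → ℕ) (θ : ℝ) (μ : Fin m → K) (lam : Fin m → I → K)
    (P : MvPolynomial (Fin m × I) K) (hP : P ≠ 0) (hPI : P ∈ F.IP _) (hMH : MH d P)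
    (hidx : IdxGe (fun q : Fin m × I => if q.2 = b then (d q.1 : ℝ)⁻¹ else 0) θ
      (bind₁ (shr a b lam) (bind₁ (ph0 a b μ) P))) :
    ∃ p : MvPolynomial (Fin m) K, p ≠ 0 ∧ p ∈ F.IP _ ∧ (∀ e, coeff e p ≠ 0 → ∀ j, e j ≤ d j) ∧
      (∀ v, N11 (F.abv v) p ≤ N11 (F.abv v) P) ∧ IdxGe (fun j => (d j : ℝ)⁻¹) θ (tr μ p) := by
  classical
  let w : Fin m × I → ℝ := fun q => if q.2 = a ∨ q.2 = b then 0 else 1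
  have hw : ∀ q, 0 ≤ w q := fun q => by simp only [w]; split_ifs <;> norm_num
  have hwsum : ∀ e : Fin m × I →₀ ℕ, ∑ q, w q * (e q : ℝ) = ((∑ q, rst a b e q : ℕ) : ℝ) := by
    intro e
    push_cast
    refine Finset.sum_congr rfl fun q _ => ?_
    simp only [w, rst]; split_ifs <;> simp
  obtain ⟨b0, hb0, hmin⟩ := Finset.exists_min_image P.support (fun e => ∑ q, rst a b e q) (support_nonempty.2 hP)
  set γ := rst a b b0 with hγ
  have hPw : IdxGe w ((∑ q, γ q : ℕ) : ℝ) P := by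
    intro e he
    rw [hwsum]
    exact_mod_cast hmin e (mem_support_iff.2 he)
  set Q := bind₁ (ph0 a b μ) P with hQ
  have hQw : IdxGe w ((∑ q, γ q : ℕ) : ℝ) Q := by
    refine IdxGe.bind (w' := w) (fun q => ?_) hPw
    simp only [ph0]
    split_ifs with h1 h2
    · have : w q = 0 := by simp [w, h1]
      rw [this]; exact IdxGe.one w
    · have : w q = 0 := by simp [w, h2]
      have h3 := IdxGe.X (K := K) w q
      rw [this] at h3 ⊢
      exact h3.add (IdxGe.C w _)
    · exact IdxGe.X w q
  have hrel : ∀ q, IRel w (w q) (shr a b lam q) (X q : MvPolynomial (Fin m × I) K) := by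
    intro q
    simp only [shr]
    split_ifs with h
    · have hz : w q = 0 := by simp [w, h]
      have h1 : IdxGe w (w q + 1) (∑ i, (if i = a ∨ i = b then 0 else C (lam q.1 i) * X (q.1, i)) : MvPolynomial (Fin m × I) K) := by
        refine IdxGe.sum _ fun i _ => ?_
        split_ifs with hi
        · exact IdxGe.zero _ _
        · have h2 := (IdxGe.C w (lam q.1 i)).mul (IdxGe.X w (q.1, i))
          have h3 : w (q.1, i) = 1 := by simp [w, hi]
          rw [h3] at h2
          rw [hz]; exact h2
      refine ⟨(IdxGe.X w q).add (h1.mono (by linarith)), IdxGe.X w q, ?_⟩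
      rw [add_sub_cancel_left]; exact h1
    · exact IRel.refl (IdxGe.X w q)
  have hdiff := IRel.bind hrel hQw
  refine ⟨Lg a b γ P, ?_, ?_, ?_, ?_, ?_⟩
  · intro h
    have h1 : coeff (bpt b b0) (Lg a b γ P) = coeff b0 P := by
      rw [Lg_eq, coeff_sum, Finset.sum_eq_single b0]
      · rw [if_pos rfl, coeff_monomial, if_pos rfl]
      · intro e he hne
        split_ifs with h2
        · rw [coeff_monomial, if_neg]
          intro h3
          apply hne
          have hb : ∀ j, e (j, b) = b0 (j, b) := fun j => by
            simpa [bpt] using DFunLike.congr_fun h3 j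
          have hr : ∀ j i, i ≠ a → i ≠ b → e (j, i) = b0 (j, i) := fun j i h4 h5 => by
            have := congrFun h2 (j, i)
            simpa [hγ, rst, h4, h5] using this
          ext ⟨j, i⟩
          by_cases hib : i = b
          · rw [hib]; exact hb j
          by_cases hia : i = a
          · have s1 := hMH e (mem_support_iff.1 he) j
            have s2 := hMH b0 (mem_support_iff.1 hb0) j
            rw [← Finset.add_sum_erase _ _ (Finset.mem_univ a)] at s1 s2
            have s3 : ∑ x ∈ Finset.univ.erase a, e (j, x) = ∑ x ∈ Finset.univ.erase a, b0 (j, x) := by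
              refine Finset.sum_congr rfl fun x hx => ?_
              have hxa := Finset.ne_of_mem_erase hx
              by_cases hxb : x = b
              · rw [hxb]; exact hb j
              · exact hr j x hxa hxb
            rw [hia]; omega
          · exact hr j i hia hib
        · simp
      · intro h2; exact absurd hb0 h2
    rw [h, coeff_zero] at h1
    exact mem_support_iff.1 hb0 h1.symm
  · rw [F.mem_IP]
    intro t
    rw [Lg_eq, coeff_sum]
    refine F.O.sum_mem fun e _ => ?_
    split_ifs
    · rw [coeff_monomial]
      split_ifs
      · exact F.mem_IP.1 hPI _
      · exact F.O.zero_mem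
    · rw [coeff_zero]; exact F.O.zero_mem
  · intro t ht j
    obtain ⟨e, he, _, rfl⟩ := Lg_coeff_ne _ _ _ _ _ ht
    rw [← hMH e he j]
    exact Finset.single_le_sum (f := fun i => e (j, i)) (fun i _ => Nat.zero_le _) (Finset.mem_univ b)
  · intro v
    rw [Lg_eq]
    refine (N1_sum_le _ _ _ fun _ => zero_le_one).trans ?_
    rw [N11, N1]
    refine Finset.sum_le_sum fun e _ => ?_
    split_ifs
    · rw [N1_monomial]; simp
    · rw [N1_zero]; exact mul_nonneg ((F.abv v).nonneg _) (by simp)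
  · rw [← Lg_ph0 a b hab]
    intro t ht
    obtain ⟨e, he, her, rfl⟩ := Lg_coeff_ne _ _ _ _ _ ht
    have h1 : coeff e (bind₁ (shr a b lam) Q) ≠ 0 := by
      have h2 : coeff e (bind₁ (shr a b lam) Q - Q) = 0 := by
        by_contra h3
        have := hdiff e h3
        rw [hwsum, her] at this
        linarith
      rw [coeff_sub, sub_eq_zero] at h2
      rw [h2]; exact he
    have h3 := hidx e h1
    refine h3.trans (le_of_eq ?_)
    rw [Fintype.sum_prod_type]
    refine Finset.sum_congr rfl fun j _ => ?_
    rw [Finset.sum_eq_single b]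
    · simp [bpt]
    · intro i _ hi; simp [hi]
    · simp

end Restr

end Part6

section Part7
set_option autoImplicit false
open MvPolynomial

section Vanish
variable {K : Type} [Field K] [CharZero K] {m : ℕ} {I : Type} [Fintype I] [DecidableEq I]

lemma N1_lin (v : AbsoluteValue K ℝ) (U : Fin m → Matrix I I K) (q : Fin m × I) {r : Fin m × I → ℝ}
    (hr : ∀ i, 0 ≤ r i) : N1 v (lin U q) r ≤ ∑ l, v (U q.1 q.2 l) * r (q.1, l) := by
  refine (N1_sum_le v _ _ hr).trans (Finset.sum_le_sum fun l _ => ?_)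
  refine (N1_mul_le v _ _ hr).trans ?_
  rw [N1_C, N1_X]

lemma bind_lin (U V : Fin m → Matrix I I K) (q : Fin m × I) :
    bind₁ (lin U) (lin V q) = lin (fun j => V j * U j) q := by
  simp only [lin, map_sum, map_mul, bind₁_C_right, bind₁_X_right, Matrix.mul_apply, Finset.sum_mul, Finset.mul_sum]
  rw [Finset.sum_comm]
  refine Finset.sum_congr rfl fun l _ => Finset.sum_congr rfl fun l' _ => by ring

lemma bind_lin_bind (U V : Fin m → Matrix I I K) (P : MvPolynomial (Fin m × I) K) :
    bind₁ (lin U) (bind₁ (lin V) P) = bind₁ (lin fun j => V j * U j) P := by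
  rw [bind₁_bind₁]
  congr 2
  funext q
  exact bind_lin U V q

lemma PF.C_mem_IP (F : PF K) {σ : Type*} {x : K} (hx : x ∈ F.O) : (C x : MvPolynomial σ K) ∈ F.IP σ := by
  classical
  rw [F.mem_IP]
  intro b
  rw [coeff_C]
  split_ifs
  · exact hx
  · exact F.O.zero_mem

lemma PF.X_mem_IP (F : PF K) {σ : Type*} (i : σ) : (X i : MvPolynomial σ K) ∈ F.IP σ := by
  classical
  rw [F.mem_IP]
  intro b
  rw [coeff_X']
  split_ifs
  · exact F.O.one_mem
  · exact F.O.zero_mem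

lemma PF.bind_mem_IP (F : PF K) {σ τ : Type*} [Fintype σ] [Fintype τ] {φ : σ → MvPolynomial τ K} (hφ : ∀ i, φ i ∈ F.IP τ)
    {P : MvPolynomial σ K} (hP : P ∈ F.IP σ) : bind₁ φ P ∈ F.IP τ := by
  rw [bind_eq_sum]
  refine Subring.sum_mem _ fun b _ => Subring.mul_mem _ (F.C_mem_IP ((F.mem_IP).1 hP b)) ?_
  exact Subring.prod_mem _ fun i _ => Subring.pow_mem _ (hφ i) _

lemma PF.lin_mem_IP (F : PF K) {U : Fin m → Matrix I I K} (hU : ∀ j i l, U j i l ∈ F.O) (q : Fin m × I) :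
    lin U q ∈ F.IP _ :=
  Subring.sum_mem _ fun _ _ => Subring.mul_mem _ (F.C_mem_IP (hU _ _ _)) (F.X_mem_IP _)

lemma vanish (F : PF K) [Nonempty I] (A B : F.ι → Matrix I I K) (hBA : ∀ v, B v * A v = 1) (c : F.ι → I → ℝ) (cs g ε : ℝ)
    (hcs : ∀ v i, |c v i| ≤ cs) (hg : ∑ v, F.m v * ∑ i, c v i = -g) (hε : 0 ≤ ε) (hε1 : ε ≤ 1)
    (d : Fin m → ℕ) (hd : ∀ j, 1 ≤ d j) (q : Fin m → ℝ) (hq : ∀ j, 0 ≤ q j) (L : ℝ) (hL0 : 0 ≤ L)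
    (hL1 : ∀ j, L ≤ d j * q j) (hL2 : ∀ j, d j * q j ≤ (1 + ε) * L)
    (P : MvPolynomial (Fin m × I) K) (hPI : P ∈ F.IP _) (hMH : MH d P) (Λ : ℝ)
    (hN : ∀ v, N1 (F.abv v) (bind₁ (lin fun _ => B v) P) (fun _ => (Fintype.card I : ℝ)) ≤ Real.exp Λ)
    (hsupp : ∀ v a, coeff a (bind₁ (lin fun _ => B v) P) ≠ 0 →
      ∀ i, |∑ j, (a (j, i) : ℝ) / d j - m / Fintype.card I| ≤ ε * m)
    (T : Fin m → Matrix I I K) (hT : ∀ j i l, T j i l ∈ F.O) (S : Fin m → I → F.ι → ℝ) (hS : ∀ j i v, 0 < S j i v)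
    (hTS : ∀ j v i' i, F.abv v ((A v * T j) i' i) ≤ S j i v * Real.exp (q j * c v i')) (i0 : I) (Bd θ : ℝ) (hBd : 0 ≤ Bd)
    (hS1 : ∀ j i, i ≠ i0 → F.pr (S j i) ≤ Real.exp (ε * q j)) (hS0 : ∀ j, F.pr (S j i0) ≤ Real.exp (Bd * q j))
    (hfin : F.M * Λ + L * (-g * m / Fintype.card I + 2 * ε * m * Fintype.card I * cs * F.M + 2 * ε * m + 2 * Bd * θ) < 0) :
    IdxGe (fun p : Fin m × I => if p.2 = i0 then (d p.1 : ℝ)⁻¹ else 0) θ (bind₁ (lin T) P) := by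
  intro e he
  set n : ℝ := (Fintype.card I : ℝ) with hn
  have hnpos : 0 < n := by rw [hn]; exact_mod_cast Fintype.card_pos
  have hcs0 : 0 ≤ cs := (abs_nonneg _).trans (hcs F.v0 (Classical.arbitrary I))
  have hsum : ∑ p : Fin m × I, (if p.2 = i0 then (d p.1 : ℝ)⁻¹ else 0) * (e p : ℝ) = ∑ j, (e (j, i0) : ℝ) / d j := by
    rw [Fintype.sum_prod_type]
    refine Finset.sum_congr rfl fun j _ => ?_
    rw [Finset.sum_eq_single i0]
    · simp only [if_true]; rw [div_eq_mul_inv, mul_comm]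
    · intro i _ h; simp [h]
    · simp
  rw [hsum]
  by_contra hlt
  push Not at hlt
  have hdpos : ∀ j, (0 : ℝ) < d j := fun j => by exact_mod_cast hd j
  have hLe : ∀ (x : Fin m → ℕ), (∀ j, x j ≤ d j) →
      |∑ j, (x j : ℝ) * q j - L * ∑ j, (x j : ℝ) / d j| ≤ ε * L * m := by
    intro x hx
    rw [Finset.mul_sum, ← Finset.sum_sub_distrib]
    refine (Finset.abs_sum_le_sum_abs _ _).trans ?_
    refine (Finset.sum_le_card_nsmul _ _ (ε * L) fun j _ => ?_).trans ?_
    · have h1 : (x j : ℝ) * q j - L * (x j / d j) = (x j / d j) * (d j * q j - L) := by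
        have := (hdpos j).ne'
        field_simp
      have h2 : (x j : ℝ) / d j ≤ 1 := by
        rw [div_le_one (hdpos j)]; exact_mod_cast hx j
      have h3 : (0 : ℝ) ≤ x j / d j := by positivity
      have h4 := hL1 j
      have h5 := hL2 j
      rw [h1, abs_mul, abs_of_nonneg h3, abs_of_nonneg (by linarith)]
      calc (x j : ℝ) / d j * (d j * q j - L) ≤ 1 * (d j * q j - L) := mul_le_mul_of_nonneg_right h2 (by linarith)
        _ ≤ _ := by linarith
    · simp; linarith
  have hMHG := hMH.bind T
  have hMHv : ∀ v, MH d (bind₁ (lin fun _ => B v) P) := fun v => hMH.bind _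
  have eqG : ∀ v, bind₁ (lin T) P = bind₁ (lin fun j => A v * T j) (bind₁ (lin fun _ => B v) P) := by
    intro v
    rw [bind_lin_bind]
    simp only [← mul_assoc, hBA, one_mul]
  set E : F.ι → ℝ := fun v => L * m / n * ∑ i, c v i + 2 * ε * L * m * n * cs with hE
  have key : ∀ v, F.abv v (coeff e (bind₁ (lin T) P)) ≤ (∏ p : Fin m × I, S p.1 p.2 v ^ e p) * Real.exp (Λ + E v) := by
    intro v
    have hS' : ∀ p : Fin m × I, 0 < (S p.1 p.2 v)⁻¹ := fun p => inv_pos.2 (hS _ _ _)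
    have h1 := coeff_le_N1 (F.abv v) (bind₁ (lin T) P) e (r := fun p => (S p.1 p.2 v)⁻¹) fun p => (hS' p).le
    have h2 : N1 (F.abv v) (bind₁ (lin T) P) (fun p => (S p.1 p.2 v)⁻¹) ≤ Real.exp (Λ + E v) := by
      rw [eqG v]
      refine (N1_bind_le _ _ _ fun p => (hS' p).le).trans ?_
      refine (N1_mono _ _ (r' := fun p => n * Real.exp (q p.1 * c v p.2)) (fun p => N1_nonneg _ _ fun p => (hS' p).le)
        fun p => ?_).trans ?_
      · refine (N1_lin _ _ _ fun p => (hS' p).le).trans ?_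
        refine (Finset.sum_le_card_nsmul _ _ (Real.exp (q p.1 * c v p.2)) fun l _ => ?_).trans ?_
        · have := hTS p.1 v p.2 l
          rw [← div_eq_mul_inv, div_le_iff₀ (hS _ _ _), mul_comm]
          exact this
        · simp [hn]
      · rw [Real.exp_add]
        refine le_trans ?_ (mul_le_mul_of_nonneg_right (hN v) (Real.exp_nonneg _))
        rw [N1, N1, Finset.sum_mul]
        refine Finset.sum_le_sum fun b hb => ?_
        have hb := mem_support_iff.1 hb
        rw [mul_assoc]
        refine mul_le_mul_of_nonneg_left ?_ ((F.abv v).nonneg _)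
        simp only [mul_pow, Finset.prod_mul_distrib]
        refine mul_le_mul_of_nonneg_left ?_ (Finset.prod_nonneg fun _ _ => pow_nonneg hnpos.le _)
        simp only [← Real.exp_nat_mul, ← Real.exp_sum]
        refine Real.exp_le_exp.2 ?_
        rw [Fintype.sum_prod_type_right]
        have h3 : ∀ i, |∑ j, (b (j, i) : ℝ) * q j - L * (m / n)| ≤ 2 * ε * L * m := by
          intro i
          have h4 := hLe (fun j => b (j, i)) fun j => by
            rw [← hMHv v b hb j]
            exact Finset.single_le_sum (f := fun i => b (j, i)) (fun _ _ => Nat.zero_le _) (Finset.mem_univ i)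
          have h5 := mul_le_mul_of_nonneg_left (hsupp v b hb i) hL0
          rw [← abs_of_nonneg hL0, ← abs_mul, abs_of_nonneg hL0, mul_sub] at h5
          have h6 := abs_sub_le (∑ j, (b (j, i) : ℝ) * q j) (L * ∑ j, (b (j, i) : ℝ) / d j) (L * (m / n))
          linarith
        have h7 : ∑ i, ∑ j, (b (j, i) : ℝ) * (q j * c v i) = ∑ i, c v i * (∑ j, (b (j, i) : ℝ) * q j) := by
          refine Finset.sum_congr rfl fun i _ => ?_
          rw [Finset.mul_sum]
          exact Finset.sum_congr rfl fun j _ => by ring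
        rw [h7]
        have h8 : ∀ i ∈ Finset.univ, c v i * (∑ j, (b (j, i) : ℝ) * q j) ≤ L * (m / n) * c v i + 2 * ε * L * m * cs := by
          intro i _
          have h9 : c v i * (∑ j, (b (j, i) : ℝ) * q j - L * (m / n)) ≤ cs * (2 * ε * L * m) := by
            refine (le_abs_self _).trans ?_
            rw [abs_mul]
            exact mul_le_mul (hcs v i) (h3 i) (abs_nonneg _) hcs0
          linarith
        refine (Finset.sum_le_sum h8).trans ?_
        rw [Finset.sum_add_distrib, ← Finset.mul_sum, Finset.sum_const, nsmul_eq_mul, hE]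
        simp only [Finset.card_univ, ← hn]
        apply le_of_eq
        ring
    have h3 := h1.trans h2
    simp only [inv_pow, Finset.prod_inv_distrib] at h3
    rw [← div_eq_mul_inv, div_le_iff₀ (Finset.prod_pos fun p _ => pow_pos (hS _ _ _) _)] at h3
    rw [mul_comm]; exact h3
  have hin : coeff e (bind₁ (lin T) P) ∈ F.O :=
    (F.mem_IP).1 (F.bind_mem_IP (F.lin_mem_IP hT) hPI) e
  refine he (F.eq_zero_of_pr hin ?_)
  refine (F.pr_le (fun v => (F.abv v).nonneg _) key).trans_lt ?_
  rw [F.pr_mul, F.pr_prod, F.pr_exp]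
  have h1 : ∏ p : Fin m × I, F.pr (fun v => S p.1 p.2 v ^ e p) ≤
      Real.exp (∑ j, (ε * (d j * q j) + Bd * (e (j, i0) * q j))) := by
    have : ∏ p : Fin m × I, F.pr (fun v => S p.1 p.2 v ^ e p) ≤
        ∏ p : Fin m × I, Real.exp (e p * ((ε + if p.2 = i0 then Bd else 0) * q p.1)) := by
      refine Finset.prod_le_prod (fun p _ => F.pr_nonneg fun v => pow_nonneg (hS _ _ _).le _) fun p _ => ?_
      rw [F.pr_pow, Real.exp_nat_mul]
      refine pow_le_pow_left₀ (F.pr_nonneg fun v => (hS _ _ _).le) ?_ _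
      split_ifs with h
      · rw [h]
        refine (hS0 p.1).trans (Real.exp_le_exp.2 ?_)
        nlinarith [mul_nonneg hε (hq p.1)]
      · rw [add_zero]; exact hS1 _ _ h
    refine this.trans (le_of_eq ?_)
    rw [← Real.exp_sum, Fintype.sum_prod_type]
    congr 1
    refine Finset.sum_congr rfl fun j _ => ?_
    have h2 : (d j : ℝ) = ∑ i, (e (j, i) : ℝ) := by
      rw [← hMHG e he j]; push_cast; rfl
    simp only [add_mul, mul_add, Finset.sum_add_distrib]
    congr 1
    · rw [h2, Finset.sum_mul, Finset.mul_sum]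
      exact Finset.sum_congr rfl fun i _ => by ring
    · rw [Finset.sum_eq_single i0]
      · simp; ring
      · intro i _ h; simp [h]
      · simp
  refine (mul_le_mul_of_nonneg_right h1 (Real.exp_nonneg _)).trans_lt ?_
  rw [← Real.exp_add, Real.exp_lt_one_iff, Finset.sum_add_distrib, ← Finset.mul_sum, ← Finset.mul_sum]
  have h2 : ∑ j, (d j * q j) ≤ 2 * L * m := by
    refine (Finset.sum_le_card_nsmul _ _ (2 * L) fun j _ => ?_).trans ?_
    · nlinarith [hL2 j]
    · simp; linarith
  have h3 : ∑ j, (e (j, i0) * q j) ≤ 2 * L * θ := by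
    have : ∑ j, (e (j, i0) * q j) ≤ ∑ j, 2 * L * ((e (j, i0) : ℝ) / d j) := by
      refine Finset.sum_le_sum fun j _ => ?_
      have h1 : (e (j, i0) : ℝ) * q j = (e (j, i0) / d j) * (d j * q j) := by
        have := (hdpos j).ne'
        field_simp
      rw [h1, mul_comm (2 * L)]
      refine mul_le_mul_of_nonneg_left ?_ (by positivity)
      nlinarith [hL2 j]
    rw [← Finset.mul_sum] at this
    exact this.trans (mul_le_mul_of_nonneg_left hlt.le (by linarith))
  have h4 : ∑ v, (F.m v : ℝ) * (Λ + E v) = F.M * Λ + L * (-g * m / n + 2 * ε * m * n * cs * F.M) := by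
    have hM : (F.M : ℝ) = ∑ v, (F.m v : ℝ) := by simp [PF.M]
    have h5 : ∀ v, (F.m v : ℝ) * (Λ + E v) = F.m v * (Λ + 2 * ε * L * m * n * cs) + L * m / n * (F.m v * ∑ i, c v i) := by
      intro v; rw [hE]; ring
    rw [Finset.sum_congr rfl fun v _ => h5 v, Finset.sum_add_distrib, ← Finset.sum_mul, ← Finset.mul_sum, hg, ← hM]
    ring
  rw [h4]
  have h6 := mul_le_mul_of_nonneg_left h2 hε
  have h7 := mul_le_mul_of_nonneg_left h3 hBd
  nlinarith
end Vanish

end Part7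

section Part8
set_option autoImplicit false
open MvPolynomial

section CaseC
variable {K : Type} [Field K] [CharZero K] {m : ℕ} {I : Type} [Fintype I] [DecidableEq I]

lemma IdxGe.of_nonneg {σ : Type*} [Fintype σ] {w : σ → ℝ} (hw : ∀ i, 0 ≤ w i) (p : MvPolynomial σ K) : IdxGe w 0 p :=
  fun _ _ => Finset.sum_nonneg fun i _ => mul_nonneg (hw i) (Nat.cast_nonneg _)

lemma pull (a b i0 : I) (hab : a ≠ b) (d : Fin m → ℕ) (θ : ℝ) (P : MvPolynomial (Fin m × I) K)
    (T T' : Fin m → Matrix I I K) (hTT : ∀ j, T j * T' j = 1) (hb : ∀ j, T' j i0 b = 1)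
    (h : IdxGe (fun p : Fin m × I => if p.2 = i0 then (d p.1 : ℝ)⁻¹ else 0) θ (bind₁ (lin T) P)) :
    IdxGe (fun q : Fin m × I => if q.2 = b then (d q.1 : ℝ)⁻¹ else 0) θ
      (bind₁ (shr a b fun j i => - T' j i0 i) (bind₁ (ph0 a b fun j => - T' j i0 a) P)) := by
  have e1 : P = bind₁ (lin T') (bind₁ (lin T) P) := by
    rw [bind_lin_bind]
    simp only [hTT]
    have : (lin fun _ : Fin m => (1 : Matrix I I K)) = X := by
      funext p
      simp only [lin]
      rw [Finset.sum_eq_single p.2]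
      · simp
      · intro l _ h; simp [Matrix.one_apply, Ne.symm h]
      · simp
    rw [this, bind₁, aeval_X_left]; rfl
  rw [bind₁_bind₁, e1, bind₁_bind₁]
  refine IdxGe.bind (fun p => ?_) h
  split_ifs with hp
  · obtain ⟨j, i⟩ := p
    simp only at hp
    subst hp
    have : bind₁ (fun q => bind₁ (shr a b fun j i' => - T' j i i') (ph0 a b (fun j => - T' j i a) q)) (lin T' (j, i)) =
        X (j, b) := by
      simp only [lin, map_sum, map_mul, bind₁_C_right, bind₁_X_right]
      have e2 : ∀ l, C (T' j i l) * bind₁ (shr a b fun j i' => - T' j i i') (ph0 a b (fun j => - T' j i a) (j, l)) =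
          (if l = a then C (T' j i a) else 0) + (if l = b then X (j, b) + ∑ l, (if l = a ∨ l = b then 0 else C (- T' j i l) * X (j, l)) + C (- T' j i a) else 0)
          + (if l = a ∨ l = b then 0 else C (T' j i l) * X (j, l)) := by
        intro l
        by_cases h1 : l = a
        · subst h1; simp [ph0, hab]
        · by_cases h2 : l = b
          · subst h2; simp [ph0, Ne.symm hab, shr, hb]
          · simp [ph0, h1, h2, shr]
      simp only [e2, Finset.sum_add_distrib, Finset.sum_ite_eq', Finset.mem_univ, if_true]
      have e3 : ∑ l, (if l = a ∨ l = b then 0 else C (- T' j i l) * X (j, l)) =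
          - ∑ l, (if l = a ∨ l = b then (0 : MvPolynomial (Fin m × I) K) else C (T' j i l) * X (j, l)) := by
        rw [← Finset.sum_neg_distrib]
        refine Finset.sum_congr rfl fun l _ => ?_
        split_ifs <;> simp
      rw [e3, C_neg]
      ring
    rw [this]
    have := IdxGe.X (K := K) (fun q : Fin m × I => if q.2 = b then (d q.1 : ℝ)⁻¹ else 0) (j, b)
    simpa using this
  · exact IdxGe.of_nonneg (fun q => by split_ifs <;> positivity) _

/-- A good approximation datum -/
def GoodPt (F : PF K) (A : F.ι → Matrix I I K) (c : F.ι → I → ℝ) (a b i0 : I) (Bd η ε q : ℝ) : Prop :=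
  ∃ (T T' : Matrix I I K) (S : I → F.ι → ℝ) (α β : F.O), (∀ i l, T i l ∈ F.O) ∧ T * T' = 1 ∧ (∀ i v, 0 < S i v) ∧
    (∀ v i' i, F.abv v ((A v * T) i' i) ≤ S i v * Real.exp (q * c v i')) ∧
    (∀ i, i ≠ i0 → F.pr (S i) ≤ Real.exp (ε * q)) ∧ F.pr (S i0) ≤ Real.exp (Bd * q) ∧ T' i0 b = 1 ∧
    IsCoprime α β ∧ β ≠ 0 ∧ - T' i0 a = (α : K) / (β : K) ∧ η * q ≤ Real.log (F.hh α β)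

lemma N1_const_le (v : AbsoluteValue K ℝ) {d : Fin m → ℕ} {P : MvPolynomial (Fin m × I) K} (hMH : MH d P) (C1 : ℝ) :
    N1 v P (fun _ => C1) = C1 ^ (∑ j, d j) * N11 v P := by
  rw [N11, N1, N1, Finset.mul_sum]
  refine Finset.sum_congr rfl fun b hb => ?_
  have hb := mem_support_iff.1 hb
  rw [Finset.prod_pow_eq_pow_sum, Fintype.sum_prod_type, Finset.sum_congr rfl fun j _ => hMH b hb j]
  simp [mul_comm]

set_option maxHeartbeats 1000000 in
lemma caseC (F : PF K) [Nonempty I] (A : F.ι → Matrix I I K) (hA : ∀ v, (A v).det ≠ 0) (c : F.ι → I → ℝ) (g : ℝ) (hg0 : 0 < g)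
    (hg : ∑ v, F.m v * ∑ i, c v i = -g) (a b i0 : I) (hab : a ≠ b) (Bd η : ℝ) (hBd : 0 ≤ Bd) (hη : 0 < η)
    (H : ∀ ε > 0, ∀ q0 : ℝ, ∃ q ≥ q0, GoodPt F A c a b i0 Bd η ε q) : False := by
  set n : ℝ := (Fintype.card I : ℝ) with hn
  have hn1 : 1 ≤ n := by rw [hn]; exact_mod_cast Fintype.card_pos
  have hnpos : 0 < n := by linarith
  obtain ⟨cs, hcs⟩ : ∃ cs : ℝ, ∀ v i, |c v i| ≤ cs := by
    refine ⟨∑ v, ∑ i, |c v i|, fun v i => ?_⟩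
    exact (Finset.single_le_sum (f := fun i => |c v i|) (fun _ _ => abs_nonneg _) (Finset.mem_univ i)).trans
      (Finset.single_le_sum (f := fun v => ∑ i, |c v i|) (fun _ _ => Finset.sum_nonneg fun _ _ => abs_nonneg _) (Finset.mem_univ v))
  have hcs0 : 0 ≤ cs := (abs_nonneg _).trans (hcs F.v0 (Classical.arbitrary I))
  set B : F.ι → Matrix I I K := fun v => (A v)⁻¹ with hB
  have hBA : ∀ v, B v * A v = 1 := fun v => Matrix.nonsing_inv_mul _ (isUnit_iff_ne_zero.2 (hA v))
  set u : ℝ := g / (4 * n) with hu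
  have hu0 : 0 < u := by positivity
  obtain ⟨ε, hε0, hε1, hε⟩ : ∃ ε : ℝ, 0 < ε ∧ ε ≤ 1 ∧ 2 * ε * (n * cs * F.M + 1) ≤ u := by
    have hM0 : (0 : ℝ) ≤ F.M := Nat.cast_nonneg _
    have h1 : 0 < 2 * (n * cs * F.M + 1) := by positivity
    refine ⟨min 1 (u / (2 * (n * cs * F.M + 1))), lt_min one_pos (by positivity), min_le_left _ _, ?_⟩
    have := min_le_right 1 (u / (2 * (n * cs * F.M + 1)))
    rw [le_div_iff₀ h1] at this
    linarith
  obtain ⟨θ, hθ0, hθ⟩ : ∃ θ : ℝ, 0 < θ ∧ 2 * Bd * θ ≤ u := by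
    refine ⟨u / (2 * Bd + 1), by positivity, ?_⟩
    rw [mul_div_assoc', div_le_iff₀ (by positivity)]
    nlinarith
  obtain ⟨m0, Cc, hCc, haux⟩ := F.aux B ε hε0
  set m := max m0 1 with hm
  have hm1 : (1 : ℝ) ≤ m := by exact_mod_cast le_max_right m0 1
  obtain ⟨κ, hκ, hroth⟩ := F.roth m θ hθ0
  obtain ⟨C1, hC1, hC1B⟩ : ∃ C1 : ℝ, 1 ≤ C1 ∧ ∀ v i, ∑ l, F.abv v (B v i l) * n ≤ C1 := by
    have hnn : ∀ v i, 0 ≤ ∑ l, F.abv v (B v i l) * n := fun v i =>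
      Finset.sum_nonneg fun l _ => mul_nonneg ((F.abv v).nonneg _) hnpos.le
    refine ⟨1 + ∑ v, ∑ i, ∑ l, F.abv v (B v i l) * n, ?_, fun v i => ?_⟩
    · have := Finset.sum_nonneg fun v (_ : v ∈ Finset.univ) => Finset.sum_nonneg fun i (_ : i ∈ Finset.univ) => hnn v i
      linarith
    · have := (Finset.single_le_sum (f := fun i => ∑ l, F.abv v (B v i l) * n) (fun i _ => hnn v i) (Finset.mem_univ i)).trans
        (Finset.single_le_sum (f := fun v => ∑ i, ∑ l, F.abv v (B v i l) * n)
          (fun v _ => Finset.sum_nonneg fun i _ => hnn v i) (Finset.mem_univ v))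
      linarith
  set lam := Real.log (C1 * Cc) with hlam
  have hCC : 1 ≤ C1 * Cc := by nlinarith
  have hlam0 : 0 ≤ lam := Real.log_nonneg hCC
  have hM0 : (0 : ℝ) ≤ F.M := Nat.cast_nonneg _
  obtain ⟨Q0, hQ1, hQ2, hQ3⟩ : ∃ Q0 : ℝ, 1 ≤ Q0 ∧ F.M * lam * 2 ≤ u * Q0 ∧ κ * (F.M * lam + 1) * 2 * m ≤ η * Q0 := by
    refine ⟨max 1 (max (F.M * lam * 2 / u) (κ * (F.M * lam + 1) * 2 * m / η)), le_max_left _ _, ?_, ?_⟩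
    · have := (le_max_left (F.M * lam * 2 / u) (κ * (F.M * lam + 1) * 2 * m / η)).trans (le_max_right 1 _)
      rw [div_le_iff₀ hu0] at this
      linarith
    · have := (le_max_right (F.M * lam * 2 / u) (κ * (F.M * lam + 1) * 2 * m / η)).trans (le_max_right 1 _)
      rw [div_le_iff₀ hη] at this
      linarith
  choose nxt hnxt hgood using H ε hε0
  -- the sequence
  obtain ⟨y, hy0, hy, hyg⟩ : ∃ y : ℕ → ℝ, (∀ t, Q0 ≤ y t) ∧ (∀ t, 2 * κ * y t ≤ y (t + 1)) ∧
      ∀ t, GoodPt F A c a b i0 Bd η ε (y t) := by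
    let x : ℕ → ℝ := fun t => Nat.rec Q0 (fun _ z => max Q0 (2 * κ * nxt z)) t
    have hx : ∀ t, x (t + 1) = max Q0 (2 * κ * nxt (x t)) := fun t => rfl
    refine ⟨fun t => nxt (x t), fun t => ?_, fun t => ?_, fun t => hgood _⟩
    · refine le_trans ?_ (hnxt _)
      cases t with
      | zero => exact le_rfl
      | succ t => rw [hx]; exact le_max_left _ _
    · refine le_trans ?_ (hnxt _)
      rw [hx]; exact le_max_right _ _
  have hymono : ∀ s t, s < t → 2 * κ * y s ≤ y t := by
    intro s t hst
    induction t, hst using Nat.le_induction with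
    | base => exact hy s
    | succ t _ ih =>
      have h1 := hy t
      have h2 := hy0 t
      nlinarith
  set q : Fin m → ℝ := fun j => y (m - 1 - j) with hq
  have hqQ : ∀ j, Q0 ≤ q j := fun j => hy0 _
  have hqpos : ∀ j, 0 < q j := fun j => by linarith [hqQ j]
  have hqmono : ∀ i j, i < j → 2 * κ * q j ≤ q i := fun i j hij => hymono _ _ (by
    have := j.2; have := Fin.lt_def.1 hij; omega)
  have hqg : ∀ j, GoodPt F A c a b i0 Bd η ε (q j) := fun j => hyg _
  choose T T' S α β hT hTT hS hTS hS1 hS0 hTb hcop hβ hTa hhh using hqg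
  set L : ℝ := (∑ j, q j) / ε with hL
  have hLq : ∀ j, q j ≤ ε * L := by
    intro j
    rw [hL, mul_div_cancel₀ _ hε0.ne']
    exact Finset.single_le_sum (f := q) (fun j _ => (hqpos j).le) (Finset.mem_univ j)
  have hmpos : 0 < m := by rw [hm]; exact lt_of_lt_of_le one_pos (le_max_right m0 1)
  have hL0 : 0 < L := by
    have h1 := hLq ⟨0, hmpos⟩
    have h2 := hqpos ⟨0, hmpos⟩
    by_contra h
    push Not at h
    nlinarith
  set d : Fin m → ℕ := fun j => ⌈L / q j⌉₊ with hd
  have hd1 : ∀ j, 1 ≤ d j := fun j => Nat.one_le_ceil_iff.2 (div_pos hL0 (hqpos j))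
  have hL1 : ∀ j, L ≤ d j * q j := fun j => by
    have := Nat.le_ceil (L / q j)
    rwa [div_le_iff₀ (hqpos j)] at this
  have hL2 : ∀ j, d j * q j ≤ (1 + ε) * L := fun j => by
    have := (Nat.ceil_lt_add_one (div_pos hL0 (hqpos j)).le).le
    have h2 := mul_le_mul_of_nonneg_right this (hqpos j).le
    rw [add_mul, div_mul_cancel₀ _ (hqpos j).ne', one_mul] at h2
    have h3 := hLq j
    have : (d j : ℝ) * q j ≤ L + q j := h2
    linarith
  have hdκ : ∀ i j, i < j → κ * d i ≤ d j := by
    intro i j hij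
    have h1 := hqmono i j hij
    have h2 : (d i : ℝ) * q i ≤ 2 * L := (hL2 i).trans (by nlinarith)
    have h3 := hL1 j
    have h4 := hqpos j
    have h5 : (0 : ℝ) ≤ d i := Nat.cast_nonneg _
    have h6 : κ * d i * q j ≤ d j * q j := by
      have := mul_le_mul_of_nonneg_left h1 h5
      nlinarith
    exact le_of_mul_le_mul_right h6 h4
  have hSd : ((∑ j, d j : ℕ) : ℝ) * Q0 ≤ 2 * m * L := by
    push_cast
    rw [Finset.sum_mul]
    refine (Finset.sum_le_card_nsmul _ _ (2 * L) fun j _ => ?_).trans ?_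
    · have h1 := hL2 j
      have h2 : (d j : ℝ) * Q0 ≤ d j * q j := mul_le_mul_of_nonneg_left (hqQ j) (Nat.cast_nonneg _)
      nlinarith
    · simp; linarith
  set Sd : ℕ := ∑ j, d j with hSdd
  obtain ⟨P, hP0, hPI, hMH, hPN, hPs⟩ := haux m (le_max_left _ _) (le_max_right _ _) d hd1
  have hN : ∀ v, N1 (F.abv v) (bind₁ (lin fun _ => B v) P) (fun _ => (Fintype.card I : ℝ)) ≤ Real.exp (Sd * lam) := by
    intro v
    refine (N1_bind_le _ _ _ fun _ => hnpos.le).trans ?_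
    refine (N1_mono _ _ (r' := fun _ => C1) (fun _ => N1_nonneg _ _ fun _ => hnpos.le) fun p => ?_).trans ?_
    · exact (N1_lin _ _ _ fun _ => hnpos.le).trans (hC1B v p.2)
    · rw [N1_const_le _ hMH, hlam, Real.exp_nat_mul, Real.exp_log (by linarith), mul_pow]
      exact mul_le_mul_of_nonneg_left (hPN v) (by positivity)
  have hidx := vanish F A B hBA c cs g ε hcs hg hε0.le hε1 d hd1 q (fun j => (hqpos j).le) L hL0.le hL1 hL2 P hPI hMH (Sd * lam)
    hN hPs T hT S hS hTS i0 Bd θ hBd hS1 hS0 (by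
      rw [← hn]
      have h1 : F.M * (Sd * lam) ≤ L * m * u := by
        have h3 : (Sd * Q0) * (F.M * lam) ≤ 2 * m * L * (F.M * lam) := mul_le_mul_of_nonneg_right hSd (by positivity)
        have h4 : m * L * (F.M * lam * 2) ≤ m * L * (u * Q0) := mul_le_mul_of_nonneg_left hQ2 (by positivity)
        have h5 : (F.M * (Sd * lam)) * Q0 ≤ (L * m * u) * Q0 := by linarith
        exact le_of_mul_le_mul_right h5 (by linarith)
      have h2 : -g * m / n = - (4 * m * u) := by rw [hu]; field_simp
      have h3 : 2 * Bd * θ ≤ m * u := by nlinarith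
      have h4 : 2 * ε * m * n * cs * F.M + 2 * ε * m ≤ m * u := by
        have := mul_le_mul_of_nonneg_left hε (by linarith : (0 : ℝ) ≤ m)
        linarith
      rw [h2]
      have h5 : L * (-(4 * m * u) + 2 * ε * m * n * cs * F.M + 2 * ε * m + 2 * Bd * θ) ≤ L * (-(2 * m * u)) :=
        mul_le_mul_of_nonneg_left (by linarith) hL0.le
      have h6 : 0 < L * m * u := by positivity
      linarith)
  have hidx2 := pull a b i0 hab d θ P T T' hTT hTb hidx
  obtain ⟨p, hp0, hpI, hpd, hpN, hpi⟩ := restrict F a b hab d θ _ _ P hP0 hPI hMH hidx2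
  refine hroth d Sd ?_ ?_ hdκ p hp0 hpI hpd α β hcop hβ ?_ ?_
  · exact (hd1 ⟨0, hmpos⟩).trans (Finset.single_le_sum (f := d) (fun _ _ => Nat.zero_le _) (Finset.mem_univ _))
  · exact fun j => ⟨hd1 j, Finset.single_le_sum (f := d) (fun _ _ => Nat.zero_le _) (Finset.mem_univ _)⟩
  · intro j
    have h1 : Real.log (F.pr fun v => N11 (F.abv v) p) ≤ F.M * lam * Sd := by
      have h2 : (F.pr fun v => N11 (F.abv v) p) ≤ (((C1 * Cc) ^ Sd)) ^ F.M := by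
        rw [← F.pr_const]
        refine F.pr_le (fun v => N1_nonneg _ _ fun _ => zero_le_one) fun v => ?_
        refine (hpN v).trans ((hPN v).trans ?_)
        exact pow_le_pow_left₀ (by linarith) (by nlinarith) _
      have h3 : 0 < F.pr fun v => N11 (F.abv v) p := F.pr_pos fun v => N1_pos _ hp0 fun _ => one_pos
      refine (Real.log_le_log h3 h2).trans (le_of_eq ?_)
      rw [Real.log_pow, Real.log_pow]; ring
    have h2 : κ * (F.M * lam * Sd + Sd) ≤ η * L := by
      have h3 : (Sd * Q0) * (κ * (F.M * lam + 1)) ≤ 2 * m * L * (κ * (F.M * lam + 1)) :=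
        mul_le_mul_of_nonneg_right hSd (by positivity)
      have h4 := mul_le_mul_of_nonneg_left hQ3 hL0.le
      have h5 : (κ * (F.M * lam * Sd + Sd)) * Q0 ≤ (η * L) * Q0 := by linarith
      exact le_of_mul_le_mul_right h5 (by linarith)
    have h3 : η * L ≤ d j * Real.log (F.hh (α j) (β j)) := by
      have h4 := mul_le_mul_of_nonneg_left (hhh j) (Nat.cast_nonneg (d j) : (0 : ℝ) ≤ d j)
      have h5 := mul_le_mul_of_nonneg_left (hL1 j) hη.le
      linarith
    have h4 : κ * (Real.log (F.pr fun v => N11 (F.abv v) p) + Sd) ≤ κ * (F.M * lam * Sd + Sd) :=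
      mul_le_mul_of_nonneg_left (by linarith) (by linarith)
    linarith
  · have : (fun j => (α j : K) / (β j : K)) = fun j => - T' j i0 a := by
      funext j; exact (hTa j).symm
    rw [this]; exact hpi
end CaseC

end Part8

section Part9
set_option autoImplicit false
open Filter

section HThm
variable {K : Type} [Field K] [CharZero K] {I : Type} [Fintype I] [DecidableEq I]

lemma ult_const {X : Type*} [Finite X] {Y : Type*} (𝒰 : Ultrafilter Y) (f : Y → X) : ∃ a, ∀ᶠ k in (𝒰 : Filter Y), f k = a := by
  obtain ⟨a, ha⟩ := Ultrafilter.eq_pure_of_finite (𝒰.map f)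
  refine ⟨a, ?_⟩
  have : {a} ∈ (𝒰.map f) := by rw [ha]; exact Set.mem_singleton a
  exact this

lemma abv_det_le (v : AbsoluteValue K ℝ) (W : Matrix I I K) (r s : I → ℝ) (h : ∀ i j, v (W i j) ≤ r i * s j) :
    v W.det ≤ (Fintype.card I).factorial * ((∏ i, r i) * ∏ i, s i) := by
  rw [Matrix.det_apply]
  refine (v.sum_le _ _).trans ?_
  refine (Finset.sum_le_card_nsmul _ _ ((∏ i, r i) * ∏ i, s i) fun σ _ => ?_).trans ?_
  · have e1 : v (Equiv.Perm.sign σ • ∏ i, W (σ i) i) = ∏ i, v (W (σ i) i) := by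
      rcases Int.units_eq_one_or (Equiv.Perm.sign σ) with h | h
      · rw [h, one_smul, map_prod]
      · rw [h, Units.neg_smul, one_smul, v.map_neg, map_prod]
    rw [e1, ← Equiv.prod_comp σ r, ← Finset.prod_mul_distrib]
    exact Finset.prod_le_prod (fun i _ => v.nonneg _) fun i _ => h _ _
  · rw [Finset.card_univ, Fintype.card_perm, nsmul_eq_mul]

lemma adj_row (T : Matrix I I K) (i0 i : I) : T.adjugate i0 i = (T.updateCol i0 (Pi.single i 1)).det := by
  rw [← Matrix.cramer_apply, Matrix.cramer_eq_adjugate_mulVec, Matrix.mulVec_single_one]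
  rfl

lemma adj_updateCol (T : Matrix I I K) (i0 : I) (x : I → K) : (T.updateCol i0 x).adjugate i0 = T.adjugate i0 := by
  funext i
  rw [adj_row, adj_row, Matrix.updateCol_idem]

lemma PF.prim (F : PF K) (M : I → K) (hM : ∀ i, M i ∈ F.O) (h0 : M ≠ 0) : ∃ (δ : K) (M' u : I → K),
    δ ∈ F.O ∧ δ ≠ 0 ∧ (∀ i, M' i ∈ F.O) ∧ (∀ i, u i ∈ F.O) ∧ (∀ i, M i = δ * M' i) ∧ ∑ i, u i * M' i = 1 := by
  haveI := F.pid
  obtain ⟨δ, hδ⟩ := (IsPrincipalIdealRing.principal (Ideal.span (Set.range fun i => (⟨M i, hM i⟩ : F.O)))).principal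
  have h1 : ∀ i, ∃ x : F.O, (⟨M i, hM i⟩ : F.O) = δ * x := by
    intro i
    have : (⟨M i, hM i⟩ : F.O) ∈ Submodule.span F.O {δ} := by
      rw [← hδ]; exact Ideal.subset_span ⟨i, rfl⟩
    obtain ⟨x, hx⟩ := Submodule.mem_span_singleton.1 this
    exact ⟨x, by rw [← hx, smul_eq_mul, mul_comm]⟩
  choose M' hM' using h1
  have h2 : δ ∈ Ideal.span (Set.range fun i => (⟨M i, hM i⟩ : F.O)) := by
    rw [hδ]; exact Submodule.mem_span_singleton_self δ
  obtain ⟨u, hu⟩ := (Ideal.mem_span_range_iff_exists_fun).1 h2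
  have hδ0 : δ ≠ 0 := by
    rintro rfl
    refine h0 (funext fun i => ?_)
    have := congrArg (Subtype.val) (hM' i)
    simpa using this
  refine ⟨δ, fun i => M' i, fun i => u i, δ.2, fun h => hδ0 (Subtype.ext h), fun i => (M' i).2, fun i => (u i).2,
    fun i => congrArg Subtype.val (hM' i), ?_⟩
  have h3 : δ * ∑ i, u i * M' i = δ * 1 := by
    rw [mul_one, Finset.mul_sum]
    refine Eq.trans (Finset.sum_congr rfl fun i _ => ?_) hu
    rw [hM' i]; ring
  have h4 := mul_left_cancel₀ hδ0 h3
  have := congrArg Subtype.val h4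
  simpa using this

lemma PF.reduced (F : PF K) (x : K) : ∃ α β : F.O, IsCoprime α β ∧ β ≠ 0 ∧ x = (α : K) / (β : K) := by
  haveI := F.isFrac
  haveI := F.pid
  obtain ⟨a, b, h, rfl⟩ := IsFractionRing.exists_reduced_fraction (A := F.O) x
  refine ⟨a, b, h.isCoprime, nonZeroDivisors.ne_zero b.2, ?_⟩
  rw [IsFractionRing.mk'_eq_div]
  rfl

/-- local height -/
noncomputable def PF.lh (F : PF K) (x : I → K) (v : F.ι) : ℝ := ∑ i, F.abv v (x i)

lemma PF.lh_nonneg (F : PF K) (x : I → K) (v : F.ι) : 0 ≤ F.lh x v := Finset.sum_nonneg fun _ _ => (F.abv v).nonneg _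

lemma PF.lh_pos (F : PF K) {x : I → K} (hx : x ≠ 0) (v : F.ι) : 0 < F.lh x v := by
  obtain ⟨i, hi⟩ := Function.ne_iff.1 hx
  exact Finset.sum_pos' (fun _ _ => (F.abv v).nonneg _) ⟨i, Finset.mem_univ _, (F.abv v).pos hi⟩

lemma PF.le_lh (F : PF K) (x : I → K) (v : F.ι) (i : I) : F.abv v (x i) ≤ F.lh x v :=
  Finset.single_le_sum (f := fun i => F.abv v (x i)) (fun _ _ => (F.abv v).nonneg _) (Finset.mem_univ i)

lemma PF.lh_smul (F : PF K) (δ : K) (x : I → K) (v : F.ι) : F.lh (fun i => δ * x i) v = F.abv v δ * F.lh x v := by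
  simp [PF.lh, Finset.mul_sum]

/-- bound for the cofactor functional -/
lemma PF.cofactor_le (F : PF K) (A B : F.ι → Matrix I I K) (hA : ∀ v, (A v).det ≠ 0) (hB : ∀ v, B v = (A v)⁻¹) (c : F.ι → I → ℝ) (q : ℝ) (i0 : I)
    (T : Matrix I I K) (S : I → F.ι → ℝ)
    (hTS : ∀ v i' i, i ≠ i0 → F.abv v ((A v * T) i' i) ≤ S i v * Real.exp (q * c v i')) (v : F.ι) (i : I) :
    F.abv v (Matrix.vecMul (T.adjugate i0) (B v) i) * F.abv v (A v).det ≤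
      (Fintype.card I).factorial * ((∏ l ∈ Finset.univ.erase i0, S l v) * Real.exp (q * (∑ i', c v i' - c v i))) := by
  have e1 : (A v * T).adjugate i0 i = (A v).det * Matrix.vecMul (T.adjugate i0) (B v) i := by
    have : (A v).adjugate = (A v).det • B v := by
      rw [hB, Matrix.inv_def, smul_smul, Ring.mul_inverse_cancel _ (isUnit_iff_ne_zero.2 (hA v)), one_smul]
    rw [Matrix.adjugate_mul_distrib, this, Matrix.mul_smul, Matrix.smul_apply, smul_eq_mul]
    rfl
  rw [mul_comm, ← map_mul, ← e1, adj_row]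
  have h := abv_det_le (F.abv v) ((A v * T).updateCol i0 (Pi.single i 1)) (fun i' => Real.exp (q * c v i'))
    (Function.update (fun l => S l v) i0 (Real.exp (-(q * c v i)))) (fun i' l => by
      by_cases hl : l = i0
      · subst hl
        rw [Matrix.updateCol_self, Function.update_self]
        by_cases hi : i' = i
        · subst hi; rw [Pi.single_eq_same, map_one, ← Real.exp_add]; simp
        · rw [Pi.single_eq_of_ne hi, map_zero]; positivity
      · rw [Matrix.updateCol_ne hl, Function.update_of_ne hl, mul_comm]
        exact hTS v i' l hl)
  refine h.trans (le_of_eq ?_)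
  congr 1
  rw [← Real.exp_sum, ← Finset.mul_prod_erase _ _ (Finset.mem_univ i0), Function.update_self,
    Finset.prod_congr rfl fun l hl => Function.update_of_ne (Finset.ne_of_mem_erase hl) _ _, mul_sub, Real.exp_sub, Real.exp_neg, Finset.mul_sum]
  field_simp

/-- Case B of the hyperplane theorem -/
lemma caseB (F : PF K) [Nonempty I] (A : F.ι → Matrix I I K) (hA : ∀ v, (A v).det ≠ 0) (c : F.ι → I → ℝ) (g : ℝ) (hg0 : 0 < g)
    (hg : ∑ v, F.m v * ∑ i, c v i = -g) (𝒰 : Ultrafilter ℕ) (q : ℕ → ℝ) (hq : Tendsto q 𝒰 atTop) (i0 : I)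
    (T : ℕ → Matrix I I K) (hT : ∀ k i l, T k i l ∈ F.O) (hM : ∀ k, (T k).adjugate i0 ≠ 0) (S : ℕ → I → F.ι → ℝ)
    (hS : ∀ k i v, 0 < S k i v) (hTS : ∀ k v i' i, i ≠ i0 → F.abv v ((A v * T k) i' i) ≤ S k i v * Real.exp (q k * c v i'))
    (hS1 : ∀ ε > 0, ∀ i, i ≠ i0 → ∀ᶠ k in (𝒰 : Filter ℕ), F.pr (S k i) ≤ Real.exp (ε * q k))
    (δ : ℕ → K) (M' : ℕ → I → K) (hδ : ∀ k, δ k ∈ F.O) (hδ0 : ∀ k, δ k ≠ 0) (hM' : ∀ k i, M' k i ∈ F.O)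
    (hMM : ∀ k i, (T k).adjugate i0 i = δ k * M' k i)
    (hH : ∀ ε > 0, ∀ᶠ k in (𝒰 : Filter ℕ), F.pr (F.lh (M' k)) ≤ Real.exp (ε * q k)) :
    ∃ M0 : I → K, M0 ≠ 0 ∧ ∀ᶠ k in (𝒰 : Filter ℕ), ∀ l, l ≠ i0 → M0 ⬝ᵥ (fun i => T k i l) = 0 := by
  classical
  set B : F.ι → Matrix I I K := fun v => (A v)⁻¹ with hB
  have hBA : ∀ v, B v * A v = 1 := fun v => Matrix.nonsing_inv_mul _ (isUnit_iff_ne_zero.2 (hA v))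
  have hM'0 : ∀ k, M' k ≠ 0 := by
    intro k h
    exact hM k (funext fun i => by rw [hMM, h]; simp)
  set al : ℕ → F.ι → I → K := fun k v => Matrix.vecMul (M' k) (B v) with hal
  have hal0 : ∀ k v, al k v ≠ 0 := by
    intro k v h
    have h1 : Matrix.vecMul (al k v) (A v) = M' k := by
      rw [hal, Matrix.vecMul_vecMul, hBA, Matrix.vecMul_one]
    rw [h, Matrix.zero_vecMul] at h1
    exact hM'0 k h1.symm
  obtain ⟨pat, hpat⟩ := ult_const 𝒰 (fun k => fun (v : F.ι) (i : I) => al k v i ≠ 0)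
  have hpatne : ∀ v, (Finset.univ.filter fun i => pat v i).Nonempty := by
    intro v
    obtain ⟨k, hk⟩ := hpat.exists
    obtain ⟨i, hi⟩ := Function.ne_iff.1 (hal0 k v)
    refine ⟨i, Finset.mem_filter.2 ⟨Finset.mem_univ _, ?_⟩⟩
    rw [← hk]; exact hi
  have hmax : ∀ v, ∃ i, pat v i ∧ ∀ i', pat v i' → c v i' ≤ c v i := by
    intro v
    obtain ⟨i, hi, hi2⟩ := Finset.exists_max_image _ (fun i => c v i) (hpatne v)
    exact ⟨i, (Finset.mem_filter.1 hi).2, fun i' h => hi2 i' (Finset.mem_filter.2 ⟨Finset.mem_univ _, h⟩)⟩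
  choose im him himax using hmax
  obtain ⟨D, hD0, hD⟩ := F.common_den (fun p : F.ι × I × I => B p.1 p.2.1 p.2.2)
  have hDK : (D : K) ≠ 0 := by exact_mod_cast hD0
  -- constants
  obtain ⟨C1, hC1, hC1B⟩ : ∃ C1 : ℝ, 1 ≤ C1 ∧ ∀ v w i l, F.abv w ((D : K) * B v i l) ≤ C1 := by
    refine ⟨1 + ∑ p : F.ι × F.ι × I × I, F.abv p.2.1 ((D : K) * B p.1 p.2.2.1 p.2.2.2), ?_, fun v w i l => ?_⟩
    · have := Finset.sum_nonneg fun (p : F.ι × F.ι × I × I) (_ : p ∈ Finset.univ) => (F.abv p.2.1).nonneg ((D : K) * B p.1 p.2.2.1 p.2.2.2)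
      linarith
    · have := Finset.single_le_sum (f := fun p : F.ι × F.ι × I × I => F.abv p.2.1 ((D : K) * B p.1 p.2.2.1 p.2.2.2))
        (fun p _ => (F.abv p.2.1).nonneg _) (Finset.mem_univ (v, w, i, l))
      simp only at this
      linarith
  have hC10 : 0 < C1 := by linarith
  -- Liouville
  have hliou : ∀ k v i, al k v i ≠ 0 →
      (C1 * F.lh (M' k) v) ^ F.m v ≤ F.abv v ((D : K) * al k v i) ^ F.m v * (C1 ^ F.M * F.pr (F.lh (M' k))) := by
    intro k v i hi
    have hx : (D : K) * al k v i = ∑ l, M' k l * ((D : K) * B v l i) := by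
      simp only [hal, Matrix.vecMul, dotProduct, Finset.mul_sum]
      exact Finset.sum_congr rfl fun l _ => by ring
    have h1 : (D : K) * al k v i ∈ F.O := by
      rw [hx]
      exact Subring.sum_mem _ fun l _ => Subring.mul_mem _ (hM' k l) (F.R_le (hD (v, l, i)))
    have h2 := F.pr_abv h1 (mul_ne_zero hDK hi)
    have h3 : ∀ w, F.abv w ((D : K) * al k v i) ≤ C1 * F.lh (M' k) w := by
      intro w
      rw [hx, PF.lh, Finset.mul_sum]
      refine ((F.abv w).sum_le _ _).trans (Finset.sum_le_sum fun l _ => ?_)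
      rw [map_mul, mul_comm]
      exact mul_le_mul_of_nonneg_right (hC1B v w l i) ((F.abv w).nonneg _)
    have h4 : 0 < (C1 * F.lh (M' k) v) := mul_pos hC10 (F.lh_pos (hM'0 k) v)
    rw [PF.pr, ← Finset.mul_prod_erase _ _ (Finset.mem_univ v)] at h2
    have h5 : ∏ w ∈ Finset.univ.erase v, F.abv w ((D : K) * al k v i) ^ F.m w ≤ ∏ w ∈ Finset.univ.erase v, (C1 * F.lh (M' k) w) ^ F.m w :=
      Finset.prod_le_prod (fun w _ => pow_nonneg ((F.abv w).nonneg _) _) fun w _ => pow_le_pow_left₀ ((F.abv w).nonneg _) (h3 w) _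
    have h6 : C1 ^ F.M * F.pr (F.lh (M' k)) = (C1 * F.lh (M' k) v) ^ F.m v * ∏ w ∈ Finset.univ.erase v, (C1 * F.lh (M' k) w) ^ F.m w := by
      rw [Finset.mul_prod_erase Finset.univ (fun w => (C1 * F.lh (M' k) w) ^ F.m w) (Finset.mem_univ v), ← F.pr_const, ← F.pr_mul]; rfl
    rw [h6]
    have h7 : 0 ≤ F.abv v ((D : K) * al k v i) ^ F.m v := pow_nonneg ((F.abv v).nonneg _) _
    have h8 : 1 ≤ F.abv v ((D : K) * al k v i) ^ F.m v * ∏ w ∈ Finset.univ.erase v, (C1 * F.lh (M' k) w) ^ F.m w :=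
      h2.trans (mul_le_mul_of_nonneg_left h5 h7)
    have h9 := mul_le_mul_of_nonneg_left h8 (pow_nonneg h4.le (F.m v))
    linarith
  -- exponents
  set n : ℝ := (Fintype.card I : ℝ) with hn
  have hn1 : 1 ≤ n := by rw [hn]; exact_mod_cast Fintype.card_pos
  set e0 : ℝ := ∑ v, F.m v * c v (im v) with he0
  have hexp : e0 ≤ -(g / 2) := by
    by_contra hcon
    push Not at hcon
    set N : ℕ := Fintype.card F.ι with hNdef
    obtain ⟨ε, hε0, hε⟩ : ∃ ε : ℝ, 0 < ε ∧ ε * (N + n) ≤ g / 4 := by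
      refine ⟨g / 4 / (N + n), by positivity, ?_⟩
      rw [div_mul_cancel₀]; positivity
    -- constant
    set C2 : ℝ := F.pr (fun v => F.abv v (D : K)) * (C1 ^ F.M) ^ N * F.pr (fun v => (Fintype.card I).factorial / F.abv v (A v).det) with hC2
    have hev : ∀ᶠ k in (𝒰 : Filter ℕ), 1 ≤ C2 * Real.exp (-(g / 4) * q k) := by
      have hSall : ∀ᶠ k in (𝒰 : Filter ℕ), ∀ i, i ≠ i0 → F.pr (S k i) ≤ Real.exp (ε * q k) := by
        rw [Filter.eventually_all]
        intro i
        by_cases h : i = i0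
        · exact Filter.Eventually.of_forall fun k h' => absurd h h'
        · filter_upwards [hS1 ε hε0 i h] with k hk _ using hk
      filter_upwards [hpat, hSall, hH ε hε0, hq.eventually_ge_atTop 0] with k hk hkS hkH hkq
      have hal1 : ∀ v, al k v (im v) ≠ 0 := by
        intro v
        have := him v
        rw [← hk] at this
        exact this
      -- product of Liouville
      have h1 : F.pr (fun v => C1 * F.lh (M' k) v) ≤ F.pr (fun v => F.abv v ((D : K) * al k v (im v))) * (C1 ^ F.M * F.pr (F.lh (M' k))) ^ N := by
        rw [PF.pr, PF.pr, hNdef, ← Finset.card_univ, ← Finset.prod_const, ← Finset.prod_mul_distrib]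
        exact Finset.prod_le_prod (fun v _ => pow_nonneg (mul_nonneg hC10.le (F.lh_nonneg _ _)) _) fun v _ => hliou k v _ (hal1 v)
      have h2 : 1 ≤ F.pr (fun v => C1 * F.lh (M' k) v) := by
        obtain ⟨i, hi⟩ := Function.ne_iff.1 (hM'0 k)
        refine (F.pr_abv (hM' k i) hi).trans (F.pr_le (fun v => (F.abv v).nonneg _) fun v => ?_)
        have := F.le_lh (M' k) v i
        have h0 := F.lh_nonneg (M' k) v
        nlinarith
      have h3 : F.pr (F.lh (M' k)) ^ N ≤ Real.exp (N * (ε * q k)) := by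
        rw [Real.exp_nat_mul]
        exact pow_le_pow_left₀ (F.pr_nonneg fun v => F.lh_nonneg _ _) hkH _
      -- cofactors
      have h4 : F.pr (fun v => F.abv v (al k v (im v))) ≤
          F.pr (fun v => (Fintype.card I).factorial / F.abv v (A v).det) *
          (Real.exp (n * (ε * q k)) * Real.exp (q k * (-g - e0))) := by
        have h5 : ∀ v, F.abv v (δ k) * F.abv v (al k v (im v)) ≤ ((Fintype.card I).factorial / F.abv v (A v).det) *
            ((∏ l ∈ Finset.univ.erase i0, S k l v) * Real.exp (q k * (∑ i', c v i' - c v (im v)))) := by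
          intro v
          have h6 := F.cofactor_le A B hA (fun v => rfl) c (q k) i0 (T k) (S k) (hTS k) v (im v)
          have h7 : Matrix.vecMul ((T k).adjugate i0) (B v) (im v) = δ k * al k v (im v) := by
            have : (T k).adjugate i0 = δ k • M' k := funext fun i => hMM k i
            rw [this, Matrix.smul_vecMul]; rfl
          have h8 : 0 < F.abv v (A v).det := (F.abv v).pos (hA v)
          rw [h7, map_mul, ← le_div_iff₀ h8] at h6
          refine h6.trans (le_of_eq ?_)
          ring
        have h6 : F.pr (fun v => F.abv v (al k v (im v))) ≤ F.pr (fun v => F.abv v (δ k) * F.abv v (al k v (im v))) := by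
          rw [F.pr_mul]
          have := F.pr_abv (hδ k) (hδ0 k)
          have h0 := F.pr_nonneg (a := fun v => F.abv v (al k v (im v))) fun v => (F.abv v).nonneg _
          nlinarith
        refine h6.trans ((F.pr_le (fun v => mul_nonneg ((F.abv v).nonneg _) ((F.abv v).nonneg _)) h5).trans ?_)
        rw [F.pr_mul, F.pr_mul, F.pr_prod, F.pr_exp]
        refine mul_le_mul_of_nonneg_left ?_ (F.pr_nonneg fun v => div_nonneg (Nat.cast_nonneg _) ((F.abv v).nonneg _))
        refine mul_le_mul ?_ (le_of_eq ?_) (Real.exp_nonneg _) (Real.exp_nonneg _)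
        · refine (Finset.prod_le_prod (fun l _ => F.pr_nonneg fun v => (hS k l v).le) fun l hl => hkS l (Finset.ne_of_mem_erase hl)).trans ?_
          rw [Finset.prod_const, ← Real.exp_nat_mul]
          refine Real.exp_le_exp.2 (mul_le_mul_of_nonneg_right ?_ (mul_nonneg hε0.le hkq))
          rw [hn]
          exact_mod_cast (Finset.card_le_univ _)
        · congr 1
          rw [he0, ← hg, ← Finset.sum_sub_distrib, Finset.mul_sum]
          exact Finset.sum_congr rfl fun v _ => by ring
      have h5 : F.pr (fun v => F.abv v ((D : K) * al k v (im v))) = F.pr (fun v => F.abv v (D : K)) * F.pr (fun v => F.abv v (al k v (im v))) := by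
        rw [← F.pr_mul]; simp only [map_mul]
      have hDn : 0 ≤ F.pr (fun v => F.abv v (D : K)) := F.pr_nonneg fun v => (F.abv v).nonneg _
      have h6 : 1 ≤ (F.pr (fun v => F.abv v (D : K)) * (F.pr (fun v => (Fintype.card I).factorial / F.abv v (A v).det) *
          (Real.exp (n * (ε * q k)) * Real.exp (q k * (-g - e0))))) * ((C1 ^ F.M) ^ N * Real.exp (N * (ε * q k))) := by
        refine h2.trans (h1.trans ?_)
        rw [h5, mul_pow]
        refine mul_le_mul ?_ ?_ (by have := F.pr_nonneg fun v => F.lh_nonneg (M' k) v; positivity) ?_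
        · exact mul_le_mul_of_nonneg_left h4 hDn
        · exact mul_le_mul_of_nonneg_left h3 (by positivity)
        · exact mul_nonneg hDn (mul_nonneg (F.pr_nonneg fun v => div_nonneg (Nat.cast_nonneg _) ((F.abv v).nonneg _)) (by positivity))
      have h7 : Real.exp (n * (ε * q k)) * Real.exp (q k * (-g - e0)) * Real.exp (N * (ε * q k)) ≤ Real.exp (-(g / 4) * q k) := by
        rw [← Real.exp_add, ← Real.exp_add]
        refine Real.exp_le_exp.2 ?_
        have h8 : ε * (N + n) * q k ≤ g / 4 * q k := mul_le_mul_of_nonneg_right hε hkq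
        have h9 : (-g - e0) * q k ≤ -(g / 2) * q k := mul_le_mul_of_nonneg_right (by linarith) hkq
        linarith
      have hC2n : 0 ≤ C2 := by
        rw [hC2]
        refine mul_nonneg (mul_nonneg hDn (by positivity)) (F.pr_nonneg fun v => div_nonneg (Nat.cast_nonneg _) ((F.abv v).nonneg _))
      refine h6.trans (le_trans (le_of_eq ?_) (mul_le_mul_of_nonneg_left h7 hC2n))
      rw [hC2]; ring
    have hlim : Tendsto (fun k => C2 * Real.exp (-(g / 4) * q k)) 𝒰 (nhds (C2 * 0)) := by
      refine Tendsto.const_mul _ (Real.tendsto_exp_atBot.comp ?_)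
      exact hq.const_mul_atTop_of_neg (by linarith)
    rw [mul_zero] at hlim
    have := ge_of_tendsto hlim hev
    linarith
  -- now conclude
  obtain ⟨k0, hk0⟩ := hpat.exists
  refine ⟨M' k0, hM'0 k0, ?_⟩
  rw [Filter.eventually_all]
  intro l
  by_cases hl : l = i0
  · exact Filter.Eventually.of_forall fun k h' => absurd hl h'
  set C3 : ℝ := 1 + ∑ v, ∑ i, F.abv v (al k0 v i) with hC3
  have hC3le : ∀ v, ∑ i, F.abv v (al k0 v i) ≤ C3 := by
    intro v
    have := Finset.single_le_sum (f := fun v => ∑ i, F.abv v (al k0 v i)) (fun v _ => Finset.sum_nonneg fun i _ => (F.abv v).nonneg _) (Finset.mem_univ v)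
    linarith
  have hlim : Tendsto (fun k => C3 ^ F.M * Real.exp (-(g / 4) * q k)) 𝒰 (nhds (C3 ^ F.M * 0)) := by
    refine Tendsto.const_mul _ (Real.tendsto_exp_atBot.comp ?_)
    exact hq.const_mul_atTop_of_neg (by linarith)
  rw [mul_zero] at hlim
  filter_upwards [hS1 (g / 4) (by positivity) l hl, hlim.eventually_lt_const one_pos, hq.eventually_ge_atTop 0] with k hkS hk1 hkq _
  refine F.eq_zero_of_pr ?_ ?_
  · exact Subring.sum_mem _ fun i _ => Subring.mul_mem _ (hM' k0 i) (hT k i l)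
  have h1 : ∀ v, F.abv v (M' k0 ⬝ᵥ fun i => T k i l) ≤ C3 * (S k l v * Real.exp (q k * c v (im v))) := by
    intro v
    have h2 : (M' k0 ⬝ᵥ fun i => T k i l) = al k0 v ⬝ᵥ (fun i => (A v * T k) i l) := by
      have : (fun i => (A v * T k) i l) = (A v).mulVec (fun i => T k i l) := rfl
      rw [this, Matrix.dotProduct_mulVec, hal, Matrix.vecMul_vecMul, hBA, Matrix.vecMul_one]
    rw [h2]
    refine ((F.abv v).sum_le _ _).trans ?_
    refine le_trans (Finset.sum_le_sum (g := fun i => F.abv v (al k0 v i) * (S k l v * Real.exp (q k * c v (im v)))) fun i _ => ?_) ?_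
    · rw [map_mul]
      by_cases hi : al k0 v i = 0
      · rw [hi]; simp
      · refine mul_le_mul_of_nonneg_left ((hTS k v i l hl).trans ?_) ((F.abv v).nonneg _)
        refine mul_le_mul_of_nonneg_left (Real.exp_le_exp.2 (mul_le_mul_of_nonneg_left ?_ hkq)) (hS _ _ _).le
        refine himax v i ?_
        rw [← hk0]; exact hi
    · rw [← Finset.sum_mul]
      exact mul_le_mul_of_nonneg_right (hC3le v) (mul_nonneg (hS _ _ _).le (Real.exp_nonneg _))
  refine (F.pr_le (fun v => (F.abv v).nonneg _) h1).trans_lt ?_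
  rw [F.pr_mul, F.pr_mul, F.pr_const, F.pr_exp]
  refine lt_of_le_of_lt ?_ hk1
  refine mul_le_mul_of_nonneg_left ?_ (pow_nonneg ?_ _)
  · refine (mul_le_mul_of_nonneg_right hkS (Real.exp_nonneg _)).trans ?_
    rw [← Real.exp_add]
    refine Real.exp_le_exp.2 ?_
    have : ∑ v, (F.m v : ℝ) * (q k * c v (im v)) = e0 * q k := by
      rw [he0, Finset.sum_mul]
      exact Finset.sum_congr rfl fun v _ => by ring
    rw [this]
    have := mul_le_mul_of_nonneg_right hexp hkq
    linarith
  · have := Finset.sum_nonneg fun v (_ : v ∈ Finset.univ) => Finset.sum_nonneg fun i (_ : i ∈ Finset.univ) => (F.abv v).nonneg (al k0 v i)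
    linarith
end HThm

end Part9

section Part10
set_option autoImplicit false
open Filter

section HThm
variable {K : Type} [Field K] [CharZero K] {I : Type} [Fintype I] [DecidableEq I]

lemma PF.ht_le (F : PF K) (M' u : I → K) (hM' : ∀ i, M' i ∈ F.O) (hu : ∀ i, u i ∈ F.O) (h1 : ∑ i, u i * M' i = 1)
    (b : I) (hb : M' b ≠ 0) (α β : I → F.O) (hβ : ∀ a, β a ≠ 0) (hαβ : ∀ a, - (M' a / M' b) = (α a : K) / (β a : K)) :
    F.pr (F.lh M') ≤ (Fintype.card I : ℝ) ^ F.M * ∏ a ∈ Finset.univ.erase b, F.hh (α a) (β a) := by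
  set N : K := ∏ a ∈ Finset.univ.erase b, (β a : K) with hN
  have hβK : ∀ a, (β a : K) ≠ 0 := fun a h => hβ a (Subtype.ext h)
  have hN0 : N ≠ 0 := Finset.prod_ne_zero_iff.2 fun a _ => hβK a
  set δ := N / M' b with hδ
  have hδ0 : δ ≠ 0 := div_ne_zero hN0 hb
  have hX : ∀ a, δ * M' a ∈ F.O ∧ ∀ v, F.abv v (δ * M' a) ≤ ∏ a ∈ Finset.univ.erase b, max (F.abv v (α a)) (F.abv v (β a)) := by
    intro a
    by_cases hab : a = b
    · subst hab
      have : δ * M' a = N := by rw [hδ]; field_simp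
      rw [this]
      refine ⟨Subring.prod_mem _ fun a _ => (β a).2, fun v => ?_⟩
      rw [hN, map_prod]
      exact Finset.prod_le_prod (fun _ _ => (F.abv v).nonneg _) fun _ _ => le_max_right _ _
    · have hmem : a ∈ Finset.univ.erase b := Finset.mem_erase.2 ⟨hab, Finset.mem_univ _⟩
      have : δ * M' a = - (α a : K) * ∏ a' ∈ (Finset.univ.erase b).erase a, (β a' : K) := by
        have h2 : N = β a * ∏ a' ∈ (Finset.univ.erase b).erase a, (β a' : K) := (Finset.mul_prod_erase _ _ hmem).symm
        have h3 : M' a / M' b = - ((α a : K) / β a) := by rw [← hαβ a, neg_neg]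
        have h4 : δ * M' a = N * (M' a / M' b) := by rw [hδ]; ring
        rw [h4, h3, h2]
        have := hβK a
        field_simp
      rw [this]
      refine ⟨Subring.mul_mem _ (Subring.neg_mem _ (α a).2) (Subring.prod_mem _ fun a _ => (β a).2), fun v => ?_⟩
      rw [map_mul, (F.abv v).map_neg, map_prod, ← Finset.mul_prod_erase _ _ hmem]
      refine mul_le_mul (le_max_left _ _) ?_ (Finset.prod_nonneg fun _ _ => (F.abv v).nonneg _) (le_max_of_le_left ((F.abv v).nonneg _))
      exact Finset.prod_le_prod (fun _ _ => (F.abv v).nonneg _) fun _ _ => le_max_right _ _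
  have hδO : δ ∈ F.O := by
    have this : ∑ i, u i * (δ * M' i) = δ := by
      have e : ∑ i, u i * (δ * M' i) = δ * ∑ i, u i * M' i := by
        rw [Finset.mul_sum]; exact Finset.sum_congr rfl fun i _ => by ring
      rw [e, h1, mul_one]
    have h3 : ∑ i, u i * (δ * M' i) ∈ F.O := Subring.sum_mem _ fun i _ => Subring.mul_mem _ (hu i) (hX i).1
    rwa [this] at h3
  have h2 : F.pr (F.lh M') ≤ F.pr (F.lh fun i => δ * M' i) := by
    have : (F.lh fun i => δ * M' i) = fun v => F.abv v δ * F.lh M' v := funext fun v => F.lh_smul _ _ v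
    rw [this, F.pr_mul]
    have h3 := F.pr_abv hδO hδ0
    have h0 := F.pr_nonneg fun v => F.lh_nonneg M' v
    have : F.pr (fun v => F.lh M' v) = F.pr (F.lh M') := rfl
    rw [this] at *
    nlinarith
  refine h2.trans ?_
  have e : ∏ a ∈ Finset.univ.erase b, F.hh (α a) (β a) = F.pr (fun v => ∏ a ∈ Finset.univ.erase b, max (F.abv v (α a)) (F.abv v (β a))) := by
    rw [F.pr_prod]; rfl
  rw [e, ← F.pr_const, ← F.pr_mul]
  refine F.pr_le (fun v => F.lh_nonneg _ _) fun v => ?_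
  refine (Finset.sum_le_card_nsmul _ _ _ fun a _ => (hX a).2 v).trans ?_
  simp

lemma PF.one_le_hh (F : PF K) (α β : F.O) (hβ : β ≠ 0) : 1 ≤ F.hh (α : K) (β : K) :=
  (F.pr_abv β.2 fun h => hβ (Subtype.ext h)).trans (F.pr_le (fun v => (F.abv v).nonneg _) fun v => le_max_right _ _)

/-- The hyperplane theorem -/
lemma HT (F : PF K) [Nonempty I] (A : F.ι → Matrix I I K) (hA : ∀ v, (A v).det ≠ 0) (c : F.ι → I → ℝ)
    (hg : ∑ v, F.m v * ∑ i, c v i < 0) (𝒰 : Ultrafilter ℕ) (q : ℕ → ℝ) (hq : Tendsto q 𝒰 atTop) (i0 : I)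
    (T : ℕ → Matrix I I K) (hT : ∀ k i l, T k i l ∈ F.O) (hM : ∀ k, (T k).adjugate i0 ≠ 0) (S : ℕ → I → F.ι → ℝ)
    (hS : ∀ k i v, 0 < S k i v) (hTS : ∀ k v i' i, i ≠ i0 → F.abv v ((A v * T k) i' i) ≤ S k i v * Real.exp (q k * c v i'))
    (hS1 : ∀ ε > 0, ∀ i, i ≠ i0 → ∀ᶠ k in (𝒰 : Filter ℕ), F.pr (S k i) ≤ Real.exp (ε * q k)) :
    ∃ M0 : I → K, M0 ≠ 0 ∧ ∀ᶠ k in (𝒰 : Filter ℕ), ∀ l, l ≠ i0 → M0 ⬝ᵥ (fun i => T k i l) = 0 := by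
  classical
  obtain ⟨g, hgg⟩ : ∃ g, g = - ∑ v, F.m v * ∑ i, c v i := ⟨_, rfl⟩
  have hg0 : 0 < g := by linarith
  have hg : ∑ v, F.m v * ∑ i, c v i = -g := by linarith
  have hMO : ∀ k i, (T k).adjugate i0 i ∈ F.O := by
    intro k i
    rw [adj_row, Matrix.det_apply]
    refine Subring.sum_mem _ fun σ _ => ?_
    have h1 : ∏ x, ((T k).updateCol i0 (Pi.single i 1)) (σ x) x ∈ F.O := by
      refine Subring.prod_mem _ fun x _ => ?_
      by_cases hx : x = i0
      · subst hx
        rw [Matrix.updateCol_self, Pi.single_apply]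
        split_ifs
        · exact F.O.one_mem
        · exact F.O.zero_mem
      · rw [Matrix.updateCol_ne hx]; exact hT _ _ _
    rcases Int.units_eq_one_or (Equiv.Perm.sign σ) with h | h
    · rw [h, one_smul]; exact h1
    · rw [h, Units.neg_smul, one_smul]; exact F.O.neg_mem h1
  choose δ M' u hδ hδ0 hM' hu hMM h1 using fun k => F.prim _ (hMO k) (hM k)
  by_cases hH : ∀ ε > 0, ∀ᶠ k in (𝒰 : Filter ℕ), F.pr (F.lh (M' k)) ≤ Real.exp (ε * q k)
  · exact caseB F A hA c g hg0 hg 𝒰 q hq i0 T hT hM S hS hTS hS1 δ M' hδ hδ0 hM' hMM hH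
  exfalso
  push Not at hH
  obtain ⟨η, hη, hH⟩ := hH
  have hH : ∀ᶠ k in (𝒰 : Filter ℕ), Real.exp (η * q k) < F.pr (F.lh (M' k)) := by
    exact hH
  have hM'0 : ∀ k, ∃ b, M' k b ≠ 0 := by
    intro k
    by_contra h
    push Not at h
    exact hM k (funext fun i => by rw [hMM, h]; simp)
  choose bb hbb using hM'0
  obtain ⟨b, hb⟩ := ult_const 𝒰 bb
  choose α β hcop hβ hαβ using fun k a => F.reduced (- (M' k a / M' k (bb k)))
  set n : ℝ := (Fintype.card I : ℝ) with hn
  have hn1 : 1 ≤ n := by rw [hn]; exact_mod_cast Fintype.card_pos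
  set η' : ℝ := η / (2 * n) with hη'
  have hη'0 : 0 < η' := by positivity
  have hmain : ∀ᶠ k in (𝒰 : Filter ℕ), ∃ a, a ≠ b ∧ η' * q k ≤ Real.log (F.hh (α k a) (β k a)) := by
    filter_upwards [hH, hb, hq.eventually_gt_atTop 0, hq.eventually_ge_atTop (2 * (F.M * Real.log n) / η)] with k hk hkb hkq hkq2
    by_contra hcon
    push Not at hcon
    have h2 := F.ht_le (M' k) (u k) (hM' k) (hu k) (h1 k) (bb k) (hbb k) (α k) (β k) (hβ k) (hαβ k)
    rw [hkb] at h2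
    have h3 := hk.trans_le h2
    have hpos : ∀ a, 0 < F.hh (α k a) (β k a) := fun a => one_pos.trans_le (F.one_le_hh _ _ (hβ k a))
    have h4 := Real.log_lt_log (Real.exp_pos _) h3
    rw [Real.log_exp, Real.log_mul (by positivity) (Finset.prod_ne_zero_iff.2 fun a _ => (hpos a).ne'), Real.log_pow,
      Real.log_prod (fun a _ => (hpos a).ne')] at h4
    have h5 : ∑ a ∈ Finset.univ.erase b, Real.log (F.hh (α k a) (β k a)) ≤ n * (η' * q k) := by
      refine (Finset.sum_le_card_nsmul _ _ (η' * q k) fun a ha => (hcon a (Finset.ne_of_mem_erase ha)).le).trans ?_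
      rw [nsmul_eq_mul]
      refine mul_le_mul_of_nonneg_right ?_ (by positivity)
      rw [hn]
      exact_mod_cast (Finset.card_le_univ _)
    have h6 : n * (η' * q k) = η / 2 * q k := by rw [hη']; field_simp
    rw [div_le_iff₀ hη] at hkq2
    rw [← hn] at h4
    linarith
  have hmain2 : ∃ a, a ≠ b ∧ ∀ᶠ k in (𝒰 : Filter ℕ), η' * q k ≤ Real.log (F.hh (α k a) (β k a)) := by
    choose aa haa using fun k => Classical.em (∃ a, a ≠ b ∧ η' * q k ≤ Real.log (F.hh (α k a) (β k a))) |>.elim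
      (fun h => (⟨h.choose, fun _ => h.choose_spec⟩ : ∃ a, (∃ a, a ≠ b ∧ η' * q k ≤ Real.log (F.hh (α k a) (β k a))) → (a ≠ b ∧ η' * q k ≤ Real.log (F.hh (α k a) (β k a)))))
      (fun h => ⟨b, fun h' => absurd h' h⟩)
    obtain ⟨a, ha⟩ := ult_const 𝒰 aa
    have h2 : ∀ᶠ k in (𝒰 : Filter ℕ), a ≠ b ∧ η' * q k ≤ Real.log (F.hh (α k a) (β k a)) := by
      filter_upwards [hmain, ha] with k hk hka
      rw [← hka]; exact haa k hk
    obtain ⟨k, hk⟩ := h2.exists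
    exact ⟨a, hk.1, h2.mono fun k hk => hk.2⟩
  obtain ⟨a, hab, hmain⟩ := hmain2
  obtain ⟨cs, hcs⟩ : ∃ cs : ℝ, ∀ v i, |c v i| ≤ cs := by
    refine ⟨∑ v, ∑ i, |c v i|, fun v i => ?_⟩
    exact (Finset.single_le_sum (f := fun i => |c v i|) (fun _ _ => abs_nonneg _) (Finset.mem_univ i)).trans
      (Finset.single_le_sum (f := fun v => ∑ i, |c v i|) (fun _ _ => Finset.sum_nonneg fun _ _ => abs_nonneg _) (Finset.mem_univ v))
  have hcs0 : 0 ≤ cs := (abs_nonneg _).trans (hcs F.v0 (Classical.arbitrary I))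
  set CA : ℝ := 1 + ∑ v, ∑ i, F.abv v (A v i b) with hCA
  have hsn : ∀ v, 0 ≤ ∑ i, F.abv v (A v i b) := fun v => Finset.sum_nonneg fun i _ => (F.abv v).nonneg _
  have hCA1 : 1 ≤ CA := by
    have := Finset.sum_nonneg fun v (_ : v ∈ Finset.univ) => hsn v
    linarith
  have hCAle : ∀ v i, F.abv v (A v i b) ≤ CA := by
    intro v i
    have := (Finset.single_le_sum (f := fun i => F.abv v (A v i b)) (fun i _ => (F.abv v).nonneg _) (Finset.mem_univ i)).trans
      (Finset.single_le_sum (f := fun v => ∑ i, F.abv v (A v i b)) (fun v _ => hsn v) (Finset.mem_univ v))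
    linarith
  refine caseC F A hA c g hg0 hg a b i0 hab (F.M * cs + 1) η' (by positivity) hη'0 fun ε hε q0 => ?_
  have hSall : ∀ᶠ k in (𝒰 : Filter ℕ), ∀ i, i ≠ i0 → F.pr (S k i) ≤ Real.exp (ε * q k) := by
    rw [Filter.eventually_all]
    intro i
    by_cases h : i = i0
    · exact Filter.Eventually.of_forall fun k h' => absurd h h'
    · filter_upwards [hS1 ε hε i h] with k hk _ using hk
  obtain ⟨k, hkm, hkS, hkb, hk0, hk1, hk2⟩ := (hmain.and (hSall.and (hb.and ((hq.eventually_ge_atTop q0).and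
    ((hq.eventually_ge_atTop 0).and (hq.eventually_ge_atTop (F.M * Real.log CA))))))).exists
  refine ⟨q k, hk0, ?_⟩
  set T1 := (T k).updateCol i0 (Pi.single b 1) with hT1
  have hMb : M' k b ≠ 0 := hkb ▸ hbb k
  have hdet : T1.det = δ k * M' k b := by rw [hT1, ← adj_row, hMM]
  have hdet0 : T1.det ≠ 0 := by rw [hdet]; exact mul_ne_zero (hδ0 k) hMb
  have hT1' : ∀ i, T1⁻¹ i0 i = M' k i / M' k b := by
    intro i
    rw [Matrix.inv_def, Matrix.smul_apply, hT1, adj_updateCol, ← hT1, hdet, hMM, Ring.inverse_eq_inv', smul_eq_mul]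
    have := hδ0 k
    field_simp
  refine ⟨T1, T1⁻¹, Function.update (S k) i0 (fun _ => CA * Real.exp (cs * q k)), α k a, β k a, ?_, Matrix.mul_nonsing_inv _ (isUnit_iff_ne_zero.2 hdet0),
    ?_, ?_, ?_, ?_, ?_, hcop k a, hβ k a, ?_, hkm⟩
  · intro i l
    by_cases hl : l = i0
    · subst hl
      rw [hT1, Matrix.updateCol_self, Pi.single_apply]
      split_ifs
      · exact F.O.one_mem
      · exact F.O.zero_mem
    · rw [hT1, Matrix.updateCol_ne hl]; exact hT _ _ _
  · intro i v
    by_cases hi : i = i0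
    · subst hi; rw [Function.update_self]; positivity
    · rw [Function.update_of_ne hi]; exact hS _ _ _
  · intro v i' i
    by_cases hi : i = i0
    · subst hi
      rw [Function.update_self]
      have : (A v * T1) i' i = A v i' b := by
        rw [Matrix.mul_apply, Finset.sum_eq_single b]
        · simp [hT1]
        · intro l _ hl
          simp [hT1, hl]
        · simp
      rw [this, mul_assoc, ← Real.exp_add]
      have h2 : 1 ≤ Real.exp (cs * q k + q k * c v i') := by
        rw [Real.one_le_exp_iff]
        have h3 := neg_le_of_abs_le (hcs v i')
        nlinarith
      have := hCAle v i'
      nlinarith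
    · rw [Function.update_of_ne hi]
      have : (A v * T1) i' i = (A v * T k) i' i := by
        rw [Matrix.mul_apply, Matrix.mul_apply]
        refine Finset.sum_congr rfl fun l _ => ?_
        rw [hT1, Matrix.updateCol_ne hi]
      rw [this]; exact hTS k v i' i hi
  · intro i hi
    rw [Function.update_of_ne hi]; exact hkS i hi
  · rw [Function.update_self, F.pr_const, mul_pow, ← Real.exp_nat_mul]
    have : CA ^ F.M = Real.exp (F.M * Real.log CA) := by rw [Real.exp_nat_mul, Real.exp_log (by linarith)]
    rw [this, ← Real.exp_add]
    refine Real.exp_le_exp.2 ?_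
    linarith
  · rw [hT1']; exact div_self hMb
  · rw [hT1', ← hkb]; exact hαβ k a
end HThm

end Part10

section Part11
set_option autoImplicit false
open Filter

section Dav
variable {K : Type} [Field K] {n : ℕ} [NeZero n]

lemma dav_rel (W : Matrix (Fin n) (Fin n) K) (i : ℕ) (hi : i < n) (J : Finset (Fin n)) (hJ : J.card = i + 1) :
    ∃ a : Fin n → K, (∃ l ∈ J, a l ≠ 0) ∧ ∀ y : Fin n → K, (∀ l : Fin n, i ≤ l → y l = 0) → ∑ l ∈ J, a l * W.mulVec y l = 0 := by
  let B : Matrix (Fin i) J K := fun l' l => W l (Fin.castLE hi.le l')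
  have hlt : Fintype.card (Fin i) < Fintype.card J := by simp [hJ]
  obtain ⟨b, hb0, hb⟩ : ∃ b : J → K, b ≠ 0 ∧ B.mulVec b = 0 := by
    have h : LinearMap.ker B.mulVecLin ≠ ⊥ := LinearMap.ker_ne_bot_of_finrank_lt (by simpa using hlt)
    obtain ⟨b, hb, hb0⟩ := (Submodule.ne_bot_iff _).1 h
    exact ⟨b, hb0, by simpa using hb⟩
  refine ⟨fun l => if h : l ∈ J then b ⟨l, h⟩ else 0, ?_, fun y hy => ?_⟩
  · obtain ⟨l, hl⟩ := Function.ne_iff.1 hb0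
    exact ⟨l, l.2, by simpa using hl⟩
  · have e1 : ∑ l ∈ J, (if h : l ∈ J then b ⟨l, h⟩ else 0) * W.mulVec y l = ∑ l : J, b l * W.mulVec y l := by
      rw [← Finset.sum_coe_sort]
      exact Finset.sum_congr rfl fun l _ => by simp
    rw [e1]
    have e2 : ∀ l : J, b l * W.mulVec y l = ∑ l', y l' * (W l l' * b l) := by
      intro l
      rw [Matrix.mulVec, dotProduct, Finset.mul_sum]
      exact Finset.sum_congr rfl fun _ _ => by ring
    rw [Finset.sum_congr rfl fun l _ => e2 l, Finset.sum_comm]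
    refine Finset.sum_eq_zero fun l' _ => ?_
    rw [← Finset.mul_sum]
    by_cases h : i ≤ l'
    · rw [hy l' h, zero_mul]
    · have := congrFun hb ⟨l', not_le.1 h⟩
      rw [Matrix.mulVec, dotProduct] at this
      have e3 : ∑ l : J, W l l' * b l = 0 := this
      rw [e3, mul_zero]

lemma dav_aux (v : AbsoluteValue K ℝ) (W : Matrix (Fin n) (Fin n) K) (w : Fin n → ℝ) (hw : ∀ l, 0 < w l) :
    ∀ i ≤ n, ∀ J : Finset (Fin n), J.card = i → ∃ π : ℕ → Fin n, J = (Finset.range i).image π ∧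
      ∀ i' ≤ i, ∀ y : Fin n → K, (∀ l : Fin n, i' ≤ l → y l = 0) →
      ∑ l ∈ J, w l * v (W.mulVec y l) ≤ 2 ^ i * ∑ l ∈ Finset.range i', w (π l) * v (W.mulVec y (π l)) := by
  have hnn : ∀ y l, 0 ≤ w l * v (W.mulVec y l) := fun y l => mul_nonneg (hw l).le (v.nonneg _)
  intro i
  induction i with
  | zero =>
    intro _ J hJ
    rw [Finset.card_eq_zero] at hJ
    subst hJ
    refine ⟨fun _ => 0, by simp, fun i' hi' y _ => ?_⟩
    obtain rfl : i' = 0 := by omega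
    simp
  | succ i ih =>
    intro hi J hJ
    obtain ⟨a, ⟨l1, hl1, ha1⟩, ha⟩ := dav_rel W i hi J hJ
    obtain ⟨s, hs, hmax⟩ := J.exists_max_image (fun l => v (a l) / w l) ⟨l1, hl1⟩
    have has : 0 < v (a s) := by
      have h1 : 0 < v (a l1) / w l1 := div_pos (v.pos ha1) (hw _)
      have h2 := h1.trans_le (hmax l1 hl1)
      by_contra h
      have : v (a s) = 0 := le_antisymm (not_lt.1 h) (v.nonneg _)
      rw [this, zero_div] at h2
      exact lt_irrefl _ h2
    obtain ⟨π, hπ, hπ2⟩ := ih (by omega) (J.erase s) (by rw [Finset.card_erase_of_mem hs, hJ]; rfl)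
    have hstep : ∀ y : Fin n → K, (∀ l : Fin n, i ≤ l → y l = 0) →
        ∑ l ∈ J, w l * v (W.mulVec y l) ≤ 2 * ∑ l ∈ J.erase s, w l * v (W.mulVec y l) := by
      intro y hy
      rw [← Finset.add_sum_erase _ _ hs, two_mul]
      refine add_le_add ?_ le_rfl
      have h1 := ha y hy
      rw [← Finset.add_sum_erase _ _ hs] at h1
      have h2 : v (a s) * v (W.mulVec y s) ≤ ∑ l ∈ J.erase s, v (a l) * v (W.mulVec y l) := by
        rw [← map_mul, eq_neg_of_add_eq_zero_left h1, v.map_neg]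
        refine (v.sum_le _ _).trans (le_of_eq ?_)
        exact Finset.sum_congr rfl fun l _ => map_mul _ _ _
      have h3 : w s * ∑ l ∈ J.erase s, v (a l) * v (W.mulVec y l) ≤ v (a s) * ∑ l ∈ J.erase s, w l * v (W.mulVec y l) := by
        rw [Finset.mul_sum, Finset.mul_sum]
        refine Finset.sum_le_sum fun l hl => ?_
        have h4 := hmax l (Finset.mem_of_mem_erase hl)
        rw [div_le_div_iff₀ (hw _) (hw _)] at h4
        have h5 := mul_le_mul_of_nonneg_right h4 (v.nonneg (W.mulVec y l))
        linarith
      have h6 := mul_le_mul_of_nonneg_left h2 (hw s).le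
      have h7 : v (a s) * (w s * v (W.mulVec y s)) ≤ v (a s) * ∑ l ∈ J.erase s, w l * v (W.mulVec y l) := by linarith
      exact le_of_mul_le_mul_left h7 has
    have hup : ∀ l < i, Function.update π i s l = π l := fun l hl => Function.update_of_ne hl.ne _ _
    have himg : (Finset.range i).image (Function.update π i s) = (Finset.range i).image π :=
      Finset.image_congr fun l hl => hup l (by simpa using hl)
    have hJ' : J = (Finset.range (i + 1)).image (Function.update π i s) := by
      rw [Finset.range_add_one, Finset.image_insert, Function.update_self, himg, ← hπ, Finset.insert_erase hs]
    refine ⟨Function.update π i s, hJ', fun i' hi' y hy => ?_⟩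
    rcases Nat.lt_or_ge i i' with h | h
    · obtain rfl : i' = i + 1 := by omega
      have hinj : Set.InjOn (Function.update π i s) (Finset.range (i + 1)) := by
        rw [← Finset.card_image_iff, ← hJ', hJ, Finset.card_range]
      have e : ∑ l ∈ J, w l * v (W.mulVec y l) =
          ∑ l ∈ Finset.range (i + 1), w (Function.update π i s l) * v (W.mulVec y (Function.update π i s l)) := by
        conv_lhs => rw [hJ']
        exact Finset.sum_image hinj
      rw [← e]
      have h0 : 0 ≤ ∑ l ∈ J, w l * v (W.mulVec y l) := Finset.sum_nonneg fun l _ => hnn y l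
      have : (1 : ℝ) ≤ 2 ^ (i + 1) := one_le_pow₀ (by norm_num)
      nlinarith
    · have h1 := hstep y fun l hl => hy l (h.trans hl)
      have h2 := hπ2 i' h y hy
      have e : ∑ l ∈ Finset.range i', w (Function.update π i s l) * v (W.mulVec y (Function.update π i s l)) =
          ∑ l ∈ Finset.range i', w (π l) * v (W.mulVec y (π l)) :=
        Finset.sum_congr rfl fun l hl => by rw [hup l ((Finset.mem_range.1 hl).trans_le h)]
      rw [e, pow_succ]
      linarith

/-- Davenport's lemma -/
lemma dav (v : AbsoluteValue K ℝ) (W : Matrix (Fin n) (Fin n) K) (w : Fin n → ℝ) (hw : ∀ l, 0 < w l) :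
    ∃ π : Equiv.Perm (Fin n), ∀ i : Fin n, ∀ y : Fin n → K, (∀ l, i < l → y l = 0) →
      ∑ l, w l * v (W.mulVec y l) ≤ 2 ^ n * ∑ l ∈ Finset.Iic i, w (π l) * v (W.mulVec y (π l)) := by
  obtain ⟨π, hπ, h⟩ := dav_aux v W w hw n le_rfl Finset.univ (by simp)
  have hsurj : Function.Surjective fun l : Fin n => π l := by
    intro j
    have : j ∈ (Finset.range n).image π := hπ ▸ Finset.mem_univ j
    obtain ⟨l, hl, hlj⟩ := Finset.mem_image.1 this
    exact ⟨⟨l, Finset.mem_range.1 hl⟩, hlj⟩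
  refine ⟨Equiv.ofBijective _ (Finite.surjective_iff_bijective.1 hsurj), fun i y hy => ?_⟩
  refine (h (i + 1) i.2 y fun l hl => hy l (Fin.lt_def.2 hl)).trans (le_of_eq ?_)
  congr 1
  symm
  refine Finset.sum_nbij (fun l => (l : ℕ)) ?_ ?_ ?_ ?_
  · intro l hl
    have := Finset.mem_Iic.1 hl
    exact Finset.mem_range.2 (Nat.lt_succ_of_le (Fin.le_def.1 this))
  · intro a _ b _ hab
    exact Fin.ext hab
  · intro l hl
    have hl' : l < i + 1 := by simpa using hl
    exact ⟨⟨l, by have := i.2; omega⟩, by simp [Fin.le_def]; omega, rfl⟩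
  · intro l _
    rfl
end Dav

end Part11

section Part12
set_option autoImplicit false
open Filter

namespace PF
variable {K : Type} [Field K] [CharZero K] (F : PF K) {n : ℕ}

/-- twisted local norm -/
noncomputable def N (A : F.ι → Matrix (Fin n) (Fin n) K) (c : F.ι → Fin n → ℝ) (q : ℝ) (x : Fin n → K) (v : F.ι) : ℝ :=
  ∑ i, Real.exp (-(q * c v i)) * F.abv v ((A v).mulVec x i)

/-- twisted height -/
noncomputable def H (A : F.ι → Matrix (Fin n) (Fin n) K) (c : F.ι → Fin n → ℝ) (q : ℝ) (x : Fin n → K) : ℝ :=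
  F.pr (F.N A c q x)

/-- the total exponent -/
noncomputable def mc (c : F.ι → Fin n → ℝ) : ℝ := ∑ v, F.m v * ∑ i, c v i

variable (A : F.ι → Matrix (Fin n) (Fin n) K) (c : F.ι → Fin n → ℝ) (q : ℝ)

lemma N_nonneg (x : Fin n → K) (v : F.ι) : 0 ≤ F.N A c q x v :=
  Finset.sum_nonneg fun i _ => mul_nonneg (Real.exp_pos _).le ((F.abv v).nonneg _)

lemma H_nonneg (x : Fin n → K) : 0 ≤ F.H A c q x := F.pr_nonneg fun v => F.N_nonneg A c q x v

lemma abv_le_N (x : Fin n → K) (v : F.ι) (i : Fin n) :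
    F.abv v ((A v).mulVec x i) ≤ F.N A c q x v * Real.exp (q * c v i) := by
  have h := Finset.single_le_sum (f := fun i => Real.exp (-(q * c v i)) * F.abv v ((A v).mulVec x i))
    (fun i _ => mul_nonneg (Real.exp_pos _).le ((F.abv v).nonneg _)) (Finset.mem_univ i)
  have h2 := mul_le_mul_of_nonneg_right h (Real.exp_pos (q * c v i)).le
  refine le_trans (le_of_eq ?_) h2
  rw [Real.exp_neg]
  field_simp

lemma N_pos (hA : ∀ v, (A v).det ≠ 0) {x : Fin n → K} (hx : x ≠ 0) (v : F.ι) : 0 < F.N A c q x v := by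
  have h1 : (A v).mulVec x ≠ 0 := fun h => hA v (Matrix.exists_mulVec_eq_zero_iff.1 ⟨x, hx, h⟩)
  obtain ⟨i, hi⟩ := Function.ne_iff.1 h1
  have h2 := F.abv_le_N A c q x v i
  have h3 : 0 < F.abv v ((A v).mulVec x i) := (F.abv v).pos hi
  have h4 := h3.trans_le h2
  exact pos_of_mul_pos_left h4 (Real.exp_pos _).le

lemma H_pos (hA : ∀ v, (A v).det ≠ 0) {x : Fin n → K} (hx : x ≠ 0) : 0 < F.H A c q x :=
  F.pr_pos fun v => F.N_pos A c q hA hx v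

lemma det_mem (T : Matrix (Fin n) (Fin n) K) (hT : ∀ i l, T i l ∈ F.O) : T.det ∈ F.O := by
  rw [Matrix.det_apply]
  refine Subring.sum_mem _ fun σ _ => ?_
  have h1 : ∏ x, T (σ x) x ∈ F.O := Subring.prod_mem _ fun x _ => hT _ _
  rcases Int.units_eq_one_or (Equiv.Perm.sign σ) with h | h
  · rw [h, one_smul]; exact h1
  · rw [h, Units.neg_smul, one_smul]; exact F.O.neg_mem h1

lemma hada (hA : ∀ v, (A v).det ≠ 0) : ∃ c0 : ℝ, 0 < c0 ∧ ∀ (c : F.ι → Fin n → ℝ) (q : ℝ) (T : Matrix (Fin n) (Fin n) K),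
    (∀ i l, T i l ∈ F.O) → T.det ≠ 0 → c0 ≤ (∏ l, F.H A c q (fun i => T i l)) * Real.exp (q * F.mc c) := by
  have hp : 0 < F.pr fun v => F.abv v (A v).det := F.pr_pos fun v => (F.abv v).pos (hA v)
  have hf : (0 : ℝ) < ((Fintype.card (Fin n)).factorial : ℝ) ^ F.M := by positivity
  refine ⟨(F.pr fun v => F.abv v (A v).det) / ((Fintype.card (Fin n)).factorial : ℝ) ^ F.M, div_pos hp hf, fun c q T hT hdet => ?_⟩
  rw [div_le_iff₀ hf]
  have h1 : F.pr (fun v => F.abv v (A v * T).det) ≤ F.pr (fun v => ((Fintype.card (Fin n)).factorial : ℝ) *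
      ((Real.exp (∑ i, q * c v i)) * ∏ l, F.N A c q (fun i => T i l) v)) := by
    refine F.pr_le (fun v => (F.abv v).nonneg _) fun v => ?_
    rw [Real.exp_sum]
    refine abv_det_le (F.abv v) _ (fun i => Real.exp (q * c v i)) (fun l => F.N A c q (fun i => T i l) v) fun i l => ?_
    rw [mul_comm]
    exact F.abv_le_N A c q (fun i => T i l) v i
  rw [F.pr_mul, F.pr_mul, F.pr_const, F.pr_exp, F.pr_prod] at h1
  have h2 : F.pr (fun v => F.abv v (A v * T).det) = F.pr (fun v => F.abv v (A v).det) * F.pr (fun v => F.abv v T.det) := by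
    rw [← F.pr_mul]
    congr 1
    funext v
    rw [Matrix.det_mul, map_mul]
  have h3 := F.pr_abv (F.det_mem T hT) hdet
  have h4 : ∑ v, (F.m v : ℝ) * ∑ i, q * c v i = q * F.mc c := by
    rw [mc, Finset.mul_sum]
    refine Finset.sum_congr rfl fun v _ => ?_
    rw [← Finset.mul_sum]; ring
  rw [h2, h4] at h1
  have h5 : F.pr (fun v => F.abv v (A v).det) ≤ F.pr (fun v => F.abv v (A v).det) * F.pr (fun v => F.abv v T.det) := by nlinarith
  refine h5.trans (h1.trans (le_of_eq ?_))
  have : ∀ l, F.pr (F.N A c q fun i => T i l) = F.H A c q fun i => T i l := fun l => rfl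
  simp only [this]
  ring

lemma mink1 [NeZero n] (hA : ∀ v, (A v).det ≠ 0) : ∃ C : ℝ, 0 < C ∧ ∀ (c : F.ι → Fin n → ℝ) (q : ℝ),
    ∃ x : Fin n → K, (∀ i, x i ∈ F.O) ∧ x ≠ 0 ∧ F.H A c q x ≤ C * Real.exp (-(q * F.mc c / n)) := by
  obtain ⟨C, hC, h⟩ := F.mink (Fin n) A hA
  have hn : (0 : ℝ) < n := by exact_mod_cast Nat.pos_of_ne_zero (NeZero.ne n)
  have hM : (0 : ℝ) < F.M := by exact_mod_cast F.M_pos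
  refine ⟨(n : ℝ) ^ F.M * Real.exp (Real.log C / n), by positivity, fun c q => ?_⟩
  set s : ℝ := (Real.log C - q * F.mc c) / (n * F.M) with hs
  obtain ⟨x, hx, hx0, hxt⟩ := h (fun v i => Real.exp (s + q * c v i)) (fun v i => Real.exp_pos _) (by
    have e : ∏ v, (∏ i, Real.exp (s + q * c v i)) ^ F.m v = F.pr (fun v => Real.exp (∑ i, (s + q * c v i))) := by
      unfold pr
      exact Finset.prod_congr rfl fun v _ => by simp only [Real.exp_sum]
    rw [e, F.pr_exp]
    have e2 : ∑ v, (F.m v : ℝ) * ∑ i, (s + q * c v i) = n * F.M * s + q * F.mc c := by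
      have : ∀ v, (F.m v : ℝ) * ∑ i, (s + q * c v i) = F.m v * (n * s) + q * (F.m v * ∑ i, c v i) := by
        intro v
        rw [Finset.sum_add_distrib, ← Finset.mul_sum]
        simp
        ring
      rw [Finset.sum_congr rfl fun v _ => this v, Finset.sum_add_distrib, ← Finset.mul_sum, ← Finset.sum_mul, mc, M]
      push_cast
      ring
    rw [e2, hs]
    have : (n : ℝ) * F.M * ((Real.log C - q * F.mc c) / (n * F.M)) + q * F.mc c = Real.log C := by
      field_simp; ring
    rw [this, Real.exp_log hC])
  refine ⟨x, hx, hx0, ?_⟩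
  have h1 : F.H A c q x ≤ F.pr (fun _ => n * Real.exp s) := by
    refine F.pr_le (fun v => F.N_nonneg A c q x v) fun v => ?_
    have : ∀ i ∈ Finset.univ, Real.exp (-(q * c v i)) * F.abv v ((A v).mulVec x i) ≤ Real.exp s := by
      intro i _
      refine (mul_le_mul_of_nonneg_left (hxt v i) (Real.exp_pos _).le).trans (le_of_eq ?_)
      rw [← Real.exp_add]; congr 1; ring
    refine (Finset.sum_le_card_nsmul _ _ _ this).trans ?_
    simp
  refine h1.trans (le_of_eq ?_)
  rw [F.pr_const, mul_pow, ← Real.exp_nat_mul, mul_assoc, ← Real.exp_add]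
  congr 2
  rw [hs]
  field_simp
  ring

lemma H_lower (hA : ∀ v, (A v).det ≠ 0) (cs : ℝ) : ∃ B : ℝ, ∀ (c : F.ι → Fin n → ℝ), (∀ v i, |c v i| ≤ cs) → ∀ q : ℝ, 0 ≤ q →
    ∀ x : Fin n → K, (∀ i, x i ∈ F.O) → x ≠ 0 → Real.exp (-(B * (1 + q))) ≤ F.H A c q x := by
  set D : ℝ := 1 + ∑ v, ∑ i, ∑ j, F.abv v ((A v)⁻¹ i j) with hD
  have hDn : 0 ≤ ∑ v, ∑ i, ∑ j, F.abv v ((A v)⁻¹ i j) :=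
    Finset.sum_nonneg fun v _ => Finset.sum_nonneg fun i _ => Finset.sum_nonneg fun j _ => (F.abv v).nonneg _
  have hD1 : 1 ≤ D := by linarith
  have hDi : ∀ v i, ∑ j, F.abv v ((A v)⁻¹ i j) ≤ D := by
    intro v i
    have h1 : ∑ j, F.abv v ((A v)⁻¹ i j) ≤ ∑ i, ∑ j, F.abv v ((A v)⁻¹ i j) :=
      Finset.single_le_sum (f := fun i => ∑ j, F.abv v ((A v)⁻¹ i j)) (fun i _ => Finset.sum_nonneg fun j _ => (F.abv v).nonneg _) (Finset.mem_univ i)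
    have h2 : ∑ i, ∑ j, F.abv v ((A v)⁻¹ i j) ≤ ∑ v, ∑ i, ∑ j, F.abv v ((A v)⁻¹ i j) :=
      Finset.single_le_sum (f := fun v => ∑ i, ∑ j, F.abv v ((A v)⁻¹ i j))
        (fun v _ => Finset.sum_nonneg fun i _ => Finset.sum_nonneg fun j _ => (F.abv v).nonneg _) (Finset.mem_univ v)
    linarith
  refine ⟨F.M * Real.log D + F.M * |cs|, fun c hc q hq x hx hx0 => ?_⟩
  obtain ⟨i, hi⟩ := Function.ne_iff.1 hx0
  have h1 : ∀ v, F.abv v (x i) ≤ D * Real.exp (q * |cs|) * F.N A c q x v := by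
    intro v
    have e : x i = ∑ j, (A v)⁻¹ i j * (A v).mulVec x j := by
      have : x = (A v)⁻¹.mulVec ((A v).mulVec x) := by
        rw [Matrix.mulVec_mulVec, Matrix.nonsing_inv_mul _ (isUnit_iff_ne_zero.2 (hA v)), Matrix.one_mulVec]
      conv_lhs => rw [this]
      rfl
    rw [e]
    refine ((F.abv v).sum_le _ _).trans ?_
    have h2 : ∀ j ∈ Finset.univ, F.abv v ((A v)⁻¹ i j * (A v).mulVec x j) ≤ F.abv v ((A v)⁻¹ i j) * (F.N A c q x v * Real.exp (q * |cs|)) := by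
      intro j _
      rw [map_mul]
      refine mul_le_mul_of_nonneg_left ((F.abv_le_N A c q x v j).trans ?_) ((F.abv v).nonneg _)
      refine mul_le_mul_of_nonneg_left (Real.exp_le_exp.2 ?_) (F.N_nonneg A c q x v)
      exact mul_le_mul_of_nonneg_left ((le_abs_self _).trans ((hc v j).trans (le_abs_self _))) hq
    refine (Finset.sum_le_sum h2).trans ?_
    rw [← Finset.sum_mul]
    have := mul_le_mul_of_nonneg_right (hDi v i) (mul_nonneg (F.N_nonneg A c q x v) (Real.exp_pos (q * |cs|)).le)
    linarith
  have h2 := (F.pr_abv (hx i) hi).trans (F.pr_le (fun v => (F.abv v).nonneg _) h1)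
  rw [F.pr_mul, F.pr_const, mul_pow, ← Real.exp_nat_mul] at h2
  have h3 : D ^ F.M = Real.exp (F.M * Real.log D) := by rw [Real.exp_nat_mul, Real.exp_log (by linarith)]
  rw [h3, ← Real.exp_add] at h2
  rw [Real.exp_neg, inv_le_iff_one_le_mul₀ (Real.exp_pos _), mul_comm]
  refine h2.trans (mul_le_mul_of_nonneg_right (Real.exp_le_exp.2 ?_) (F.H_nonneg A c q x))
  have := Real.log_nonneg hD1
  have : (0 : ℝ) ≤ F.M * Real.log D := by positivity
  have : (0 : ℝ) ≤ F.M * |cs| := by positivity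
  nlinarith

lemma H_upper (cs : ℝ) : ∃ B : ℝ, ∀ (c : F.ι → Fin n → ℝ), (∀ v i, |c v i| ≤ cs) → ∀ q : ℝ, 0 ≤ q →
    ∀ j : Fin n, F.H A c q (Pi.single j 1) ≤ Real.exp (B * (1 + q)) := by
  set D : ℝ := 1 + ∑ v, ∑ j, ∑ i, F.abv v ((A v) i j) with hD
  have hDn : 0 ≤ ∑ v, ∑ j, ∑ i, F.abv v ((A v) i j) :=
    Finset.sum_nonneg fun v _ => Finset.sum_nonneg fun i _ => Finset.sum_nonneg fun j _ => (F.abv v).nonneg _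
  have hD1 : 1 ≤ D := by linarith
  have hDi : ∀ v j, ∑ i, F.abv v ((A v) i j) ≤ D := by
    intro v i
    have h1 : ∑ j, F.abv v ((A v) j i) ≤ ∑ i, ∑ j, F.abv v ((A v) j i) :=
      Finset.single_le_sum (f := fun i => ∑ j, F.abv v ((A v) j i)) (fun i _ => Finset.sum_nonneg fun j _ => (F.abv v).nonneg _) (Finset.mem_univ i)
    have h2 : ∑ i, ∑ j, F.abv v ((A v) j i) ≤ ∑ v, ∑ i, ∑ j, F.abv v ((A v) j i) :=
      Finset.single_le_sum (f := fun v => ∑ i, ∑ j, F.abv v ((A v) j i))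
        (fun v _ => Finset.sum_nonneg fun i _ => Finset.sum_nonneg fun j _ => (F.abv v).nonneg _) (Finset.mem_univ v)
    linarith
  refine ⟨F.M * Real.log D + F.M * |cs|, fun c hc q hq j => ?_⟩
  have h1 : F.H A c q (Pi.single j 1) ≤ F.pr (fun _ => D * Real.exp (q * |cs|)) := by
    refine F.pr_le (fun v => F.N_nonneg A c q _ v) fun v => ?_
    have : ∀ i ∈ Finset.univ, Real.exp (-(q * c v i)) * F.abv v ((A v).mulVec (Pi.single j 1) i) ≤
        Real.exp (q * |cs|) * F.abv v (A v i j) := by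
      intro i _
      rw [Matrix.mulVec_single_one]
      refine mul_le_mul_of_nonneg_right (Real.exp_le_exp.2 ?_) ((F.abv v).nonneg _)
      have h2 := neg_le_of_abs_le (hc v i)
      have h3 := le_abs_self cs
      nlinarith
    refine (Finset.sum_le_sum this).trans ?_
    rw [← Finset.mul_sum, mul_comm]
    exact mul_le_mul_of_nonneg_right (hDi v j) (Real.exp_pos _).le
  refine h1.trans ?_
  have h3 : D ^ F.M = Real.exp (F.M * Real.log D) := by rw [Real.exp_nat_mul, Real.exp_log (by linarith)]
  rw [F.pr_const, mul_pow, ← Real.exp_nat_mul, h3, ← Real.exp_add]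
  refine Real.exp_le_exp.2 ?_
  have := Real.log_nonneg hD1
  have : (0 : ℝ) ≤ F.M * Real.log D := by positivity
  have : (0 : ℝ) ≤ F.M * |cs| := by positivity
  nlinarith

end PF

end Part12

section Part13
set_option autoImplicit false
open Filter

lemma ult_lim (𝒰 : Ultrafilter ℕ) (f : ℕ → ℝ) (B : ℝ) (h : ∀ᶠ k in (𝒰 : Filter ℕ), |f k| ≤ B) :
    ∃ a, Tendsto f 𝒰 (nhds a) := by
  have h1 : (𝒰.map f : Filter ℝ) ≤ Filter.principal (Set.Icc (-B) B) := by
    rw [Filter.le_principal_iff]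
    exact h.mono fun k hk => abs_le.1 hk
  obtain ⟨a, _, ha⟩ := isCompact_Icc.ultrafilter_le_nhds (𝒰.map f) h1
  exact ⟨a, ha⟩

namespace PF
variable {K : Type} [Field K] [CharZero K] (F : PF K) {n : ℕ} [NeZero n]
variable (A : F.ι → Matrix (Fin n) (Fin n) K)

lemma bdd_c (c : F.ι → Fin n → ℝ) : ∃ cs : ℝ, ∀ v i, |c v i| ≤ cs :=
  ⟨∑ v, ∑ i, |c v i|, fun v i =>
    (Finset.single_le_sum (f := fun i => |c v i|) (fun _ _ => abs_nonneg _) (Finset.mem_univ i)).trans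
      (Finset.single_le_sum (f := fun v => ∑ i, |c v i|) (fun _ _ => Finset.sum_nonneg fun _ _ => abs_nonneg _) (Finset.mem_univ v))⟩

lemma minima_step (hA : ∀ v, (A v).det ≠ 0) (c : F.ι → Fin n → ℝ) (q : ℝ) (hq : 0 ≤ q) (S : Submodule K (Fin n → K)) :
    ∃ (x : Fin n → K) (r : ℝ), S ≠ ⊤ → (∀ i, x i ∈ F.O) ∧ x ∉ S ∧ 0 < r ∧ F.H A c q x ≤ 2 * r ∧
      ∀ x', (∀ i, x' i ∈ F.O) → x' ∉ S → r ≤ F.H A c q x' := by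
  by_cases hS : S = ⊤
  · exact ⟨0, 0, fun h => absurd hS h⟩
  obtain ⟨cs, hcs⟩ := F.bdd_c c
  obtain ⟨B, hB⟩ := F.H_lower A hA cs
  have hne : ∃ j, (Pi.single j 1 : Fin n → K) ∉ S := by
    by_contra h
    push Not at h
    refine hS (eq_top_iff.2 fun x _ => ?_)
    rw [pi_eq_sum_univ' x]
    refine Submodule.sum_mem _ fun j _ => Submodule.smul_mem _ _ ?_
    convert h j using 1
  obtain ⟨j, hj⟩ := hne
  set X : Set ℝ := F.H A c q '' {x | (∀ i, x i ∈ F.O) ∧ x ∉ S} with hX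
  have hXne : X.Nonempty := ⟨_, Pi.single j 1, ⟨fun i => by
    rw [Pi.single_apply]; split_ifs
    · exact F.O.one_mem
    · exact F.O.zero_mem, hj⟩, rfl⟩
  have hlow : ∀ y ∈ X, Real.exp (-(B * (1 + q))) ≤ y := by
    rintro _ ⟨x, ⟨hx, hxS⟩, rfl⟩
    exact hB c hcs q hq x hx fun h => hxS (h ▸ S.zero_mem)
  have hpos : 0 < sInf X := (Real.exp_pos _).trans_le (le_csInf hXne hlow)
  obtain ⟨_, ⟨x, ⟨hx, hxS⟩, rfl⟩, hlt⟩ := exists_lt_of_csInf_lt hXne (show sInf X < 2 * sInf X by linarith)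
  exact ⟨x, sInf X, fun _ => ⟨hx, hxS, hpos, hlt.le, fun x' hx' hx'S => csInf_le ⟨_, hlow⟩ ⟨x', ⟨hx', hx'S⟩, rfl⟩⟩⟩

lemma minima_k (hA : ∀ v, (A v).det ≠ 0) (c : F.ι → Fin n → ℝ) (q : ℝ) (hq : 0 ≤ q) :
    ∃ (T : Matrix (Fin n) (Fin n) K) (r : Fin n → ℝ), (∀ i l, T i l ∈ F.O) ∧ T.det ≠ 0 ∧ (∀ l, 0 < r l) ∧
      (∀ l, F.H A c q (fun i => T i l) ≤ 2 * r l) ∧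
      ∀ x, (∀ i, x i ∈ F.O) → ∀ l l', l ≤ l' → T⁻¹.mulVec x l' ≠ 0 → r l ≤ F.H A c q x := by
  classical
  choose e r her using F.minima_step A hA c q hq
  obtain ⟨S, hS0, hS1⟩ : ∃ S : ℕ → Submodule K (Fin n → K), S 0 = ⊥ ∧ ∀ l, S (l + 1) = S l ⊔ Submodule.span K {e (S l)} :=
    ⟨fun l => Nat.rec ⊥ (fun _ S => S ⊔ Submodule.span K {e S}) l, rfl, fun l => rfl⟩
  have hfr : ∀ l, Module.finrank K ↥(S l) ≤ l := by
    intro l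
    induction l with
    | zero => simp [hS0]
    | succ l ih =>
      rw [hS1]
      have h1 := Submodule.finrank_add_le_finrank_add_finrank (S l) (Submodule.span K {e (S l)})
      have h2 : Module.finrank K ↥(Submodule.span K {e (S l)}) ≤ 1 := (finrank_span_le_card _).trans (by simp)
      omega
  have htop : ∀ l < n, S l ≠ ⊤ := by
    intro l hl h
    have := hfr l
    rw [h, finrank_top] at this
    simp at this
    omega
  have hmono : Monotone S := monotone_nat_of_le_succ fun l => by rw [hS1]; exact le_sup_left
  have hmem : ∀ l l', l < l' → e (S l) ∈ S l' := fun l l' h =>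
    hmono (Nat.succ_le_of_lt h) (by rw [Nat.succ_eq_add_one, hS1]; exact (le_sup_right : _ ≤ S l ⊔ _) (Submodule.mem_span_singleton_self _))
  set T : Matrix (Fin n) (Fin n) K := fun i l => e (S l) i with hT
  have hmul : ∀ y, T.mulVec y = ∑ l : Fin n, y l • e (S l) := by
    intro y
    funext i
    simp [Matrix.mulVec, dotProduct, hT, mul_comm]
  have hdet : T.det ≠ 0 := by
    intro h
    obtain ⟨y, hy0, hy⟩ := Matrix.exists_mulVec_eq_zero_iff.2 h
    obtain ⟨l1, hl1⟩ := Function.ne_iff.1 hy0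
    obtain ⟨l, hl, hmax⟩ := (Finset.univ.filter fun l => y l ≠ 0).exists_max_image id ⟨l1, by simpa using hl1⟩
    have hl' : y l ≠ 0 := by simpa using hl
    rw [hmul, ← Finset.add_sum_erase _ _ (Finset.mem_univ l)] at hy
    have h1 : y l • e (S l) ∈ S l := by
      rw [eq_neg_of_add_eq_zero_left hy]
      refine Submodule.neg_mem _ (Submodule.sum_mem _ fun l' hl'' => ?_)
      by_cases h0 : y l' = 0
      · rw [h0, zero_smul]; exact Submodule.zero_mem _
      · have h2 := hmax l' (by simpa using h0)
        exact Submodule.smul_mem _ _ (hmem _ _ (lt_of_le_of_ne h2 (fun h => Finset.ne_of_mem_erase hl'' (Fin.ext h))))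
    exact (her _ (htop l l.2)).2.1 ((Submodule.smul_mem_iff _ hl').1 h1)
  have hcol : ∀ l : Fin n, T⁻¹.mulVec (e (S l)) = Pi.single l 1 := by
    intro l
    have : e (S l) = T.mulVec (Pi.single l 1) := by
      rw [Matrix.mulVec_single_one]; rfl
    rw [this, Matrix.mulVec_mulVec, Matrix.nonsing_inv_mul _ (isUnit_iff_ne_zero.2 hdet), Matrix.one_mulVec]
  have hsup : ∀ l ≤ n, ∀ x ∈ S l, ∀ l' : Fin n, l ≤ l' → T⁻¹.mulVec x l' = 0 := by
    intro l
    induction l with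
    | zero =>
      intro _ x hx l' _
      have : x = 0 := by simpa [hS0] using hx
      rw [this, Matrix.mulVec_zero]; rfl
    | succ l ih =>
      intro hl x hx l' hl'
      rw [hS1] at hx
      obtain ⟨x1, hx1, x2, hx2, rfl⟩ := Submodule.mem_sup.1 hx
      obtain ⟨a, rfl⟩ := Submodule.mem_span_singleton.1 hx2
      rw [Matrix.mulVec_add, Pi.add_apply, ih (by omega) x1 hx1 l' (by omega), zero_add, Matrix.mulVec_smul,
        hcol ⟨l, by omega⟩, Pi.smul_apply, Pi.single_apply, if_neg (fun h => by rw [Fin.ext_iff] at h; simp at h; omega), smul_zero]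
  refine ⟨T, fun l => r (S l), fun i l => (her _ (htop l l.2)).1 i, hdet, fun l => (her _ (htop l l.2)).2.2.1,
    fun l => (her _ (htop l l.2)).2.2.2.1, fun x hx l l' hll hne => (her _ (htop l l.2)).2.2.2.2 x hx fun hxS => ?_⟩
  exact hne (hsup l l.2.le x hxS l' hll)

/-- upper bounds for columns -/
def PA (c : F.ι → Fin n → ℝ) (𝒰 : Ultrafilter ℕ) (q : ℕ → ℝ) (T : ℕ → Matrix (Fin n) (Fin n) K) (ν : Fin n → ℝ) : Prop :=
  ∀ ε > 0, ∀ l, ∀ᶠ k in (𝒰 : Filter ℕ), F.H A c (q k) (fun i => T k i l) ≤ Real.exp ((ν l + ε) * q k)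

/-- lower bounds -/
def PB (c : F.ι → Fin n → ℝ) (𝒰 : Ultrafilter ℕ) (q : ℕ → ℝ) (T : ℕ → Matrix (Fin n) (Fin n) K) (ν : Fin n → ℝ) : Prop :=
  ∀ ε > 0, ∀ l, ∀ᶠ k in (𝒰 : Filter ℕ), ∀ x : Fin n → K, (∀ i, x i ∈ F.O) → (T k)⁻¹.mulVec x l ≠ 0 →
    Real.exp ((ν l - ε) * q k) ≤ F.H A c (q k) x

lemma minima (hA : ∀ v, (A v).det ≠ 0) (c : F.ι → Fin n → ℝ) (𝒰 : Ultrafilter ℕ) (q : ℕ → ℝ) (hq : Tendsto q 𝒰 atTop) :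
    ∃ (T : ℕ → Matrix (Fin n) (Fin n) K) (ν : Fin n → ℝ), (∀ k i l, T k i l ∈ F.O) ∧ (∀ k, (T k).det ≠ 0) ∧ Monotone ν ∧
      F.PA A c 𝒰 q T ν ∧ F.PB A c 𝒰 q T ν := by
  choose T r hT hdet hr hH hx using fun k => F.minima_k A hA c (max (q k) 0) (le_max_right _ _)
  obtain ⟨cs, hcs⟩ := F.bdd_c c
  obtain ⟨B1, hB1⟩ := F.H_lower A hA cs
  obtain ⟨B2, hB2⟩ := F.H_upper A cs
  have hcol0 : ∀ k l, (fun i => T k i l) ≠ 0 := by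
    intro k l h
    exact hdet k (Matrix.det_eq_zero_of_column_eq_zero l fun i => congrFun h i)
  have hqm : ∀ᶠ k in (𝒰 : Filter ℕ), max (q k) 0 = q k := by
    filter_upwards [hq.eventually_ge_atTop 0] with k hk using max_eq_left hk
  have hlim : ∀ l, ∃ a, Tendsto (fun k => Real.log (r k l) / q k) 𝒰 (nhds a) := by
    intro l
    refine ult_lim 𝒰 _ (2 * |B1| + 2 * |B2| + 1) ?_
    filter_upwards [hqm, hq.eventually_ge_atTop 1] with k hk hk1
    have hk0 : 0 < q k := by linarith
    have h1 := (hB1 c hcs (q k) hk0.le _ (fun i => hT k i l) (hcol0 k l)).trans (hk ▸ hH k l)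
    obtain ⟨j, hj⟩ : ∃ j, (T k)⁻¹.mulVec (Pi.single j 1) l ≠ 0 := by
      by_contra h
      push Not at h
      have h3 : (T k)⁻¹.det ≠ 0 := by
        rw [Matrix.det_nonsing_inv, Ring.inverse_eq_inv']
        exact inv_ne_zero (hdet k)
      refine h3 (Matrix.det_eq_zero_of_row_eq_zero l fun j => ?_)
      have := h j
      rwa [Matrix.mulVec_single_one] at this
    have h2 := (hx k (Pi.single j 1) (fun i => by
      rw [Pi.single_apply]; split_ifs
      · exact F.O.one_mem
      · exact F.O.zero_mem) l l le_rfl hj)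
    rw [hk] at h2
    have h2 := h2.trans (hB2 c hcs (q k) hk0.le j)
    have h3 := Real.log_le_log (hr k l) h2
    have h4 := Real.log_le_log (Real.exp_pos _) h1
    rw [Real.log_exp] at h3
    rw [Real.log_exp, Real.log_mul (by norm_num) (hr k l).ne'] at h4
    have h5 : Real.log 2 ≤ 1 := by have := Real.log_two_lt_d9; linarith
    rw [abs_div, abs_of_pos hk0, div_le_iff₀ hk0, abs_le]
    have := le_abs_self B1
    have := le_abs_self B2
    have := abs_nonneg B1
    have := abs_nonneg B2
    constructor <;> nlinarith
  choose ν hν using hlim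
  have ha : F.PA A c 𝒰 q T ν := by
    intro ε hε l
    filter_upwards [hqm, hq.eventually_ge_atTop 1, (hν l).eventually_lt_const (show ν l < ν l + ε / 2 by linarith),
      hq.eventually_ge_atTop (2 / ε)] with k hk hk1 hk2 hk3
    rw [div_lt_iff₀ (by linarith)] at hk2
    rw [div_le_iff₀ hε] at hk3
    have h1 := hH k l
    rw [hk] at h1
    refine h1.trans ?_
    rw [← Real.log_le_iff_le_exp (by have := hr k l; positivity), Real.log_mul (by norm_num) (hr k l).ne']
    have h5 : Real.log 2 ≤ 1 := by have := Real.log_two_lt_d9; linarith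
    nlinarith
  refine ⟨T, ν, hT, hdet, ?_, ha, ?_⟩
  · intro l l' hll
    refine le_of_forall_pos_le_add fun ε hε => ?_
    have hall := (((hq.eventually_ge_atTop 1).and ((hν l).eventually_const_lt (show ν l - ε / 2 < ν l by linarith))).and
      ((ha (ε / 2) (by positivity) l').and hqm)).exists
    obtain ⟨k, ⟨hk1, hk2⟩, hk3, hk4⟩ := hall
    have hk0 : 0 < q k := by linarith
    have h1 := hx k (fun i => T k i l') (fun i => hT k i l') l l' hll (by
      have : (fun i => T k i l') = (T k).mulVec (Pi.single l' 1) := by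
        rw [Matrix.mulVec_single_one]; rfl
      rw [this, Matrix.mulVec_mulVec, Matrix.nonsing_inv_mul _ (isUnit_iff_ne_zero.2 (hdet k)), Matrix.one_mulVec]
      simp)
    rw [hk4] at h1
    have h2 := h1.trans hk3
    rw [← Real.log_le_iff_le_exp (hr k l)] at h2
    rw [lt_div_iff₀ hk0] at hk2
    have h3 := hk2.trans_le h2
    have := lt_of_mul_lt_mul_right h3 hk0.le
    linarith
  · intro ε hε l
    filter_upwards [hqm, hq.eventually_ge_atTop 1, (hν l).eventually_const_lt (show ν l - ε < ν l by linarith)] with k hk hk1 hk2 x hxO hne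
    have h1 := hx k x hxO l l le_rfl hne
    rw [hk] at h1
    refine le_trans ?_ h1
    rw [lt_div_iff₀ (by linarith)] at hk2
    rw [← Real.le_log_iff_exp_le (hr k l)]
    exact hk2.le

end PF

end Part13

section Part14
set_option autoImplicit false
open Filter

namespace PF
variable {K : Type} [Field K] [CharZero K] (F : PF K) {n : ℕ} [NeZero n]
variable (A : F.ι → Matrix (Fin n) (Fin n) K)

lemma PA.all {F : PF K} {A : F.ι → Matrix (Fin n) (Fin n) K} {c : F.ι → Fin n → ℝ} {𝒰 : Ultrafilter ℕ} {q : ℕ → ℝ}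
    {T : ℕ → Matrix (Fin n) (Fin n) K} {ν : Fin n → ℝ} (h : F.PA A c 𝒰 q T ν) (ε : ℝ) (hε : 0 < ε) :
    ∀ᶠ k in (𝒰 : Filter ℕ), ∀ l, F.H A c (q k) (fun i => T k i l) ≤ Real.exp ((ν l + ε) * q k) :=
  Filter.eventually_all.2 fun l => h ε hε l

lemma PB.all {F : PF K} {A : F.ι → Matrix (Fin n) (Fin n) K} {c : F.ι → Fin n → ℝ} {𝒰 : Ultrafilter ℕ} {q : ℕ → ℝ}
    {T : ℕ → Matrix (Fin n) (Fin n) K} {ν : Fin n → ℝ} (h : F.PB A c 𝒰 q T ν) (ε : ℝ) (hε : 0 < ε) :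
    ∀ᶠ k in (𝒰 : Filter ℕ), ∀ l, ∀ x : Fin n → K, (∀ i, x i ∈ F.O) → (T k)⁻¹.mulVec x l ≠ 0 →
    Real.exp ((ν l - ε) * q k) ≤ F.H A c (q k) x :=
  Filter.eventually_all.2 fun l => h ε hε l

lemma sum_ge (hA : ∀ v, (A v).det ≠ 0) (c : F.ι → Fin n → ℝ) (𝒰 : Ultrafilter ℕ) (q : ℕ → ℝ) (hq : Tendsto q 𝒰 atTop)
    (T : ℕ → Matrix (Fin n) (Fin n) K) (hT : ∀ k i l, T k i l ∈ F.O) (hdet : ∀ k, (T k).det ≠ 0) (ν : Fin n → ℝ)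
    (h : F.PA A c 𝒰 q T ν) : - F.mc c ≤ ∑ l, ν l := by
  obtain ⟨c0, hc0, hc⟩ := F.hada A hA
  refine le_of_forall_pos_le_add fun ε hε => ?_
  set ε' : ℝ := ε / (n + 1) with hε'
  have hε0 : 0 < ε' := by positivity
  have hεe : ε = n * ε' + ε' := by rw [hε']; field_simp
  obtain ⟨k, hk1, hk2, hk3⟩ := ((h.all ε' hε0).and ((hq.eventually_ge_atTop 1).and (hq.eventually_ge_atTop (- Real.log c0 / ε')))).exists
  have h1 := hc c (q k) (T k) (hT k) (hdet k)
  have h2 : ∏ l, F.H A c (q k) (fun i => T k i l) ≤ Real.exp (∑ l, (ν l + ε') * q k) := by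
    rw [Real.exp_sum]
    exact Finset.prod_le_prod (fun l _ => F.H_nonneg A c _ _) fun l _ => hk1 l
  have h3 := h1.trans (mul_le_mul_of_nonneg_right h2 (Real.exp_pos _).le)
  rw [← Real.exp_add, ← Real.log_le_iff_le_exp hc0, ← Finset.sum_mul, Finset.sum_add_distrib] at h3
  simp only [Finset.sum_const, Finset.card_univ, Fintype.card_fin, nsmul_eq_mul] at h3
  rw [div_le_iff₀ hε0] at hk3
  have h4 : 0 ≤ (∑ l, ν l + n * ε' + ε' + F.mc c) * q k := by linarith
  have h5 := nonneg_of_mul_nonneg_left h4 (by linarith)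
  linarith

lemma pb_of_pa (hA : ∀ v, (A v).det ≠ 0) (c : F.ι → Fin n → ℝ) (𝒰 : Ultrafilter ℕ) (q : ℕ → ℝ) (hq : Tendsto q 𝒰 atTop)
    (T : ℕ → Matrix (Fin n) (Fin n) K) (hT : ∀ k i l, T k i l ∈ F.O) (hdet : ∀ k, (T k).det ≠ 0) (ν : Fin n → ℝ)
    (h : F.PA A c 𝒰 q T ν) (hs : ∑ l, ν l ≤ - F.mc c) : F.PB A c 𝒰 q T ν := by
  obtain ⟨c0, hc0, hc⟩ := F.hada A hA
  intro ε hε l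
  set ε' : ℝ := ε / (n + 1) with hε'
  have hε0 : 0 < ε' := by positivity
  have hεe : ε = n * ε' + ε' := by rw [hε']; field_simp
  filter_upwards [h.all ε' hε0, hq.eventually_ge_atTop 1, hq.eventually_ge_atTop (- Real.log c0 / ε')] with k hk1 hk2 hk3 x hx hne
  have hdet' : ((T k).updateCol l x).det ≠ 0 := by
    rw [← Matrix.cramer_apply, ← Matrix.det_smul_inv_mulVec_eq_cramer (T k) x (isUnit_iff_ne_zero.2 (hdet k)), Pi.smul_apply, smul_eq_mul]
    exact mul_ne_zero (hdet k) hne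
  have hx0 : x ≠ 0 := by
    rintro rfl
    simp at hne
  have hHx := F.H_pos A c (q k) hA hx0
  have h1 := hc c (q k) ((T k).updateCol l x) (fun i l' => by
    by_cases hl : l' = l
    · subst hl; rw [Matrix.updateCol_self]; exact hx i
    · rw [Matrix.updateCol_ne hl]; exact hT k i l') hdet'
  rw [← Finset.mul_prod_erase _ _ (Finset.mem_univ l)] at h1
  have e1 : (fun i => (T k).updateCol l x i l) = x := by
    funext i; rw [Matrix.updateCol_self]
  have h2 : ∏ l' ∈ Finset.univ.erase l, F.H A c (q k) (fun i => (T k).updateCol l x i l') ≤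
      Real.exp (∑ l' ∈ Finset.univ.erase l, (ν l' + ε') * q k) := by
    rw [Real.exp_sum]
    refine Finset.prod_le_prod (fun l _ => F.H_nonneg A c _ _) fun l' hl' => ?_
    have : (fun i => (T k).updateCol l x i l') = fun i => T k i l' := by
      funext i; rw [Matrix.updateCol_ne (Finset.ne_of_mem_erase hl')]
    rw [this]; exact hk1 l'
  rw [e1] at h1
  have h3 := h1.trans (mul_le_mul_of_nonneg_right (mul_le_mul_of_nonneg_left h2 hHx.le) (Real.exp_pos _).le)
  rw [mul_assoc, ← Real.exp_add, ← Finset.sum_mul] at h3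
  have h4 := Real.log_le_log hc0 h3
  rw [Real.log_mul hHx.ne' (Real.exp_pos _).ne', Real.log_exp] at h4
  have h5 : ∑ l' ∈ Finset.univ.erase l, (ν l' + ε') = ∑ l', ν l' + n * ε' - (ν l + ε') := by
    rw [Finset.sum_erase_eq_sub (Finset.mem_univ l), Finset.sum_add_distrib]
    simp
  rw [h5] at h4
  rw [← Real.le_log_iff_exp_le hHx]
  rw [div_le_iff₀ hε0] at hk3
  have h6 : (∑ l, ν l + F.mc c) * q k ≤ 0 := mul_nonpos_of_nonpos_of_nonneg (by linarith) (by linarith)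
  have h7 : 0 ≤ ε' * q k := mul_nonneg hε0.le (by linarith)
  rw [hεe]
  linarith

/-- twisting the exponents at the place `v0` -/
noncomputable def twist (c : F.ι → Fin n → ℝ) (π : Equiv.Perm (Fin n)) (ρ : Fin n → ℝ) (v : F.ι) (i : Fin n) : ℝ :=
  c v i + if v = F.v0 then ρ (π.symm i) else 0

lemma mc_twist (c : F.ι → Fin n → ℝ) (π : Equiv.Perm (Fin n)) (ρ : Fin n → ℝ) : F.mc (F.twist c π ρ) = F.mc c + ∑ l, ρ l := by
  unfold mc twist
  simp only [Finset.sum_add_distrib, mul_add]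
  congr 1
  rw [Finset.sum_eq_single F.v0]
  · simp [F.m_v0, Equiv.sum_comp π.symm ρ]
  · intro v _ hv
    simp [hv]
  · simp

lemma twist_low (c : F.ι → Fin n → ℝ) (q : ℝ) (hq : 0 ≤ q) (T : Matrix (Fin n) (Fin n) K) (π : Equiv.Perm (Fin n))
    (hπ : ∀ i : Fin n, ∀ y : Fin n → K, (∀ l, i < l → y l = 0) →
      ∑ l, Real.exp (-(q * c F.v0 l)) * F.abv F.v0 ((A F.v0 * T).mulVec y l) ≤
        2 ^ n * ∑ l ∈ Finset.Iic i, Real.exp (-(q * c F.v0 (π l))) * F.abv F.v0 ((A F.v0 * T).mulVec y (π l)))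
    (ρ : Fin n → ℝ) (hρ : Monotone ρ) (y : Fin n → K) (i : Fin n) (hy : ∀ l, i < l → y l = 0) :
    Real.exp (-(q * ρ i)) * F.H A c q (T.mulVec y) ≤ 2 ^ n * F.H A (F.twist c π ρ) q (T.mulVec y) := by
  have h1 : ∀ v, (if v = F.v0 then Real.exp (-(q * ρ i)) else 1) * F.N A c q (T.mulVec y) v ≤
      (if v = F.v0 then 2 ^ n else 1) * F.N A (F.twist c π ρ) q (T.mulVec y) v := by
    intro v
    by_cases hv : v = F.v0
    · subst hv
      rw [if_pos rfl, if_pos rfl]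
      have h2 := mul_le_mul_of_nonneg_left (hπ i y hy) (Real.exp_pos (-(q * ρ i))).le
      unfold N
      simp only [Matrix.mulVec_mulVec]
      refine h2.trans ?_
      rw [mul_left_comm]
      refine mul_le_mul_of_nonneg_left ?_ (by positivity)
      rw [Finset.mul_sum]
      have e : ∑ l, Real.exp (-(q * F.twist c π ρ F.v0 l)) * F.abv F.v0 ((A F.v0 * T).mulVec y l) =
          ∑ l, Real.exp (-(q * F.twist c π ρ F.v0 (π l))) * F.abv F.v0 ((A F.v0 * T).mulVec y (π l)) :=
        (Equiv.sum_comp π fun l => Real.exp (-(q * F.twist c π ρ F.v0 l)) * F.abv F.v0 ((A F.v0 * T).mulVec y l)).symm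
      rw [e]
      refine (Finset.sum_le_sum fun l hl => ?_).trans (Finset.sum_le_univ_sum_of_nonneg fun l =>
        mul_nonneg (Real.exp_pos _).le ((F.abv F.v0).nonneg _))
      rw [← mul_assoc, ← Real.exp_add]
      refine mul_le_mul_of_nonneg_right (Real.exp_le_exp.2 ?_) ((F.abv F.v0).nonneg _)
      simp only [twist, if_true, Equiv.symm_apply_apply]
      have := mul_le_mul_of_nonneg_left (hρ (Finset.mem_Iic.1 hl)) hq
      linarith
    · rw [if_neg hv, if_neg hv, one_mul, one_mul]
      refine le_of_eq ?_
      unfold N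
      simp [twist, hv]
  have h2 := F.pr_le (fun v => mul_nonneg (by split_ifs <;> positivity) (F.N_nonneg A c q _ v)) h1
  rw [F.pr_mul, F.pr_mul] at h2
  have e : ∀ a : ℝ, F.pr (fun v => if v = F.v0 then a else 1) = a := by
    intro a
    unfold pr
    rw [Finset.prod_eq_single F.v0]
    · simp [F.m_v0]
    · intro v _ hv
      simp [hv]
    · simp
  rw [e, e] at h2
  exact h2

lemma exists_top {y : Fin n → K} (hy : y ≠ 0) : ∃ i, y i ≠ 0 ∧ ∀ l, i < l → y l = 0 := by
  classical
  obtain ⟨l1, hl1⟩ := Function.ne_iff.1 hy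
  obtain ⟨l, hl, hmax⟩ := (Finset.univ.filter fun l => y l ≠ 0).exists_max_image id ⟨l1, by simpa using hl1⟩
  refine ⟨l, by simpa using hl, fun l' hl' => ?_⟩
  by_contra h
  exact absurd (hmax l' (by simpa using h)) (not_le.2 hl')

lemma exists_twist (c : F.ι → Fin n → ℝ) (𝒰 : Ultrafilter ℕ) (q : ℕ → ℝ) (hq : Tendsto q 𝒰 atTop)
    (T : ℕ → Matrix (Fin n) (Fin n) K) (hdet : ∀ k, (T k).det ≠ 0) (ν : Fin n → ℝ)
    (h : F.PB A c 𝒰 q T ν) (ρ : Fin n → ℝ) (hρ : Monotone ρ) : ∃ π, ∀ ε > 0, ∀ᶠ k in (𝒰 : Filter ℕ), ∀ x : Fin n → K,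
      (∀ i, x i ∈ F.O) → x ≠ 0 → ∃ i, (T k)⁻¹.mulVec x i ≠ 0 ∧ (∀ l, i < l → (T k)⁻¹.mulVec x l = 0) ∧
        Real.exp ((ν i - ρ i - ε) * q k) ≤ F.H A (F.twist c π ρ) (q k) x := by
  choose π hπ using fun k => dav (F.abv F.v0) (A F.v0 * T k) (fun l => Real.exp (-(q k * c F.v0 l))) fun l => Real.exp_pos _
  obtain ⟨π0, hπ0⟩ := ult_const 𝒰 π
  refine ⟨π0, fun ε hε => ?_⟩
  filter_upwards [hπ0, h.all (ε / 2) (by positivity), hq.eventually_ge_atTop 1, hq.eventually_ge_atTop (2 * (n * Real.log 2) / ε)] with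
    k hk0 hk1 hk2 hk3 x hx hx0
  have hu := isUnit_iff_ne_zero.2 (hdet k)
  have hxy : (T k).mulVec ((T k)⁻¹.mulVec x) = x := by
    rw [Matrix.mulVec_mulVec, Matrix.mul_nonsing_inv _ hu, Matrix.one_mulVec]
  have hy0 : (T k)⁻¹.mulVec x ≠ 0 := by
    intro h
    rw [h, Matrix.mulVec_zero] at hxy
    exact hx0 hxy.symm
  obtain ⟨i, hi, hi2⟩ := exists_top hy0
  refine ⟨i, hi, hi2, ?_⟩
  have h1 := F.twist_low A c (q k) (by linarith) (T k) (π k) (hπ k) ρ hρ _ i hi2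
  rw [hxy, hk0] at h1
  have h2 := hk1 i x hx hi
  have h3 := (mul_le_mul_of_nonneg_left h2 (Real.exp_pos (-(q k * ρ i))).le).trans h1
  have h4 : (2 : ℝ) ^ n = Real.exp (n * Real.log 2) := by rw [Real.exp_nat_mul, Real.exp_log (by norm_num)]
  rw [h4, ← Real.exp_add] at h3
  have h5 := mul_le_mul_of_nonneg_left h3 (Real.exp_pos (-(n * Real.log 2))).le
  rw [← mul_assoc, ← Real.exp_add, ← Real.exp_add, neg_add_cancel, Real.exp_zero, one_mul] at h5
  refine le_trans (Real.exp_le_exp.2 ?_) h5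
  rw [div_le_iff₀ hε] at hk3
  linarith

lemma sum_le (hA : ∀ v, (A v).det ≠ 0) (c : F.ι → Fin n → ℝ) (𝒰 : Ultrafilter ℕ) (q : ℕ → ℝ) (hq : Tendsto q 𝒰 atTop)
    (T : ℕ → Matrix (Fin n) (Fin n) K) (hdet : ∀ k, (T k).det ≠ 0) (ν : Fin n → ℝ) (hν : Monotone ν)
    (h : F.PB A c 𝒰 q T ν) : ∑ l, ν l ≤ - F.mc c := by
  obtain ⟨π, hπ⟩ := F.exists_twist A c 𝒰 q hq T hdet ν h ν hν
  obtain ⟨C, hC, hCx⟩ := F.mink1 A hA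
  have hn : (0 : ℝ) < n := by exact_mod_cast Nat.pos_of_ne_zero (NeZero.ne n)
  refine le_of_forall_pos_le_add fun ε hε => ?_
  set ε' : ℝ := ε / (2 * n) with hε'
  have hε0 : 0 < ε' := by positivity
  have hεe : ε = n * ε' + n * ε' := by rw [hε']; field_simp; norm_num
  obtain ⟨k, hk1, hk2, hk3⟩ := ((hπ ε' hε0).and ((hq.eventually_ge_atTop 1).and (hq.eventually_ge_atTop (Real.log C / ε')))).exists
  obtain ⟨x, hx, hx0, hH⟩ := hCx (F.twist c π ν) (q k)
  obtain ⟨i, _, _, h1⟩ := hk1 x hx hx0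
  have h2 := h1.trans hH
  rw [sub_self, zero_sub, F.mc_twist] at h2
  have h3 := Real.log_le_log (Real.exp_pos _) h2
  rw [Real.log_exp, Real.log_mul hC.ne' (Real.exp_pos _).ne', Real.log_exp] at h3
  rw [div_le_iff₀ hε0] at hk3
  have h4 : q k * (F.mc c + ∑ l, ν l) / n ≤ q k * (2 * ε') := by linarith
  rw [div_le_iff₀ hn, mul_assoc] at h4
  have h5 := le_of_mul_le_mul_left h4 (by linarith)
  linarith

end PF

end Part14

section Part15
set_option autoImplicit false
open Filter

namespace PF
variable {K : Type} [Field K] [CharZero K] (F : PF K) {n : ℕ} [NeZero n]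
variable (A : F.ι → Matrix (Fin n) (Fin n) K)

lemma HG_mono (hA : ∀ v, (A v).det ≠ 0) (c : F.ι → Fin n → ℝ) (𝒰 : Ultrafilter ℕ) (q : ℕ → ℝ) (hq : Tendsto q 𝒰 atTop)
    (T : ℕ → Matrix (Fin n) (Fin n) K) (hT : ∀ k i l, T k i l ∈ F.O) (hdet : ∀ k, (T k).det ≠ 0) (ν : Fin n → ℝ)
    (h : F.PA A c 𝒰 q T ν) (hs : ∑ l, ν l ≤ - F.mc c) (hν : Monotone ν) (i0 : Fin n) (hi0 : ∀ l, l ≤ i0) (μ : ℝ)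
    (hμ : ∀ l, l ≠ i0 → ν l ≤ μ) (hμ0 : μ < ν i0) :
    ∃ M0 : Fin n → K, M0 ≠ 0 ∧ ∀ᶠ k in (𝒰 : Filter ℕ), ∀ l, l ≠ i0 → M0 ⬝ᵥ (fun i => T k i l) = 0 := by
  have hPB := F.pb_of_pa A hA c 𝒰 q hq T hT hdet ν h hs
  have hs2 := F.sum_ge A hA c 𝒰 q hq T hT hdet ν h
  set ρ : Fin n → ℝ := fun l => min (ν l) μ with hρ
  have hρm : Monotone ρ := fun a b hab => min_le_min_right _ (hν hab)
  obtain ⟨π, hπ⟩ := F.exists_twist A c 𝒰 q hq T hdet ν hPB ρ hρm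
  have hρl : ∀ l, l ≠ i0 → ρ l = ν l := fun l hl => min_eq_left (hμ l hl)
  have hρ0 : ρ i0 = μ := min_eq_right hμ0.le
  set c' := F.twist c π ρ with hc'
  have hmc : F.mc c' = - (ν i0 - μ) := by
    rw [hc', F.mc_twist]
    have e1 : ∑ l, ρ l = ∑ l, ν l - (ν i0 - μ) := by
      rw [← Finset.add_sum_erase _ _ (Finset.mem_univ i0), ← Finset.add_sum_erase _ ν (Finset.mem_univ i0), hρ0,
        Finset.sum_congr rfl fun l hl => hρl l (Finset.ne_of_mem_erase hl)]
      ring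
    rw [e1]; linarith
  obtain ⟨T', ν', hT', hdet', hν', hPA', hPB'⟩ := F.minima A hA c' 𝒰 q hq
  have hsum' := F.sum_le A hA c' 𝒰 q hq T' hdet' ν' hν' hPB'
  have hcol : ∀ k l, (fun i => T' k i l) ≠ 0 := by
    intro k l h0
    exact hdet' k (Matrix.det_eq_zero_of_column_eq_zero l fun i => congrFun h0 i)
  -- lower bounds for the minima of the twisted problem
  have hcmp : ∀ (a b : ℝ), (∀ ε > 0, ∃ᶠ k in (𝒰 : Filter ℕ), Real.exp ((a - ε) * q k) ≤ Real.exp ((b + ε) * q k)) → a ≤ b := by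
    intro a b hab
    refine le_of_forall_pos_le_add fun ε hε => ?_
    obtain ⟨k, hk1, hk2⟩ := ((hab (ε / 2) (by positivity)).and_eventually (hq.eventually_ge_atTop 1)).exists
    have := le_of_mul_le_mul_right (Real.exp_le_exp.1 hk1) (by linarith)
    linarith
  have hν0 : ∀ l, 0 ≤ ν' l := by
    intro l
    refine hcmp _ _ fun ε hε => Eventually.frequently ?_
    filter_upwards [hπ ε hε, hPA' ε hε l, hq.eventually_ge_atTop 1] with k hk1 hk2 hk3
    obtain ⟨i, _, _, hi⟩ := hk1 _ (fun i => hT' k i l) (hcol k l)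
    refine le_trans (Real.exp_le_exp.2 ?_) (hi.trans hk2)
    have : ρ i ≤ ν i := min_le_left _ _
    exact mul_le_mul_of_nonneg_right (by linarith) (by linarith)
  have hνg : ∀ l, (∃ᶠ k in (𝒰 : Filter ℕ), ((T k)⁻¹ * T' k) i0 l ≠ 0) → ν i0 - μ ≤ ν' l := by
    intro l hl
    refine hcmp _ _ fun ε hε => ?_
    refine (hl.and_eventually ((hπ ε hε).and (hPA' ε hε l))).mono fun k hk => ?_
    obtain ⟨hk0, hk1, hk2⟩ := hk
    obtain ⟨i, _, hi2, hi⟩ := hk1 _ (fun i => hT' k i l) (hcol k l)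
    have : i = i0 := by
      by_contra hne
      exact hk0 (hi2 i0 (lt_of_le_of_ne (hi0 i) hne))
    subst this
    rw [hρ0] at hi
    exact hi.trans hk2
  -- the distinguished column
  have hex : ∀ k, ∃ l, ((T k)⁻¹ * T' k) i0 l ≠ 0 := by
    intro k
    by_contra hcon
    push Not at hcon
    have := Matrix.det_eq_zero_of_row_eq_zero i0 hcon
    rw [Matrix.det_mul, Matrix.det_nonsing_inv, Ring.inverse_eq_inv'] at this
    exact mul_ne_zero (inv_ne_zero (hdet k)) (hdet' k) this
  choose ls hls using hex
  obtain ⟨l0, hl0⟩ := ult_const 𝒰 ls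
  have hl0' : ∀ᶠ k in (𝒰 : Filter ℕ), ((T k)⁻¹ * T' k) i0 l0 ≠ 0 := hl0.mono fun k hk => hk ▸ hls k
  have hg0 := hνg l0 hl0'.frequently
  have hoth : ∀ l, l ≠ l0 → ν' l ≤ 0 := by
    intro l hl
    have e1 : ν' l0 + ν' l ≤ ∑ l, ν' l := by
      rw [← Finset.add_sum_erase _ _ (Finset.mem_univ l0)]
      have := Finset.single_le_sum (f := ν') (fun i _ => hν0 i) (Finset.mem_erase.2 ⟨hl, Finset.mem_univ l⟩)
      linarith
    linarith
  have hz : ∀ l, l ≠ l0 → ∀ᶠ k in (𝒰 : Filter ℕ), ((T k)⁻¹ * T' k) i0 l = 0 := by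
    intro l hl
    by_contra hcon
    have := hνg l (Filter.not_eventually.1 hcon)
    have := hoth l hl
    linarith
  have hmain := HT F A hA c' (by have : F.mc c' < 0 := by linarith
                                 exact this) 𝒰 q hq l0 T' hT' (by
    intro k h0
    have h1 := Matrix.det_eq_zero_of_row_eq_zero (A := (T' k).adjugate) l0 fun i => congrFun h0 i
    rw [Matrix.det_adjugate] at h1
    exact hdet' k (by by_contra hne; exact pow_ne_zero _ hne h1)) (fun k i v => F.N A c' (q k) (fun j => T' k j i) v) (fun k i v => F.N_pos A c' (q k) hA (hcol k i) v)
    (fun k v i' i _ => F.abv_le_N A c' (q k) (fun j => T' k j i) v i')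
    (fun ε hε i hi => by
      filter_upwards [hPA' ε hε i, hq.eventually_ge_atTop 1] with k hk1 hk2
      refine le_trans hk1 (Real.exp_le_exp.2 (mul_le_mul_of_nonneg_right ?_ (by linarith)))
      have := hoth i hi
      linarith)
  obtain ⟨M0, hM0, hM⟩ := hmain
  refine ⟨M0, hM0, ?_⟩
  have hz' : ∀ᶠ k in (𝒰 : Filter ℕ), ∀ l, l ≠ l0 → ((T k)⁻¹ * T' k) i0 l = 0 := by
    refine Filter.eventually_all.2 fun l => ?_
    by_cases hl : l = l0
    · exact Eventually.of_forall fun k hk => absurd hl hk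
    · exact (hz l hl).mono fun k hk _ => hk
  filter_upwards [hM, hz', hl0'] with k hk1 hk2 hk3 l hl
  have hu := isUnit_iff_ne_zero.2 (hdet k)
  have hu' := isUnit_iff_ne_zero.2 (hdet' k)
  have hZY : ((T k)⁻¹ * T' k) * ((T' k)⁻¹ * T k) = 1 := by
    rw [Matrix.mul_assoc, ← Matrix.mul_assoc (T' k), Matrix.mul_nonsing_inv _ hu', Matrix.one_mul, Matrix.nonsing_inv_mul _ hu]
  have hY : ((T' k)⁻¹ * T k) l0 l = 0 := by
    have e := congrFun (congrFun hZY i0) l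
    rw [Matrix.mul_apply, Finset.sum_eq_single l0 (fun j _ hj => by rw [hk2 j hj, zero_mul]) (by simp), Matrix.one_apply_ne hl.symm] at e
    exact (mul_eq_zero.1 e).resolve_left hk3
  have hTT : T k = T' k * ((T' k)⁻¹ * T k) := by
    rw [← Matrix.mul_assoc, Matrix.mul_nonsing_inv _ hu', Matrix.one_mul]
  have e2 : M0 ⬝ᵥ (fun i => T k i l) = (Matrix.vecMul M0 (T k)) l := rfl
  rw [e2, hTT, ← Matrix.vecMul_vecMul]
  change ∑ j, Matrix.vecMul M0 (T' k) j * ((T' k)⁻¹ * T k) j l = 0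
  refine Finset.sum_eq_zero fun j _ => ?_
  by_cases hj : j = l0
  · subst hj; rw [hY, mul_zero]
  · have : Matrix.vecMul M0 (T' k) j = 0 := hk1 j hj
    rw [this, zero_mul]

lemma HG (hA : ∀ v, (A v).det ≠ 0) (c : F.ι → Fin n → ℝ) (𝒰 : Ultrafilter ℕ) (q : ℕ → ℝ) (hq : Tendsto q 𝒰 atTop)
    (T : ℕ → Matrix (Fin n) (Fin n) K) (hT : ∀ k i l, T k i l ∈ F.O) (hdet : ∀ k, (T k).det ≠ 0) (ν : Fin n → ℝ)
    (h : F.PA A c 𝒰 q T ν) (hs : ∑ l, ν l ≤ - F.mc c) (i0 : Fin n) (μ : ℝ)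
    (hμ : ∀ l, l ≠ i0 → ν l ≤ μ) (hμ0 : μ < ν i0) :
    ∃ M0 : Fin n → K, M0 ≠ 0 ∧ ∀ᶠ k in (𝒰 : Filter ℕ), ∀ l, l ≠ i0 → M0 ⬝ᵥ (fun i => T k i l) = 0 := by
  set σ := Tuple.sort ν with hσ
  have hm : Monotone (ν ∘ σ) := Tuple.monotone_sort ν
  obtain ⟨M0, h0, hM⟩ := F.HG_mono A hA c 𝒰 q hq (fun k => (T k).submatrix id σ) (fun k i l => hT k i (σ l))
    (fun k => by
      rw [Matrix.det_permute']
      refine mul_ne_zero ?_ (hdet k)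
      rcases Int.units_eq_one_or (Equiv.Perm.sign σ) with h | h <;> simp [h]) (ν ∘ σ) (fun ε hε l => h ε hε (σ l))
    (by
      have : ∑ l, (ν ∘ σ) l = ∑ l, ν l := Equiv.sum_comp σ ν
      rw [this]; exact hs) hm (σ.symm i0) (fun l => by
        by_contra hl
        push Not at hl
        have h1 := hm hl.le
        simp only [Function.comp, Equiv.apply_symm_apply] at h1
        have h2 := hμ (σ l) (fun h => hl.ne (by rw [← h, Equiv.symm_apply_apply]))
        linarith) μ (fun l hl => hμ (σ l) fun h => hl (by rw [← h, Equiv.symm_apply_apply])) (by simpa using hμ0)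
  refine ⟨M0, h0, hM.mono fun k hk l hl => ?_⟩
  have := hk (σ.symm l) (fun h => hl (σ.symm.injective h))
  simpa using this

end PF

end Part15

section Part16
set_option autoImplicit false
open Filter

section compound
variable {K : Type} [Field K] {n p : ℕ}

/-- the increasing enumeration of a subset -/
noncomputable def pcEmb (J : Set.powersetCard (Fin n) p) : Fin p ↪o Fin n := Set.powersetCard.ofFinEmbEquiv.symm J

noncomputable instance pcFintype : Fintype (Set.powersetCard (Fin n) p) := Fintype.ofFinite _

/-- compound matrix -/
noncomputable def cmpd (p : ℕ) (A : Matrix (Fin n) (Fin n) K) :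
    Matrix (Set.powersetCard (Fin n) p) (Set.powersetCard (Fin n) p) K := 
  open Classical in
  LinearMap.toMatrix ((Pi.basisFun K (Fin n)).exteriorPower p) ((Pi.basisFun K (Fin n)).exteriorPower p)
    (exteriorPower.map p (Matrix.toLin' A))

lemma cmpd_mul (A B : Matrix (Fin n) (Fin n) K) : cmpd p (A * B) = cmpd p A * cmpd p B := by
  classical
  unfold cmpd
  rw [← LinearMap.toMatrix_comp, Matrix.toLin'_mul, exteriorPower.map_comp]

lemma cmpd_one : cmpd p (1 : Matrix (Fin n) (Fin n) K) = 1 := by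
  classical
  unfold cmpd
  rw [Matrix.toLin'_one, exteriorPower.map_id, LinearMap.toMatrix_id]

lemma cmpd_apply (A : Matrix (Fin n) (Fin n) K) (J L : Set.powersetCard (Fin n) p) :
    cmpd p A J L = (Matrix.of fun i j => A (pcEmb J j) (pcEmb L i)).det := by
  classical
  unfold cmpd
  rw [LinearMap.toMatrix_apply, exteriorPower.basis_apply, exteriorPower.ιMulti_family, exteriorPower.map_apply_ιMulti,
    exteriorPower.basis_repr_apply, exteriorPower.ιMultiDual_apply_ιMulti]
  congr 1
  ext i j
  simp [pcEmb]

lemma cmpd_det (A : Matrix (Fin n) (Fin n) K) (hA : A.det ≠ 0) : (cmpd p A).det ≠ 0 := by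
  have h : cmpd p A * cmpd p A⁻¹ = 1 := by
    rw [← cmpd_mul, Matrix.mul_nonsing_inv _ (isUnit_iff_ne_zero.2 hA), cmpd_one]
  intro h0
  have := congrArg Matrix.det h
  rw [Matrix.det_mul, h0, zero_mul, Matrix.det_one] at this
  exact zero_ne_one this

lemma pcEmb_mem (J : Set.powersetCard (Fin n) p) (j : Fin p) : pcEmb J j ∈ J.1 := by
  have := (Set.powersetCard.mem_range_ofFinEmbEquiv_symm_iff_mem J (pcEmb J j)).1 ⟨j, rfl⟩
  exact this

lemma pcEmb_sum (J : Set.powersetCard (Fin n) p) (f : Fin n → ℝ) : ∑ j, f (pcEmb J j) = ∑ i ∈ J.1, f i := by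
  have h : Finset.univ.map (pcEmb J).toEmbedding = J.1 := by
    apply Finset.eq_of_subset_of_card_le
    · intro x hx
      obtain ⟨j, _, rfl⟩ := Finset.mem_map.1 hx
      exact pcEmb_mem J j
    · rw [Finset.card_map, Finset.card_univ, Fintype.card_fin]
      exact J.2.le
  rw [← h, Finset.sum_map]
  rfl

lemma pcEmb_surj (J : Set.powersetCard (Fin n) p) (g : Fin p → Fin n) (hg : StrictMono g) (h : ∀ j, g j ∈ J.1) : g = pcEmb J := by
  exact Finset.orderEmbOfFin_unique J.2 h hg

lemma pc_sum_sum (hp : 1 ≤ p) (f : Fin n → ℝ) :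
    ∑ J : Set.powersetCard (Fin n) p, ∑ j, f (pcEmb J j) = ((n - 1).choose (p - 1) : ℕ) * ∑ i, f i := by
  simp only [pcEmb_sum]
  have h1 : ∑ J : Set.powersetCard (Fin n) p, ∑ i ∈ J.1, f i = ∑ s ∈ Finset.powersetCard p Finset.univ, ∑ i ∈ s, f i := by
    refine (Finset.sum_subtype (Finset.powersetCard p Finset.univ) (p := fun s => s ∈ Set.powersetCard (Fin n) p) (fun s => ?_) fun s => ∑ i ∈ s, f i).symm
    rw [Finset.mem_powersetCard_univ]
    rfl
  have h2 : ∀ s : Finset (Fin n), ∑ i ∈ s, f i = ∑ i, if {i} ⊆ s then f i else 0 := by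
    intro s
    simp only [Finset.singleton_subset_iff]
    rw [Finset.sum_ite_mem, Finset.univ_inter]
  rw [h1]
  simp only [h2]
  rw [Finset.sum_comm, Finset.mul_sum]
  refine Finset.sum_congr rfl fun i _ => ?_
  rw [← Finset.sum_filter, Finset.sum_const, nsmul_eq_mul, Finset.card_filter_powersetCard_subset _ _ _ (by simp) (by simpa using hp)]
  simp

/-- If an alternating form kills all the `p`-fold products of columns of `T` except the one
indexed by `P`, then it kills every product which has a factor without components along `P`. -/
lemma alt_kill (T : Matrix (Fin n) (Fin n) K) (hT : T.det ≠ 0) (f : (Fin n → K) [⋀^Fin p]→ₗ[K] K) (P : Set.powersetCard (Fin n) p)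
    (hf : ∀ L : Set.powersetCard (Fin n) p, L ≠ P → f (fun j i => T i (pcEmb L j)) = 0) (x : Fin n → K)
    (hx : ∀ l ∈ P.1, T⁻¹.mulVec x l = 0) (w : Fin p → Fin n → K) (a : Fin p) (hw : w a = x) : f w = 0 := by
  classical
  have hu := isUnit_iff_ne_zero.2 hT
  set g := f.compLinearMap (Matrix.toLin' T) with hg
  let π : (Fin n → K) →ₗ[K] (Fin n → K) := LinearMap.pi fun i => if i ∈ P.1 then LinearMap.proj i else 0
  have hπ : ∀ y i, π y i = if i ∈ P.1 then y i else 0 := by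
    intro y i
    by_cases hi : i ∈ P.1 <;> simp [π, hi]
  have h1 : g = g.compLinearMap π := by
    refine Module.Basis.ext_alternating (Pi.basisFun K (Fin n)) fun v hv => ?_
    by_cases hP : ∀ j, v j ∈ P.1
    · rw [AlternatingMap.compLinearMap_apply]
      refine congrArg g (funext fun j => ?_)
      ext i
      rw [hπ, Pi.basisFun_apply]
      split_ifs with h
      · simp
      · rw [Pi.single_apply, if_neg]
        rintro rfl
        exact h (hP j)
    · push Not at hP
      obtain ⟨j, hj⟩ := hP
      have hz : g.compLinearMap π (fun i => Pi.basisFun K (Fin n) (v i)) = 0 := by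
        rw [AlternatingMap.compLinearMap_apply]
        refine AlternatingMap.map_coord_zero _ j ?_
        ext i
        rw [hπ, Pi.basisFun_apply]
        split_ifs with h
        · rw [Pi.single_apply, if_neg]
          · rfl
          · rintro rfl
            exact hj h
        · rfl
      rw [hz]
      set σ := Tuple.sort v with hσ
      have hm : StrictMono (v ∘ σ) := (Tuple.monotone_sort v).strictMono_of_injective (hv.comp σ.injective)
      let L : Set.powersetCard (Fin n) p := ⟨Finset.univ.image v, by
        change (Finset.univ.image v).card = p
        rw [Finset.card_image_of_injective _ hv]; simp⟩
      have hL : v ∘ σ = pcEmb L := pcEmb_surj L _ hm fun j => Finset.mem_image_of_mem _ (Finset.mem_univ _)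
      have hLP : L ≠ P := by
        intro h
        apply hj
        rw [← h]
        exact Finset.mem_image_of_mem _ (Finset.mem_univ _)
      have h2 := AlternatingMap.map_congr_perm g (v := fun i => Pi.basisFun K (Fin n) (v i)) σ
      rw [h2]
      have h3 : g ((fun i => Pi.basisFun K (Fin n) (v i)) ∘ σ) = 0 := by
        rw [← hf L hLP, hg, AlternatingMap.compLinearMap_apply]
        congr 1
        funext j
        have : v (σ j) = pcEmb L j := congrFun hL j
        simp only [Function.comp_apply, this, Pi.basisFun_apply]
        rw [Matrix.toLin'_apply, Matrix.mulVec_single_one]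
        rfl
      rw [h3, smul_zero]
  have h2 : f w = g (fun j => T⁻¹.mulVec (w j)) := by
    rw [hg, AlternatingMap.compLinearMap_apply]
    congr 1
    funext j
    rw [Matrix.toLin'_apply, Matrix.mulVec_mulVec, Matrix.mul_nonsing_inv _ hu, Matrix.one_mulVec]
  rw [h2, h1, AlternatingMap.compLinearMap_apply]
  refine AlternatingMap.map_coord_zero _ a ?_
  ext i
  rw [hπ, hw]
  split_ifs with h
  · exact hx i h
  · rfl

/-- from a linear form on the exterior power to a linear form -/
lemma exists_form (M0 : Set.powersetCard (Fin n) p → K) (hM0 : M0 ≠ 0) (hp : 1 ≤ p) :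
    ∃ M : Fin n → K, M ≠ 0 ∧ ∀ (T : Matrix (Fin n) (Fin n) K) (_ : T.det ≠ 0) (P : Set.powersetCard (Fin n) p)
      (_ : ∀ L, L ≠ P → M0 ⬝ᵥ (fun J => cmpd p T J L) = 0) (x : Fin n → K) (_ : ∀ l ∈ P.1, T⁻¹.mulVec x l = 0), M ⬝ᵥ x = 0 := by
  classical
  set b := (Pi.basisFun K (Fin n)).exteriorPower p with hb
  let φ : ⋀[K]^p (Fin n → K) →ₗ[K] K := ∑ J, M0 J • b.coord J
  let f := φ.compAlternatingMap (exteriorPower.ιMulti K p (M := Fin n → K))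
  have hfw : ∀ w, f w = ∑ J, M0 J * b.repr (exteriorPower.ιMulti K p w) J := by
    intro w
    simp [f, φ]
  obtain ⟨J0, hJ0⟩ := Function.ne_iff.1 hM0
  have hfJ : f (fun j => Pi.single (pcEmb J0 j) 1) = M0 J0 := by
    rw [hfw]
    have : exteriorPower.ιMulti K p (fun j => (Pi.single (pcEmb J0 j) 1 : Fin n → K)) = b J0 := by
      rw [hb, exteriorPower.basis_apply, exteriorPower.ιMulti_family]
      congr 1
      funext j
      simp [pcEmb]
    rw [this]
    simp [Finsupp.single_apply]
  let a : Fin p := ⟨0, hp⟩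
  let e : Fin p → Fin n → K := fun j => Pi.single (pcEmb J0 j) 1
  let m : (Fin n → K) →ₗ[K] K := f.toMultilinearMap.toLinearMap e a
  have hm : ∀ u, m u = f (Function.update e a u) := fun u => rfl
  have hmx : ∀ x : Fin n → K, (fun i => m (Pi.single i 1)) ⬝ᵥ x = m x := by
    intro x
    rw [LinearMap.pi_apply_eq_sum_univ m x]
    refine Finset.sum_congr rfl fun i _ => ?_
    rw [smul_eq_mul, mul_comm]
    refine congrArg (x i * ·) (congrArg m (funext fun j => ?_))
    simp [Pi.single_apply, eq_comm]
  refine ⟨fun i => m (Pi.single i 1), fun h0 => hJ0 ?_, ?_⟩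
  · have := congrFun h0 (pcEmb J0 a)
    simp only [hm] at this
    rw [← hfJ]
    refine Eq.trans ?_ this
    congr 1
    exact (Function.update_eq_self a e).symm
  · intro T hT P hP x hx
    rw [hmx, hm]
    refine alt_kill T hT f P (fun L hL => ?_) x hx _ a (Function.update_self _ _ _)
    rw [← hP L hL, hfw]
    refine Finset.sum_congr rfl fun J _ => ?_
    congr 1
    change _ = cmpd p T J L
    unfold cmpd
    rw [LinearMap.toMatrix_apply, ← hb, exteriorPower.basis_apply, exteriorPower.ιMulti_family, exteriorPower.map_apply_ιMulti]
    congr 3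
    funext j
    ext i
    simp [pcEmb]

end compound

end Part16

section Part17
set_option autoImplicit false
open Filter

namespace PF
variable {K : Type} [Field K] [CharZero K] (F : PF K) {n : ℕ} [NeZero n]
variable (A : F.ι → Matrix (Fin n) (Fin n) K)

lemma HG' (hA : ∀ v, (A v).det ≠ 0) (c : F.ι → Fin n → ℝ) (𝒰 : Ultrafilter ℕ) (q : ℕ → ℝ) (hq : Tendsto q 𝒰 atTop)
    (T : ℕ → Matrix (Fin n) (Fin n) K) (hT : ∀ k i l, T k i l ∈ F.O) (hdet : ∀ k, (T k).det ≠ 0) (ν : Fin n → ℝ)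
    (h : F.PA A c 𝒰 q T ν) (hs : ∑ l, ν l ≤ - F.mc c) (i0 : Fin n) (hμ : ∀ l, l ≠ i0 → ν l < ν i0) :
    ∃ M0 : Fin n → K, M0 ≠ 0 ∧ ∀ᶠ k in (𝒰 : Filter ℕ), ∀ l, l ≠ i0 → M0 ⬝ᵥ (fun i => T k i l) = 0 := by
  rcases (Finset.univ.erase i0).eq_empty_or_nonempty with h0 | h0
  · refine F.HG A hA c 𝒰 q hq T hT hdet ν h hs i0 (ν i0 - 1) (fun l hl => ?_) (by linarith)
    exact absurd (Finset.mem_erase.2 ⟨hl, Finset.mem_univ l⟩) (by rw [h0]; simp)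
  · obtain ⟨j, hj, hmax⟩ := Finset.exists_max_image _ ν h0
    exact F.HG A hA c 𝒰 q hq T hT hdet ν h hs i0 (ν j) (fun l hl => hmax l (Finset.mem_erase.2 ⟨hl, Finset.mem_univ l⟩))
      (hμ j (Finset.ne_of_mem_erase hj))

/-- the compound system -/
lemma cmpd_bound {p N : ℕ} (e : Fin N ≃ Set.powersetCard (Fin n) p) (c : F.ι → Fin n → ℝ) (q : ℝ) (T : Matrix (Fin n) (Fin n) K) (L : Fin N) :
    F.H (fun v => (cmpd p (A v)).submatrix e e) (fun v J => ∑ j, c v (pcEmb (e J) j)) q (fun J => (cmpd p T).submatrix e e J L) ≤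
      ((N * p.factorial : ℕ) : ℝ) ^ F.M * ∏ j, F.H A c q (fun i => T i (pcEmb (e L) j)) := by
  have key : ∀ v, F.N (fun v => (cmpd p (A v)).submatrix e e) (fun v J => ∑ j, c v (pcEmb (e J) j)) q (fun J => (cmpd p T).submatrix e e J L) v ≤
      ((N * p.factorial : ℕ) : ℝ) * ∏ j, F.N A c q (fun i => T i (pcEmb (e L) j)) v := by
    intro v
    have h1 : ∀ J : Fin N, Real.exp (-(q * ∑ j, c v (pcEmb (e J) j))) *
        F.abv v (((cmpd p (A v)).submatrix e e).mulVec (fun J => (cmpd p T).submatrix e e J L) J) ≤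
        p.factorial * ∏ j, F.N A c q (fun i => T i (pcEmb (e L) j)) v := by
      intro J
      have e1 : ((cmpd p (A v)).submatrix e e).mulVec (fun J => (cmpd p T).submatrix e e J L) J = cmpd p (A v * T) (e J) (e L) := by
        rw [cmpd_mul]
        change (((cmpd p (A v)).submatrix e e) * ((cmpd p T).submatrix e e)) J L = _
        rw [Matrix.submatrix_mul_equiv]
        rfl
      rw [e1, cmpd_apply]
      have h2 := abv_det_le (F.abv v) (Matrix.of fun i j => (A v * T) (pcEmb (e J) j) (pcEmb (e L) i))
        (fun j => F.N A c q (fun i => T i (pcEmb (e L) j)) v) (fun j => Real.exp (q * c v (pcEmb (e J) j))) (fun i j =>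
          F.abv_le_N A c q (fun i' => T i' (pcEmb (e L) i)) v (pcEmb (e J) j))
      rw [← Real.exp_sum, ← Finset.mul_sum, Fintype.card_fin] at h2
      refine (mul_le_mul_of_nonneg_left h2 (Real.exp_pos _).le).trans (le_of_eq ?_)
      rw [Real.exp_neg]
      field_simp
    refine (Finset.sum_le_sum fun J _ => h1 J).trans (le_of_eq ?_)
    rw [Finset.sum_const, Finset.card_univ, Fintype.card_fin, nsmul_eq_mul]
    push_cast
    ring
  refine (F.pr_le (fun v => F.N_nonneg _ _ _ _ v) key).trans (le_of_eq ?_)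
  rw [F.pr_mul, F.pr_const, F.pr_prod]
  rfl

/-- **The Subspace Theorem** (in a form suited to ultrafilters) -/
theorem subspace (hA : ∀ v, (A v).det ≠ 0) (c : F.ι → Fin n → ℝ) (hc : F.mc c < 0) (𝒰 : Ultrafilter ℕ) (q : ℕ → ℝ)
    (hq : Tendsto q 𝒰 atTop) (x : ℕ → Fin n → K) (hx : ∀ k i, x k i ∈ F.O)
    (hH : ∀ ε > 0, ∀ᶠ k in (𝒰 : Filter ℕ), F.H A c (q k) (x k) ≤ Real.exp (ε * q k)) :
    ∃ M0 : Fin n → K, M0 ≠ 0 ∧ ∀ᶠ k in (𝒰 : Filter ℕ), M0 ⬝ᵥ x k = 0 := by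
  classical
  obtain ⟨T, ν, hT, hdet, hν, hPA, hPB⟩ := F.minima A hA c 𝒰 q hq
  have hs1 := F.sum_ge A hA c 𝒰 q hq T hT hdet ν hPA
  have hs2 := F.sum_le A hA c 𝒰 q hq T hdet ν hν hPB
  set P : Finset (Fin n) := Finset.univ.filter fun l => 0 < ν l with hP
  set p := P.card with hp
  let P' : Set.powersetCard (Fin n) p := ⟨P, rfl⟩
  have hPne : P.Nonempty := by
    obtain ⟨l, _, hl⟩ := Finset.exists_lt_of_sum_lt (s := Finset.univ) (f := fun _ : Fin n => (0 : ℝ)) (g := ν) (by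
      rw [Finset.sum_const_zero]; linarith)
    exact ⟨l, by simpa [hP] using hl⟩
  have hp1 : 1 ≤ p := hPne.card_pos
  have hxP : ∀ᶠ k in (𝒰 : Filter ℕ), ∀ l ∈ P, (T k)⁻¹.mulVec (x k) l = 0 := by
    refine (Filter.eventually_all_finset P).2 fun l hl => ?_
    have hl0 : 0 < ν l := (Finset.mem_filter.1 hl).2
    filter_upwards [hPB (ν l / 3) (by linarith) l, hH (ν l / 3) (by linarith), hq.eventually_ge_atTop 1] with k hk1 hk2 hk3
    by_contra hne
    have := le_of_mul_le_mul_right (Real.exp_le_exp.1 ((hk1 (x k) (hx k) hne).trans hk2)) (by linarith)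
    linarith
  set N := Fintype.card (Set.powersetCard (Fin n) p) with hN
  let e : Fin N ≃ Set.powersetCard (Fin n) p := (Fintype.equivFin _).symm
  haveI : NeZero N := ⟨by
    rw [hN]
    exact (Fintype.card_pos_iff.2 ⟨P'⟩).ne'⟩
  set ν' : Fin N → ℝ := fun J => ∑ j, ν (pcEmb (e J) j) with hν'
  have hC0 : (0 : ℝ) ≤ ((N * p.factorial : ℕ) : ℝ) ^ F.M := by positivity
  have hPA' : F.PA (fun v => (cmpd p (A v)).submatrix e e) (fun v J => ∑ j, c v (pcEmb (e J) j)) 𝒰 q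
      (fun k => (cmpd p (T k)).submatrix e e) ν' := by
    intro ε hε L
    set C : ℝ := ((N * p.factorial : ℕ) : ℝ) ^ F.M with hC
    set ε' := ε / (p + 1) with hε'
    have hε0 : 0 < ε' := by positivity
    have hεe : ε = p * ε' + ε' := by rw [hε']; field_simp
    have hCq : ∀ᶠ k in (𝒰 : Filter ℕ), C ≤ Real.exp (ε' * q k) :=
      (Real.tendsto_exp_atTop.comp (hq.const_mul_atTop hε0)).eventually_ge_atTop C
    filter_upwards [hPA.all ε' hε0, hCq] with k hk1 hk2
    refine (F.cmpd_bound A e c (q k) (T k) L).trans ?_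
    have h1 : ∏ j, F.H A c (q k) (fun i => T k i (pcEmb (e L) j)) ≤ Real.exp (∑ j, (ν (pcEmb (e L) j) + ε') * q k) := by
      rw [Real.exp_sum]
      exact Finset.prod_le_prod (fun l _ => F.H_nonneg A c _ _) fun l _ => hk1 _
    refine (mul_le_mul hk2 h1 (Finset.prod_nonneg fun l _ => F.H_nonneg A c _ _) (Real.exp_pos _).le).trans ?_
    rw [← Real.exp_add, ← Finset.sum_mul, Finset.sum_add_distrib]
    simp only [Finset.sum_const, Finset.card_univ, Fintype.card_fin, nsmul_eq_mul]
    refine Real.exp_le_exp.2 (le_of_eq ?_)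
    rw [hεe]
    ring
  have hsum : ∀ f : Fin n → ℝ, ∑ J : Fin N, ∑ j, f (pcEmb (e J) j) = ((n - 1).choose (p - 1) : ℕ) * ∑ i, f i := by
    intro f
    rw [Equiv.sum_comp e fun J => ∑ j, f (pcEmb J j)]
    exact pc_sum_sum hp1 f
  obtain ⟨M0, hM0, hM⟩ := F.HG' (fun v => (cmpd p (A v)).submatrix e e) (fun v => by
      rw [Matrix.det_submatrix_equiv_self]; exact cmpd_det _ (hA v)) (fun v J => ∑ j, c v (pcEmb (e J) j)) 𝒰 q hq
    (fun k => (cmpd p (T k)).submatrix e e) (fun k J L => by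
      rw [Matrix.submatrix_apply, cmpd_apply]
      exact F.det_mem _ fun i j => hT k _ _) (fun k => by
      rw [Matrix.det_submatrix_equiv_self]; exact cmpd_det _ (hdet k)) ν' hPA' (by
      unfold mc
      simp only [hsum, hν']
      have : ∑ v, F.m v * (((n - 1).choose (p - 1) : ℕ) * ∑ i, c v i) = ((n - 1).choose (p - 1) : ℕ) * F.mc c := by
        unfold mc
        rw [Finset.mul_sum]
        exact Finset.sum_congr rfl fun v _ => by ring
      rw [this, ← mul_neg]
      exact mul_le_mul_of_nonneg_left hs2 (Nat.cast_nonneg _)) (e.symm P') (by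
      intro L hL
      have hLP : e L ≠ P' := fun h => hL (by rw [← h, Equiv.symm_apply_apply])
      simp only [hν', pcEmb_sum, Equiv.apply_symm_apply]
      change ∑ i ∈ (e L).1, ν i < ∑ i ∈ P, ν i
      set Q := (e L).1 with hQ
      have hQc : Q.card = p := (e L).2
      have hQP : Q ≠ P := fun h => hLP (Subtype.ext h)
      have h1 : ∑ i ∈ Q, ν i ≤ ∑ i ∈ Q ∩ P, ν i := by
        rw [← Finset.sum_sdiff (Finset.inter_subset_left : Q ∩ P ⊆ Q)]
        have : ∑ i ∈ Q \ (Q ∩ P), ν i ≤ 0 := by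
          refine Finset.sum_nonpos fun i hi => ?_
          simp only [Finset.mem_sdiff, Finset.mem_inter, hP, Finset.mem_filter, Finset.mem_univ, true_and, not_and, not_lt] at hi
          exact hi.2 hi.1
        linarith
      have h2 : (P \ (Q ∩ P)).Nonempty := by
        rw [Finset.sdiff_nonempty]
        intro h
        have h3 : P ⊆ Q := h.trans Finset.inter_subset_left
        exact hQP (Finset.eq_of_subset_of_card_le h3 hQc.le).symm
      have h3 : 0 < ∑ i ∈ P \ (Q ∩ P), ν i :=
        Finset.sum_pos (fun i hi => (Finset.mem_filter.1 (Finset.mem_sdiff.1 hi).1).2) h2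
      rw [← Finset.sum_sdiff (Finset.inter_subset_right : Q ∩ P ⊆ P)]
      linarith)
  obtain ⟨M, hM1, hM2⟩ := exists_form (p := p) (fun J => M0 (e.symm J)) (fun h => hM0 (by
    funext J
    have := congrFun h (e J)
    simpa using this)) hp1
  refine ⟨M, hM1, ?_⟩
  filter_upwards [hM, hxP] with k hk1 hk2
  refine hM2 (T k) (hdet k) P' (fun L hL => ?_) (x k) hk2
  have := hk1 (e.symm L) (fun h => hL (e.symm.injective h))
  refine Eq.trans ?_ this
  refine Eq.trans (Equiv.sum_comp e (fun J => M0 (e.symm J) * cmpd p (T k) J L)).symm (Finset.sum_congr rfl fun J _ => ?_)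
  simp

end PF

end Part17

section Part18
set_option autoImplicit false
open Filter

namespace PF
variable {K : Type} [Field K] [CharZero K] (F : PF K) {n : ℕ} [NeZero n]

lemma unit_log {x : K} (hx0 : x ≠ 0) (hx : x ∈ F.O) (hxi : x⁻¹ ∈ F.O) : ∑ v, F.m v * Real.log (F.abv v x) = 0 := by
  have h1 := F.pr_abv hx hx0
  have h2 := F.pr_abv hxi (inv_ne_zero hx0)
  have h3 := Real.log_nonneg h1
  have h4 := Real.log_nonneg h2
  rw [F.log_pr fun v => (F.abv v).pos hx0] at h3
  rw [F.log_pr fun v => (F.abv v).pos (inv_ne_zero hx0)] at h4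
  simp only [map_inv₀, Real.log_inv, mul_neg, Finset.sum_neg_distrib] at h4
  linarith

theorem unit_core (𝒰 : Ultrafilter ℕ) (u : ℕ → Fin n → K) (hu0 : ∀ k i, u k i ≠ 0) (hu : ∀ k i, u k i ∈ F.O)
    (hui : ∀ k i, (u k i)⁻¹ ∈ F.O) (a : Fin n → K) (ha : ∀ i, a i ≠ 0) (hau : ∀ᶠ k in (𝒰 : Filter ℕ), a ⬝ᵥ u k = 1)
    (hnc : ∀ b, ¬ ∀ᶠ k in (𝒰 : Filter ℕ), u k = b) : ∃ M0 : Fin n → K, M0 ≠ 0 ∧ ∀ᶠ k in (𝒰 : Filter ℕ), M0 ⬝ᵥ u k = 0 := by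
  classical
  let w : ℕ → Option (Fin n) → K := fun k o => o.elim 1 (u k)
  have hw0 : ∀ k o, w k o ≠ 0 := by
    intro k o; cases o
    · exact one_ne_zero
    · exact hu0 k _
  let lg : ℕ → F.ι → Option (Fin n) → ℝ := fun k v o => Real.log (F.abv v (w k o))
  have hlg0 : ∀ k v, lg k v none = 0 := by
    intro k v
    simp [lg, w]
  have hlgs : ∀ k o, ∑ v, F.m v * lg k v o = 0 := by
    intro k o; cases o
    · simp [hlg0]
    · exact F.unit_log (hu0 k _) (hu k _) (hui k _)
  choose mx hmx using fun k v => Finite.exists_max (lg k v)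
  let h : ℕ → ℝ := fun k => ∑ v, F.m v * lg k v (mx k v)
  have hmx0 : ∀ k v, 0 ≤ lg k v (mx k v) := fun k v => (hlg0 k v) ▸ hmx k v none
  have hterm : ∀ k v, 0 ≤ F.m v * lg k v (mx k v) := fun k v => mul_nonneg (Nat.cast_nonneg _) (hmx0 k v)
  have hm1 : ∀ v, (1 : ℝ) ≤ F.m v := fun v => by exact_mod_cast F.m_pos v
  have hup : ∀ k v o, lg k v o ≤ h k := by
    intro k v o
    have h1 := Finset.single_le_sum (f := fun v => F.m v * lg k v (mx k v)) (fun v _ => hterm k v) (Finset.mem_univ v)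
    have h2 := mul_le_mul_of_nonneg_right (hm1 v) (hmx0 k v)
    have h3 := hmx k v o
    simp only [one_mul] at h2
    exact h3.trans (h2.trans h1)
  have hlow : ∀ k v o, - h k ≤ lg k v o := by
    intro k v o
    have h1 := hlgs k o
    have h2 : ∑ v' ∈ Finset.univ.erase v, F.m v' * lg k v' o ≤ h k := by
      refine (Finset.sum_le_sum fun v' _ => mul_le_mul_of_nonneg_left (hmx k v' o) (Nat.cast_nonneg _)).trans ?_
      exact Finset.sum_le_univ_sum_of_nonneg (hterm k)
    rw [← Finset.add_sum_erase _ _ (Finset.mem_univ v)] at h1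
    have h3 : - h k ≤ F.m v * lg k v o := by linarith
    by_cases h4 : 0 ≤ lg k v o
    · have : 0 ≤ h k := Finset.sum_nonneg fun v _ => hterm k v
      linarith
    · have := mul_le_mul_of_nonpos_right (hm1 v) (not_le.1 h4).le
      linarith
  -- the heights tend to infinity
  have hq : Tendsto h 𝒰 atTop := by
    rw [tendsto_atTop]
    intro B
    by_contra hcon
    rw [← Ultrafilter.eventually_not] at hcon
    have hfin : {y : Fin n → K | ∀ i, y i ∈ {x : K | x ∈ F.O ∧ ∀ v, F.abv v x ≤ Real.exp B}}.Finite :=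
      Set.Finite.pi' fun i => F.finite_bdd (Real.exp B)
    have hev : ∀ᶠ k in (𝒰 : Filter ℕ), u k ∈ {y : Fin n → K | ∀ i, y i ∈ {x : K | x ∈ F.O ∧ ∀ v, F.abv v x ≤ Real.exp B}} := by
      filter_upwards [hcon] with k hk i
      refine ⟨hu k i, fun v => ?_⟩
      have h1 := hup k v (some i)
      rw [← Real.log_le_iff_le_exp ((F.abv v).pos (hu0 k i))]
      exact h1.trans (not_le.1 hk).le
    obtain ⟨b, _, hb⟩ := (Ultrafilter.eventually_exists_mem_iff hfin (P := fun b k => u k = b)).1 (hev.mono fun k hk => ⟨u k, hk, rfl⟩)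
    exact hnc b hb
  choose i hi using fun v => ult_const 𝒰 fun k => mx k v
  have hbd : ∀ v o, ∃ C, Tendsto (fun k => lg k v o / h k) 𝒰 (nhds C) := by
    intro v o
    refine ult_lim 𝒰 _ 1 ?_
    filter_upwards [hq.eventually_ge_atTop 1] with k hk
    rw [abs_div, div_le_one (by rw [abs_of_pos (by linarith)]; linarith), abs_of_pos (by linarith : 0 < h k), abs_le]
    exact ⟨hlow k v o, hup k v o⟩
  choose C hC using hbd
  have hC0 : ∀ v, C v none = 0 := by
    intro v
    refine tendsto_nhds_unique (hC v none) ?_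
    simp only [hlg0, zero_div]
    exact tendsto_const_nhds
  have hCs : ∀ o, ∑ v, F.m v * C v o = 0 := by
    intro o
    have h1 : Tendsto (fun k => ∑ v, F.m v * (lg k v o / h k)) 𝒰 (nhds (∑ v, F.m v * C v o)) :=
      tendsto_finsetSum _ fun v _ => (hC v o).const_mul _
    refine tendsto_nhds_unique h1 ?_
    have : ∀ k, ∑ v, F.m v * (lg k v o / h k) = 0 := by
      intro k
      simp only [← mul_div_assoc]
      rw [← Finset.sum_div, hlgs, zero_div]
    simp only [this]
    exact tendsto_const_nhds
  have hCm : ∑ v, F.m v * C v (i v) = 1 := by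
    have h1 : Tendsto (fun k => ∑ v, F.m v * (lg k v (i v) / h k)) 𝒰 (nhds (∑ v, F.m v * C v (i v))) :=
      tendsto_finsetSum _ fun v _ => (hC v (i v)).const_mul _
    refine tendsto_nhds_unique h1 ?_
    refine tendsto_const_nhds.congr' ?_
    filter_upwards [hq.eventually_ge_atTop 1, Filter.eventually_all.2 hi] with k hk1 hk2
    simp only [← mul_div_assoc]
    rw [← Finset.sum_div, eq_comm, div_eq_one_iff_eq (by linarith)]
    exact Finset.sum_congr rfl fun v _ => by rw [hk2 v]
  let A : F.ι → Matrix (Fin n) (Fin n) K := fun v => (i v).elim 1 fun j => (1 : Matrix (Fin n) (Fin n) K).updateRow j a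
  have hA : ∀ v, (A v).det ≠ 0 := by
    intro v
    rcases hiv : i v with _ | j
    · simp [A, hiv]
    · simp only [A, hiv, Option.elim]
      rw [← Matrix.cramer_transpose_apply, Matrix.transpose_one, Matrix.cramer_one]
      exact ha j
  let s : F.ι → Fin n → Option (Fin n) := fun v j => if i v = some j then none else some j
  have hAu : ∀ v, ∀ y : Fin n → K, a ⬝ᵥ y = 1 → ∀ j, (A v).mulVec y j = (s v j).elim 1 y := by
    intro v y hy j
    rcases hiv : i v with _ | j'
    · simp [A, s, hiv]
    · by_cases hj : j' = j
      · subst hj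
        simp only [A, s, hiv, Option.elim, if_true, Matrix.mulVec, Matrix.updateRow_self]
        exact hy
      · simp only [A, s, hiv, Option.elim, Option.some.injEq, hj, if_false, Matrix.mulVec]
        rw [Matrix.updateRow_ne (Ne.symm hj)]
        change (1 : Matrix (Fin n) (Fin n) K).mulVec y j = _
        rw [Matrix.one_mulVec]
  have hmc : F.mc (fun v j => C v (s v j)) < 0 := by
    have h1 : ∀ v, ∑ j, C v (s v j) = ∑ o, C v o - C v (i v) := by
      intro v
      rw [Fintype.sum_option]
      rcases hiv : i v with _ | j'
      · simp [s, hiv]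
      · rw [← Finset.add_sum_erase _ _ (Finset.mem_univ j'), ← Finset.add_sum_erase _ (fun j => C v (some j)) (Finset.mem_univ j')]
        have : ∑ j ∈ Finset.univ.erase j', C v (s v j) = ∑ j ∈ Finset.univ.erase j', C v (some j) := by
          refine Finset.sum_congr rfl fun j hj => ?_
          simp [s, hiv, (Finset.ne_of_mem_erase hj).symm]
        rw [this]
        simp [s, hiv]
        ring
    have h2 : F.mc (fun v j => C v (s v j)) = -1 := by
      unfold mc
      simp only [h1, mul_sub, Finset.sum_sub_distrib, Finset.mul_sum, hCm]
      rw [Finset.sum_comm]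
      simp [hCs]
    rw [h2]; norm_num
  refine F.subspace A hA (fun v j => C v (s v j)) hmc 𝒰 h hq u hu fun ε hε => ?_
  have hM : (0 : ℝ) < F.M := by exact_mod_cast F.M_pos
  set ε' : ℝ := ε / (2 * F.M) with hε'
  have hε0 : 0 < ε' := by positivity
  have hev : ∀ᶠ k in (𝒰 : Filter ℕ), ∀ v o, lg k v o / h k < C v o + ε' :=
    Filter.eventually_all.2 fun v => Filter.eventually_all.2 fun o => (hC v o).eventually_lt_const (by linarith)
  have hn : ∀ᶠ k in (𝒰 : Filter ℕ), (n : ℝ) ≤ Real.exp (ε' * h k) :=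
    (Real.tendsto_exp_atTop.comp (hq.const_mul_atTop hε0)).eventually_ge_atTop _
  filter_upwards [hev, hn, hq.eventually_ge_atTop 1, hau] with k hk1 hk2 hk3 hk4
  have hN : ∀ v, F.N A (fun v j => C v (s v j)) (h k) (u k) v ≤ Real.exp (2 * ε' * h k) := by
    intro v
    have h1 : ∀ j, Real.exp (-(h k * C v (s v j))) * F.abv v ((A v).mulVec (u k) j) ≤ Real.exp (ε' * h k) := by
      intro j
      rw [hAu v (u k) hk4 j]
      have e1 : F.abv v ((s v j).elim 1 (u k)) = Real.exp (lg k v (s v j)) := (Real.exp_log ((F.abv v).pos (hw0 k _))).symm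
      rw [e1, ← Real.exp_add]
      refine Real.exp_le_exp.2 ?_
      have := hk1 v (s v j)
      rw [div_lt_iff₀ (by linarith)] at this
      linarith
    refine (Finset.sum_le_sum fun j _ => h1 j).trans ?_
    rw [Finset.sum_const, Finset.card_univ, Fintype.card_fin, nsmul_eq_mul]
    refine (mul_le_mul_of_nonneg_right hk2 (Real.exp_pos _).le).trans (le_of_eq ?_)
    rw [← Real.exp_add]
    ring_nf
  refine (F.pr_le (fun v => F.N_nonneg _ _ _ _ v) hN).trans (le_of_eq ?_)
  rw [F.pr_const, ← Real.exp_nat_mul]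
  congr 1
  rw [hε']
  field_simp

theorem unit_seq {ι : Type} [Fintype ι] [Nonempty ι] (𝒰 : Ultrafilter ℕ) (x : ℕ → ι → K) (hx0 : ∀ k i, x k i ≠ 0) (hx : ∀ k i, x k i ∈ F.O)
    (hxi : ∀ k i, (x k i)⁻¹ ∈ F.O) (hs : ∀ k, ∑ i, x k i = 0)
    (hnc : ∀ i j, i ≠ j → ∀ b, ¬ ∀ᶠ k in (𝒰 : Filter ℕ), x k i / x k j = b) : False := by
  classical
  let W : ℕ → Prop := fun N => ∃ a : ι → K, a ≠ 0 ∧ (∀ᶠ k in (𝒰 : Filter ℕ), a ⬝ᵥ x k = 0) ∧ (Finset.univ.filter fun i => a i ≠ 0).card = N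
  have hW : ∃ N, W N := ⟨_, fun _ => 1, fun h => one_ne_zero (congrFun h (Classical.arbitrary ι)), Eventually.of_forall fun k => by
    simpa [dotProduct] using hs k, rfl⟩
  obtain ⟨a, ha0, hak, hcard⟩ := Nat.find_spec hW
  have hmin : ∀ N < Nat.find hW, ¬ W N := fun N hN => Nat.find_min hW hN
  rw [← hcard] at hmin
  set J := Finset.univ.filter fun i => a i ≠ 0 with hJ
  obtain ⟨j0, hj0⟩ := Function.ne_iff.1 ha0
  have hj0' : a j0 ≠ 0 := hj0
  have hj0J : j0 ∈ J := by simpa [hJ] using hj0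
  have hsum : ∀ k, a ⬝ᵥ x k = a j0 * x k j0 + ∑ j ∈ J.erase j0, a j * x k j := by
    intro k
    rw [Finset.add_sum_erase J (fun j => a j * x k j) hj0J, hJ, Finset.sum_filter_of_ne]
    · rfl
    · intro j _ h; exact left_ne_zero_of_mul h
  let n := Fintype.card (J.erase j0)
  let e : Fin n ≃ J.erase j0 := (Fintype.equivFin _).symm
  have hsum2 : ∀ f : ι → K, ∑ j ∈ J.erase j0, f j = ∑ t, f (e t) := by
    intro f
    rw [Equiv.sum_comp e fun j => f j, Finset.sum_coe_sort]
  have hn : n ≠ 0 := by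
    intro h0
    obtain ⟨k, hk⟩ := hak.exists
    rw [hsum, hsum2] at hk
    haveI : IsEmpty (Fin n) := by rw [h0]; infer_instance
    rw [Fintype.sum_empty, add_zero] at hk
    exact mul_ne_zero hj0 (hx0 k j0) hk
  haveI : NeZero n := ⟨hn⟩
  have hej : ∀ t, a (e t) ≠ 0 := fun t => (Finset.mem_filter.1 (Finset.mem_of_mem_erase (e t).2)).2
  obtain ⟨M0, hM0, hM⟩ := F.unit_core 𝒰 (fun k t => x k (e t) / x k j0) (fun k t => div_ne_zero (hx0 k _) (hx0 k _))
    (fun k t => by rw [div_eq_mul_inv]; exact F.O.mul_mem (hx k _) (hxi k _))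
    (fun k t => by rw [inv_div, div_eq_mul_inv]; exact F.O.mul_mem (hx k _) (hxi k _))
    (fun t => - a (e t) / a j0) (fun t => div_ne_zero (neg_ne_zero.2 (hej t)) hj0) (by
      filter_upwards [hak] with k hk
      rw [hsum, hsum2] at hk
      have h1 : ∑ t, a (e t) * x k (e t) = - (a j0 * x k j0) := by linear_combination hk
      have h2 : (fun t => - a (e t) / a j0) ⬝ᵥ (fun t => x k (e t) / x k j0) = - (∑ t, a (e t) * x k (e t)) / (a j0 * x k j0) := by
        rw [← Finset.sum_neg_distrib, Finset.sum_div]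
        refine Finset.sum_congr rfl fun t _ => ?_
        rw [div_mul_div_comm]; ring
      rw [h2, h1, neg_neg, div_self (mul_ne_zero hj0 (hx0 k j0))]) (by
      intro b hb
      have t0 : Fin n := 0
      refine hnc (e t0) j0 (Finset.ne_of_mem_erase (e t0).2) (b t0) (hb.mono fun k hk => congrFun hk t0))
  let a' : ι → K := fun i => if h : i ∈ J.erase j0 then M0 (e.symm ⟨i, h⟩) else 0
  have ha'e : ∀ t, a' (e t) = M0 t := by
    intro t
    have := (e t).2
    simp only [a', dif_pos this, Subtype.coe_eta, Equiv.symm_apply_apply]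
  have ha'z : ∀ i, i ∉ J.erase j0 → a' i = 0 := fun i hi => dif_neg hi
  refine hmin (Finset.univ.filter fun i => a' i ≠ 0).card ?_ ⟨a', ?_, ?_, rfl⟩
  · refine lt_of_le_of_lt (Finset.card_le_card (t := J.erase j0) fun i hi => ?_) (Finset.card_erase_lt_of_mem hj0J)
    by_contra h
    exact (Finset.mem_filter.1 hi).2 (ha'z i h)
  · intro h0
    apply hM0
    funext t
    rw [← ha'e t, h0]; rfl
  · filter_upwards [hM] with k hk
    have h1 : a' ⬝ᵥ x k = ∑ j ∈ J.erase j0, a' j * x k j := by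
      refine (Finset.sum_subset (Finset.subset_univ _) fun i _ hi => ?_).symm
      rw [ha'z i hi, zero_mul]
    rw [h1, hsum2]
    have h2 : M0 ⬝ᵥ (fun t => x k (e t) / x k j0) = (∑ t, a' (e t) * x k (e t)) / x k j0 := by
      rw [Finset.sum_div]
      refine Finset.sum_congr rfl fun t _ => ?_
      rw [ha'e, mul_div_assoc]
    rw [h2, div_eq_zero_iff] at hk
    exact hk.resolve_right (hx0 k j0)

end PF

end Part18

section Part19
set_option autoImplicit false

namespace NF
open NumberField IsDedekindDomain

/-- Primes above `N`. -/
abbrev SP (K : Type) [Field K] [NumberField K] (N : ℕ) : Type :=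
  {p : HeightOneSpectrum (𝓞 K) // (N : 𝓞 K) ∈ p.asIdeal}

/-- The places under consideration. -/
abbrev Pl (K : Type) [Field K] [NumberField K] (N : ℕ) : Type := InfinitePlace K ⊕ SP K N

variable {K : Type} [Field K] [NumberField K] {N : ℕ}

lemma SP_finite (hN : 2 ≤ N) : Finite (SP K N) := by
  have h := Ideal.finite_factors (R := 𝓞 K) (I := Ideal.span {(N : 𝓞 K)}) (by
    simp only [Submodule.zero_eq_bot, ne_eq, Ideal.span_singleton_eq_bot]
    exact_mod_cast (by omega : N ≠ 0))
  refine Set.Finite.to_subtype (h.subset fun p hp => ?_)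
  exact Ideal.dvd_span_singleton.2 hp

lemma SP_nonempty (hN : 2 ≤ N) : Nonempty (SP K N) := by
  have h : Ideal.span {(N : 𝓞 K)} ≠ ⊤ := by
    rw [Ne, Ideal.span_singleton_eq_top]
    intro h
    have h2 := (NumberField.isUnit_iff_norm).1 h
    have h3 : ((N : 𝓞 K) : K) = algebraMap ℚ K (N : ℚ) := by simp
    rw [RingOfIntegers.coe_norm] at h2
    rw [h3, Algebra.norm_algebraMap, abs_pow] at h2
    have h4 : (1 : ℚ) < |(N : ℚ)| := by
      rw [Nat.abs_cast]; exact_mod_cast (by omega : 1 < N)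
    exact absurd h2 (one_lt_pow₀ h4 (Module.finrank_pos (R := ℚ) (M := K)).ne').ne'
  obtain ⟨M, hM, hle⟩ := Ideal.exists_le_maximal _ h
  have hNM : (N : 𝓞 K) ∈ M := hle (Ideal.mem_span_singleton_self _)
  refine ⟨⟨⟨M, hM.isPrime, ?_⟩, hNM⟩⟩
  rintro rfl
  rw [Ideal.mem_bot] at hNM
  exact (by omega : N ≠ 0) (by exact_mod_cast hNM)

/-- Absolute values. -/
noncomputable def av : Pl K N → AbsoluteValue K ℝ :=
  Sum.elim (fun w => w.1) (fun p => HeightOneSpectrum.adicAbv K p.1)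

/-- Multiplicities. -/
noncomputable def mu : Pl K N → ℕ := Sum.elim (fun w => w.mult) (fun _ => 1)

lemma av_inl (w : InfinitePlace K) (x : K) : av (N := N) (Sum.inl w) x = w x := rfl
lemma av_inr (p : SP K N) (x : K) : av (Sum.inr p) x = HeightOneSpectrum.adicAbv K p.1 x := rfl

lemma adic_le_one (p : HeightOneSpectrum (𝓞 K)) (r : 𝓞 K) :
    HeightOneSpectrum.adicAbv K p (algebraMap (𝓞 K) K r) ≤ 1 :=
  p.adicAbv_coe_le_one _ r

lemma adic_pow (p : HeightOneSpectrum (𝓞 K)) (r : 𝓞 K) (e : ℕ) (h : r ∈ p.asIdeal ^ e) :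
    HeightOneSpectrum.adicAbv K p (algebraMap (𝓞 K) K r) ≤
      ((Ideal.absNorm p.asIdeal : ℝ) ^ e)⁻¹ := by
  have h1 := (p.intValuation_le_pow_iff_mem r e).2 h
  rw [HeightOneSpectrum.adicAbv_def, HeightOneSpectrum.valuation_of_algebraMap]
  have h2 := (WithZeroMulInt.toNNReal_strictMono
    (HeightOneSpectrum.one_lt_absNorm_nnreal p)).monotone h1
  refine le_trans (NNReal.coe_le_coe.2 h2) (le_of_eq ?_)
  have h3 : WithZeroMulInt.toNNReal (HeightOneSpectrum.absNorm_ne_zero p)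
      (WithZero.exp (-(e : ℤ))) = (Ideal.absNorm p.asIdeal : NNReal) ^ (-(e : ℤ)) := by
    rw [WithZeroMulInt.toNNReal_neg_apply _ WithZero.exp_ne_zero]
    rfl
  erw [h3]
  simp

lemma two_le_absNorm (p : HeightOneSpectrum (𝓞 K)) : (2 : ℝ) ≤ Ideal.absNorm p.asIdeal := by
  exact_mod_cast HeightOneSpectrum.one_lt_absNorm p

lemma adic_N (p : SP K N) : HeightOneSpectrum.adicAbv K p.1 (N : K) ≤ 1 / 2 := by
  have h := adic_pow p.1 (N : 𝓞 K) 1 (by simpa using p.2)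
  rw [map_natCast] at h
  refine h.trans ?_
  rw [pow_one, one_div]
  exact inv_anti₀ (by norm_num) (two_le_absNorm p.1)

lemma adic_N_eq (p : HeightOneSpectrum (𝓞 K)) (hp : (N : 𝓞 K) ∉ p.asIdeal) :
    HeightOneSpectrum.adicAbv K p (N : K) = 1 := by
  have h := (p.adicAbv_coe_eq_one_iff (K := K) (HeightOneSpectrum.one_lt_absNorm_nnreal p)
    (N : 𝓞 K)).2 hp
  rw [map_natCast] at h
  exact h

lemma int_of_adic (x : K) (h : ∀ p : HeightOneSpectrum (𝓞 K), HeightOneSpectrum.adicAbv K p x ≤ 1) :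
    x ∈ (algebraMap (𝓞 K) K).range := by
  refine HeightOneSpectrum.mem_integers_of_valuation_le_one K x fun p => ?_
  have h1 := h p
  rw [HeightOneSpectrum.adicAbv_def] at h1
  exact (WithZeroMulInt.toNNReal_le_one_iff (HeightOneSpectrum.one_lt_absNorm_nnreal p)).1
    (by exact_mod_cast h1)

variable (K N) in
/-- The ring of integers with `N` inverted. -/
def ON : Subring K where
  carrier := {x | ∃ n : ℕ, (N : K) ^ n * x ∈ (algebraMap (𝓞 K) K).range}
  mul_mem' := by
    rintro a b ⟨n, hn⟩ ⟨k, hk⟩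
    exact ⟨n + k, by simpa [pow_add, mul_mul_mul_comm] using mul_mem hn hk⟩
  one_mem' := ⟨0, by simpa using one_mem _⟩
  add_mem' := by
    rintro a b ⟨n, hn⟩ ⟨k, hk⟩
    have hN : ∀ j : ℕ, (N : K) ^ j ∈ (algebraMap (𝓞 K) K).range := fun j =>
      pow_mem (natCast_mem _ N) j
    refine ⟨n + k, ?_⟩
    have := add_mem (mul_mem (hN k) hn) (mul_mem (hN n) hk)
    convert this using 1
    ring
  zero_mem' := ⟨0, by simpa using zero_mem _⟩
  neg_mem' := by
    rintro a ⟨n, hn⟩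
    exact ⟨n, by simpa using neg_mem hn⟩

lemma mem_ON {x : K} : x ∈ ON K N ↔ ∃ n : ℕ, (N : K) ^ n * x ∈ (algebraMap (𝓞 K) K).range :=
  Iff.rfl

lemma R_le : (algebraMap (𝓞 K) K).range ≤ ON K N := fun x hx => ⟨0, by simpa using hx⟩

lemma adic_ON {x : K} (hx : x ∈ ON K N) (p : HeightOneSpectrum (𝓞 K))
    (hp : (N : 𝓞 K) ∉ p.asIdeal) : HeightOneSpectrum.adicAbv K p x ≤ 1 := by
  obtain ⟨n, r, hr⟩ := hx
  have h := adic_le_one p r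
  rw [hr, map_mul, map_pow, adic_N_eq p hp, one_pow, one_mul] at h
  exact h

lemma NK (hN : 2 ≤ N) : (N : K) ≠ 0 := by exact_mod_cast (by omega : N ≠ 0)

lemma inv_pow_ON (hN : 2 ≤ N) (n : ℕ) : ((N : K) ^ n)⁻¹ ∈ ON K N :=
  ⟨n, by rw [mul_inv_cancel₀ (pow_ne_zero _ (NK hN))]; exact one_mem _⟩

lemma den (x : K) : ∃ D : ℕ, D ≠ 0 ∧ (D : K) * x ∈ (algebraMap (𝓞 K) K).range := by
  obtain ⟨a, b, hb, rfl⟩ := IsFractionRing.div_surjective (𝓞 K) x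
  have hb0 : b ≠ 0 := nonZeroDivisors.ne_zero hb
  refine ⟨Ideal.absNorm (Ideal.span {b}), ?_, ?_⟩
  · rw [Ideal.absNorm_ne_zero_iff]
    exact Ideal.finiteQuotientOfFreeOfNeBot _ (by simpa using hb0)
  · obtain ⟨c, hc⟩ := Ideal.mem_span_singleton.1 (Ideal.absNorm_mem (Ideal.span {b}))
    have h1 := congrArg (algebraMap (𝓞 K) K) hc
    rw [map_natCast, map_mul] at h1
    have hb1 : algebraMap (𝓞 K) K b ≠ 0 := by simpa using hb0
    refine ⟨c * a, ?_⟩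
    rw [h1, map_mul]
    field_simp

lemma one_le [Fintype (SP K N)] (x : K) (hx : x ∈ ON K N) (h0 : x ≠ 0) :
    1 ≤ ∏ v : Pl K N, av v x ^ mu v := by
  classical
  have h := NumberField.prod_abs_eq_one h0
  rw [Fintype.prod_sum_type]
  simp only [av_inl, av_inr, mu, Sum.elim_inl, Sum.elim_inr, pow_one]
  have hpos : 0 ≤ ∏ w : InfinitePlace K, w x ^ w.mult :=
    Finset.prod_nonneg fun w _ => pow_nonneg (apply_nonneg w x) _
  rw [← h]
  refine mul_le_mul_of_nonneg_left ?_ hpos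
  rw [← finprod_comp_equiv (FinitePlace.equivHeightOneSpectrum (K := K)).symm]
  have hfin : (fun p : HeightOneSpectrum (𝓞 K) =>
      (FinitePlace.equivHeightOneSpectrum.symm p) x).mulSupport.Finite :=
    (FinitePlace.hasFiniteMulSupport h0).comp_of_injective
      (FinitePlace.equivHeightOneSpectrum (K := K)).symm.injective
  have hval : ∀ p : HeightOneSpectrum (𝓞 K), (FinitePlace.equivHeightOneSpectrum.symm p) x =
      HeightOneSpectrum.adicAbv K p x := fun p => by
    rw [FinitePlace.equivHeightOneSpectrum_symm_apply, FinitePlace.norm_embedding]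
  set S : Finset (HeightOneSpectrum (𝓞 K)) := Finset.univ.image (fun p : SP K N => p.1) with hS
  rw [finprod_eq_prod_of_mulSupport_subset (s := hfin.toFinset ∪ S) _ (by
    intro p hp; simp only [Finset.coe_union, Set.mem_union]; left; simpa using hp)]
  have h3 : ∏ p : SP K N, HeightOneSpectrum.adicAbv K p.1 x =
      ∏ p ∈ S, HeightOneSpectrum.adicAbv K p x := by
    rw [hS, Finset.prod_image (by intro a _ b _ hab; exact Subtype.ext hab)]
  rw [h3, ← Finset.prod_sdiff (Finset.subset_union_right (s₁ := hfin.toFinset) (s₂ := S))]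
  simp only [hval]
  refine mul_le_of_le_one_left (Finset.prod_nonneg fun p _ => apply_nonneg _ _) ?_
  refine Finset.prod_le_one (fun p _ => apply_nonneg _ _) fun p hp => ?_
  refine adic_ON hx p fun hp2 => ?_
  rw [Finset.mem_sdiff] at hp
  exact hp.2 (Finset.mem_image.2 ⟨⟨p, hp2⟩, Finset.mem_univ _, rfl⟩)

lemma finite_bdd (hN : 2 ≤ N) (B : ℝ) : {x : K | x ∈ ON K N ∧ ∀ v : Pl K N, av v x ≤ B}.Finite := by
  obtain ⟨n, hn⟩ := pow_unbounded_of_one_lt B (one_lt_two)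
  have hinj : Function.Injective (fun x : K => (N : K) ^ n * x) :=
    mul_right_injective₀ (pow_ne_zero _ (NK hN))
  refine ((Embeddings.finite_of_norm_le K ℂ ((N : ℝ) ^ n * B)).preimage hinj.injOn).subset ?_
  rintro x ⟨hx, hv⟩
  have hIntg : (N : K) ^ n * x ∈ (algebraMap (𝓞 K) K).range := by
    refine int_of_adic _ fun p => ?_
    rw [map_mul, map_pow]
    by_cases hp : (N : 𝓞 K) ∈ p.asIdeal
    · have h1 := adic_N (⟨p, hp⟩ : SP K N)
      have h2 := hv (Sum.inr ⟨p, hp⟩)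
      rw [av_inr] at h2
      calc _ ≤ (1 / 2 : ℝ) ^ n * 2 ^ n := by
            refine mul_le_mul (pow_le_pow_left₀ (apply_nonneg _ _) h1 n) (h2.trans hn.le)
              (apply_nonneg _ _) (by positivity)
        _ = 1 := by rw [← mul_pow]; norm_num
    · rw [adic_N_eq p hp, one_pow, one_mul]
      exact adic_ON hx p hp
  refine ⟨?_, fun φ => ?_⟩
  · obtain ⟨r, hr⟩ := hIntg
    show IsIntegral ℤ ((N : K) ^ n * x)
    rw [← hr]
    exact RingOfIntegers.isIntegral_coe r
  · show ‖φ ((N : K) ^ n * x)‖ ≤ _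
    have h := hv (Sum.inl (InfinitePlace.mk φ))
    rw [av_inl, InfinitePlace.apply] at h
    rw [map_mul, map_pow, map_natCast, norm_mul, norm_pow, Complex.norm_natCast]
    exact mul_le_mul_of_nonneg_left h (by positivity)

lemma pid (hN : 2 ≤ N) (hcl : ∀ I : Ideal (𝓞 K), I ≠ ⊥ → ∃ J : Ideal (𝓞 K), (N : 𝓞 K) ∈ J ∧
    (I * J).IsPrincipal) : IsPrincipalIdealRing (ON K N) := by
  refine ⟨fun I => ?_⟩
  by_cases hI : I = ⊥
  · rw [hI]; exact bot_isPrincipal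
  let f : 𝓞 K →+* ON K N := (algebraMap (𝓞 K) K).codRestrict (ON K N) (fun r => R_le ⟨r, rfl⟩)
  have hf : ∀ r, ((f r : ON K N) : K) = algebraMap (𝓞 K) K r := fun r => rfl
  have key : ∀ x : ON K N, ∃ (n : ℕ) (r : 𝓞 K), f r = (N : ON K N) ^ n * x := by
    rintro ⟨x, n, r, hr⟩
    exact ⟨n, r, Subtype.ext (by rw [hf, hr]; simp)⟩
  have hI' : I.comap f ≠ ⊥ := by
    intro h
    apply hI
    rw [eq_bot_iff]
    intro x hx
    obtain ⟨n, r, hr⟩ := key x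
    have h1 : r ∈ I.comap f := by
      rw [Ideal.mem_comap, hr]; exact I.mul_mem_left _ hx
    rw [h, Ideal.mem_bot] at h1
    rw [h1, map_zero] at hr
    have h2 := congrArg (Subtype.val) hr
    simp only [ZeroMemClass.coe_zero, MulMemClass.coe_mul, SubmonoidClass.coe_pow] at h2
    have h3 := (mul_eq_zero.1 h2.symm).resolve_left (pow_ne_zero _ (by simpa using NK (K := K) hN))
    exact (Ideal.mem_bot).2 (Subtype.ext h3)
  obtain ⟨J, hNJ, a, ha⟩ := hcl _ hI'
  rw [Ideal.submodule_span_eq] at ha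
  refine ⟨f a, ?_⟩
  rw [Ideal.submodule_span_eq]
  apply le_antisymm
  · intro x hx
    obtain ⟨n, r, hr⟩ := key x
    have h1 : r ∈ I.comap f := by
      rw [Ideal.mem_comap, hr]; exact I.mul_mem_left _ hx
    have h2 := Ideal.mul_mem_mul h1 hNJ
    rw [ha, Ideal.mem_span_singleton] at h2
    obtain ⟨b, hb⟩ := h2
    rw [Ideal.mem_span_singleton]
    refine ⟨⟨_, inv_pow_ON hN (n + 1)⟩ * f b, Subtype.ext ?_⟩
    have h3 := congrArg (algebraMap (𝓞 K) K) hb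
    have h4 := congrArg Subtype.val hr
    rw [map_mul, map_mul, map_natCast, ← hf r, h4] at h3
    simp only [MulMemClass.coe_mul, SubmonoidClass.coe_pow, hf] at h3 ⊢
    have h5 := NK (K := K) hN
    have h6 : ((N : ON K N) : K) = (N : K) := by simp
    rw [h6] at h3
    field_simp
    rw [← h3]; ring
  · rw [Ideal.span_singleton_le_iff_mem]
    have : a ∈ I.comap f * J := by rw [ha]; exact Ideal.mem_span_singleton_self _
    exact (Ideal.mul_le_inf this).1

lemma exists_cl : ∃ N : ℕ, N ≠ 0 ∧ ∀ N', N ∣ N' → ∀ I : Ideal (𝓞 K), I ≠ ⊥ →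
    ∃ J : Ideal (𝓞 K), (N' : 𝓞 K) ∈ J ∧ (I * J).IsPrincipal := by
  classical
  choose J hJ using (ClassGroup.mk0_surjective (R := 𝓞 K))
  refine ⟨∏ c, Ideal.absNorm (J c : Ideal (𝓞 K)), ?_, fun N' hN' I hI => ?_⟩
  · refine Finset.prod_ne_zero_iff.2 fun c _ => ?_
    rw [Ideal.absNorm_ne_zero_iff]
    exact Ideal.finiteQuotientOfFreeOfNeBot _ (nonZeroDivisors.ne_zero (J c).2)
  · have hI0 := mem_nonZeroDivisors_of_ne_zero hI
    set c := (ClassGroup.mk0 ⟨I, hI0⟩)⁻¹ with hc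
    refine ⟨J c, ?_, ?_⟩
    · obtain ⟨k, hk⟩ := (Finset.dvd_prod_of_mem (fun c => Ideal.absNorm (J c : Ideal (𝓞 K)))
        (Finset.mem_univ c)).trans hN'
      rw [hk, Nat.cast_mul]
      exact Ideal.mul_mem_right _ _ (Ideal.absNorm_mem _)
    · rw [← ClassGroup.mk0_eq_one_iff (mul_mem hI0 (J c).2)]
      have : (⟨I * (J c : Ideal (𝓞 K)), mul_mem hI0 (J c).2⟩ : nonZeroDivisors (Ideal (𝓞 K))) =
        ⟨I, hI0⟩ * J c := rfl
      rw [this, map_mul, hJ, hc, mul_inv_cancel]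

end NF

end Part19

section Part20
set_option autoImplicit false

namespace NF
open NumberField IsDedekindDomain

variable {K : Type} [Field K] [NumberField K] {N : ℕ}

lemma le_house (w : InfinitePlace K) (x : K) : w x ≤ house x := by
  rw [← InfinitePlace.norm_embedding_eq w x]
  exact norm_le_pi_norm (canonicalEmbedding K x) w.embedding

lemma house_le {x : K} {B : ℝ} (hB : 0 ≤ B) (h : ∀ w : InfinitePlace K, w x ≤ B) : house x ≤ B := by
  refine (pi_norm_le_iff_of_nonneg hB).2 fun φ => ?_
  have := h (InfinitePlace.mk φ)
  rwa [InfinitePlace.apply] at this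

lemma av_int_le (v : Pl K N) (r : 𝓞 K) {B : ℝ} (hB : 1 ≤ B)
    (h : house (algebraMap (𝓞 K) K r) ≤ B) : av v (algebraMap (𝓞 K) K r) ≤ B := by
  cases v with
  | inl w => exact (le_house w _).trans h
  | inr p => exact (adic_le_one p.1 r).trans hB

lemma siegel : ∃ C : ℝ, 1 ≤ C ∧ ∀ (α β : Type) [Fintype α] [Fintype β] [Nonempty β]
    (a : α → β → K) (B : ℝ), 1 ≤ B → 2 * Fintype.card α ≤ Fintype.card β →
    (∀ i j, a i j ∈ (algebraMap (𝓞 K) K).range) → (∀ (v : Pl K N) i j, av v (a i j) ≤ B) →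
    ∃ ξ : β → K, (∀ j, ξ j ∈ ON K N) ∧ ξ ≠ 0 ∧ (∀ i, ∑ j, a i j * ξ j = 0) ∧
      ∀ (v : Pl K N) j, av v (ξ j) ≤ C * Fintype.card β * B := by
  classical
  obtain ⟨c, hc⟩ : ∃ c : ℝ, ∀ (α β : Type) [Fintype α] [Fintype β] (a : Matrix α β (𝓞 K)) (A : ℝ),
      a ≠ 0 → 0 < Fintype.card α → Fintype.card α < Fintype.card β →
      (∀ k l, house (algebraMap (𝓞 K) K (a k l)) ≤ A) → ∃ ξ : β → 𝓞 K, ξ ≠ 0 ∧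
      Matrix.mulVec a ξ = 0 ∧ ∀ l, house (ξ l).1 ≤ c * ((c * Fintype.card β * A) ^
        ((Fintype.card α : ℝ) / (Fintype.card β - Fintype.card α))) :=
    ⟨_, fun _ _ _ _ a _ ha h0 hpq hA =>
      house.exists_ne_zero_int_vec_house_le K a ha h0 hpq rfl hA rfl⟩
  set c0 : ℝ := max 1 |c| with hc0
  have h1c : 1 ≤ c0 := le_max_left _ _
  have hcc : |c| ≤ c0 := le_max_right _ _
  refine ⟨c0 ^ 2, one_le_pow₀ h1c, ?_⟩
  intro α β _ _ _ a B hB hcard haR haB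
  choose a' ha' using haR
  have hq : (1 : ℝ) ≤ Fintype.card β := by exact_mod_cast Fintype.card_pos
  have hbig : 1 ≤ c0 * Fintype.card β * B :=
    one_le_mul_of_one_le_of_one_le (one_le_mul_of_one_le_of_one_le h1c hq) hB
  have hbig2 : c0 * (c0 * Fintype.card β * B) = c0 ^ 2 * Fintype.card β * B := by ring
  have hbig3 : 1 ≤ c0 ^ 2 * Fintype.card β * B := by
    rw [← hbig2]; exact one_le_mul_of_one_le_of_one_le h1c hbig
  by_cases h0 : (Matrix.of a' : Matrix α β (𝓞 K)) = 0
  · refine ⟨fun _ => 1, fun _ => one_mem _, ?_, fun i => ?_, fun v j => ?_⟩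
    · intro h
      exact one_ne_zero (congrFun h (Classical.arbitrary β))
    · refine Finset.sum_eq_zero fun j _ => ?_
      rw [← ha' i j, show a' i j = 0 from congrFun (congrFun h0 i) j]
      simp
    · rw [map_one]; exact hbig3
  have hα : 0 < Fintype.card α := by
    rw [Fintype.card_pos_iff]
    by_contra hne
    rw [not_nonempty_iff] at hne
    exact h0 (Subsingleton.elim _ _)
  obtain ⟨ξ, hξ0, hξ, hb⟩ := hc α β (Matrix.of a') B h0 hα (by omega) (fun k l => by
    refine house_le (by linarith) fun w => ?_
    have := haB (Sum.inl w) k l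
    rwa [← ha' k l] at this)
  refine ⟨fun j => algebraMap (𝓞 K) K (ξ j), fun j => R_le ⟨_, rfl⟩, ?_, fun i => ?_, fun v j => ?_⟩
  · intro h
    apply hξ0
    funext j
    have := congrFun h j
    simpa using this
  · have := congrArg (algebraMap (𝓞 K) K) (congrFun hξ i)
    simp only [Matrix.mulVec, dotProduct, map_sum, map_mul, Matrix.of_apply, Pi.zero_apply,
      map_zero] at this
    rw [← this]
    exact Finset.sum_congr rfl fun j _ => by rw [ha']
  · refine av_int_le v _ hbig3 ?_
    refine (hb j).trans ?_
    set e : ℝ := (Fintype.card α : ℝ) / (Fintype.card β - Fintype.card α) with he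
    have hcard' : 2 * (Fintype.card α : ℝ) ≤ Fintype.card β := by exact_mod_cast hcard
    have hα' : (0 : ℝ) < Fintype.card α := by exact_mod_cast hα
    have he1 : e ≤ 1 := by
      rw [he, div_le_one (by linarith)]; linarith
    have h2 : |c * Fintype.card β * B| ≤ c0 * Fintype.card β * B := by
      rw [abs_mul, abs_mul, Nat.abs_cast, abs_of_pos (by linarith : 0 < B)]
      gcongr
    rw [← hbig2]
    refine (le_abs_self _).trans ?_
    rw [abs_mul]
    refine mul_le_mul hcc ?_ (abs_nonneg _) (by linarith)
    refine (Real.abs_rpow_le_abs_rpow _ _).trans ?_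
    have he0 : 0 ≤ e := div_nonneg hα'.le (by linarith)
    refine (Real.rpow_le_rpow (abs_nonneg _) h2 he0).trans ?_
    calc _ ≤ (c0 * Fintype.card β * B) ^ (1 : ℝ) := Real.rpow_le_rpow_of_exponent_le hbig he1
      _ = _ := Real.rpow_one _

lemma cell_diff {t : ℝ} (ht : 0 < t) {z z' : ℂ} (h1 : ⌊2 * z.re / t⌋ = ⌊2 * z'.re / t⌋)
    (h2 : ⌊2 * z.im / t⌋ = ⌊2 * z'.im / t⌋) : ‖z - z'‖ ≤ t := by
  have key : ∀ a b : ℝ, ⌊2 * a / t⌋ = ⌊2 * b / t⌋ → |a - b| ≤ t / 2 := by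
    intro a b h
    have h3 := Int.abs_sub_lt_one_of_floor_eq_floor h
    rw [← sub_div, abs_div, abs_of_pos ht, div_lt_one ht, ← mul_sub, abs_mul, abs_two] at h3
    linarith
  have h3 := Complex.norm_le_abs_re_add_abs_im (z - z')
  rw [Complex.sub_re, Complex.sub_im] at h3
  linarith [key _ _ h1, key _ _ h2]

lemma cell_mem {t R a : ℝ} (ht : 0 < t) (h : |a| ≤ R) :
    ⌊2 * a / t⌋ ∈ Finset.Icc (-⌈2 * R / t⌉) ⌈2 * R / t⌉ := by
  obtain ⟨h1, h2⟩ := abs_le.1 h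
  rw [Finset.mem_Icc]
  constructor
  · rw [Int.le_floor, Int.cast_neg]
    have h3 := Int.le_ceil (2 * R / t)
    have h4 : -(2 * R / t) ≤ 2 * a / t := by
      rw [← neg_div]; gcongr; linarith
    linarith
  · refine (Int.floor_mono (a := 2 * a / t) (b := 2 * R / t) (by gcongr)).trans ?_
    exact Int.floor_le_ceil _

lemma cell_card {t R : ℝ} (ht : 0 < t) (h : 3 * t ≤ R) :
    ((Finset.Icc (-⌈2 * R / t⌉) ⌈2 * R / t⌉).card : ℝ) ≤ 5 * R / t := by
  have h3 : 3 ≤ R / t := by rwa [le_div_iff₀ ht]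
  have h1 := Int.ceil_lt_add_one (2 * R / t)
  have h0 : (0 : ℤ) ≤ ⌈2 * R / t⌉ := Int.ceil_nonneg (by rw [mul_div_assoc]; linarith)
  rw [Int.card_Icc]
  have h2 : (((⌈2 * R / t⌉ + 1 - -⌈2 * R / t⌉).toNat : ℤ) : ℝ) = 2 * ⌈2 * R / t⌉ + 1 := by
    rw [Int.toNat_of_nonneg (by omega)]; push_cast; ring
  rw [← Int.cast_natCast, h2]
  rw [mul_div_assoc] at h1 ⊢
  rw [mul_div_assoc]
  linarith

end NF

end Part20

section Part21
set_option autoImplicit false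

namespace NF
open NumberField IsDedekindDomain

variable {K : Type} [Field K] [NumberField K] {N : ℕ}

lemma exists_exp {q τ : ℝ} (hq : 1 < q) (h0 : 0 < τ) (h1 : τ ≤ 1) :
    ∃ e : ℕ, (q ^ e)⁻¹ ≤ τ ∧ q ^ e ≤ q / τ := by
  obtain ⟨n, hn1, hn2⟩ := exists_nat_pow_near ((one_le_inv₀ h0).2 h1) hq
  refine ⟨n + 1, inv_le_of_inv_le₀ h0 hn2.le, ?_⟩
  rw [pow_succ, mul_comm, div_eq_mul_inv]
  gcongr

lemma den_matrix {P I : Type} [Finite P] [Finite I] (A : P → Matrix I I K) :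
    ∃ D : ℕ, D ≠ 0 ∧ ∀ p i j, (D : K) * A p i j ∈ (algebraMap (𝓞 K) K).range := by
  classical
  have := Fintype.ofFinite P
  have := Fintype.ofFinite I
  choose d hd0 hd using fun x : P × I × I => den (K := K) (A x.1 x.2.1 x.2.2)
  refine ⟨∏ x, d x, Finset.prod_ne_zero_iff.2 fun x _ => hd0 x, fun p i j => ?_⟩
  obtain ⟨k, hk⟩ := Finset.dvd_prod_of_mem d (Finset.mem_univ (p, i, j))
  rw [hk, Nat.cast_mul, mul_assoc, mul_left_comm]
  exact mul_mem (natCast_mem _ k) (hd (p, i, j))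

lemma card_quot (p : HeightOneSpectrum (𝓞 K)) (e : ℕ) [Fintype (𝓞 K ⧸ p.asIdeal ^ e)] :
    Fintype.card (𝓞 K ⧸ p.asIdeal ^ e) = Ideal.absNorm p.asIdeal ^ e := by
  rw [← map_pow, Ideal.absNorm_apply, Submodule.cardQuot_apply, Nat.card_eq_fintype_card]

lemma count_ineq [Fintype (SP K N)] {I : Type} [Fintype I] {c T : ℝ} (hc : 0 < c) (hT : 0 < T)
    (t : Pl K N → I → ℝ) (ht : ∀ v i, 0 < t v i) (G1 : InfinitePlace K → I → ℝ)
    (G2 : SP K N → I → ℝ) (Q : SP K N → ℝ) (h1 : ∀ w i, 0 ≤ G1 w i) (h2 : ∀ p i, 0 ≤ G2 p i)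
    (hG1 : ∀ w i, G1 w i ≤ (5 * (c * T) / t (Sum.inl w) i) ^ w.mult)
    (hG2 : ∀ p i, G2 p i ≤ Q p / t (Sum.inr p) i)
    (hprod : (5 * c) ^ (Fintype.card I * Module.finrank ℚ K) * ∏ p : SP K N, ∏ _i : I, Q p ≤
      ∏ v, (∏ i, t v i) ^ mu v) :
    (∏ w, ∏ i, G1 w i) * ∏ p, ∏ i, G2 p i ≤ T ^ (Fintype.card I * Module.finrank ℚ K) := by
  calc _ ≤ (∏ w : InfinitePlace K, ∏ i, (5 * (c * T) / t (Sum.inl w) i) ^ w.mult) *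
        ∏ p : SP K N, ∏ i, Q p / t (Sum.inr p) i := by
        refine mul_le_mul (Finset.prod_le_prod (fun w _ => Finset.prod_nonneg fun i _ => h1 w i)
          fun w _ => Finset.prod_le_prod (fun i _ => h1 w i) fun i _ => hG1 w i)
          (Finset.prod_le_prod (fun w _ => Finset.prod_nonneg fun i _ => h2 w i)
          fun w _ => Finset.prod_le_prod (fun i _ => h2 w i) fun i _ => hG2 w i)
          (Finset.prod_nonneg fun w _ => Finset.prod_nonneg fun i _ => h2 w i)
          (Finset.prod_nonneg fun w _ => Finset.prod_nonneg fun i _ => by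
                have := ht (Sum.inl w) i; positivity)
    _ = T ^ (Fintype.card I * Module.finrank ℚ K) *
        ((5 * c) ^ (Fintype.card I * Module.finrank ℚ K) * ∏ p : SP K N, ∏ _i : I, Q p) /
        ∏ v, (∏ i, t v i) ^ mu v := by
        have hm : ∀ y : ℝ, ∏ w : InfinitePlace K, ∏ _i : I, y ^ w.mult =
            y ^ (Fintype.card I * Module.finrank ℚ K) := by
          intro y
          simp only [Finset.prod_const, Finset.card_univ, ← pow_mul]
          rw [Finset.prod_pow_eq_pow_sum, ← Finset.sum_mul, InfinitePlace.sum_mult_eq, mul_comm]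
        rw [Fintype.prod_sum_type]
        simp only [mu, Sum.elim_inl, Sum.elim_inr, pow_one, div_pow, Finset.prod_div_distrib,
          hm, ← Finset.prod_pow]
        rw [show 5 * (c * T) = T * (5 * c) by ring, mul_pow, div_mul_div_comm, mul_assoc]
    _ ≤ T ^ (Fintype.card I * Module.finrank ℚ K) := by
        have hpos : 0 < ∏ v, (∏ i, t v i) ^ mu v := Finset.prod_pos fun v _ =>
          pow_pos (Finset.prod_pos fun i _ => ht v i) _
        rw [div_le_iff₀ hpos]
        gcongr

lemma arch_bound {I κ : Type} [Fintype I] [Fintype κ] (w : InfinitePlace K) (A : Matrix I I K)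
    (ω : κ → 𝓞 K) (T : ℕ) (a : I → κ → ℕ) (ha : ∀ j k, a j k ≤ T) (i : I) :
    w (A.mulVec (fun j => algebraMap (𝓞 K) K (∑ k, ((a j k : ℕ) : ℤ) • ω k)) i) ≤
      (∑ j, ∑ k, w (A i j) * w (algebraMap (𝓞 K) K (ω k))) * T := by
  rw [Matrix.mulVec, dotProduct, Finset.sum_mul]
  refine (w.1.sum_le _ _).trans (Finset.sum_le_sum fun j _ => ?_)
  rw [map_sum, Finset.mul_sum, Finset.sum_mul]
  refine (w.1.sum_le _ _).trans (Finset.sum_le_sum fun k _ => ?_)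
  show w _ ≤ _
  rw [zsmul_eq_mul, map_mul, map_mul, map_mul, map_intCast, Int.cast_natCast, mul_assoc]
  refine mul_le_mul_of_nonneg_left ?_ (apply_nonneg _ _)
  rw [mul_comm]
  refine mul_le_mul_of_nonneg_left ?_ (apply_nonneg _ _)
  rw [← InfinitePlace.norm_embedding_eq, map_natCast, Complex.norm_natCast]
  exact_mod_cast ha j k

set_option maxHeartbeats 1000000 in
lemma mink_int [Fintype (SP K N)] (I : Type) [Fintype I] [Nonempty I]
    (A : Pl K N → Matrix I I K) :
    ∃ C : ℝ, 0 < C ∧ ∀ t : Pl K N → I → ℝ, (∀ v i, 0 < t v i) →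
    (∀ (p : SP K N) i, t (Sum.inr p) i ≤ 1) → C ≤ ∏ v, (∏ i, t v i) ^ mu v →
    ∃ x : I → 𝓞 K, x ≠ 0 ∧
      ∀ v i, av v ((A v).mulVec (fun j => algebraMap (𝓞 K) K (x j)) i) ≤ t v i := by
  classical
  obtain ⟨D, hD0, hD⟩ := den_matrix (fun p : SP K N => A (Sum.inr p))
  choose E hE using hD
  have hDK : (D : K) ≠ 0 := by exact_mod_cast hD0
  let κ := Module.Free.ChooseBasisIndex ℤ (𝓞 K)
  let ω : Module.Basis κ ℤ (𝓞 K) := RingOfIntegers.basis K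
  let d : ℕ := Fintype.card κ
  have hd : d = Module.finrank ℚ K := by
    rw [← RingOfIntegers.rank K, Module.finrank_eq_card_chooseBasisIndex]
  have hdpos : 0 < d := by rw [hd]; exact Module.finrank_pos
  let n : ℕ := Fintype.card I
  have hn : 0 < n := Fintype.card_pos
  set c : ℝ := 1 + ∑ w : InfinitePlace K, ∑ i, ∑ j, ∑ k, w (A (Sum.inl w) i j) * w (ω k) with hc
  have hcterm : ∀ w : InfinitePlace K, ∀ i, ∑ j, ∑ k, w (A (Sum.inl w) i j) * w (ω k) ≤ c := by
    intro w i
    have hnn : ∀ (w : InfinitePlace K) i, 0 ≤ ∑ j, ∑ k, w (A (Sum.inl w) i j) * w (ω k) :=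
      fun w i => Finset.sum_nonneg fun j _ => Finset.sum_nonneg fun k _ =>
        mul_nonneg (apply_nonneg _ _) (apply_nonneg _ _)
    have h1 := Finset.single_le_sum (f := fun i => ∑ j, ∑ k, w (A (Sum.inl w) i j) * w (ω k))
      (fun i _ => hnn w i) (Finset.mem_univ i)
    have h2 := Finset.single_le_sum
      (f := fun w : InfinitePlace K => ∑ i, ∑ j, ∑ k, w (A (Sum.inl w) i j) * w (ω k))
      (fun w _ => Finset.sum_nonneg fun i _ => hnn w i) (Finset.mem_univ w)
    refine h1.trans (h2.trans ?_)
    rw [hc]; linarith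
  have hc1 : 1 ≤ c := by
    rw [hc, le_add_iff_nonneg_right]
    exact Finset.sum_nonneg fun w _ => Finset.sum_nonneg fun i _ => Finset.sum_nonneg fun j _ =>
      Finset.sum_nonneg fun k _ => mul_nonneg (apply_nonneg _ _) (apply_nonneg _ _)
  let q : SP K N → ℝ := fun p => Ideal.absNorm p.1.asIdeal
  have hq2 : ∀ p, 2 ≤ q p := fun p => two_le_absNorm p.1
  let δ : SP K N → ℝ := fun p => HeightOneSpectrum.adicAbv K p.1 (D : K)
  have hδ0 : ∀ p, 0 < δ p := fun p => (HeightOneSpectrum.adicAbv K p.1).pos hDK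
  have hδ1 : ∀ p, δ p ≤ 1 := fun p => HeightOneSpectrum.adicAbv_natCast_le_one K p.1 D
  refine ⟨(5 * c) ^ (n * d) * ∏ p : SP K N, ∏ i : I, (q p / δ p), ?_, ?_⟩
  · refine mul_pos (by positivity) (Finset.prod_pos fun p _ => Finset.prod_pos fun i _ =>
      div_pos (by linarith [hq2 p]) (hδ0 p))
  intro t ht ht1 hprod
  -- choose T
  obtain ⟨T, hT⟩ := exists_nat_ge (∑ w : InfinitePlace K, ∑ i, 3 * t (Sum.inl w) i + 1)
  have hTw : ∀ (w : InfinitePlace K) i, 3 * t (Sum.inl w) i ≤ T := by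
    intro w i
    have h1 := Finset.single_le_sum (f := fun i => 3 * t (Sum.inl w) i)
      (fun i _ => by have := ht (Sum.inl w) i; positivity) (Finset.mem_univ i)
    have h2 := Finset.single_le_sum (f := fun w : InfinitePlace K => ∑ i, 3 * t (Sum.inl w) i)
      (fun w _ => Finset.sum_nonneg fun i _ => by have := ht (Sum.inl w) i; positivity)
      (Finset.mem_univ w)
    refine h1.trans (h2.trans ?_)
    linarith
  have hT0 : (0 : ℝ) < T := by
    refine lt_of_lt_of_le ?_ hT
    have : 0 ≤ ∑ w : InfinitePlace K, ∑ i, 3 * t (Sum.inl w) i :=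
      Finset.sum_nonneg fun w _ => Finset.sum_nonneg fun i _ => by
        have := ht (Sum.inl w) i; positivity
    linarith
  have hexp : ∀ (p : SP K N) (i : I), ∃ e : ℕ, (q p ^ e)⁻¹ ≤ δ p * t (Sum.inr p) i ∧
      q p ^ e ≤ q p / (δ p * t (Sum.inr p) i) := fun p i =>
    exists_exp (by linarith [hq2 p]) (mul_pos (hδ0 p) (ht _ _))
      (mul_le_one₀ (hδ1 p) (ht _ _).le (ht1 p i))
  choose e he1 he2 using hexp
  -- the box
  let X : (I → κ → Fin (T + 1)) → I → 𝓞 K := fun a j => ∑ k, ((a j k : ℕ) : ℤ) • ω k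
  let Z : (I → κ → Fin (T + 1)) → InfinitePlace K → I → ℂ := fun a w i =>
    w.embedding ((A (Sum.inl w)).mulVec (fun j => algebraMap (𝓞 K) K (X a j)) i)
  let Y : (I → κ → Fin (T + 1)) → SP K N → I → 𝓞 K := fun a p i => ∑ j, E p i j * X a j
  have hZ : ∀ a (w : InfinitePlace K) i, ‖Z a w i‖ ≤ c * T := by
    intro a w i
    show ‖w.embedding _‖ ≤ _
    rw [InfinitePlace.norm_embedding_eq]
    refine (arch_bound w (A (Sum.inl w)) ω T (fun j k => (a j k : ℕ))
      (fun j k => Nat.lt_succ_iff.1 (a j k).2) i).trans ?_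
    exact mul_le_mul_of_nonneg_right (hcterm w i) hT0.le
  have hY : ∀ a (p : SP K N) i, algebraMap (𝓞 K) K (Y a p i) =
      D * (A (Sum.inr p)).mulVec (fun j => algebraMap (𝓞 K) K (X a j)) i := by
    intro a p i
    simp only [Y, Matrix.mulVec, dotProduct, map_sum, map_mul, hE, Finset.mul_sum, mul_assoc]
  -- cells
  let F1 : InfinitePlace K → I → Finset ℤ := fun w i =>
    Finset.Icc (-⌈2 * (c * T) / t (Sum.inl w) i⌉) ⌈2 * (c * T) / t (Sum.inl w) i⌉
  let F2 : InfinitePlace K → I → Finset ℤ := fun w i => if w.IsReal then {0} else F1 w i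
  have hZre : ∀ a w i, ⌊2 * (Z a w i).re / t (Sum.inl w) i⌋ ∈ F1 w i := fun a w i =>
    cell_mem (ht _ _) ((Complex.abs_re_le_norm _).trans (hZ a w i))
  have hZim : ∀ a w i, ⌊2 * (Z a w i).im / t (Sum.inl w) i⌋ ∈ F2 w i := by
    intro a w i
    simp only [F2]
    split_ifs with hw
    · have : (Z a w i).im = 0 := by
        simp only [Z]
        rw [← InfinitePlace.embedding_of_isReal_apply hw]
        exact Complex.ofReal_im _
      rw [this]; simp
    · exact cell_mem (ht _ _) ((Complex.abs_im_le_norm _).trans (hZ a w i))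
  have hfinq : ∀ (p : SP K N) i, Finite (𝓞 K ⧸ p.1.asIdeal ^ e p i) := fun p i =>
    Ideal.finiteQuotientOfFreeOfNeBot _ (pow_ne_zero _ p.1.ne_bot)
  letI : ∀ (p : SP K N) i, Fintype (𝓞 K ⧸ p.1.asIdeal ^ e p i) := fun p i => Fintype.ofFinite _
  let f : (I → κ → Fin (T + 1)) → ((w : InfinitePlace K) → (i : I) → F1 w i × F2 w i) ×
      ((p : SP K N) → (i : I) → 𝓞 K ⧸ p.1.asIdeal ^ e p i) := fun a =>
    (fun w i => (⟨_, hZre a w i⟩, ⟨_, hZim a w i⟩), fun p i => Ideal.Quotient.mk _ (Y a p i))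
  have hcard : Fintype.card (((w : InfinitePlace K) → (i : I) → F1 w i × F2 w i) ×
      ((p : SP K N) → (i : I) → 𝓞 K ⧸ p.1.asIdeal ^ e p i)) <
      Fintype.card (I → κ → Fin (T + 1)) := by
    rw [Fintype.card_prod, Fintype.card_pi, Fintype.card_pi]
    simp only [Fintype.card_pi, Fintype.card_prod, Fintype.card_coe, card_quot, Fintype.card_fin,
      Finset.prod_const, Finset.card_univ]
    rw [← pow_mul, mul_comm (Fintype.card κ)]
    have hcw : ∀ w i, ((F1 w i).card : ℝ) * (F2 w i).card ≤
        (5 * (c * T) / t (Sum.inl w) i) ^ w.mult := by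
      intro w i
      have h3t : 3 * t (Sum.inl w) i ≤ c * T :=
        (hTw w i).trans (le_mul_of_one_le_left hT0.le hc1)
      have hF1 : ((F1 w i).card : ℝ) ≤ 5 * (c * T) / t (Sum.inl w) i := cell_card (ht _ _) h3t
      by_cases hw : w.IsReal
      · simp only [F2, hw, if_true, Finset.card_singleton, Nat.cast_one, mul_one,
          InfinitePlace.mult, pow_one]
        exact hF1
      · simp only [F2, hw, if_false, InfinitePlace.mult]
        rw [pow_two]
        exact mul_le_mul hF1 hF1 (Nat.cast_nonneg _) ((Nat.cast_nonneg _).trans hF1)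
    have hcp : ∀ p i, ((Ideal.absNorm p.1.asIdeal ^ e p i : ℕ) : ℝ) ≤
        (q p / δ p) / t (Sum.inr p) i := by
      intro p i
      rw [div_div, Nat.cast_pow]
      exact he2 p i
    rw [← Nat.cast_lt (α := ℝ)]
    push_cast
    have hP := count_ineq (by linarith) hT0 t ht
      (fun w i => ((F1 w i).card : ℝ) * (F2 w i).card)
      (fun p i => (Ideal.absNorm p.1.asIdeal : ℝ) ^ e p i) (fun p => q p / δ p)
      (fun w i => by positivity) (fun p i => by positivity) hcw
      (fun p i => by simpa using hcp p i) (by rw [← hd]; exact hprod)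
    rw [← hd] at hP
    refine hP.trans_lt ?_
    exact pow_lt_pow_left₀ (by linarith) hT0.le (Nat.mul_pos hn hdpos).ne'
  obtain ⟨a, b, hab, hfab⟩ := Fintype.exists_ne_map_eq_of_card_lt f hcard
  have hsub : ∀ v, ∀ i, (A v).mulVec (fun j => algebraMap (𝓞 K) K ((X a - X b) j)) i =
      (A v).mulVec (fun j => algebraMap (𝓞 K) K (X a j)) i -
      (A v).mulVec (fun j => algebraMap (𝓞 K) K (X b j)) i := by
    intro v i
    rw [← Pi.sub_apply, ← Matrix.mulVec_sub]
    congr 2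
  refine ⟨X a - X b, ?_, ?_⟩
  · intro h
    apply hab
    funext j k
    have h1 : X a j = X b j := by
      have := congrFun h j
      simpa [sub_eq_zero] using this
    have h2 := congrArg (fun y => ω.repr y k) h1
    simp only [X, ω.repr_sum_self] at h2
    exact Fin.ext (by exact_mod_cast h2)
  · rintro (w | p) i
    · rw [av_inl, hsub, ← InfinitePlace.norm_embedding_eq, map_sub]
      have h1 := congrFun (congrFun (congrArg Prod.fst hfab) w) i
      simp only [f, Prod.mk.injEq, Subtype.mk.injEq] at h1
      exact cell_diff (ht _ _) h1.1 h1.2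
    · rw [av_inr, hsub]
      have h1 := congrFun (congrFun (congrArg Prod.snd hfab) p) i
      simp only [f] at h1
      rw [Ideal.Quotient.eq] at h1
      have h2 := adic_pow p.1 _ _ h1
      rw [map_sub, hY, hY, ← mul_sub, map_mul] at h2
      have h3 := h2.trans (he1 p i)
      exact le_of_mul_le_mul_left h3 (hδ0 p)

lemma mink (hN : 2 ≤ N) [Fintype (SP K N)] (I : Type) [Fintype I] [Nonempty I]
    (A : Pl K N → Matrix I I K) :
    ∃ C : ℝ, 0 < C ∧ ∀ t : Pl K N → I → ℝ, (∀ v i, 0 < t v i) →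
    C ≤ ∏ v, (∏ i, t v i) ^ mu v → ∃ x : I → K, (∀ i, x i ∈ ON K N) ∧ x ≠ 0 ∧
      ∀ v i, av v ((A v).mulVec x i) ≤ t v i := by
  obtain ⟨C, hC, h⟩ := mink_int (N := N) I A
  refine ⟨C, hC, fun t ht hprod => ?_⟩
  have hN0 := NK (K := K) hN
  have hNprod : ∏ v : Pl K N, av v (N : K) ^ mu v = 1 := by
    apply le_antisymm
    · have h1 := one_le (N := N) ((N : K) ^ 1)⁻¹ (inv_pow_ON hN 1) (by simpa using hN0)
      simp only [pow_one, map_inv₀, inv_pow, Finset.prod_inv_distrib] at h1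
      exact (one_le_inv₀ (Finset.prod_pos fun v _ => pow_pos ((av v).pos hN0) _)).1 h1
    · exact one_le (N : K) (natCast_mem _ N) hN0
  obtain ⟨s, hs⟩ := pow_unbounded_of_one_lt (∑ p : SP K N, ∑ i, t (Sum.inr p) i) one_lt_two
  obtain ⟨x, hx0, hx⟩ := h (fun v i => av v (N : K) ^ s * t v i)
    (fun v i => mul_pos (pow_pos ((av v).pos hN0) _) (ht v i))
    (fun p i => by
      have h1 := Finset.single_le_sum (f := fun i => t (Sum.inr p) i)
        (fun i _ => (ht (Sum.inr p) i).le) (Finset.mem_univ i)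
      have h2 := Finset.single_le_sum (f := fun p : SP K N => ∑ i, t (Sum.inr p) i)
        (fun p _ => Finset.sum_nonneg fun i _ => (ht (Sum.inr p) i).le) (Finset.mem_univ p)
      have h3 : t (Sum.inr p) i ≤ 2 ^ s := h1.trans (h2.trans hs.le)
      calc _ ≤ (1 / 2 : ℝ) ^ s * 2 ^ s := by
            refine mul_le_mul (pow_le_pow_left₀ (apply_nonneg _ _) (adic_N p) s) h3
              (ht _ _).le (by positivity)
        _ = 1 := by rw [← mul_pow]; norm_num)
    (by
      refine hprod.trans (le_of_eq ?_)
      have : ∀ v : Pl K N, (∏ i, av v (N : K) ^ s * t v i) ^ mu v =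
          (av v (N : K) ^ mu v) ^ (s * Fintype.card I) * (∏ i, t v i) ^ mu v := by
        intro v
        rw [Finset.prod_mul_distrib, Finset.prod_const, Finset.card_univ, mul_pow]
        congr 1
        rw [← pow_mul, ← pow_mul, ← pow_mul]
        congr 1
        ring
      simp only [this]
      rw [Finset.prod_mul_distrib, Finset.prod_pow, hNprod, one_pow, one_mul])
  refine ⟨((N : K) ^ s)⁻¹ • fun j => algebraMap (𝓞 K) K (x j), fun i => ?_, ?_, fun v i => ?_⟩
  · exact mul_mem (inv_pow_ON hN s) (R_le ⟨_, rfl⟩)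
  · intro h0
    apply hx0
    have h1 := (smul_eq_zero.1 h0).resolve_left (inv_ne_zero (pow_ne_zero _ hN0))
    funext j
    have := congrFun h1 j
    simpa using this
  · rw [Matrix.mulVec_smul, Pi.smul_apply, smul_eq_mul, map_mul, map_inv₀, map_pow,
      inv_mul_le_iff₀ (pow_pos ((av v).pos hN0) _)]
    exact hx v i

/-- The arithmetic data attached to a number field. -/
theorem exists_PF (S : Set K) (hS : S.Finite) (h0 : ∀ s ∈ S, s ≠ 0) :
    ∃ F : PF K, ∀ s ∈ S, s ∈ F.O ∧ s⁻¹ ∈ F.O := by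
  classical
  obtain ⟨N0, hN0, hcl⟩ := exists_cl (K := K)
  choose d hd0 hd using den (K := K)
  let D : ℕ := ∏ s ∈ hS.toFinset, d s * d s⁻¹
  have hD : D ≠ 0 := Finset.prod_ne_zero_iff.2 fun s _ => mul_ne_zero (hd0 _) (hd0 _)
  let N : ℕ := 2 * N0 * D
  have hN : 2 ≤ N := by
    have : 0 < N0 * D := Nat.pos_of_ne_zero (mul_ne_zero hN0 hD)
    show 2 ≤ 2 * N0 * D
    rw [mul_assoc]; omega
  have hdd : ∀ x : K, d x ∣ N → x ∈ ON K N := by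
    rintro x ⟨k, hk⟩
    refine ⟨1, ?_⟩
    rw [pow_one, hk, Nat.cast_mul, mul_right_comm]
    exact mul_mem (hd x) (natCast_mem _ k)
  haveI := SP_finite (K := K) hN
  letI : Fintype (SP K N) := Fintype.ofFinite _
  let F : PF K :=
    { ι := Pl K N
      fin := inferInstance
      dec := inferInstance
      O := ON K N
      R := (algebraMap (𝓞 K) K).range
      R_le := R_le
      pid := pid hN (hcl N ⟨2 * D, by show 2 * N0 * D = _; ring⟩)
      den := den
      abv := av
      m := mu
      m_pos := by
        rintro (w | p)
        · exact InfinitePlace.mult_pos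
        · exact Nat.one_pos
      one_le := one_le
      finite_bdd := finite_bdd hN
      siegel := siegel
      mink := fun I _ _ _ A _ => mink hN I A
      v0 := Sum.inr (SP_nonempty hN).some
      m_v0 := rfl }
  refine ⟨F, fun s hs => ?_⟩
  have h1 : d s * d s⁻¹ ∣ N := (Finset.dvd_prod_of_mem (fun s => d s * d s⁻¹)
    (hS.mem_toFinset.2 hs)).trans ⟨2 * N0, by show 2 * N0 * D = _; ring⟩
  exact ⟨hdd _ ((dvd_mul_right _ _).trans h1), hdd _ ((dvd_mul_left _ _).trans h1)⟩

end NF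

end Part21

section Part22
set_option autoImplicit false

namespace NF

/-- Number field case, ultrafilter form. -/
theorem nf_seq {K : Type} [Field K] [NumberField K] (Γ : Subgroup Kˣ) (hΓ : Γ.FG)
    {ι : Type} [Fintype ι] [Nonempty ι] (𝒰 : Ultrafilter ℕ) (x : ℕ → ι → Kˣ)
    (hx : ∀ k i, x k i ∈ Γ) (hs : ∀ k, ∑ i, (x k i : K) = 0) :
    ∃ i j, i ≠ j ∧ ∃ b : K, ∀ᶠ k in (𝒰 : Filter ℕ), (x k i : K) / x k j = b := by
  obtain ⟨S, rfl⟩ := hΓ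
  obtain ⟨F, hF⟩ := exists_PF (K := K) ((fun u : Kˣ => (u : K)) '' (S : Set Kˣ))
    (S.finite_toSet.image _) (by rintro _ ⟨u, _, rfl⟩; exact u.ne_zero)
  have key : ∀ u ∈ Subgroup.closure (S : Set Kˣ), (u : K) ∈ F.O ∧ ((u : K))⁻¹ ∈ F.O := by
    intro u hu
    induction hu using Subgroup.closure_induction with
    | mem u hu => exact hF _ ⟨u, hu, rfl⟩
    | one => simp [one_mem]
    | mul a b _ _ ha hb =>
      rw [Units.val_mul, mul_inv]
      exact ⟨mul_mem ha.1 hb.1, mul_mem ha.2 hb.2⟩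
    | inv a _ ha =>
      rw [Units.val_inv_eq_inv_val, inv_inv]
      exact ⟨ha.2, ha.1⟩
  by_contra hcon
  exact F.unit_seq 𝒰 (fun k i => (x k i : K)) (fun k i => (x k i).ne_zero)
    (fun k i => (key _ (hx k i)).1) (fun k i => (key _ (hx k i)).2) hs
    (fun i j hij b h => hcon ⟨i, j, hij, b, h⟩)

lemma min_subgroup {M : Type*} [AddCommGroup M] [Module.Finite ℤ M] (𝓗 : Set (AddSubgroup M))
    (hne : 𝓗.Nonempty) (hinf : ∀ H ∈ 𝓗, ∀ H' ∈ 𝓗, H ⊓ H' ∈ 𝓗) :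
    ∃ H ∈ 𝓗, ∀ H' ∈ 𝓗, ∀ γ ∈ H, ∃ n : ℕ, 0 < n ∧ n • γ ∈ H' := by
  let r : AddSubgroup M → ℕ := fun H => Module.finrank ℤ (AddSubgroup.toIntSubmodule H)
  obtain ⟨H, hH, hmin⟩ : ∃ H ∈ 𝓗, ∀ H' ∈ 𝓗, r H ≤ r H' := by
    obtain ⟨H, hH, hm⟩ := (measure r).wf.has_min 𝓗 hne
    exact ⟨H, hH, fun H' hH' => not_lt.1 (hm H' hH')⟩
  refine ⟨H, hH, fun H' hH' γ hγ => ?_⟩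
  have h1 := hmin _ (hinf H hH H' hH')
  let P := AddSubgroup.toIntSubmodule H
  let Q := AddSubgroup.toIntSubmodule (H ⊓ H')
  have hQP : Q ≤ P := fun y hy => hy.1
  have h2 := Submodule.finrank_quotient_add_finrank (Q.submoduleOf P)
  have h3 : Module.finrank ℤ (Q.submoduleOf P) = Module.finrank ℤ Q :=
    (Submodule.submoduleOfEquivOfLe hQP).finrank_eq
  have h4 : Module.finrank ℤ (P ⧸ Q.submoduleOf P) = 0 := by
    have h5 : Module.finrank ℤ P ≤ Module.finrank ℤ Q := h1
    omega
  rw [Module.finrank_eq_zero_iff_isTorsion] at h4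
  obtain ⟨⟨a, ha⟩, hb⟩ := @h4 (Submodule.Quotient.mk ⟨γ, hγ⟩)
  have ha0 : a ≠ 0 := nonZeroDivisors.ne_zero ha
  have hb' : a • (Submodule.Quotient.mk ⟨γ, hγ⟩ : P ⧸ Q.submoduleOf P) = 0 := hb
  rw [← Submodule.Quotient.mk_smul, Submodule.Quotient.mk_eq_zero] at hb'
  have h6 : a • γ ∈ H' := hb'.2
  refine ⟨a.natAbs, Int.natAbs_pos.2 ha0, ?_⟩
  rw [← natCast_zsmul]
  rcases Int.natAbs_eq a with h | h
  · rwa [← h]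
  · have h7 : ((a.natAbs : ℕ) : ℤ) = -a := by omega
    rw [h7, neg_smul]
    exact neg_mem h6

lemma torsion_finite {M : Type*} [AddCommGroup M] [Module.Finite ℤ M] (H : AddSubgroup M)
    (h : ∀ γ ∈ H, ∃ n : ℕ, 0 < n ∧ n • γ = 0) : (H : Set M).Finite := by
  let P := AddSubgroup.toIntSubmodule H
  have : Finite P := Module.finite_of_fg_torsion P (by
    rintro ⟨γ, hγ⟩
    obtain ⟨n, hn, h0⟩ := h γ hγ
    refine ⟨⟨n, mem_nonZeroDivisors_of_ne_zero (by exact_mod_cast hn.ne')⟩, Subtype.ext ?_⟩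
    show (n : ℤ) • γ = 0
    rw [natCast_zsmul, h0])
  exact Set.toFinite (P : Set M)

lemma root_bound {K : Type*} [Field K] [CharZero K] [FiniteDimensional ℚ K] (D : ℕ)
    (hD : Module.finrank ℚ K ≤ D) (u : K) (n : ℕ) (hn : 0 < n) (h : u ^ n = 1) :
    u ^ (2 * D).factorial = 1 := by
  have hfin : IsOfFinOrder u := isOfFinOrder_iff_pow_eq_one.2 ⟨n, hn, h⟩
  have hm : 0 < orderOf u := hfin.orderOf_pos
  rw [← orderOf_dvd_iff_pow_eq_one, Nat.dvd_iff_prime_pow_dvd_dvd]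
  intro p k hp hpk
  rcases Nat.eq_zero_or_pos k with rfl | hk
  · simp
  obtain ⟨c, hc⟩ := hpk
  have hprim : IsPrimitiveRoot (u ^ c) (p ^ k) :=
    (IsPrimitiveRoot.orderOf u).pow hm (by rw [hc, mul_comm])
  have hpk0 : 0 < p ^ k := pow_pos hp.pos k
  have h1 : (p ^ k).totient ≤ D := by
    have h2 := Polynomial.cyclotomic_eq_minpoly_rat hprim hpk0
    have h3 := minpoly.natDegree_le (A := ℚ) (u ^ c)
    rw [← h2, Polynomial.natDegree_cyclotomic] at h3
    exact h3.trans hD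
  have h4 : p ^ k ≤ 2 * D := by
    rw [Nat.totient_prime_pow hp hk] at h1
    have h5 : p ^ k = p ^ (k - 1) * p := by rw [← pow_succ, Nat.sub_add_cancel hk]
    have h6 : p ≤ 2 * (p - 1) := by have := hp.two_le; omega
    calc p ^ k = p ^ (k - 1) * p := h5
      _ ≤ p ^ (k - 1) * (2 * (p - 1)) := Nat.mul_le_mul_left _ h6
      _ = 2 * (p ^ (k - 1) * (p - 1)) := by ring
      _ ≤ 2 * D := Nat.mul_le_mul_left _ h1
  exact Nat.dvd_factorial hpk0 h4

end NF

end Part22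

section Part23
set_option autoImplicit false

namespace NF

lemma to_type_zero {L : Type*} [Field L] [Algebra ℚ L] [FiniteDimensional ℚ L] :
    ∃ (K : Type) (_ : Field K) (_ : NumberField K) (_ : L ≃+* K),
      Module.finrank ℚ K = Module.finrank ℚ L := by
  let f : L →ₐ[ℚ] AlgebraicClosure ℚ := IsAlgClosed.lift
  let e : L ≃ₐ[ℚ] f.fieldRange := AlgEquiv.ofInjectiveField f
  haveI : FiniteDimensional ℚ f.fieldRange := e.toLinearEquiv.finiteDimensional
  refine ⟨f.fieldRange, inferInstance, ?_, e.toRingEquiv, ?_⟩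
  · exact { to_charZero := inferInstance, to_finiteDimensional := by convert this }
  · convert e.toLinearEquiv.finrank_eq.symm

/-- Specialization of a finitely generated domain to number fields of bounded degree. -/
lemma spec {A : Type*} [CommRing A] [IsDomain A] [Algebra ℚ A] [Algebra.FiniteType ℚ A] :
    ∃ D : ℕ, ∀ g : A, g ≠ 0 → ∃ (K : Type) (_ : Field K) (_ : NumberField K) (φ : A →+* K),
      φ g ≠ 0 ∧ Module.finrank ℚ K ≤ D := by
  obtain ⟨s, f, hinj, hfin⟩ := exists_finite_inj_algHom_of_fg ℚ A
  letI : Algebra (MvPolynomial (Fin s) ℚ) A := f.toRingHom.toAlgebra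
  have hfa : ∀ b, algebraMap (MvPolynomial (Fin s) ℚ) A b = f b := fun b => rfl
  haveI : Module.Finite (MvPolynomial (Fin s) ℚ) A := hfin
  obtain ⟨G, hG⟩ := (Module.Finite.fg_top : (⊤ : Submodule (MvPolynomial (Fin s) ℚ) A).FG)
  refine ⟨G.card, fun g hg => ?_⟩
  have hI : (Ideal.span {g}).comap (algebraMap (MvPolynomial (Fin s) ℚ) A) ≠ ⊥ :=
    Ideal.comap_ne_bot_of_integral_mem hg (Ideal.mem_span_singleton_self g)
      (Algebra.IsIntegral.isIntegral g)
  obtain ⟨b, hb, hb0⟩ := Submodule.exists_mem_ne_zero_of_ne_bot hI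
  obtain ⟨c, hc⟩ : ∃ c : Fin s → ℚ, MvPolynomial.eval c b ≠ 0 := by
    by_contra hcon
    push Not at hcon
    exact hb0 (MvPolynomial.funext fun c => by rw [hcon c, map_zero])
  let m : Ideal (MvPolynomial (Fin s) ℚ) := RingHom.ker (MvPolynomial.eval c)
  haveI hm : m.IsMaximal := RingHom.ker_isMaximal_of_surjective _ fun q =>
    ⟨MvPolynomial.C q, by simp⟩
  obtain ⟨Q, hQ, hQm⟩ := Ideal.exists_ideal_over_maximal_of_isIntegral (S := A) m (by
    rw [(RingHom.injective_iff_ker_eq_bot _).1 (by exact hinj)]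
    exact bot_le)
  letI : Field (A ⧸ Q) := Ideal.Quotient.field Q
  have hspan : Submodule.span ℚ ((Ideal.Quotient.mkₐ ℚ Q) '' (G : Set A)) = ⊤ := by
    rw [eq_top_iff]
    rintro y -
    obtain ⟨a, rfl⟩ := Ideal.Quotient.mkₐ_surjective ℚ Q y
    have ha : a ∈ Submodule.span (MvPolynomial (Fin s) ℚ) (G : Set A) := by
      rw [hG]; trivial
    induction ha using Submodule.span_induction with
    | mem a ha => exact Submodule.subset_span ⟨a, ha, rfl⟩
    | zero => rw [map_zero]; exact zero_mem _
    | add a a' _ _ h h' => rw [map_add]; exact add_mem h h'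
    | smul p a _ h =>
      have h1 : p - MvPolynomial.C (MvPolynomial.eval c p) ∈ m := by
        rw [RingHom.mem_ker]; simp
      rw [← hQm, Ideal.mem_comap, map_sub, hfa, hfa] at h1
      have h2 : f (MvPolynomial.C (MvPolynomial.eval c p)) =
          algebraMap ℚ A (MvPolynomial.eval c p) := f.commutes _
      rw [h2] at h1
      have h3 : (Ideal.Quotient.mkₐ ℚ Q) (p • a) =
          (MvPolynomial.eval c p) • (Ideal.Quotient.mkₐ ℚ Q) a := by
        rw [Algebra.smul_def, hfa, map_mul, Algebra.smul_def]
        congr 1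
        rw [← sub_eq_zero, ← AlgHom.commutes (Ideal.Quotient.mkₐ ℚ Q), ← map_sub]
        exact Ideal.Quotient.eq_zero_iff_mem.2 h1
      rw [h3]
      exact Submodule.smul_mem _ _ h
  classical
  have hspan' : Submodule.span ℚ ((G.image (Ideal.Quotient.mkₐ ℚ Q) : Finset (A ⧸ Q)) :
      Set (A ⧸ Q)) = ⊤ := by
    rw [Finset.coe_image]; exact hspan
  haveI : FiniteDimensional ℚ (A ⧸ Q) := ⟨⟨_, hspan'⟩⟩
  have hrank : Module.finrank ℚ (A ⧸ Q) ≤ G.card := by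
    have h1 := finrank_span_finset_le_card (R := ℚ) (G.image (Ideal.Quotient.mkₐ ℚ Q))
    rw [Set.finrank, hspan', finrank_top] at h1
    exact h1.trans Finset.card_image_le
  obtain ⟨K, iF, iN, e, he⟩ := to_type_zero (L := A ⧸ Q)
  refine ⟨K, iF, iN, (e : A ⧸ Q →+* K).comp (Ideal.Quotient.mk Q), ?_, he.trans_le hrank⟩
  rw [RingHom.comp_apply]
  intro h
  have h1 : Ideal.Quotient.mk Q g = 0 := e.injective (by rw [map_zero]; exact h)
  rw [Ideal.Quotient.eq_zero_iff_mem] at h1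
  have h2 : b ∈ m := by
    rw [← hQm, Ideal.mem_comap]
    exact (Ideal.span_singleton_le_iff_mem Q).2 h1 hb
  exact hc h2

end NF

end Part23

section Part24
set_option autoImplicit false

namespace NF

lemma pair_gamma {M : Type*} [AddCommGroup M] [Module.Finite ℤ M] (𝒰 : Ultrafilter ℕ) (r : ℕ → M)
    (hr : ∀ b, ¬ ∀ᶠ k in (𝒰 : Filter ℕ), r k = b) :
    ∃ γ : M, (∀ n : ℕ, 0 < n → n • γ ≠ 0) ∧ ∀ (H : AddSubgroup M) (b : M),
      (∀ᶠ k in (𝒰 : Filter ℕ), r k - b ∈ H) → ∃ n : ℕ, 0 < n ∧ n • γ ∈ H := by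
  obtain ⟨H, ⟨b, hb⟩, hmin⟩ := min_subgroup
    {H : AddSubgroup M | ∃ b : M, ∀ᶠ k in (𝒰 : Filter ℕ), r k - b ∈ H} ⟨⊤, 0, by simp⟩ (by
      rintro H ⟨b, hb⟩ H' ⟨b', hb'⟩
      obtain ⟨k0, h0, h0'⟩ := (hb.and hb').exists
      refine ⟨r k0, ?_⟩
      filter_upwards [hb, hb'] with k hk hk'
      refine ⟨?_, ?_⟩
      · have := sub_mem hk h0
        rwa [sub_sub_sub_cancel_right] at this
      · have := sub_mem hk' h0'
        rwa [sub_sub_sub_cancel_right] at this)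
  by_cases ht : ∀ γ ∈ H, ∃ n : ℕ, 0 < n ∧ n • γ = 0
  · exfalso
    have hfin := torsion_finite H ht
    have h2 : ∀ᶠ k in (𝒰 : Filter ℕ), ∃ h ∈ (H : Set M), r k - b = h :=
      hb.mono fun k hk => ⟨_, hk, rfl⟩
    rw [Ultrafilter.eventually_exists_mem_iff hfin] at h2
    obtain ⟨h, _, hh⟩ := h2
    exact hr (h + b) (hh.mono fun k hk => by rw [← hk, sub_add_cancel])
  · push Not at ht
    obtain ⟨γ, hγ, hn⟩ := ht
    exact ⟨γ, hn, fun H' b' h' => hmin H' ⟨b', h'⟩ γ hγ⟩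

theorem weak_seq {G : Type*} [Field G] [CharZero G] (Γ : Subgroup Gˣ) (hΓ : Γ.FG)
    {ι : Type} [Fintype ι] [Nonempty ι] (𝒰 : Ultrafilter ℕ) (x : ℕ → ι → Gˣ)
    (hx : ∀ k i, x k i ∈ Γ) (hs : ∀ k, ∑ i, (x k i : G) = 0) :
    ∃ i j, i ≠ j ∧ ∃ b : Gˣ, ∀ᶠ k in (𝒰 : Filter ℕ), x k i / x k j = b := by
  classical
  by_contra hcon
  push Not at hcon
  obtain ⟨S, hS⟩ := id hΓ
  let T : Finset G := S.image (fun u : Gˣ => (u : G)) ∪ S.image (fun u : Gˣ => ((u⁻¹ : Gˣ) : G))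
  let A := Algebra.adjoin ℚ (T : Set G)
  haveI : Algebra.FiniteType ℚ A := (Subalgebra.fg_iff_finiteType _).1 (Subalgebra.fg_adjoin_finset T)
  have hΓA : ∀ u ∈ Γ, (u : G) ∈ A ∧ ((u⁻¹ : Gˣ) : G) ∈ A := by
    intro u hu
    rw [← hS] at hu
    induction hu using Subgroup.closure_induction with
    | mem u hu =>
      refine ⟨Algebra.subset_adjoin ?_, Algebra.subset_adjoin ?_⟩
      · exact Finset.mem_coe.2 (Finset.mem_union_left _ (Finset.mem_image_of_mem (fun u : Gˣ => (u : G)) hu))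
      · exact Finset.mem_coe.2 (Finset.mem_union_right _
          (Finset.mem_image_of_mem (fun u : Gˣ => ((u⁻¹ : Gˣ) : G)) hu))
    | one => simp [one_mem]
    | mul a b _ _ ha hb =>
      rw [Units.val_mul, mul_inv, Units.val_mul]
      exact ⟨mul_mem ha.1 hb.1, mul_mem ha.2 hb.2⟩
    | inv a _ ha =>
      rw [inv_inv]
      exact ⟨ha.2, ha.1⟩
  let ψ : Γ →* A :=
    { toFun := fun u => ⟨(u : Gˣ), (hΓA u u.2).1⟩
      map_one' := by ext; simp
      map_mul' := fun a b => by ext; simp }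
  have hψ : ∀ u : Γ, ((ψ u : A) : G) = ((u : Gˣ) : G) := fun u => rfl
  have hψinj : ∀ u v : Γ, ψ u = ψ v → u = v := fun u v h =>
    Subtype.ext (Units.ext (congrArg (fun a : A => (a : G)) h))
  obtain ⟨D, hD⟩ := spec (A := A)
  let W := (2 * D).factorial
  have hW : 0 < W := Nat.factorial_pos _
  haveI : Group.FG Γ := (Group.fg_iff_subgroup_fg _).2 hΓ
  haveI : Module.Finite ℤ (Additive Γ) := by
    rw [Module.Finite.iff_addGroup_fg]
    infer_instance
  let y : ℕ → ι → Γ := fun k i => ⟨x k i, hx k i⟩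
  have hpair : ∀ p : ι × ι, p.1 ≠ p.2 → ∃ γ : Γ, (∀ n : ℕ, 0 < n → γ ^ n ≠ 1) ∧
      ∀ (H : Subgroup Γ) (b : Γ), (∀ᶠ k in (𝒰 : Filter ℕ), (y k p.1 / y k p.2) / b ∈ H) →
        ∃ n : ℕ, 0 < n ∧ γ ^ n ∈ H := by
    intro p hp
    obtain ⟨γ, h1, h2⟩ := pair_gamma (M := Additive Γ) 𝒰
      (fun k => Additive.ofMul (y k p.1 / y k p.2)) (by
        intro b hb
        obtain ⟨k, hk, hk'⟩ := (hb.and (hcon p.1 p.2 hp ((b.toMul : Γ) : Gˣ))).exists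
        refine hk' ?_
        rw [← hk]; rfl)
    exact ⟨γ.toMul, h1, fun H b => h2 H.toAddSubgroup (Additive.ofMul b)⟩
  choose! γ hγ1 hγ2 using hpair
  let P : Finset (ι × ι) := Finset.univ.filter fun p => p.1 ≠ p.2
  let g : A := ∏ p ∈ P, (ψ (γ p) ^ W - 1)
  have hg : g ≠ 0 := by
    refine Finset.prod_ne_zero_iff.2 fun p hp => ?_
    have hp' : p.1 ≠ p.2 := (Finset.mem_filter.1 hp).2
    intro h0
    rw [sub_eq_zero, ← map_pow, ← map_one ψ] at h0
    exact hγ1 p hp' W hW (hψinj _ _ h0)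
  obtain ⟨K, _, _, φ, hφ, hfr⟩ := hD g hg
  let f : Γ →* Kˣ := (((φ : A →* K).comp ψ)).toHomUnits
  have hf : ∀ u : Γ, ((f u : Kˣ) : K) = φ (ψ u) := fun u => rfl
  have hfg : f.range.FG := by
    have : Group.FG f.range := inferInstance
    exact (Group.fg_iff_subgroup_fg _).1 this
  obtain ⟨i, j, hij, b, hb⟩ := nf_seq f.range hfg 𝒰 (fun k i => f (y k i)) (fun k i => ⟨_, rfl⟩) (by
    intro k
    have h1 : ∑ i, ψ (y k i) = 0 := by
      apply Subtype.ext
      rw [AddSubmonoidClass.coe_finset_sum]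
      exact hs k
    simp only [hf]
    rw [← map_sum, h1, map_zero])
  obtain ⟨k0, hk0⟩ := hb.exists
  obtain ⟨n, hn, hmem⟩ := hγ2 (i, j) hij f.ker (y k0 i / y k0 j) (by
    filter_upwards [hb] with k hk
    rw [MonoidHom.mem_ker, map_div, div_eq_one]
    apply Units.ext
    rw [map_div, map_div, Units.val_div_eq_div_val, Units.val_div_eq_div_val]
    exact hk.trans hk0.symm)
  rw [MonoidHom.mem_ker, map_pow] at hmem
  have h3 : φ (ψ (γ (i, j))) ^ n = 1 := by
    rw [← hf, ← Units.val_pow_eq_pow_val, hmem, Units.val_one]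
  have h4 := root_bound D hfr _ n hn h3
  apply hφ
  rw [map_prod]
  refine Finset.prod_eq_zero (i := (i, j)) (Finset.mem_filter.2 ⟨Finset.mem_univ _, hij⟩) ?_
  rw [map_sub, map_pow, map_one, h4, sub_self]

end NF

end Part24

section Part25
set_option autoImplicit false

namespace NF

theorem strong_seq {G : Type*} [Field G] [CharZero G] {ι : Type} [DecidableEq ι]
    (𝒰 : Ultrafilter ℕ) (n : ℕ) : ∀ (s : Finset ι) (_ : s.card = n)
    (Γ : Subgroup Gˣ) (_ : Γ.FG) (x : ℕ → ι → Gˣ) (_ : ∀ k, ∀ i ∈ s, x k i ∈ Γ)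
    (_ : ∀ k, ∑ i ∈ s, (x k i : G) = 0)
    (_ : ∀ k, ∀ I ⊆ s, I.Nonempty → ∑ i ∈ I, (x k i : G) = 0 → I = s),
    ∀ i ∈ s, ∀ j ∈ s, ∃ b : Gˣ, ∀ᶠ k in (𝒰 : Filter ℕ), x k i / x k j = b := by
  induction n with
  | zero =>
    intro s hs _ _ _ _ _ _ i hi
    rw [Finset.card_eq_zero] at hs
    subst hs
    simp at hi
  | succ n ih =>
    intro s hcard Γ hΓ x hx hs hm i0 hi0 j0 hj0
    haveI : Nonempty s := ⟨⟨i0, hi0⟩⟩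
    obtain ⟨⟨i, hi⟩, ⟨j, hj⟩, hij, b, hb⟩ := weak_seq Γ hΓ (ι := s) 𝒰 (fun k l => x k l)
      (fun k l => hx k l l.2) (fun k => by
        rw [← hs k]; exact Finset.sum_coe_sort s (fun l => (x k l : G)))
    have hij' : i ≠ j := fun h => hij (Subtype.ext h)
    -- it suffices to treat ratios with denominator `j`
    suffices h : ∀ l ∈ s, ∃ b : Gˣ, ∀ᶠ k in (𝒰 : Filter ℕ), x k l / x k j = b by
      obtain ⟨b1, h1⟩ := h i0 hi0
      obtain ⟨b2, h2⟩ := h j0 hj0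
      refine ⟨b1 / b2, ?_⟩
      filter_upwards [h1, h2] with k hk1 hk2
      rw [← hk1, ← hk2, div_div_div_cancel_right]
    by_cases hdeg : s = {i, j}
    · intro l hl
      rw [hdeg, Finset.mem_insert, Finset.mem_singleton] at hl
      rcases hl with rfl | rfl
      · exact ⟨b, hb⟩
      · exact ⟨1, by simp⟩
    -- replace the sequence by one for which the ratio is always `b`
    obtain ⟨k0, hk0⟩ := hb.exists
    classical
    let κ : ℕ → ℕ := fun k => if x k i / x k j = b then k else k0
    have hκ : ∀ k, x (κ k) i = b * x (κ k) j := by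
      intro k
      rw [← div_eq_iff_eq_mul]
      by_cases h : x k i / x k j = b
      · simp only [κ, if_pos h]; exact h
      · simp only [κ, if_neg h]; exact hk0
    have hκe : ∀ᶠ k in (𝒰 : Filter ℕ), κ k = k := by
      filter_upwards [hb] with k hk
      exact if_pos hk
    have hb1 : (1 : G) + b ≠ 0 := by
      intro h0
      refine hdeg (hm (κ 0) {i, j} ?_ ⟨i, by simp⟩ ?_).symm
      · intro l hl
        rw [Finset.mem_insert, Finset.mem_singleton] at hl
        rcases hl with rfl | rfl <;> assumption
      · rw [Finset.sum_pair hij', hκ 0, Units.val_mul, ← add_one_mul, add_comm, h0, zero_mul]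
    let c : Gˣ := Units.mk0 _ hb1
    let z : ℕ → ι → Gˣ := fun k => Function.update (x (κ k)) j (c * x (κ k) j)
    have hzj : ∀ k, z k j = c * x (κ k) j := fun k => Function.update_self _ _ _
    have hzl : ∀ k l, l ≠ j → z k l = x (κ k) l := fun k l h => Function.update_of_ne h _ _
    have hsum1 : ∀ k, ∀ I : Finset ι, j ∈ I → i ∉ I →
        ∑ l ∈ I, (z k l : G) = ∑ l ∈ insert i I, (x (κ k) l : G) := by
      intro k I hjI hiI
      rw [Finset.sum_insert hiI, ← Finset.add_sum_erase I _ hjI, ← Finset.add_sum_erase I _ hjI,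
        hzj, hκ k, Units.val_mul, Units.val_mul]
      rw [Finset.sum_congr rfl (fun l hl => by rw [hzl k l (Finset.ne_of_mem_erase hl)])]
      simp only [c, Units.val_mk0]
      ring
    have hji : j ∈ s.erase i := Finset.mem_erase.2 ⟨hij'.symm, hj⟩
    have key := ih (s.erase i) (by rw [Finset.card_erase_of_mem hi, hcard]; rfl)
      (Γ ⊔ Subgroup.closure {c}) (hΓ.sup ⟨{c}, by simp⟩) z (by
        intro k l hl
        by_cases h : l = j
        · subst h
          rw [hzj]
          exact mul_mem (Subgroup.mem_sup_right (Subgroup.subset_closure rfl))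
            (Subgroup.mem_sup_left (hx _ _ hj))
        · rw [hzl k l h]
          exact Subgroup.mem_sup_left (hx _ _ (Finset.mem_of_mem_erase hl))) (by
        intro k
        rw [hsum1 k _ hji (Finset.notMem_erase _ _), Finset.insert_erase hi]
        exact hs _) (by
        intro k I hI hne h0
        by_cases hjI : j ∈ I
        · have hiI : i ∉ I := fun h => Finset.notMem_erase i s (hI h)
          rw [hsum1 k I hjI hiI] at h0
          have := hm (κ k) (insert i I) (Finset.insert_subset hi (hI.trans (Finset.erase_subset _ _)))
            (Finset.insert_nonempty _ _) h0
          rw [← this, Finset.erase_insert hiI]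
        · exfalso
          rw [Finset.sum_congr rfl (fun l hl => by
            rw [hzl k l (fun h => hjI (h ▸ hl))])] at h0
          have := hm (κ k) I (hI.trans (Finset.erase_subset _ _)) hne h0
          exact hjI (this ▸ hj))
    intro l hl
    by_cases hli : l = i
    · subst hli; exact ⟨b, hb⟩
    by_cases hlj : l = j
    · subst hlj; exact ⟨1, by simp⟩
    obtain ⟨b', hb'⟩ := key l (Finset.mem_erase.2 ⟨hli, hl⟩) j hji
    refine ⟨c * b', ?_⟩
    filter_upwards [hb', hκe] with k hk hk2
    rw [hzj, hzl k l hlj, hk2] at hk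
    rw [← hk, mul_div_assoc', mul_div_mul_left_eq_div]

end NF

/-- Finiteness of the set of nondegenerate solutions of the unit equation in several unknowns
(Evertse; van der Poorten and Schlickewei), a consequence of the Subspace Theorem. -/
theorem unit_equation_finite {G : Type*} [Field G] [CharZero G] (Γ : Subgroup Gˣ) (hΓ : Γ.FG)
    (ι : Type) [Fintype ι] :
    {x : ι → Gˣ | (∀ i, x i ∈ Γ) ∧ ∑ i, (x i : G) = 1 ∧
      ∀ I : Finset ι, I.Nonempty → ∑ i ∈ I, (x i : G) ≠ 0}.Finite := by
  classical
  by_contra hinf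
  have hinf' : Set.Infinite _ := hinf
  let e := hinf'.natEmbedding
  let x : ℕ → ι → Gˣ := fun k => (e k : ι → Gˣ)
  have hxm : ∀ k, _ := fun k => (e k).2
  have hxinj : Function.Injective x := fun a b h => e.injective (Subtype.ext h)
  let z : ℕ → Option ι → Gˣ := fun k o => o.elim (-1) (x k)
  have hJ : ∀ k, ∀ J : Finset (Option ι), none ∉ J → J.Nonempty →
      ∑ o ∈ J, (z k o : G) = 0 → False := by
    intro k J hn hne h0
    have hJe : J = J.eraseNone.map Function.Embedding.some := by
      rw [Finset.map_some_eraseNone, Finset.erase_eq_of_notMem hn]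
    rw [hJe, Finset.sum_map] at h0
    refine (hxm k).2.2 J.eraseNone ?_ h0
    rw [hJe] at hne
    exact Finset.map_nonempty.1 hne
  have key := NF.strong_seq (Filter.hyperfilter ℕ) _ (Finset.univ : Finset (Option ι)) rfl
    (Γ ⊔ Subgroup.closure {-1}) (hΓ.sup ⟨{-1}, by simp⟩) z (by
      intro k o _
      cases o with
      | none => exact Subgroup.mem_sup_right (Subgroup.subset_closure rfl)
      | some i => exact Subgroup.mem_sup_left ((hxm k).1 i)) (by
      intro k
      rw [Fintype.sum_option]
      have := (hxm k).2.1
      change ((-1 : Gˣ) : G) + ∑ i, (x k i : G) = 0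
      rw [show ∑ i, (x k i : G) = 1 from this]
      simp) (by
      intro k I _ hne h0
      by_cases hn : none ∈ I
      · by_contra hI
        have h1 : ∑ o ∈ Iᶜ, (z k o : G) = 0 := by
          have h2 := Finset.sum_add_sum_compl I (fun o => (z k o : G))
          rw [h0, zero_add, Fintype.sum_option] at h2
          rw [h2]
          change ((-1 : Gˣ) : G) + ∑ i, (x k i : G) = 0
          rw [show ∑ i, (x k i : G) = 1 from (hxm k).2.1]
          simp
        exact hJ k Iᶜ (by simpa using hn) (by
          rw [Finset.nonempty_iff_ne_empty, Ne, Finset.compl_eq_empty_iff]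
          exact hI) h1
      · exact (hJ k I hn hne h0).elim)
  have h2 : ∀ i, ∃ b : Gˣ, ∀ᶠ k in (Filter.hyperfilter ℕ : Filter ℕ), x k i = b := by
    intro i
    obtain ⟨b, hb⟩ := key (some i) (Finset.mem_univ _) none (Finset.mem_univ _)
    refine ⟨b * (-1), ?_⟩
    filter_upwards [hb] with k hk
    rw [← div_eq_iff_eq_mul]
    exact hk
  choose v hv using h2
  have h3 : ∀ᶠ k in (Filter.hyperfilter ℕ : Filter ℕ), x k = v := by
    filter_upwards [Filter.eventually_all.2 hv] with k hk
    exact funext hk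
  obtain ⟨k, hk⟩ := h3.exists
  have h4 : ∀ᶠ k' in (Filter.hyperfilter ℕ : Filter ℕ), k' ≠ k := by
    have : ({k} : Set ℕ)ᶜ ∈ Filter.hyperfilter ℕ :=
      Filter.compl_mem_hyperfilter_of_finite (Set.finite_singleton k)
    exact this
  obtain ⟨k', h5, h6⟩ := (h3.and h4).exists
  exact h6 (hxinj (h5.trans hk.symm))

end Part25

/-- `B` is a minimal vanishing subsum of the family `t`. -/
def MinVanish {G : Type*} [Field G] {ι : Type} (t : ι → Gˣ) (B : Finset ι) : Prop :=
  ∑ i ∈ B, (t i : G) = 0 ∧ ∀ I ⊆ B, I.Nonempty → ∑ i ∈ I, (t i : G) = 0 → I = B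

theorem ratios_finite {G : Type*} [Field G] [CharZero G] (Γ : Subgroup Gˣ) (hΓ : Γ.FG)
    (hneg : (-1 : Gˣ) ∈ Γ) (ι : Type) [Fintype ι] [DecidableEq ι] :
    ∃ R : Set Gˣ, R.Finite ∧ ∀ (t : ι → Gˣ), (∀ i, t i ∈ Γ) → ∀ B : Finset ι, MinVanish t B →
      ∀ i ∈ B, ∀ j ∈ B, t i / t j ∈ R := by
  classical
  refine ⟨{1} ∪ ⋃ B : Finset ι, ⋃ j : ι, ⋃ k : {i // i ∈ B.erase j},
    (fun x : {i // i ∈ B.erase j} → Gˣ => - x k) '' {x | (∀ i, x i ∈ Γ) ∧ ∑ i, (x i : G) = 1 ∧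
      ∀ I : Finset {i // i ∈ B.erase j}, I.Nonempty → ∑ i ∈ I, (x i : G) ≠ 0}, ?_, ?_⟩
  · refine (Set.finite_singleton _).union ?_
    exact Set.finite_iUnion fun B => Set.finite_iUnion fun j => Set.finite_iUnion fun k =>
      (unit_equation_finite Γ hΓ _).image _
  · rintro t ht B ⟨h0, hmin⟩ i hi j hj
    by_cases hij : i = j
    · left; simp [hij]
    right
    simp only [Set.mem_iUnion]
    refine ⟨B, j, ⟨i, by simp [hij, hi]⟩, fun k => -(t k / t j), ⟨?_, ?_, ?_⟩, by simp⟩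
    · intro k
      have : -(t k / t j) = (-1) * (t k / t j) := by simp
      show -(t k / t j) ∈ Γ
      rw [this]
      exact Γ.mul_mem hneg (Γ.div_mem (ht _) (ht _))
    · have h1 : ∑ k : {i // i ∈ B.erase j}, ((-(t k / t j) : Gˣ) : G)
          = ∑ k ∈ B.erase j, -((t k : G) / t j) := by
        rw [← Finset.sum_coe_sort (B.erase j) (fun k => -((t k : G) / t j))]
        simp
      rw [h1, Finset.sum_neg_distrib, ← Finset.sum_div]
      have h2 := Finset.add_sum_erase B (fun k => (t k : G)) hj
      rw [h0] at h2
      have h3 : ∑ k ∈ B.erase j, (t k : G) = - t j := by linear_combination h2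
      rw [h3]; field_simp
    · intro I hI hsum
      have h1 : ∑ k ∈ I.map (Function.Embedding.subtype _), (t k : G) = 0 := by
        rw [Finset.sum_map]
        have : ∑ k ∈ I, ((-(t k / t j) : Gˣ) : G) = -(∑ k ∈ I, (t k : G)) / t j := by
          rw [neg_div, Finset.sum_div, ← Finset.sum_neg_distrib]; simp
        rw [this] at hsum
        simpa using hsum
      have hsub : I.map (Function.Embedding.subtype _) ⊆ B.erase j := by
        intro k hk
        simp only [Finset.mem_map, Function.Embedding.subtype_apply] at hk
        obtain ⟨a, _, rfl⟩ := hk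
        exact a.2
      have h2 := hmin _ (hsub.trans (Finset.erase_subset _ _)) (by simpa using hI) h1
      have := hsub (h2 ▸ hj)
      simp at this

/-- A vanishing six-term sum in which no even term cancels an odd term splits as one clique, or
as two cliques which are not balanced between even and odd indices. -/
theorem six_split {G : Type*} [Field G] (t : Fin 6 → Gˣ) (h0 : ∑ i, (t i : G) = 0)
    (hp : ∀ i j : Fin 6, i < 3 → 3 ≤ j → (t i : G) + t j ≠ 0) :
    ∃ B : Finset (Fin 6), MinVanish t B ∧ B.Nonempty ∧ (B = Finset.univ ∨
      (MinVanish t Bᶜ ∧ (B.filter (· < 3)).card ≠ (B.filter (3 ≤ ·)).card)) := by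
  classical
  let V : Finset (Finset (Fin 6)) :=
    Finset.univ.filter fun B => B.Nonempty ∧ ∑ i ∈ B, (t i : G) = 0
  have hV : V.Nonempty := ⟨Finset.univ, by simp [V, h0]⟩
  obtain ⟨B, hB, hmin⟩ := Finset.exists_min_image V Finset.card hV
  have hVm : ∀ C, C ∈ V ↔ C.Nonempty ∧ ∑ i ∈ C, (t i : G) = 0 := by simp [V]
  obtain ⟨hBn, hB0⟩ := (hVm B).1 hB
  have mB : MinVanish t B := ⟨hB0, fun I hI hIn hI0 =>
    Finset.eq_of_subset_of_card_le hI (hmin I ((hVm I).2 ⟨hIn, hI0⟩))⟩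
  refine ⟨B, mB, hBn, ?_⟩
  by_cases hBu : B = Finset.univ
  · exact Or.inl hBu
  right
  have hsd : ∀ C D : Finset (Fin 6), C ⊆ D → ∑ i ∈ C, (t i : G) = 0 → ∑ i ∈ D, (t i : G) = 0 →
      ∑ i ∈ D \ C, (t i : G) = 0 := by
    intro C D h hC hD
    have := Finset.sum_sdiff (f := fun i => (t i : G)) h
    rw [hC, hD] at this; simpa using this
  have hBc0 : ∑ i ∈ Bᶜ, (t i : G) = 0 := by
    rw [Finset.compl_eq_univ_sdiff]; exact hsd _ _ (Finset.subset_univ _) hB0 h0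
  have hBcn : Bᶜ.Nonempty := by
    rw [Finset.nonempty_iff_ne_empty]; simpa using hBu
  have hge2 : ∀ C ∈ V, 2 ≤ C.card := by
    intro C hC
    obtain ⟨hCn, hC0⟩ := (hVm C).1 hC
    by_contra hlt
    have : C.card = 1 := by have := hCn.card_pos; omega
    obtain ⟨a, rfl⟩ := Finset.card_eq_one.1 this
    simp at hC0
  have hpar : ∀ C ∈ V, C.card = 2 → (C.filter (· < 3)).card ≠ (C.filter (3 ≤ ·)).card := by
    intro C hC h2 he
    have hC0 := ((hVm C).1 hC).2
    have hkey : ∀ C : Finset (Fin 6), C.card = 2 →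
        (C.filter (· < 3)).card = (C.filter (3 ≤ ·)).card →
        ∃ i j : Fin 6, i < 3 ∧ 3 ≤ j ∧ C = {i, j} := by decide
    obtain ⟨i, j, hi, hj, rfl⟩ := hkey C h2 he
    rw [Finset.sum_pair (by omega)] at hC0
    exact hp i j hi hj hC0
  have hcc := hmin Bᶜ ((hVm _).2 ⟨hBcn, hBc0⟩)
  have hcard := Finset.card_add_card_compl B
  simp only [Fintype.card_fin] at hcard
  have hB2 := hge2 B hB
  refine ⟨⟨hBc0, ?_⟩, ?_⟩
  · intro I hI hIn hI0
    by_contra hne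
    have hJ0 := hsd _ _ hI hI0 hBc0
    have hJn : (Bᶜ \ I).Nonempty := by
      rw [Finset.sdiff_nonempty]; exact fun h => hne (hI.antisymm h)
    have hIV := (hVm I).2 ⟨hIn, hI0⟩
    have hJV := (hVm _).2 ⟨hJn, hJ0⟩
    have e1 := hmin _ hIV
    have e2 := hmin _ hJV
    have e3 := Finset.card_sdiff_add_card_eq_card hI
    have b2 : B.card = 2 := by omega
    have i2 : I.card = 2 := by omega
    have j2 : (Bᶜ \ I).card = 2 := by omega
    have p1 := hpar _ hB b2
    have p2 := hpar _ hIV i2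
    have p3 := hpar _ hJV j2
    have s1 := Finset.card_filter_add_card_filter_not (s := B) (fun i : Fin 6 => i < 3)
    have s2 := Finset.card_filter_add_card_filter_not (s := I) (fun i : Fin 6 => i < 3)
    have s3 := Finset.card_filter_add_card_filter_not (s := Bᶜ \ I) (fun i : Fin 6 => i < 3)
    simp only [not_lt] at s1 s2 s3
    have u : (B.filter (· < 3)).card + ((I.filter (· < 3)).card + ((Bᶜ \ I).filter (· < 3)).card)
        = 3 := by
      rw [← Finset.card_union_of_disjoint, ← Finset.filter_union, Finset.union_sdiff_of_subset hI,
        ← Finset.card_union_of_disjoint, ← Finset.filter_union, Finset.union_compl]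
      · decide
      · exact Finset.disjoint_filter_filter disjoint_compl_right
      · exact Finset.disjoint_filter_filter Finset.disjoint_sdiff
    omega
  · intro he
    have s1 := Finset.card_filter_add_card_filter_not (s := B) (fun i : Fin 6 => i < 3)
    simp only [not_lt] at s1
    exact hpar B hB (by omega) he

open scoped Pointwise in
theorem six_ratios_finite {G : Type*} [Field G] [CharZero G] (Γ : Subgroup Gˣ) (hΓ : Γ.FG)
    (hneg : (-1 : Gˣ) ∈ Γ) :
    ∃ N : Set Gˣ, N.Finite ∧ ∀ (t : Fin 6 → Gˣ), (∀ i, t i ∈ Γ) → ∑ i, (t i : G) = 0 →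
      (∀ i j : Fin 6, i < 3 → 3 ≤ j → (t i : G) + t j ≠ 0) →
      t 0 * t 1 * t 2 = - (t 3 * t 4 * t 5) → ∀ i j, t i / t j ∈ N := by
  classical
  obtain ⟨R, hR, hRt⟩ := ratios_finite Γ hΓ hneg (Fin 6)
  -- possible values of the power of the ratio between the two cliques
  let Q : Set Gˣ := (fun s : Fin 6 → Gˣ => -(s 3 * s 4 * s 5) / (s 0 * s 1 * s 2)) ''
    Set.pi Set.univ fun _ => R
  have hQ : Q.Finite := (Set.Finite.pi' fun _ => hR).subset (by intro x hx i; exact hx i trivial)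
    |>.image _
  let L : Set Gˣ := ⋃ k ∈ ({-3, -2, -1, 1, 2, 3} : Set ℤ), {l | l ^ k ∈ Q}
  have hL : L.Finite := by
    have hroot : ∀ n : ℕ, n ≠ 0 → ∀ q : Gˣ, {l : Gˣ | l ^ n = q}.Finite := by
      intro n hn q
      refine Set.Finite.of_finite_image (f := (Units.val : Gˣ → G)) ?_ Units.val_injective.injOn
      refine (Polynomial.nthRootsFinset n (q : G)).finite_toSet.subset ?_
      rintro _ ⟨l, hl, rfl⟩
      simp only [Finset.mem_coe]
      rw [Polynomial.mem_nthRootsFinset (Nat.pos_of_ne_zero hn)]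
      have := congrArg Units.val (show l ^ n = q from hl)
      simpa using this
    have hpos : ∀ n : ℕ, n ≠ 0 → ∀ A : Set Gˣ, A.Finite → {l : Gˣ | l ^ n ∈ A}.Finite := by
      intro n hn A hA
      refine (hA.biUnion fun q _ => hroot n hn q).subset ?_
      intro l hl
      simp only [Set.mem_iUnion]
      exact ⟨_, hl, rfl⟩
    refine Set.Finite.biUnion (by simp) ?_
    intro k hk
    have hk0 : k ≠ 0 := by rintro rfl; simp at hk
    refine ((hpos k.natAbs (by simpa using hk0) _ (hQ.union hQ.inv))).subset ?_
    intro l hl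
    rcases Int.natAbs_eq k with h | h
    · left
      have : l ^ k ∈ Q := hl
      rw [h, zpow_natCast] at this
      exact this
    · right
      have : l ^ k ∈ Q := hl
      rw [h, zpow_neg, zpow_natCast] at this
      exact this
  refine ⟨R ∪ (R * L * R), hR.union ((hR.mul hL).mul hR), ?_⟩
  intro t ht h0 hp hrel i j
  obtain ⟨B, mB, ⟨b, hb⟩, hcase⟩ := six_split t h0 hp
  by_cases hBu : B = Finset.univ
  · exact Or.inl (hRt t ht B mB i (by simp [hBu]) j (by simp [hBu]))
  obtain ⟨mC, hne⟩ := hcase.resolve_left hBu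
  obtain ⟨c, hc⟩ : Bᶜ.Nonempty := by
    rw [Finset.nonempty_iff_ne_empty]; simpa using hBu
  have hbc : t b / t c ∈ L := by
    let s : Fin 6 → Gˣ := fun i => t i / (if i ∈ B then t b else t c)
    have hs : ∀ i, s i ∈ R := by
      intro i
      by_cases hi : i ∈ B
      · simpa [s, hi] using hRt t ht B mB i hi b hb
      · simpa [s, hi] using hRt t ht _ mC i (by simpa using hi) c hc
    let e : Fin 6 → ℤ := fun i => if i ∈ B then 1 else 0
    have hts : ∀ i, t i = s i * t c * (t b / t c) ^ (e i) := by
      intro i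
      by_cases hi : i ∈ B
      · simp [s, e, hi]
      · simp [s, e, hi]
    have c1 : ∀ B : Finset (Fin 6), (B.filter (· < 3)).card =
        (if 0 ∈ B then 1 else 0) + (if 1 ∈ B then 1 else 0) + (if 2 ∈ B then 1 else 0) := by decide
    have c2 : ∀ B : Finset (Fin 6), (B.filter (3 ≤ ·)).card =
        (if 3 ∈ B then 1 else 0) + (if 4 ∈ B then 1 else 0) + (if 5 ∈ B then 1 else 0) := by decide
    have hpow : (t b / t c) ^ (e 0 + e 1 + e 2 - (e 3 + e 4 + e 5)) ∈ Q := by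
      refine ⟨s, fun i _ => hs i, ?_⟩
      have h := hrel
      rw [hts 0, hts 1, hts 2, hts 3, hts 4, hts 5] at h
      generalize t b / t c = l at h ⊢
      rw [zpow_sub, zpow_add, zpow_add, zpow_add, zpow_add]
      show -(s 3 * s 4 * s 5) / (s 0 * s 1 * s 2) = _
      generalize l ^ e 0 = l0 at h ⊢
      generalize l ^ e 1 = l1 at h ⊢
      generalize l ^ e 2 = l2 at h ⊢
      generalize l ^ e 3 = l3 at h ⊢
      generalize l ^ e 4 = l4 at h ⊢
      generalize l ^ e 5 = l5 at h ⊢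
      have h' := congrArg Units.val h
      ext
      push_cast at h' ⊢
      have := (t c).ne_zero
      field_simp
      have h3 : (t c : G) ^ 3 ≠ 0 := pow_ne_zero _ this
      apply mul_left_cancel₀ h3
      linear_combination -h'
    refine Set.mem_biUnion (x := e 0 + e 1 + e 2 - (e 3 + e 4 + e 5)) ?_ hpow
    rw [c1, c2] at hne
    simp only [Set.mem_insert_iff, Set.mem_singleton_iff, e]
    split_ifs at hne ⊢ <;> first | omega | simp
  have hcb : t c / t b ∈ L := by
    have hinv : ∀ l ∈ L, l⁻¹ ∈ L := by
      intro l hl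
      obtain ⟨k, hk, hl⟩ := Set.mem_iUnion₂.1 hl
      refine Set.mem_biUnion (x := -k) ?_ ?_
      · simp only [Set.mem_insert_iff, Set.mem_singleton_iff] at hk ⊢; omega
      · show l⁻¹ ^ (-k) ∈ Q
        simpa using hl
    have := hinv _ hbc
    rwa [inv_div] at this
  by_cases hi : i ∈ B <;> by_cases hj : j ∈ B
  · exact Or.inl (hRt t ht B mB i hi j hj)
  · right
    have := Set.mul_mem_mul (Set.mul_mem_mul (hRt t ht B mB i hi b hb) hbc)
      (hRt t ht _ mC c hc j (by simpa using hj))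
    simpa using this
  · right
    have := Set.mul_mem_mul (Set.mul_mem_mul (hRt t ht _ mC i (by simpa using hi) c hc) hcb)
      (hRt t ht B mB b hb j hj)
    simpa using this
  · exact Or.inl (hRt t ht _ mC i (by simpa using hi) j (by simpa using hj))

/-- Let `G` be a field of characteristic 0 and `Γ` a finitely generated subgroup of
`G*`. Then there is a finite set of normalized pairs in `G* × G*` such that for every
normalized pair `(a1, a2)` outside this set, the equation `a1·x1 + a2·x2 = 1` has at
most two solutions `(x1, x2) ∈ Γ × Γ`. -/
theorem normalized_unit_equation_at_most_two_solutions
    (G : Type*) [Field G] [CharZero G] (Γ : Subgroup Gˣ) (hΓ : Γ.FG) :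
    ∃ S : Finset (G × G), (∀ p ∈ S, p.1 ≠ 0 ∧ p.2 ≠ 0 ∧ p.1 + p.2 = 1) ∧
      ∀ a1 a2 : G, a1 ≠ 0 → a2 ≠ 0 → a1 + a2 = 1 → (a1, a2) ∉ S →
        ∃ p q : Gˣ × Gˣ,
          {x : Gˣ × Gˣ | x.1 ∈ Γ ∧ x.2 ∈ Γ ∧ a1 * x.1 + a2 * x.2 = 1} ⊆ {p, q} := by
  classical
  -- enlarge the group by `-1`
  let Γ' : Subgroup Gˣ := Γ ⊔ Subgroup.zpowers (-1)
  have hΓ' : Γ'.FG := hΓ.sup ⟨{-1}, by simp [Subgroup.zpowers_eq_closure]⟩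
  have hneg : (-1 : Gˣ) ∈ Γ' := (le_sup_right : _ ≤ Γ') (Subgroup.mem_zpowers _)
  have hle : Γ ≤ Γ' := le_sup_left
  obtain ⟨N, hN, hNt⟩ := six_ratios_finite Γ' hΓ' hneg
  let f : Gˣ × Gˣ → G × G := fun n =>
    ((1 + (n.2 : G)) / ((n.2 : G) - n.1), 1 - (1 + (n.2 : G)) / ((n.2 : G) - n.1))
  let S : Finset (G × G) := ((hN.prod hN).image f).toFinset.filter
    fun p => p.1 ≠ 0 ∧ p.2 ≠ 0 ∧ p.1 + p.2 = 1
  refine ⟨S, fun p hp => (Finset.mem_filter.1 hp).2, ?_⟩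
  intro a1 a2 h1 h2 h12 hS
  by_contra hcon
  push Not at hcon
  -- two distinct solutions different from (1,1)
  obtain ⟨x, ⟨hx1, hx2, hx⟩, hxn⟩ := Set.not_subset.1 (hcon (1, 1) (1, 1))
  obtain ⟨y, ⟨hy1, hy2, hy⟩, hyn⟩ := Set.not_subset.1 (hcon (1, 1) x)
  obtain ⟨x1, x2⟩ := x
  obtain ⟨y1, y2⟩ := y
  simp only [Set.mem_insert_iff, Set.mem_singleton_iff, Prod.mk.injEq, or_self, not_or] at *
  have ha2 : a2 = 1 - a1 := by linear_combination h12
  subst ha2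
  have hx1' : (x1 : G) ≠ 1 := by
    intro h
    have h' : (x2 : G) = 1 := by
      rw [h] at hx; exact mul_left_cancel₀ h2 (by linear_combination hx)
    exact hxn ⟨Units.ext h, Units.ext h'⟩
  have hx2' : (x2 : G) ≠ 1 := by
    intro h
    exact hx1' (mul_left_cancel₀ h1 (by rw [h] at hx; linear_combination hx))
  have hy1' : (y1 : G) ≠ 1 := by
    intro h
    have h' : (y2 : G) = 1 := by
      rw [h] at hy; exact mul_left_cancel₀ h2 (by linear_combination hy)
    exact hyn.1 ⟨Units.ext h, Units.ext h'⟩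
  have hy2' : (y2 : G) ≠ 1 := by
    intro h
    exact hy1' (mul_left_cancel₀ h1 (by rw [h] at hy; linear_combination hy))
  have hxy1 : (x1 : G) ≠ y1 := by
    intro h
    have h' : (x2 : G) = y2 := by
      rw [h] at hx; exact mul_left_cancel₀ h2 (by linear_combination hx - hy)
    exact hyn.2 ⟨Units.ext h.symm, Units.ext h'.symm⟩
  have hxy2 : (x2 : G) ≠ y2 := by
    intro h
    exact hxy1 (mul_left_cancel₀ h1 (by rw [h] at hx; linear_combination hx - hy))
  have hx12 : (x1 : G) ≠ x2 := by
    intro h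
    exact hx1' (by rw [← h] at hx; linear_combination hx)
  have hy12 : (y1 : G) ≠ y2 := by
    intro h
    exact hy1' (by rw [← h] at hy; linear_combination hy)
  have hdet2 : (x1 : G) * y2 ≠ x2 * y1 := by
    intro h
    apply hxy1
    linear_combination (-(x1 : G)) * hy + (y1 : G) * hx + (1 - a1) * h
  have hdet : (x1 : G) * y2 + x2 + y1 - x2 * y1 - y2 - x1 = 0 := by
    apply mul_left_cancel₀ h1
    linear_combination ((y2 : G) - 1) * hx + (1 - (x2 : G)) * hy
  let t : Fin 6 → Gˣ := ![x1 * y2, x2, y1, -(x2 * y1), -y2, -x1]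
  have hngm : ∀ u ∈ Γ', -u ∈ Γ' := by
    intro u hu
    have := Γ'.mul_mem hneg hu
    simpa using this
  have hall := hNt t ?_ ?_ ?_ ?_
  · apply hS
    refine Finset.mem_filter.2 ⟨?_, h1, h2, h12⟩
    rw [Set.Finite.mem_toFinset]
    refine ⟨(t 0 / t 4, t 3 / t 2), ⟨hall 0 4, hall 3 2⟩, ?_⟩
    have e1 : t 0 / t 4 = -x1 := by
      show x1 * y2 / (-y2) = -x1
      rw [div_neg, mul_div_cancel_right]
    have e2 : t 3 / t 2 = -x2 := by
      show -(x2 * y1) / y1 = -x2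
      rw [neg_div, mul_div_cancel_right]
    have e3 : (1 + (((-x2 : Gˣ)) : G)) / (((-x2 : Gˣ) : G) - ((-x1 : Gˣ) : G)) = a1 := by
      push_cast
      rw [div_eq_iff (by intro h; exact hx12 (by linear_combination h))]
      linear_combination -hx
    simp only [f, e1, e2]
    rw [e3]
  · intro i
    have m1 := hle hx1
    have m2 := hle hx2
    have m3 := hle hy1
    have m4 := hle hy2
    fin_cases i
    · exact Γ'.mul_mem m1 m4
    · exact m2
    · exact m3
    · exact hngm _ (Γ'.mul_mem m2 m3)
    · exact hngm _ m4
    · exact hngm _ m1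
  · simp [t, Fin.sum_univ_succ]
    linear_combination hdet
  · have n1 := sub_ne_zero.2 hx1'
    have n2 := sub_ne_zero.2 hx2'
    have n3 := sub_ne_zero.2 hy1'
    have n4 := sub_ne_zero.2 hy2'
    intro i j hi hj h
    fin_cases i <;> fin_cases j <;> simp at hi hj <;> simp [t] at h
    · exact hdet2 (by linear_combination h)
    · exact n1 (mul_left_cancel₀ y2.ne_zero (by linear_combination h))
    · exact n4 (mul_left_cancel₀ x1.ne_zero (by linear_combination h))
    · exact n3 (mul_left_cancel₀ x2.ne_zero (by linear_combination -h))
    · exact hxy2 (by linear_combination h)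
    · exact hx12 (by linear_combination -h)
    · exact n2 (mul_left_cancel₀ y1.ne_zero (by linear_combination -h))
    · exact hy12 (by linear_combination h)
    · exact hxy1 (by linear_combination -h)
  · show x1 * y2 * x2 * y1 = -(-(x2 * y1) * -y2 * -x1)
    ext
    push_cast
    ring
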